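/- Let D ⊂ ℂ be a domain and let ρ : D → [-∞,∞) be a subharmonic function that is bounded from below, and assume that ℂ \ D is not polar or ρ is not constant. Then: (i) every f ∈ L²_h(G_{D,ρ}) extends to a holomorphic function on G_{D̂,ρ̂}, and (ii) G_{D̂,ρ̂} is an L²_h-domain of holomorphy; that is, the L²_h-holomorphic hull of G_{D,ρ} equals G_{D̂,ρ̂}. -/

import Mathlib

open MeasureTheory Filter Metric Set

/-- `elog x` is `log x` with value `-∞` for `x ≤ 0`, as an extended real. -/
noncomputable def elog (x : ℝ) : EReal := if x ≤ 0 then ⊥ else ((Real.log x : ℝ) : EReal)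

/-- The sub-mean value inequality over circles of closed discs contained in `Ω`, phrased via
continuous real-valued majorants of the (extended-real-valued) function on the circle. -/
def SubmeanOn (u : ℂ → EReal) (Ω : Set ℂ) : Prop :=
  ∀ c : ℂ, ∀ r : ℝ, 0 < r → Metric.closedBall c r ⊆ Ω →
    ∀ φ : ℝ → ℝ, Continuous φ →
      (∀ θ : ℝ, u (c + r * Complex.exp (θ * Complex.I)) ≤ ((φ θ : ℝ) : EReal)) →
      u c ≤ (((2 * Real.pi)⁻¹ * ∫ θ in (0:ℝ)..(2 * Real.pi), φ θ : ℝ) : EReal)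

/-- `u : Ω → [-∞, ∞)` is subharmonic on the open set `Ω ⊆ ℂ`: upper semicontinuous,
nowhere `+∞`, not identically `-∞` on any connected component, sub-mean value inequality. -/
def SubharmonicOn (u : ℂ → EReal) (Ω : Set ℂ) : Prop :=
  IsOpen Ω ∧ UpperSemicontinuousOn u Ω ∧
  (∀ z ∈ Ω, u z ≠ ⊤) ∧
  (∀ z ∈ Ω, ∃ w ∈ connectedComponentIn Ω z, u w ≠ ⊥) ∧
  SubmeanOn u Ω

/-- A set `E ⊆ ℂ` is polar if some subharmonic function on an open set containing `E`
equals `-∞` on `E`. -/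
def PolarSet (E : Set ℂ) : Prop :=
  ∃ Ω : Set ℂ, E ⊆ Ω ∧ ∃ u : ℂ → EReal, SubharmonicOn u Ω ∧ ∀ z ∈ E, u z = ⊥

/-- The space of square-integrable holomorphic functions on `D`. -/
def L2h {E : Type*} [NormedAddCommGroup E] [NormedSpace ℂ E] [MeasureSpace E]
    (D : Set E) : Set (E → ℂ) :=
  {f | DifferentiableOn ℂ f D ∧ IntegrableOn (fun z => ‖f z‖ ^ 2) D volume}

/-- `D` is an `L²ₕ`-domain of holomorphy. -/
def IsL2hDomainOfHolomorphy {E : Type*} [NormedAddCommGroup E] [NormedSpace ℂ E]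
    [MeasureSpace E] (D : Set E) : Prop :=
  ¬ ∃ D₀ D₁ : Set E, IsOpen D₀ ∧ IsConnected D₀ ∧ IsOpen D₁ ∧ IsConnected D₁ ∧
      D₀ ⊆ D₁ ∩ D ∧ ¬ (D₁ ⊆ D) ∧
      ∀ f ∈ L2h D, ∃ g : E → ℂ, DifferentiableOn ℂ g D₁ ∧ Set.EqOn g f D₀

/-- The Hartogs domain `G_{D,ρ} = {(z₁,z₂) : z₁ ∈ D, |z₂| < e^{-ρ(z₁)}}`. -/
def hartogs (D : Set ℂ) (ρ : ℂ → EReal) : Set (ℂ × ℂ) :=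
  {p | p.1 ∈ D ∧ elog ‖p.2‖ < - ρ p.1}

/-- `S(D)`: boundary points near which the complement of `D` is polar. -/
def polarS (D : Set ℂ) : Set ℂ :=
  {z ∈ frontier D | ∃ U : Set ℂ, IsOpen U ∧ z ∈ U ∧ PolarSet (U \ D)}

/-- `fj` is the family of coefficients of a Hartogs expansion of `f` on `G_{D,ρ}`. -/
def HartogsExpansion (D : Set ℂ) (ρ : ℂ → EReal) (f : ℂ × ℂ → ℂ) (fj : ℕ → ℂ → ℂ) : Prop :=
  (∀ j, DifferentiableOn ℂ (fj j) D) ∧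
  ∀ p ∈ hartogs D ρ, HasSum (fun j => fj j p.1 * p.2 ^ j) (f p)

/-- `ρ_f(z) = limsup_j (1/j) log |f_j(z)|` for coefficients `fj`. -/
noncomputable def coeffGrowth (fj : ℕ → ℂ → ℂ) (z : ℂ) : EReal :=
  Filter.limsup (fun (j : ℕ) => ((((j : ℝ)⁻¹ : ℝ)) : EReal) * elog ‖fj j z‖) Filter.atTop

/-- The upper semicontinuous regularization `g*`. -/
noncomputable def uscReg (g : ℂ → EReal) (z : ℂ) : EReal := Filter.limsup g (nhds z)

/-- `ρ̃ = sup_{f ∈ L²ₕ(G_{D,ρ})} (ρ_f)*`. -/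
noncomputable def rhoTilde (D : Set ℂ) (ρ : ℂ → EReal) (z : ℂ) : EReal :=
  ⨆ fj ∈ {fj : ℕ → ℂ → ℂ | ∃ f ∈ L2h (hartogs D ρ), HartogsExpansion D ρ f fj},
    uscReg (coeffGrowth fj) z

/-- `D̂ = D ∪ {z ∈ S(D) : limsup_{D ∋ w → z} ρ(w) < ∞}`. -/
def DHat (D : Set ℂ) (ρ : ℂ → EReal) : Set ℂ :=
  D ∪ {z ∈ polarS D | Filter.limsup ρ (nhdsWithin z D) < ⊤}

open Classical in
/-- `ρ̂`, extending `ρ` to `D̂` by boundary limsups. -/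
noncomputable def rhoHat (D : Set ℂ) (ρ : ℂ → EReal) (z : ℂ) : EReal :=
  if z ∈ D then ρ z else Filter.limsup ρ (nhdsWithin z D)

/-- `u` is plurisubharmonic on an open `Ω ⊆ ℂⁿ`. -/
def PlurisubharmonicOn {n : ℕ} (u : (Fin n → ℂ) → EReal) (Ω : Set (Fin n → ℂ)) : Prop :=
  IsOpen Ω ∧ UpperSemicontinuousOn u Ω ∧
  (∀ z ∈ Ω, u z ≠ ⊤) ∧
  (∀ z ∈ Ω, ∃ w ∈ connectedComponentIn Ω z, u w ≠ ⊥) ∧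
  ∀ a b : Fin n → ℂ, SubmeanOn (fun lam => u (a + lam • b)) {lam : ℂ | a + lam • b ∈ Ω}

/-- A set `E ⊆ ℂⁿ` is pluripolar. -/
def PluripolarSet {n : ℕ} (E : Set (Fin n → ℂ)) : Prop :=
  ∃ Ω : Set (Fin n → ℂ), E ⊆ Ω ∧
    ∃ u : (Fin n → ℂ) → EReal, PlurisubharmonicOn u Ω ∧ ∀ z ∈ E, u z = ⊥

/-- `D ⊆ ℂⁿ` is pseudoconvex: it admits a plurisubharmonic exhaustion function. -/
def IsPseudoconvex {n : ℕ} (D : Set (Fin n → ℂ)) : Prop :=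
  ∃ u : (Fin n → ℂ) → EReal, PlurisubharmonicOn u D ∧
    ∀ c : ℝ, IsCompact {z | z ∈ D ∧ u z ≤ (c : EReal)}

/-- `L²ₕ(D)` is infinite dimensional: arbitrarily many elements that are
linearly independent as functions on `D`. -/
def L2hInfiniteDim {E : Type*} [NormedAddCommGroup E] [NormedSpace ℂ E] [MeasureSpace E]
    (D : Set E) : Prop :=
  ∀ N : ℕ, ∃ fs : Fin N → E → ℂ, (∀ i, fs i ∈ L2h D) ∧
    ∀ c : Fin N → ℂ, (∀ z ∈ D, ∑ i, c i * fs i z = 0) → c = 0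

open scoped ContDiff Topology ComplexConjugate

/-! ### Wirtinger calculus -/

/-- `f` has real derivative `h ↦ p h + q conj h` at `z`. -/
def HasW (f : ℂ → ℂ) (p q z : ℂ) : Prop :=
  HasFDerivAt f (p • (ContinuousLinearMap.id ℝ ℂ) + q • (Complex.conjCLE : ℂ →L[ℝ] ℂ)) z

/-- The Wirtinger derivative `∂f/∂z`. -/
noncomputable def dz (f : ℂ → ℂ) (z : ℂ) : ℂ :=
  (fderiv ℝ f z 1 - Complex.I * fderiv ℝ f z Complex.I) / 2

/-- The Wirtinger derivative `∂f/∂z̄`. -/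
noncomputable def dzb (f : ℂ → ℂ) (z : ℂ) : ℂ :=
  (fderiv ℝ f z 1 + Complex.I * fderiv ℝ f z Complex.I) / 2

theorem clm_eq_wirtinger (L : ℂ →L[ℝ] ℂ) :
    L = ((L 1 - Complex.I * L Complex.I) / 2) • (ContinuousLinearMap.id ℝ ℂ) +
      ((L 1 + Complex.I * L Complex.I) / 2) • (Complex.conjCLE : ℂ →L[ℝ] ℂ) := by
  ext h
  have : h = h.re • (1 : ℂ) + h.im • Complex.I := by
    simp [Complex.re_add_im]
  conv_lhs => rw [this]
  rw [map_add, map_smul, map_smul]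
  have hc : (starRingEnd ℂ) h = h.re - h.im * Complex.I := by
    apply Complex.ext <;> simp
  have hh : h = h.re + h.im * Complex.I := by simp
  simp only [add_apply, smul_apply,
    ContinuousLinearMap.id_apply, ContinuousLinearEquiv.coe_coe, Complex.conjCLE_apply, hc,
    smul_eq_mul, Complex.real_smul]
  rw [hh]
  simp only [Complex.add_re, Complex.ofReal_re, Complex.mul_re, Complex.I_re, mul_zero,
    Complex.ofReal_im, Complex.I_im, mul_one, sub_self, add_zero, Complex.add_im, Complex.mul_im,
    zero_add]
  ring_nf
  simp only [Complex.I_sq]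
  ring

theorem DifferentiableAt.hasW {f : ℂ → ℂ} {z : ℂ} (h : DifferentiableAt ℝ f z) :
    HasW f (dz f z) (dzb f z) z := by
  have := h.hasFDerivAt
  rw [clm_eq_wirtinger (fderiv ℝ f z)] at this
  exact this

namespace HasW
variable {f g : ℂ → ℂ} {p q p' q' z : ℂ}

theorem dz_eq (h : HasW f p q z) : dz f z = p := by
  unfold dz
  rw [HasFDerivAt.fderiv h]
  simp
  ring_nf
  simp only [Complex.I_sq]
  ring

theorem dzb_eq (h : HasW f p q z) : dzb f z = q := by
  unfold dzb
  rw [HasFDerivAt.fderiv h]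
  simp
  ring_nf
  simp only [Complex.I_sq]
  ring

theorem differentiableAt (h : HasW f p q z) : DifferentiableAt ℝ f z :=
  HasFDerivAt.differentiableAt h

theorem congr' (h : HasW f p q z) (hp : p = p') (hq : q = q') : HasW f p' q' z := by
  subst hp; subst hq; exact h

theorem add (hf : HasW f p q z) (hg : HasW g p' q' z) :
    HasW (fun z => f z + g z) (p + p') (q + q') z := by
  have := HasFDerivAt.add hf hg
  refine this.congr_fderiv ?_
  ext h; simp; ring

theorem neg (hf : HasW f p q z) : HasW (fun z => - f z) (-p) (-q) z := by
  have := HasFDerivAt.neg hf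
  refine this.congr_fderiv ?_
  ext h; simp; ring

theorem sub (hf : HasW f p q z) (hg : HasW g p' q' z) :
    HasW (fun z => f z - g z) (p - p') (q - q') z := by
  simpa only [sub_eq_add_neg] using hf.add hg.neg

theorem const (c z : ℂ) : HasW (fun _ => c) 0 0 z := by
  have := hasFDerivAt_const (𝕜 := ℝ) c z
  refine this.congr_fderiv ?_
  ext h; simp

theorem id (z : ℂ) : HasW (fun z => z) 1 0 z := by
  have := hasFDerivAt_id (𝕜 := ℝ) z
  refine this.congr_fderiv ?_
  ext h; simp

theorem mul (hf : HasW f p q z) (hg : HasW g p' q' z) :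
    HasW (fun z => f z * g z) (p * g z + f z * p') (q * g z + f z * q') z := by
  have := HasFDerivAt.mul hf hg
  refine this.congr_fderiv ?_
  ext h; simp; ring

theorem star_conj (hf : HasW f p q z) :
    HasW (fun z => conj (f z)) (conj q) (conj p) z := by
  have := (Complex.conjCLE : ℂ →L[ℝ] ℂ).hasFDerivAt.comp z hf
  refine this.congr_fderiv ?_
  ext h; simp; ring

theorem comp_hol {F : ℂ → ℂ} {F' : ℂ} (hF : HasDerivAt F F' (f z)) (hf : HasW f p q z) :
    HasW (fun z => F (f z)) (F' * p) (F' * q) z := by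
  have := (hF.hasFDerivAt.restrictScalars ℝ).comp z hf
  refine this.congr_fderiv ?_
  ext h; simp; ring

theorem of_hasDerivAt {F : ℂ → ℂ} {F' : ℂ} (hF : HasDerivAt F F' z) : HasW F F' 0 z := by
  have := comp_hol (f := fun z => z) hF (HasW.id z)
  simpa using this

theorem comp_real {F : ℝ → ℝ} {F' : ℝ} {u : ℂ → ℝ} (hF : HasDerivAt F F' (u z))
    (hf : HasW (fun z => (u z : ℂ)) p q z) :
    HasW (fun z => ((F (u z) : ℝ) : ℂ)) (F' * p) (F' * q) z := by
  have h1 : HasFDerivAt u (Complex.reCLM ∘L (p • (ContinuousLinearMap.id ℝ ℂ) +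
      q • (Complex.conjCLE : ℂ →L[ℝ] ℂ))) z := by
    have := Complex.reCLM.hasFDerivAt.comp z hf
    exact this
  have h2 := (Complex.ofRealCLM.hasFDerivAt.comp z (hF.hasFDerivAt.comp z h1))
  have h3 : (p • (ContinuousLinearMap.id ℝ ℂ) + q • (Complex.conjCLE : ℂ →L[ℝ] ℂ)) =
      Complex.ofRealCLM ∘L (Complex.reCLM ∘L (p • (ContinuousLinearMap.id ℝ ℂ) +
      q • (Complex.conjCLE : ℂ →L[ℝ] ℂ))) := by
    have a := Complex.ofRealCLM.hasFDerivAt.comp z h1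
    exact HasFDerivAt.unique hf a
  refine h2.congr_fderiv ?_
  ext h
  have h4 := congrArg (fun L => L h) h3
  simp only [ContinuousLinearMap.comp_apply] at h4 ⊢
  simp only [Complex.ofRealCLM_apply] at h4
  simp only [ContinuousLinearMap.toSpanSingleton_apply, Complex.ofRealCLM_apply, smul_eq_mul, Complex.ofReal_mul]
  rw [← h4]
  simp; ring

theorem congr_of_eventuallyEq (h : HasW f p q z) (hg : g =ᶠ[𝓝 z] f) : HasW g p q z :=
  HasFDerivAt.congr_of_eventuallyEq h hg

theorem real (hf : HasW f p q z) (him : ∀ z, (f z).im = 0) : p = conj q := by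
  have h := hf.star_conj
  have e : (fun z => conj (f z)) = f := by
    ext z; exact Complex.conj_eq_iff_im.2 (him z)
  rw [e] at h
  rw [← hf.dz_eq, h.dz_eq]

end HasW

theorem ContDiff.dzb_smooth {f : ℂ → ℂ} (hf : ContDiff ℝ ∞ f) : ContDiff ℝ ∞ (dzb f) := by
  unfold dzb
  fun_prop

theorem ContDiff.dz_smooth {f : ℂ → ℂ} (hf : ContDiff ℝ ∞ f) : ContDiff ℝ ∞ (dz f) := by
  unfold dz
  fun_prop

theorem ContDiff.hasW {f : ℂ → ℂ} (hf : ContDiff ℝ ∞ f) (z : ℂ) : HasW f (dz f z) (dzb f z) z :=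
  (hf.differentiable (by simp) z).hasW

theorem dz_dzb_comm {f : ℂ → ℂ} (hf : ContDiff ℝ ∞ f) (z : ℂ) : dzb (dz f) z = dz (dzb f) z := by
  have h : ContDiff ℝ ∞ (fderiv ℝ f) := hf.fderiv_right (by simp)
  have hd : DifferentiableAt ℝ (fderiv ℝ f) z := h.differentiable (by simp) z
  have hs : ∀ v w, fderiv ℝ (fderiv ℝ f) z v w = fderiv ℝ (fderiv ℝ f) z w v := by
    have := (hf.contDiffAt (x := z)).isSymmSndFDerivAt (by simp; exact WithTop.coe_le_coe.2 le_top)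
    exact this
  have key : ∀ v, HasFDerivAt (fun y => fderiv ℝ f y v)
      ((fderiv ℝ (fderiv ℝ f) z).flip v) z := by
    intro v
    have := hd.hasFDerivAt.clm_apply (hasFDerivAt_const v z)
    refine this.congr_fderiv ?_
    ext w; simp
  have k1 : HasFDerivAt (dz f) ((1/2 : ℂ) • ((fderiv ℝ (fderiv ℝ f) z).flip 1 -
      Complex.I • (fderiv ℝ (fderiv ℝ f) z).flip Complex.I)) z := by
    have := ((key 1).sub ((key Complex.I).const_smul Complex.I)).const_smul (1/2 : ℂ)
    refine this.congr_of_eventuallyEq (Eventually.of_forall fun y => ?_)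
    simp [dz]; ring
  have k2 : HasFDerivAt (dzb f) ((1/2 : ℂ) • ((fderiv ℝ (fderiv ℝ f) z).flip 1 +
      Complex.I • (fderiv ℝ (fderiv ℝ f) z).flip Complex.I)) z := by
    have := ((key 1).add ((key Complex.I).const_smul Complex.I)).const_smul (1/2 : ℂ)
    refine this.congr_of_eventuallyEq (Eventually.of_forall fun y => ?_)
    simp [dzb]; ring
  rw [dzb, k1.fderiv, dz, k2.fderiv]
  simp
  rw [hs Complex.I 1]
  ring

theorem dzb_eventuallyEq {f g : ℂ → ℂ} {z : ℂ} (h : f =ᶠ[𝓝 z] g) : dzb f z = dzb g z := by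
  simp only [dzb, h.fderiv_eq]

theorem dz_eventuallyEq {f g : ℂ → ℂ} {z : ℂ} (h : f =ᶠ[𝓝 z] g) : dz f z = dz g z := by
  simp only [dz, h.fderiv_eq]

theorem tsupport_dzb_subset (f : ℂ → ℂ) : tsupport (dzb f) ⊆ tsupport f := by
  refine closure_minimal ?_ (isClosed_tsupport f)
  intro z hz
  by_contra hn
  apply hz
  have : f =ᶠ[𝓝 z] fun _ => 0 := notMem_tsupport_iff_eventuallyEq.1 hn
  rw [dzb_eventuallyEq this]
  simp [dzb]

theorem tsupport_dz_subset (f : ℂ → ℂ) : tsupport (dz f) ⊆ tsupport f := by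
  refine closure_minimal ?_ (isClosed_tsupport f)
  intro z hz
  by_contra hn
  apply hz
  have : f =ᶠ[𝓝 z] fun _ => 0 := notMem_tsupport_iff_eventuallyEq.1 hn
  rw [dz_eventuallyEq this]
  simp [dz]

theorem HasCompactSupport.dzb_compact {f : ℂ → ℂ} (h : HasCompactSupport f) :
    HasCompactSupport (dzb f) :=
  h.mono' (subset_closure.trans (tsupport_dzb_subset f))

theorem HasCompactSupport.dz_compact {f : ℂ → ℂ} (h : HasCompactSupport f) :
    HasCompactSupport (dz f) :=
  h.mono' (subset_closure.trans (tsupport_dz_subset f))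

theorem integral_fderiv_apply_eq_zero {f : ℂ → ℂ} (hf : ContDiff ℝ ∞ f) (hc : HasCompactSupport f)
    (v : ℂ) : ∫ z, fderiv ℝ f z v = 0 := by
  obtain ⟨R, hR⟩ := hc.isCompact.isBounded.subset_ball (0 : ℂ)
  obtain ⟨χ, hχ⟩ : ∃ χ : ContDiffBump (0 : ℂ), χ.rIn = |R| + 1 :=
    ⟨⟨|R| + 1, |R| + 2, by positivity, by linarith⟩, rfl⟩
  have hcd : Continuous (fderiv ℝ f) := hf.continuous_fderiv (by simp)
  have hcs : HasCompactSupport (fderiv ℝ f) := hc.fderiv ℝ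
  have h1 : Continuous fun z => fderiv ℝ f z v := by fun_prop
  have h1c : HasCompactSupport fun z => fderiv ℝ f z v :=
    hcs.comp_left (g := fun L : ℂ →L[ℝ] ℂ => L v) (by simp)
  have hχs : ContDiff ℝ ∞ (fun z => χ z) := χ.contDiff
  have h2 : Continuous (fderiv ℝ (fun z => χ z)) := hχs.continuous_fderiv (by simp)
  have h3 : Continuous fun z => fderiv ℝ (fun z => χ z) z v := by fun_prop
  have hfc := hf.continuous
  have := integral_smul_fderiv_eq_neg_fderiv_smul_of_integrable (μ := (volume : Measure ℂ))
    (f := fun z => χ z) (g := f) (v := v) ?_ ?_ ?_ ?_ ?_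
  · have e1 : ∀ z, χ z • fderiv ℝ f z v = fderiv ℝ f z v := by
      intro z
      by_cases hz : z ∈ tsupport f
      · have : χ z = 1 := χ.one_of_mem_closedBall (by
          rw [hχ]; have := hR hz; rw [mem_ball] at this; rw [mem_closedBall]
          linarith [le_abs_self R])
        simp [this]
      · have : fderiv ℝ f z = 0 := by
          have : f =ᶠ[𝓝 z] fun _ => 0 := notMem_tsupport_iff_eventuallyEq.1 hz
          rw [this.fderiv_eq]; simp
        simp [this]
    have e2 : ∀ z, fderiv ℝ (fun z => χ z) z v • f z = 0 := fun z => by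
      by_cases hz : z ∈ tsupport f
      · have : fderiv ℝ (fun z => χ z) z = 0 := by
          have : (fun z => χ z) =ᶠ[𝓝 z] fun _ => 1 := χ.eventuallyEq_one_of_mem_ball (by
            rw [hχ]; have := hR hz; rw [mem_ball] at this ⊢
            linarith [le_abs_self R])
          rw [this.fderiv_eq]; simp
        simp [this]
      · simp [image_eq_zero_of_notMem_tsupport hz]
    simpa [e1, e2] using this
  · exact Continuous.integrable_of_hasCompactSupport (h3.smul hfc) hc.smul_left
  · exact Continuous.integrable_of_hasCompactSupport (hχs.continuous.smul h1) h1c.smul_left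
  · exact Continuous.integrable_of_hasCompactSupport (hχs.continuous.smul hfc) hc.smul_left
  · exact fun z _ => (hχs.differentiable (by simp)) z
  · exact fun z _ => (hf.differentiable (by simp)) z

theorem integrable_fderiv_apply {f : ℂ → ℂ} (hf : ContDiff ℝ ∞ f) (hc : HasCompactSupport f)
    (v : ℂ) : Integrable fun z => fderiv ℝ f z v := by
  have hcd : Continuous (fderiv ℝ f) := hf.continuous_fderiv (by simp)
  exact Continuous.integrable_of_hasCompactSupport (by fun_prop)
    ((hc.fderiv ℝ).comp_left (g := fun L : ℂ →L[ℝ] ℂ => L v) (by simp))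

theorem integral_dzb_eq_zero {f : ℂ → ℂ} (hf : ContDiff ℝ ∞ f) (hc : HasCompactSupport f) :
    ∫ z, dzb f z = 0 := by
  have h1 := integrable_fderiv_apply hf hc
  unfold dzb
  rw [integral_div, integral_add (h1 _) ((h1 _).const_mul _), integral_const_mul,
    integral_fderiv_apply_eq_zero hf hc, integral_fderiv_apply_eq_zero hf hc]
  simp

theorem integral_dz_eq_zero {f : ℂ → ℂ} (hf : ContDiff ℝ ∞ f) (hc : HasCompactSupport f) :
    ∫ z, dz f z = 0 := by
  have h1 := integrable_fderiv_apply hf hc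
  unfold dz
  rw [integral_div, integral_sub (h1 _) ((h1 _).const_mul _), integral_const_mul,
    integral_fderiv_apply_eq_zero hf hc, integral_fderiv_apply_eq_zero hf hc]
  simp

/-- A quarter of the Laplacian of a real function. -/
noncomputable def qlap (u : ℂ → ℝ) (z : ℂ) : ℝ := (dzb (dz fun z => (u z : ℂ)) z).re

theorem ContDiff.ofReal_comp {u : ℂ → ℝ} (h : ContDiff ℝ ∞ u) :
    ContDiff ℝ ∞ (fun z => (u z : ℂ)) :=
  Complex.ofRealCLM.contDiff.comp h

theorem ContDiff.conj_comp {u : ℂ → ℂ} (h : ContDiff ℝ ∞ u) :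
    ContDiff ℝ ∞ (fun z => conj (u z)) :=
  Complex.conjCLE.contDiff.comp h

theorem dz_eq_conj_dzb {u : ℂ → ℝ} (h : ContDiff ℝ ∞ u) (z : ℂ) :
    dz (fun z => (u z : ℂ)) z = conj (dzb (fun z => (u z : ℂ)) z) :=
  (h.ofReal_comp.hasW z).real (by simp)

theorem qlap_im {u : ℂ → ℝ} (h : ContDiff ℝ ∞ u) (z : ℂ) :
    ((qlap u z : ℝ) : ℂ) = dzb (dz fun z => (u z : ℂ)) z := by
  apply Complex.ext
  · simp [qlap]
  · have h1 : dz (fun z => (u z : ℂ)) = fun z => conj (dzb (fun z => (u z : ℂ)) z) := by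
      ext z; exact dz_eq_conj_dzb h z
    have h2 := (h.ofReal_comp.dzb_smooth.hasW z).star_conj.dzb_eq
    rw [← h1, ← dz_dzb_comm h.ofReal_comp] at h2
    simpa using (Complex.conj_eq_iff_im.1 h2.symm).symm

theorem ContDiff.qlap_smooth {u : ℂ → ℝ} (h : ContDiff ℝ ∞ u) : ContDiff ℝ ∞ (qlap u) :=
  Complex.reCLM.contDiff.comp h.ofReal_comp.dz_smooth.dzb_smooth

theorem basic_inequality_smooth {w φ : ℂ → ℝ} {b : ℂ → ℂ} (hw : ContDiff ℝ ∞ w)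
    (hφ : ContDiff ℝ ∞ φ) (hb : ContDiff ℝ ∞ b) (hbc : HasCompactSupport b)
    (hw0 : ∀ z ∈ tsupport b, 0 ≤ w z) :
    ∫ z, (w z * qlap φ z - qlap w z) * ‖b z‖ ^ 2 * Real.exp (φ z) ≤
      (∫ z, w z * ‖dzb b z‖ ^ 2 * Real.exp (φ z)) +
      2 * ∫ z, ‖dzb (fun z => (w z : ℂ)) z‖ * ‖b z‖ * ‖dzb b z‖ * Real.exp (φ z) := by
  set W : ℂ → ℂ := fun z => (w z : ℂ) with hW
  set Φ : ℂ → ℂ := fun z => (φ z : ℂ) with hΦ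
  have sW : ContDiff ℝ ∞ W := hw.ofReal_comp
  have sΦ : ContDiff ℝ ∞ Φ := hφ.ofReal_comp
  set E : ℂ → ℂ := fun z => Complex.exp (Φ z) with hE
  have sE : ContDiff ℝ ∞ E := sΦ.cexp
  have sbb : ContDiff ℝ ∞ (fun z => conj (b z)) := hb.conj_comp
  set Y : ℂ → ℂ := fun z => dz b z + dz Φ z * b z with hY
  have s1 := hb.dz_smooth
  have s2 := hb.dzb_smooth
  have s3 := sΦ.dz_smooth
  have s4 := sW.dzb_smooth
  have sY : ContDiff ℝ ∞ Y := s1.add (s3.mul hb)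
  have cb : HasCompactSupport (fun z => conj (b z)) :=
    hbc.comp_left (g := fun z => conj z) (by simp)
  have wE : ∀ z, HasW E (E z * dz Φ z) (E z * dzb Φ z) z := fun z =>
    HasW.comp_hol (Complex.hasDerivAt_exp (Φ z)) (sΦ.hasW z)
  set X1 : ℂ → ℂ := fun z => (W z * E z) * (conj (b z)) * Y z
  set X2 : ℂ → ℂ := fun z => (W z * E z) * (conj (b z)) * dzb b z
  set X3 : ℂ → ℂ := fun z => (dzb W z * E z) * (conj (b z)) * b z
  have sX1 : ContDiff ℝ ∞ X1 := ((sW.mul sE).mul sbb).mul sY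
  have sX2 : ContDiff ℝ ∞ X2 := ((sW.mul sE).mul sbb).mul s2
  have sX3 : ContDiff ℝ ∞ X3 := ((s4.mul sE).mul sbb).mul hb
  have cX1 : HasCompactSupport X1 := (cb.mul_left).mul_right
  have cX2 : HasCompactSupport X2 := (cb.mul_left).mul_right
  have cX3 : HasCompactSupport X3 := (cb.mul_left).mul_right
  have i1 := integral_dzb_eq_zero sX1 cX1
  have i2 := integral_dz_eq_zero sX2 cX2
  have i3 := integral_dz_eq_zero sX3 cX3
  have ident : ∀ z, dzb X1 z - dz X2 z - dz X3 z =
      W z * E z * (conj (Y z) * Y z) + (W z * dzb (dz Φ) z - dzb (dz W) z) * E z * (conj (b z) * b z)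
      - W z * E z * (conj (dzb b z) * dzb b z)
      - E z * (conj (dzb W z) * conj (b z) * dzb b z + dzb W z * b z * conj (dzb b z)) := by
    intro z
    have hb' := hb.hasW z
    have h1 := ((((sW.hasW z).mul (wE z)).mul hb'.star_conj).mul
      ((s1.hasW z).add ((s3.hasW z).mul hb'))).dzb_eq
    have h2 := ((((sW.hasW z).mul (wE z)).mul hb'.star_conj).mul (s2.hasW z)).dz_eq
    have h3 := ((((s4.hasW z).mul (wE z)).mul hb'.star_conj).mul hb').dz_eq
    have e1 : dzb X1 z = _ := h1
    have e2 : dz X2 z = _ := h2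
    have e3 : dz X3 z = _ := h3
    rw [e1, e2, e3]
    have eW : dz W z = conj (dzb W z) := dz_eq_conj_dzb hw z
    have eΦ : conj (dz Φ z) = dzb Φ z := by
      have : dz Φ z = conj (dzb Φ z) := dz_eq_conj_dzb hφ z
      rw [this, Complex.conj_conj]
    have c1 := dz_dzb_comm hb z
    have c2 := dz_dzb_comm sW z
    simp only [hY, map_add, map_mul, eW, eΦ, c1, c2]
    ring
  have cn : ∀ x : ℂ, conj x * x = ((‖x‖ ^ 2 : ℝ) : ℂ) := by
    intro x; rw [mul_comm, Complex.mul_conj, Complex.normSq_eq_norm_sq]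
  have Ee : ∀ z, E z = ((Real.exp (φ z) : ℝ) : ℂ) := by
    intro z; simp [hE, hΦ]
  have identr : ∀ z, (dzb X1 z - dz X2 z - dz X3 z).re =
      w z * Real.exp (φ z) * ‖Y z‖ ^ 2 + (w z * qlap φ z - qlap w z) * ‖b z‖ ^ 2 * Real.exp (φ z)
      - w z * ‖dzb b z‖ ^ 2 * Real.exp (φ z)
      - Real.exp (φ z) * (2 * (dzb W z * b z * conj (dzb b z)).re) := by
    intro z
    rw [ident z, cn, cn, cn, ← qlap_im hφ, ← qlap_im hw, Ee]
    have h5 : conj (dzb W z) * conj (b z) * dzb b z + dzb W z * b z * conj (dzb b z) =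
        ((2 * (dzb W z * b z * conj (dzb b z)).re : ℝ) : ℂ) := by
      have : conj (dzb W z) * conj (b z) * dzb b z = conj (dzb W z * b z * conj (dzb b z)) := by
        simp
      rw [this, add_comm, Complex.add_conj]
    rw [h5]
    simp only [hW, ← Complex.ofReal_mul, ← Complex.ofReal_sub, ← Complex.ofReal_add,
      Complex.ofReal_re]
    ring
  have csb : HasCompactSupport fun z => ‖b z‖ ^ 2 := hbc.comp_left (g := fun z => ‖z‖ ^ 2) (by simp)
  have csd : HasCompactSupport fun z => ‖dzb b z‖ ^ 2 :=
    hbc.dzb_compact.comp_left (g := fun z => ‖z‖ ^ 2) (by simp)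
  have csd' : HasCompactSupport fun z => ‖dzb b z‖ :=
    hbc.dzb_compact.comp_left (g := fun z => ‖z‖) (by simp)
  have I1 : Integrable fun z => (w z * qlap φ z - qlap w z) * ‖b z‖ ^ 2 * Real.exp (φ z) := by
    apply Continuous.integrable_of_hasCompactSupport
    · have a1 := hw.continuous
      have a2 := hφ.qlap_smooth.continuous
      have a3 := hw.qlap_smooth.continuous
      have a4 := hb.continuous
      fun_prop
    · exact (csb.mul_left).mul_right
  have I2 : Integrable fun z => w z * ‖dzb b z‖ ^ 2 * Real.exp (φ z) := by
    apply Continuous.integrable_of_hasCompactSupport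
    · have a1 := hw.continuous
      have a4 := s2.continuous
      fun_prop
    · exact (csd.mul_left).mul_right
  have I3 : Integrable fun z => ‖dzb W z‖ * ‖b z‖ * ‖dzb b z‖ * Real.exp (φ z) := by
    apply Continuous.integrable_of_hasCompactSupport
    · have a1 := s4.continuous
      have a3 := hb.continuous
      have a4 := s2.continuous
      fun_prop
    · exact (csd'.mul_left).mul_right
  have J1 : Integrable (dzb X1) := Continuous.integrable_of_hasCompactSupport
    sX1.dzb_smooth.continuous cX1.dzb_compact
  have J2 : Integrable (dz X2) := Continuous.integrable_of_hasCompactSupport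
    sX2.dz_smooth.continuous cX2.dz_compact
  have J3 : Integrable (dz X3) := Continuous.integrable_of_hasCompactSupport
    sX3.dz_smooth.continuous cX3.dz_compact
  have K : ∫ z, (dzb X1 z - dz X2 z - dz X3 z).re = 0 := by
    have := integral_re ((J1.sub J2).sub J3)
    simp only [RCLike.re_eq_complex_re] at this
    have e : (∫ z, (dzb X1 - dz X2 - dz X3) z) = 0 := by
      simp only [Pi.sub_apply]
      rw [integral_sub (by exact J1.sub J2) J3, integral_sub J1 J2, i1, i2, i3]; simp
    rw [e] at this
    simpa using this
  have KI : Integrable fun z => (dzb X1 z - dz X2 z - dz X3 z).re := ((J1.sub J2).sub J3).re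
  have final : ∫ z, ((w z * qlap φ z - qlap w z) * ‖b z‖ ^ 2 * Real.exp (φ z) -
      w z * ‖dzb b z‖ ^ 2 * Real.exp (φ z) -
      2 * (‖dzb W z‖ * ‖b z‖ * ‖dzb b z‖ * Real.exp (φ z))) ≤
      ∫ z, (dzb X1 z - dz X2 z - dz X3 z).re := by
    apply integral_mono ((I1.sub I2).sub (I3.const_mul 2)) KI
    intro z
    simp only [identr, Pi.sub_apply]
    have n1 : 0 ≤ w z * Real.exp (φ z) * ‖Y z‖ ^ 2 := by
      by_cases hz : z ∈ tsupport b
      · have := hw0 z hz; positivity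
      · have e0 : b =ᶠ[𝓝 z] fun _ => 0 := notMem_tsupport_iff_eventuallyEq.1 hz
        have : Y z = 0 := by
          simp only [hY, dz_eventuallyEq e0, e0.self_of_nhds]; simp [dz]
        simp [this]
    have n2 : (dzb W z * b z * conj (dzb b z)).re ≤ ‖dzb W z‖ * ‖b z‖ * ‖dzb b z‖ := by
      refine (Complex.re_le_norm _).trans ?_
      simp
    have n3 : Real.exp (φ z) * (2 * (dzb W z * b z * conj (dzb b z)).re) ≤
        2 * (‖dzb W z‖ * ‖b z‖ * ‖dzb b z‖ * Real.exp (φ z)) := by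
      have := mul_le_mul_of_nonneg_left n2 (Real.exp_pos (φ z)).le
      linarith
    linarith
  rw [K, integral_sub (by exact I1.sub I2) (I3.const_mul 2), integral_sub I1 I2, integral_const_mul] at final
  linarith

/-! ### Real-valued, locally bounded subharmonic functions -/

/-- A real-valued, locally bounded below subharmonic function on an open set. -/
structure BSub (v : ℂ → ℝ) (Ω : Set ℂ) : Prop where
  isOpen : IsOpen Ω
  usc : UpperSemicontinuousOn v Ω
  bddBelow : ∀ K ⊆ Ω, IsCompact K → ∃ m : ℝ, ∀ z ∈ K, m ≤ v z
  submean : ∀ z ∈ Ω, ∃ s > 0, ∀ c ∈ ball z s, ∀ r, 0 < r → r < s →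
    v c ≤ Real.circleAverage v c r

theorem exists_bounded_usc_extension {v : ℂ → ℝ} {Ω K : Set ℂ} (husc : UpperSemicontinuousOn v Ω)
    (hbd : ∀ K ⊆ Ω, IsCompact K → ∃ m : ℝ, ∀ z ∈ K, m ≤ v z) (hK : IsCompact K) (hKΩ : K ⊆ Ω) :
    ∃ V : ℂ → ℝ, UpperSemicontinuous V ∧ (∃ C, ∀ z, |V z| ≤ C) ∧ EqOn V v K := by
  classical
  obtain ⟨m, hm⟩ := hbd K hKΩ hK
  obtain ⟨M, hM⟩ := UpperSemicontinuousOn.bddAbove_of_isCompact hK (husc.mono hKΩ)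
  refine ⟨K.piecewise v fun _ => m, ?_, ⟨max |m| |M|, fun z => ?_⟩, fun z hz => by simp [hz]⟩
  · intro z y hy
    by_cases hz : z ∈ K
    · have h1 : K.piecewise v (fun _ => m) z = v z := by simp [hz]
      rw [h1] at hy
      have h2 := (husc.mono hKΩ) z hz y hy
      rw [eventually_nhdsWithin_iff] at h2
      filter_upwards [h2] with x hx
      by_cases hxK : x ∈ K
      · simpa [hxK] using hx hxK
      · simpa [hxK] using (hm z hz).trans_lt hy
    · have h1 : K.piecewise v (fun _ => m) z = m := by simp [hz]
      rw [h1] at hy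
      filter_upwards [hK.isClosed.isOpen_compl.mem_nhds hz] with x hx
      have : x ∉ K := hx
      simpa [this] using hy
  · by_cases hz : z ∈ K
    · have h2 : v z ≤ M := hM ⟨z, hz, rfl⟩
      have h3 := hm z hz
      simp only [hz, piecewise_eq_of_mem]
      rw [abs_le]
      constructor
      · have := neg_abs_le m
        linarith [le_max_left |m| |M|]
      · linarith [le_max_right |m| |M|, le_abs_self M]
    · simp [hz]

theorem BSub.exists_ext {v : ℂ → ℝ} {Ω K : Set ℂ} (h : BSub v Ω) (hK : IsCompact K)
    (hKΩ : K ⊆ Ω) :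
    ∃ V : ℂ → ℝ, UpperSemicontinuous V ∧ (∃ C, ∀ z, |V z| ≤ C) ∧ EqOn V v K :=
  exists_bounded_usc_extension h.usc h.bddBelow hK hKΩ

theorem circleIntegrable_of_bounded {V : ℂ → ℝ} (hV : Measurable V) {C : ℝ} (hC : ∀ z, |V z| ≤ C)
    (c : ℂ) (r : ℝ) : CircleIntegrable V c r := by
  rw [circleIntegrable_def, intervalIntegrable_iff]
  have hm : Measurable fun θ => V (circleMap c r θ) := hV.comp (continuous_circleMap c r).measurable
  exact Measure.integrableOn_of_bounded (M := C) (by simp; exact ENNReal.mul_ne_top (by simp) (by simp)) hm.aestronglyMeasurable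
    (ae_of_all _ fun θ => by simpa using hC _)

theorem circleIntegrable_of_sphere {v V : ℂ → ℝ} {c : ℂ} {r : ℝ} (hV : CircleIntegrable V c r)
    (h : EqOn V v (sphere c |r|)) : CircleIntegrable v c r := by
  rw [circleIntegrable_def] at hV ⊢
  have : (fun θ => v (circleMap c r θ)) = fun θ => V (circleMap c r θ) := by
    ext θ; exact (h (circleMap_mem_sphere' c r θ)).symm
  rwa [this]

theorem BSub.circleIntegrable {v : ℂ → ℝ} {Ω : Set ℂ} (h : BSub v Ω) {c : ℂ} {r : ℝ}
    (hr : sphere c |r| ⊆ Ω) : CircleIntegrable v c r := by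
  obtain ⟨V, hV, ⟨C, hC⟩, hE⟩ := h.exists_ext (isCompact_sphere c |r|) hr
  exact circleIntegrable_of_sphere (circleIntegrable_of_bounded hV.measurable hC c r) hE

theorem BSub.add {u v : ℂ → ℝ} {Ω : Set ℂ} (hu : BSub u Ω) (hv : BSub v Ω) :
    BSub (fun z => u z + v z) Ω where
  isOpen := hu.isOpen
  usc := hu.usc.add hv.usc
  bddBelow K hK hKc := by
    obtain ⟨m, hm⟩ := hu.bddBelow K hK hKc
    obtain ⟨n, hn⟩ := hv.bddBelow K hK hKc
    exact ⟨m + n, fun z hz => add_le_add (hm z hz) (hn z hz)⟩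
  submean z hz := by
    obtain ⟨s, hs, h1⟩ := hu.submean z hz
    obtain ⟨t, ht, h2⟩ := hv.submean z hz
    obtain ⟨q, hq, h3⟩ := isOpen_iff.1 hu.isOpen z hz
    refine ⟨min (min s t) (q / 2), by positivity, fun c hc r hr hrs => ?_⟩
    simp only [mem_ball, lt_min_iff] at hc hrs
    have hsp : sphere c |r| ⊆ Ω := by
      intro x hx
      apply h3
      have hx' : dist x c = r := by rwa [mem_sphere, abs_of_pos hr] at hx
      rw [mem_ball]
      linarith [dist_triangle x c z]
    rw [Real.circleAverage_fun_add (hu.circleIntegrable hsp) (hv.circleIntegrable hsp)]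
    exact add_le_add (h1 c hc.1.1 r hr hrs.1.1) (h2 c hc.1.2 r hr hrs.1.2)

theorem BSub.const_mul {v : ℂ → ℝ} {Ω : Set ℂ} (hv : BSub v Ω) {a : ℝ} (ha : 0 ≤ a) :
    BSub (fun z => a * v z) Ω where
  isOpen := hv.isOpen
  usc := (Continuous.comp_upperSemicontinuousOn (g := fun x => a * x) (by fun_prop) hv.usc
    (fun x y hxy => mul_le_mul_of_nonneg_left hxy ha))
  bddBelow K hK hKc := by
    obtain ⟨n, hn⟩ := hv.bddBelow K hK hKc
    exact ⟨a * n, fun z hz => mul_le_mul_of_nonneg_left (hn z hz) ha⟩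
  submean z hz := by
    obtain ⟨s, hs, h1⟩ := hv.submean z hz
    refine ⟨s, hs, fun c hc r hr hrs => ?_⟩
    have := mul_le_mul_of_nonneg_left (h1 c hc r hr hrs) ha
    refine this.trans (le_of_eq ?_)
    have := Real.circleAverage_fun_smul (a := a) (f := v) (c := c) (R := r)
    simpa [smul_eq_mul] using this.symm

theorem BSub.mono {v : ℂ → ℝ} {Ω Ω' : Set ℂ} (hv : BSub v Ω) (h : Ω' ⊆ Ω) (ho : IsOpen Ω') :
    BSub v Ω' where
  isOpen := ho
  usc := hv.usc.mono h
  bddBelow K hK hKc := hv.bddBelow K (hK.trans h) hKc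
  submean z hz := hv.submean z (h hz)

theorem bsub_const (a : ℝ) {Ω : Set ℂ} (ho : IsOpen Ω) : BSub (fun _ => a) Ω where
  isOpen := ho
  usc := upperSemicontinuousOn_const
  bddBelow _ _ _ := ⟨a, fun _ _ => le_rfl⟩
  submean _ _ := ⟨1, one_pos, fun c _ r _ _ => by simp [Real.circleAverage_const]⟩

theorem integral_radial_nonneg {v : ℂ → ℝ} {k : ℝ → ℝ} {z : ℂ} {s : ℝ} (hk : ∀ t, 0 ≤ k t)
    (hv : ∀ r, 0 < r → r < s → CircleIntegrable v z r ∧ v z ≤ Real.circleAverage v z r) :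
    0 ≤ ∫ ζ, (ball (0 : ℂ) s).indicator (fun ζ => k ‖ζ‖ * (v (z + ζ) - v z)) ζ := by
  rw [← Complex.integral_comp_polarCoord_symm]
  set F : ℝ × ℝ → ℝ := fun p => p.1 • (ball (0 : ℂ) s).indicator
    (fun ζ => k ‖ζ‖ * (v (z + ζ) - v z)) (Complex.polarCoord.symm p) with hF
  by_cases hint : IntegrableOn F polarCoord.target
  · have ht : polarCoord.target = Ioi (0 : ℝ) ×ˢ Ioo (-Real.pi) Real.pi := rfl
    rw [ht, Measure.volume_eq_prod, setIntegral_prod _ (by rw [ht] at hint; exact hint)]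
    apply setIntegral_nonneg measurableSet_Ioi
    intro r hr
    rw [mem_Ioi] at hr
    have hn : ∀ θ : ℝ, ‖(Complex.polarCoord.symm (r, θ) : ℂ)‖ = r := fun θ => by
      rw [Complex.norm_polarCoord_symm]; exact abs_of_pos hr
    have hcm : ∀ θ : ℝ, z + Complex.polarCoord.symm (r, θ) = circleMap z r θ := fun θ => by
      rw [Complex.polarCoord_symm_apply, circleMap]
      simp [Complex.exp_mul_I]
    by_cases hrs : r < s
    · have : ∀ θ : ℝ, F (r, θ) = r * k r * (v (circleMap z r θ) - v z) := by
        intro θ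
        simp only [hF]
        rw [indicator_of_mem (by rw [mem_ball_zero_iff, hn]; exact hrs), hn, hcm, smul_eq_mul]
        ring
      change 0 ≤ ∫ θ in Ioo (-Real.pi) Real.pi, F (r, θ)
      simp only [this]
      rw [integral_const_mul]
      obtain ⟨hi, hsub⟩ := hv r hr hrs
      apply mul_nonneg (mul_nonneg hr.le (hk r))
      rw [← integral_Ioc_eq_integral_Ioo, ← intervalIntegral.integral_of_le (by linarith [Real.pi_pos])]
      have hper : Function.Periodic (fun θ => v (circleMap z r θ) - v z) (2 * Real.pi) := by
        intro θ; simp [periodic_circleMap z r θ]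
      have := hper.intervalIntegral_add_eq (-Real.pi) 0
      rw [show -Real.pi + 2 * Real.pi = Real.pi by ring, zero_add] at this
      rw [this, intervalIntegral.integral_sub hi (by simp)]
      rw [Real.circleAverage_def, smul_eq_mul] at hsub
      have hp : 0 < 2 * Real.pi := by positivity
      rw [inv_mul_eq_div, le_div_iff₀ hp] at hsub
      simp only [intervalIntegral.integral_const, sub_zero, smul_eq_mul]
      linarith
    · have : ∀ θ : ℝ, F (r, θ) = 0 := by
        intro θ
        simp only [hF]
        rw [indicator_of_notMem (by rw [mem_ball_zero_iff, hn]; exact hrs)]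
        simp
      change 0 ≤ ∫ θ in Ioo (-Real.pi) Real.pi, F (r, θ)
      simp [this]
  · rw [integral_undef hint]

theorem qlap_nonneg_of_submean {f : ℂ → ℝ} (hf : ContDiff ℝ ∞ f) {z : ℂ}
    (hsub : ∀ᶠ r in 𝓝[>] (0 : ℝ), f z ≤ Real.circleAverage f z r) : 0 ≤ qlap f z := by
  set F : ℂ → ℂ := fun z => (f z : ℂ) with hF
  have sF := hf.ofReal_comp
  by_contra hneg
  push Not at hneg
  set ε := - qlap f z / 2 with hε
  have hε0 : 0 < ε := by rw [hε]; linarith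
  set a := dz F z
  set b := dz (dz F) z
  set L := qlap f z
  set g : ℂ → ℂ := fun ζ => F ζ - (a * (ζ - z) + b / 2 * (ζ - z) ^ 2 +
      conj (a * (ζ - z) + b / 2 * (ζ - z) ^ 2) + L * ((ζ - z) * conj (ζ - z))) with hg
  have hq : ∀ ζ, HasW (fun ζ => a * (ζ - z) + b / 2 * (ζ - z) ^ 2) (a + b * (ζ - z)) 0 ζ := by
    intro ζ
    apply HasW.of_hasDerivAt
    have h1 : HasDerivAt (fun ζ => ζ - z) 1 ζ := (hasDerivAt_id ζ).sub_const z
    refine ((h1.const_mul a).add ((h1.pow 2).const_mul (b / 2))).congr_deriv ?_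
    simp; ring
  have hgW : ∀ ζ, HasW g (dz F ζ - (a + b * (ζ - z) + L * conj (ζ - z)))
      (conj (dz F ζ - (a + b * (ζ - z) + L * conj (ζ - z)))) ζ := by
    intro ζ
    have h1 : HasW (fun ζ => ζ - z) 1 0 ζ := by
      simpa using (HasW.id ζ).sub (HasW.const z ζ)
    have := (sF.hasW ζ).sub ((((hq ζ).add (hq ζ).star_conj)).add
      ((HasW.const (L : ℂ) ζ).mul (h1.mul h1.star_conj)))
    refine this.congr' ?_ ?_
    · simp only [map_zero, zero_mul, mul_zero, add_zero, zero_add, one_mul]; rfl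
    · rw [dz_eq_conj_dzb hf]
      simp
  have hsmall : ∀ᶠ ζ in 𝓝 z, ‖dz F ζ - (a + b * (ζ - z) + L * conj (ζ - z))‖ ≤
      ε / 4 * ‖ζ - z‖ := by
    have h2 := sF.dz_smooth.hasW z
    rw [← qlap_im hf] at h2
    have h3 := (HasFDerivAt.isLittleO h2).def (c := ε / 4) (by positivity)
    filter_upwards [h3] with ζ hζ
    refine (le_of_eq ?_).trans hζ
    congr 1
    simp only [a, b, L, hF, add_apply, smul_apply, ContinuousLinearMap.id_apply, smul_eq_mul,
        ContinuousLinearEquiv.coe_coe, Complex.conjCLE_apply]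
    ring
  obtain ⟨δ, hδ, hball⟩ := eventually_nhds_iff_ball.1 hsmall
  have hbound : ∀ ζ ∈ ball z δ, ‖g ζ - F z‖ ≤ ε / 2 * ‖ζ - z‖ ^ 2 := fun ζ hζ => by
    have := Convex.norm_image_sub_le_of_norm_fderiv_le (𝕜 := ℝ) (f := g) (s := closedBall z ‖ζ - z‖)
      (C := ε / 2 * ‖ζ - z‖) (x := z) (y := ζ) (fun x _ => (hgW x).differentiableAt) ?_
      (convex_closedBall _ _) (by simp) (by simp [dist_eq_norm])
    · have e : g z = F z := by simp [hg]
      rw [e] at this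
      refine this.trans (le_of_eq (by ring))
    · intro x hx
      have hx' : ‖x - z‖ ≤ ‖ζ - z‖ := by simpa [dist_eq_norm] using hx
      have hxb : x ∈ ball z δ := by
        rw [mem_ball, dist_eq_norm] at hζ ⊢; linarith
      rw [HasFDerivAt.fderiv (hgW x)]
      have h5 := hball x hxb
      refine ContinuousLinearMap.opNorm_le_bound _ (by positivity) fun h => ?_
      simp only [add_apply, smul_apply, ContinuousLinearMap.id_apply, smul_eq_mul,
        ContinuousLinearEquiv.coe_coe, Complex.conjCLE_apply]
      refine (norm_add_le _ _).trans ?_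
      rw [norm_mul, norm_mul, RCLike.norm_conj, RCLike.norm_conj]
      have h6 : ε / 4 * ‖x - z‖ ≤ ε / 4 * ‖ζ - z‖ := by gcongr
      have := mul_le_mul_of_nonneg_right (h5.trans h6) (norm_nonneg h)
      linarith
  have hev : ∀ᶠ r in 𝓝[>] (0 : ℝ), r < δ := by
    filter_upwards [Ioo_mem_nhdsGT hδ] with r hr using hr.2
  obtain ⟨r, hr1, hr2, hr0⟩ := (hsub.and (hev.and self_mem_nhdsWithin)).exists
  replace hr0 : 0 < r := hr0
  set q : ℂ → ℂ := fun ζ => a * (ζ - z) + b / 2 * (ζ - z) ^ 2 with hqdef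
  have hqavg : Real.circleAverage (fun ζ => (q ζ).re) z r = 0 := by
    have hd : Differentiable ℂ q := by intro ζ; simp only [hqdef]; fun_prop
    have h1 : Real.circleAverage q z r = q z := (hd.diffContOnCl).circleAverage
    have h2 := Complex.reCLM.circleAverage_comp_comm (c := z) (R := r) (f := q)
      (hd.continuous.continuousOn.circleIntegrable' )
    rw [h1] at h2
    have : (fun ζ => (q ζ).re) = Complex.reCLM ∘ q := rfl
    rw [this, h2]
    simp [hqdef]
  have hmono : Real.circleAverage f z r ≤
      Real.circleAverage (fun ζ => 2 * (q ζ).re + (f z + (L + ε / 2) * r ^ 2)) z r := by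
    have hqc : Continuous q := by simp only [hqdef]; fun_prop
    apply Real.circleAverage_mono
    · exact hf.continuous.continuousOn.circleIntegrable'
    · exact (by fun_prop : Continuous _).continuousOn.circleIntegrable'
    · intro ζ hζ
      have hn : ‖ζ - z‖ = r := by simpa [dist_eq_norm, abs_of_pos hr0] using hζ
      have h7 := hbound ζ (by rw [mem_ball, dist_eq_norm, hn]; exact hr2)
      rw [hn] at h7
      have h8 := (Complex.re_le_norm _).trans h7
      have h9 : (g ζ - F z).re = f ζ - 2 * (q ζ).re - L * r ^ 2 - f z := by
        have h10 : g ζ - F z = (f ζ : ℂ) - (q ζ + conj (q ζ) +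
            L * ((ζ - z) * conj (ζ - z))) - (f z : ℂ) := rfl
        rw [h10, Complex.mul_conj, Complex.normSq_eq_norm_sq, hn, Complex.add_conj]
        generalize q ζ = t
        norm_cast
        ring
      rw [h9] at h8
      linarith
  rw [Real.circleAverage_fun_add, Real.circleAverage_const] at hmono
  · have := Real.circleAverage_fun_smul (a := (2 : ℝ)) (f := fun ζ => (q ζ).re) (c := z) (R := r)
    simp only [smul_eq_mul] at this
    rw [this, hqavg] at hmono
    have hL2 : L + ε / 2 < 0 := by rw [hε]; linarith
    have : (L + ε / 2) * r ^ 2 < 0 := mul_neg_of_neg_of_pos hL2 (by positivity)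
    linarith
  · have hqc : Continuous q := by simp only [hqdef]; fun_prop
    exact (by fun_prop : Continuous _).continuousOn.circleIntegrable'
  · exact circleIntegrable_const _ _ _

/-- Bounded upper semicontinuous functions are limits of Lipschitz majorants. -/
theorem exists_continuous_majorants {g : ℝ → ℝ} (hg : UpperSemicontinuous g) {m M : ℝ}
    (hm : ∀ t, m ≤ g t) (hM : ∀ t, g t ≤ M) :
    ∃ φ : ℕ → ℝ → ℝ, (∀ n, Continuous (φ n)) ∧ (∀ n t, g t ≤ φ n t) ∧ (∀ n t, φ n t ≤ M) ∧
      (∀ t, Tendsto (fun n => φ n t) atTop (𝓝 (g t))) ∧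
      ∀ T, Function.Periodic g T → ∀ n, Function.Periodic (φ n) T := by
  set φ : ℕ → ℝ → ℝ := fun n t => ⨆ s, (g s - n * |t - s|) with hφ
  have hbdd : ∀ (n : ℕ) t, BddAbove (range fun s => g s - (n : ℝ) * |t - s|) := fun n t => by
    refine ⟨M, ?_⟩
    rintro _ ⟨s, rfl⟩
    have : 0 ≤ (n : ℝ) * |t - s| := by positivity
    have := hM s
    simp only; linarith
  have hle : ∀ n t, g t ≤ φ n t := fun n t => by
    have := le_ciSup (hbdd n t) t
    simpa using this
  have hub : ∀ n t, φ n t ≤ M := fun n t => by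
    apply ciSup_le
    intro s
    have : 0 ≤ (n : ℝ) * |t - s| := by positivity
    have := hM s
    linarith
  refine ⟨φ, fun n => ?_, hle, hub, fun t => ?_, fun T hT n t => ?_⟩
  · have hl : LipschitzWith n (φ n) := by
      apply LipschitzWith.of_le_add_mul
      intro x y
      apply ciSup_le
      intro s
      have h1 := le_ciSup (hbdd n y) s
      have h2 : |y - s| ≤ |x - s| + |x - y| := by
        have := abs_sub_le y x s
        rw [abs_sub_comm y x] at this; linarith
      have h3 : (n : ℝ) * |y - s| ≤ n * (|x - s| + |x - y|) :=
        mul_le_mul_of_nonneg_left h2 (by positivity)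
      rw [Real.dist_eq]
      simp only [NNReal.coe_natCast]
      simp only [hφ]
      linarith
    exact hl.continuous
  · rw [Metric.tendsto_atTop]
    intro ε hε
    have h1 := hg t (g t + ε / 2) (by linarith)
    obtain ⟨δ, hδ, hb⟩ := Metric.eventually_nhds_iff_ball.1 h1
    obtain ⟨N, hN⟩ := exists_nat_gt ((M - m) / δ)
    refine ⟨N, fun n hn => ?_⟩
    rw [Real.dist_eq, abs_lt]
    constructor
    · linarith [hle n t]
    · suffices h : φ n t ≤ g t + ε / 2 by linarith
      apply ciSup_le
      intro s
      by_cases hs : s ∈ ball t δ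
      · have : 0 ≤ (n : ℝ) * |t - s| := by positivity
        linarith [hb s hs]
      · have h4 : δ ≤ |t - s| := by
          rw [mem_ball, Real.dist_eq, abs_sub_comm] at hs
          exact not_lt.1 hs
        have h6 : M - m ≤ n * |t - s| := by
          rw [div_lt_iff₀ hδ] at hN
          calc M - m ≤ N * δ := hN.le
            _ ≤ n * |t - s| := by gcongr
        linarith [hm t, hM s]
  · simp only [hφ]
    refine ((Equiv.addRight T).iSup_congr fun s => ?_).symm
    simp only [Equiv.coe_addRight, hT s, add_sub_add_right_eq_sub]

theorem exists_circle_majorants {u : ℂ → ℝ} {Ω : Set ℂ} (husc : UpperSemicontinuousOn u Ω)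
    (hbd : ∀ K ⊆ Ω, IsCompact K → ∃ m : ℝ, ∀ z ∈ K, m ≤ u z) {c : ℂ} {r : ℝ} (hr : 0 ≤ r)
    (hc : closedBall c r ⊆ Ω) :
    ∃ V : ℂ → ℝ, UpperSemicontinuous V ∧ (∃ C, ∀ z, |V z| ≤ C) ∧ EqOn V u (closedBall c r) ∧
      ∃ φ : ℕ → ℝ → ℝ, (∀ n, Continuous (φ n)) ∧ (∀ n t, u (circleMap c r t) ≤ φ n t) ∧
        (∀ n, Function.Periodic (φ n) (2 * Real.pi)) ∧
        Tendsto (fun n => (2 * Real.pi)⁻¹ * ∫ θ in (0 : ℝ)..(2 * Real.pi), φ n θ) atTop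
          (𝓝 (Real.circleAverage u c r)) := by
  obtain ⟨V, hV, ⟨C, hC⟩, hE⟩ := exists_bounded_usc_extension husc hbd (isCompact_closedBall c r) hc
  have hE' : ∀ θ : ℝ, V (circleMap c r θ) = u (circleMap c r θ) := fun θ =>
    hE (sphere_subset_closedBall (circleMap_mem_sphere c hr θ))
  obtain ⟨φ, hφc, hφg, hφM, hφt, hφp⟩ := exists_continuous_majorants
    (g := fun θ => V (circleMap c r θ)) (m := -C) (M := C)
    (hV.comp (continuous_circleMap c r)) (fun t => (abs_le.1 (hC _)).1)
    (fun t => (abs_le.1 (hC _)).2)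
  refine ⟨V, hV, ⟨C, hC⟩, hE, φ, hφc, fun n t => hE' t ▸ hφg n t,
    hφp _ fun t => by simp [periodic_circleMap c r t], ?_⟩
  rw [Real.circleAverage_def, smul_eq_mul]
  apply Tendsto.const_mul
  simp only [← hE']
  apply intervalIntegral.tendsto_integral_filter_of_dominated_convergence (fun _ => C)
  · exact Eventually.of_forall fun n => (hφc n).aestronglyMeasurable
  · refine Eventually.of_forall fun n => ae_of_all _ fun t _ => ?_
    rw [Real.norm_eq_abs, abs_le]
    exact ⟨(abs_le.1 (hC _)).1.trans (hφg n t), hφM n t⟩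
  · simp
  · exact ae_of_all _ fun t _ => hφt t

theorem SubmeanOn.truncation_le {u : ℂ → EReal} {Ω : Set ℂ}
    (htop : ∀ z ∈ Ω, u z ≠ ⊤) (hsub : SubmeanOn u Ω) (N : ℝ) {c : ℂ} {r : ℝ} (hr : 0 < r)
    (hc : closedBall c r ⊆ Ω) {v : ℂ → ℝ} (hv : v = fun z => (max (u z) N).toReal)
    (hvusc : UpperSemicontinuousOn v Ω) : v c ≤ Real.circleAverage v c r := by
  have hmem : ∀ θ : ℝ, circleMap c r θ ∈ Ω := fun θ =>
    hc (sphere_subset_closedBall (circleMap_mem_sphere c hr.le θ))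
  have hval : ∀ z ∈ Ω, ((v z : ℝ) : EReal) = max (u z) N := fun z hz => by
    rw [hv]
    exact EReal.coe_toReal (by simp [htop z hz]) (by simp)
  have hN : ∀ z ∈ Ω, N ≤ v z := fun z hz => by
    have : ((N : ℝ) : EReal) ≤ (v z : ℝ) := by rw [hval z hz]; exact le_max_right _ _
    exact_mod_cast this
  obtain ⟨V, hV, ⟨C, hC⟩, hE, φ, hφc, hφg, -, hlim⟩ := exists_circle_majorants hvusc
    (fun K hK _ => ⟨N, fun z hz => hN z (hK hz)⟩) hr.le hc
  have h1 : N ≤ Real.circleAverage v c r := by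
    have h2 : Real.circleAverage (fun _ => N) c r ≤ Real.circleAverage v c r := by
      apply Real.circleAverage_mono
      · exact circleIntegrable_const _ _ _
      · refine circleIntegrable_of_sphere (circleIntegrable_of_bounded hV.measurable hC c r) ?_
        rw [abs_of_pos hr]
        exact hE.mono sphere_subset_closedBall
      · intro z hz
        rw [abs_of_pos hr] at hz
        exact hN z (hc (sphere_subset_closedBall hz))
    rwa [Real.circleAverage_const] at h2
  have h2 : u c ≤ (Real.circleAverage v c r : ℝ) := by
    refine ge_of_tendsto ((continuous_coe_real_ereal.tendsto _).comp hlim)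
      (Eventually.of_forall fun n => hsub c r hr hc (φ n) (hφc n) fun θ => ?_)
    have h3 : u (circleMap c r θ) ≤ v (circleMap c r θ) := by
      rw [hval _ (hmem θ)]; exact le_max_left _ _
    refine le_trans ?_ (EReal.coe_le_coe_iff.2 (hφg n θ))
    simpa [circleMap] using h3
  have h3 : ((v c : ℝ) : EReal) ≤ (Real.circleAverage v c r : ℝ) := by
    rw [hval c (hc (mem_closedBall_self hr.le))]
    exact max_le h2 (by exact_mod_cast h1)
  exact_mod_cast h3

theorem upperSemicontinuousOn_truncation {u : ℂ → EReal} {Ω : Set ℂ}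
    (husc : UpperSemicontinuousOn u Ω) (htop : ∀ z ∈ Ω, u z ≠ ⊤) (N : ℝ) :
    UpperSemicontinuousOn (fun z => (max (u z) N).toReal) Ω := by
  intro z hz y hy
  have hval : ∀ z ∈ Ω, (((max (u z) N).toReal : ℝ) : EReal) = max (u z) N := fun z hz =>
    EReal.coe_toReal (by simp [htop z hz]) (by simp)
  have h1 : max (u z) N < (y : EReal) := by rw [← hval z hz]; exact_mod_cast hy
  rw [max_lt_iff] at h1
  have h2 := husc z hz y h1.1
  filter_upwards [h2, self_mem_nhdsWithin] with x hx hxΩ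
  have : (((max (u x) N).toReal : ℝ) : EReal) < y := by
    rw [hval x hxΩ]; exact max_lt hx h1.2
  exact_mod_cast this

theorem SubharmonicOn.bsub_truncation {u : ℂ → EReal} {Ω : Set ℂ} (hu : SubharmonicOn u Ω)
    (N : ℝ) : BSub (fun z => (max (u z) N).toReal) Ω where
  isOpen := hu.1
  usc := upperSemicontinuousOn_truncation hu.2.1 hu.2.2.1 N
  bddBelow K hK _ := by
    refine ⟨N, fun z hz => ?_⟩
    have h : (((max (u z) N).toReal : ℝ) : EReal) = max (u z) N :=
      EReal.coe_toReal (by simp [hu.2.2.1 z (hK hz)]) (by simp)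
    have : ((N : ℝ) : EReal) ≤ ((max (u z) N).toReal : ℝ) := by rw [h]; exact le_max_right _ _
    exact_mod_cast this
  submean z hz := by
    obtain ⟨q, hq, h3⟩ := isOpen_iff.1 hu.1 z hz
    refine ⟨q / 2, by positivity, fun c hc r hr hrs => ?_⟩
    refine SubmeanOn.truncation_le hu.2.2.1 hu.2.2.2.2 N hr (fun x hx => h3 ?_) rfl
      (upperSemicontinuousOn_truncation hu.2.1 hu.2.2.1 N)
    rw [mem_closedBall] at hx
    rw [mem_ball] at hc ⊢
    linarith [dist_triangle x c z]

theorem BSub.exists_radius {v : ℂ → ℝ} {Ω K : Set ℂ} (h : BSub v Ω) (hK : IsCompact K)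
    (hKΩ : K ⊆ Ω) : ∃ s > 0, ∀ c ∈ K, ∀ r, 0 < r → r < s → v c ≤ Real.circleAverage v c r := by
  refine hK.induction_on (p := fun K => ∃ s > 0, ∀ c ∈ K, ∀ r, 0 < r → r < s →
    v c ≤ Real.circleAverage v c r) ⟨1, one_pos, by simp⟩ ?_ ?_ ?_
  · rintro s t hst ⟨ε, hε, h⟩
    exact ⟨ε, hε, fun c hc => h c (hst hc)⟩
  · rintro s t ⟨ε, hε, h⟩ ⟨δ, hδ, h'⟩
    refine ⟨min ε δ, by positivity, ?_⟩
    rintro c (hc | hc) r hr hrs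
    · exact h c hc r hr (hrs.trans_le (min_le_left _ _))
    · exact h' c hc r hr (hrs.trans_le (min_le_right _ _))
  · intro z hz
    obtain ⟨s, hs, h'⟩ := h.submean z (hKΩ hz)
    exact ⟨ball z s, mem_nhdsWithin_of_mem_nhds (ball_mem_nhds z hs), s, hs, h'⟩

/-- A standard mollifier of radius `1 / (n + 1)`. -/
noncomputable def mollifier (n : ℕ) : ContDiffBump (0 : ℂ) :=
  ⟨1 / (2 * (n + 1)), 1 / (n + 1), by positivity, by
    apply one_div_lt_one_div_of_lt <;> linarith [(Nat.cast_nonneg n : (0 : ℝ) ≤ n)]⟩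

/-- Mollification of a function at scale `1 / (n + 1)`. -/
noncomputable def mollify (n : ℕ) (V : ℂ → ℝ) : ℂ → ℝ :=
  convolution ((mollifier n).normed volume) V (ContinuousLinearMap.lsmul ℝ ℝ) volume

theorem mollify_apply (n : ℕ) (V : ℂ → ℝ) (z : ℂ) :
    mollify n V z = ∫ ζ, (mollifier n).normed volume ζ * V (z - ζ) := by
  simp [mollify, convolution]

theorem locallyIntegrable_of_bounded {V : ℂ → ℝ} (hV : Measurable V) {C : ℝ}
    (hC : ∀ z, |V z| ≤ C) : LocallyIntegrable V volume := by
  refine (locallyIntegrable_const C).mono hV.aestronglyMeasurable (ae_of_all _ fun z => ?_)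
  rw [Real.norm_eq_abs]
  exact (hC z).trans (le_abs_self C)

theorem contDiff_mollify {V : ℂ → ℝ} (hV : LocallyIntegrable V volume) (n : ℕ) :
    ContDiff ℝ ∞ (mollify n V) :=
  (mollifier n).hasCompactSupport_normed.contDiff_convolution_left _
    (mollifier n).contDiff_normed hV

theorem integrable_mollify_integrand {V : ℂ → ℝ} (hV : Measurable V) {C : ℝ}
    (hC : ∀ z, |V z| ≤ C) (n : ℕ) (z : ℂ) :
    Integrable fun ζ => (mollifier n).normed volume ζ * V (z - ζ) := by
  refine Integrable.mul_bdd (c := C) (mollifier n).integrable_normed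
    (hV.comp (measurable_const.sub measurable_id)).aestronglyMeasurable
    (ae_of_all _ fun ζ => by simpa using hC _)

theorem mollify_le {V : ℂ → ℝ} (hV : Measurable V) {C : ℝ} (hC : ∀ z, |V z| ≤ C) {a : ℝ}
    (ha : ∀ z, V z ≤ a) (n : ℕ) (z : ℂ) : mollify n V z ≤ a := by
  rw [mollify_apply]
  calc _ ≤ ∫ ζ, (mollifier n).normed volume ζ * a := by
        apply integral_mono (integrable_mollify_integrand hV hC n z)
          ((mollifier n).integrable_normed.mul_const a)
        intro ζ
        exact mul_le_mul_of_nonneg_left (ha _) ((mollifier n).nonneg_normed ζ)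
    _ = a := by rw [integral_mul_const, (mollifier n).integral_normed, one_mul]

theorem le_mollify {V : ℂ → ℝ} (hV : Measurable V) {C : ℝ} (hC : ∀ z, |V z| ≤ C) {a : ℝ}
    (ha : ∀ z, a ≤ V z) (n : ℕ) (z : ℂ) : a ≤ mollify n V z := by
  rw [mollify_apply]
  calc a = ∫ ζ, (mollifier n).normed volume ζ * a := by
        rw [integral_mul_const, (mollifier n).integral_normed, one_mul]
    _ ≤ _ := by
        apply integral_mono ((mollifier n).integrable_normed.mul_const a)
          (integrable_mollify_integrand hV hC n z)
        intro ζ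
        exact mul_le_mul_of_nonneg_left (ha _) ((mollifier n).nonneg_normed ζ)

theorem mollify_eq_of_const {V : ℂ → ℝ} {n : ℕ} {z : ℂ} {a : ℝ}
    (h : ∀ ζ ∈ ball z (1 / (n + 1)), V ζ = a) : mollify n V z = a := by
  have hz : V z = a := h z (mem_ball_self (by positivity))
  have := (mollifier n).normed_convolution_eq_right (μ := volume) (g := V) (x₀ := z)
    (fun x hx => (h x hx).trans hz.symm)
  rw [mollify, this, hz]

theorem mollify_tendsto_ae {V : ℂ → ℝ} (hV : LocallyIntegrable V volume) :
    ∀ᵐ z, Tendsto (fun n => mollify n V z) atTop (𝓝 (V z)) := by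
  have hlim : Tendsto (fun n : ℕ => (mollifier n).rOut) atTop (𝓝 0) :=
    tendsto_one_div_add_atTop_nhds_zero_nat
  refine ContDiffBump.ae_convolution_tendsto_right_of_locallyIntegrable (K := 2) hlim
    (Eventually.of_forall fun n => le_of_eq ?_) hV
  simp only [mollifier]
  field_simp

theorem mollify_submean {V : ℂ → ℝ} (hV : Measurable V) {C : ℝ} (hC : ∀ z, |V z| ≤ C) {n : ℕ}
    {z : ℂ} {r : ℝ} (h : ∀ ζ ∈ ball z (1 / (n + 1)), V ζ ≤ Real.circleAverage V ζ r) :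
    mollify n V z ≤ Real.circleAverage (mollify n V) z r := by
  have hprod : Integrable (fun p : ℝ × ℂ => (mollifier n).normed volume p.2 *
      V (circleMap z r p.1 - p.2)) ((volume.restrict (Ioc 0 (2 * Real.pi))).prod volume) := by
    have h1 : Integrable (fun p : ℝ × ℂ => (mollifier n).normed volume p.2)
        ((volume.restrict (Ioc 0 (2 * Real.pi))).prod volume) :=
      (mollifier n).integrable_normed.comp_snd _
    refine Integrable.mul_bdd (c := C) h1 ?_ (ae_of_all _ fun ζ => by simpa using hC _)
    refine (hV.comp ?_).aestronglyMeasurable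
    exact ((continuous_circleMap z r).measurable.comp measurable_fst).sub measurable_snd
  have hin : ∀ ζ, (2 * Real.pi)⁻¹ * ∫ t in Ioc 0 (2 * Real.pi),
      (mollifier n).normed volume ζ * V (circleMap z r t - ζ) =
      (mollifier n).normed volume ζ * Real.circleAverage V (z - ζ) r := by
    intro ζ
    rw [integral_const_mul, Real.circleAverage_def, smul_eq_mul,
      intervalIntegral.integral_of_le (by positivity)]
    have : ∀ t, circleMap z r t - ζ = circleMap (z - ζ) r t := by
      intro t; simp only [circleMap]; ring
    simp only [this]
    ring
  have hsw : Real.circleAverage (mollify n V) z r =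
      ∫ ζ, (mollifier n).normed volume ζ * Real.circleAverage V (z - ζ) r := by
    rw [Real.circleAverage_def]
    simp only [mollify_apply, smul_eq_mul]
    rw [intervalIntegral.integral_of_le (by positivity), integral_integral_swap hprod,
      ← integral_const_mul]
    exact integral_congr_ae (ae_of_all _ hin)
  rw [hsw, mollify_apply]
  apply integral_mono (integrable_mollify_integrand hV hC n z)
  · refine (hprod.integral_prod_right.const_mul (2 * Real.pi)⁻¹).congr (ae_of_all _ hin)
  · intro ζ
    by_cases hζ : ζ ∈ Function.support ((mollifier n).normed volume)
    · refine mul_le_mul_of_nonneg_left (h _ ?_) ((mollifier n).nonneg_normed ζ)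
      rw [(mollifier n).support_normed_eq] at hζ
      simpa [dist_eq_norm, mollifier] using hζ
    · have : (mollifier n).normed volume ζ = 0 := by simpa using hζ
      simp [this]

theorem BSub.eventually_qlap_mollify_nonneg {v V : ℂ → ℝ} {Ω K U : Set ℂ} (h : BSub v Ω)
    (hK : IsCompact K) (hKU : K ⊆ U) (hU : IsOpen U) (hUΩ : U ⊆ Ω) (hV : Measurable V) {C : ℝ}
    (hC : ∀ z, |V z| ≤ C) (hE : EqOn V v U) :
    ∀ᶠ n in atTop, ∀ z ∈ K, 0 ≤ qlap (mollify n V) z := by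
  obtain ⟨δ, hδ, hδU⟩ := hK.exists_cthickening_subset_open hU hKU
  obtain ⟨s, hs, hsub⟩ := h.exists_radius (hK.cthickening (r := δ / 2))
    ((cthickening_mono (by linarith) K).trans (hδU.trans hUΩ))
  have hev : ∀ᶠ n : ℕ in atTop, 1 / ((n : ℝ) + 1) < δ / 2 :=
    tendsto_one_div_add_atTop_nhds_zero_nat.eventually_lt_const (by positivity)
  filter_upwards [hev] with n hn z hz
  apply qlap_nonneg_of_submean (contDiff_mollify (locallyIntegrable_of_bounded hV hC) n)
  filter_upwards [Ioo_mem_nhdsGT (lt_min hs (half_pos hδ))] with r hr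
  obtain ⟨hr0, hr1⟩ := hr
  rw [lt_min_iff] at hr1
  refine mollify_submean hV hC fun ζ hζ => ?_
  have hζK : ζ ∈ cthickening (δ / 2) K :=
    mem_cthickening_of_dist_le ζ z _ _ hz (hζ.le.trans hn.le)
  have e1 : V ζ = v ζ := hE (hδU (cthickening_mono (by linarith) K hζK))
  rw [e1]
  refine (hsub ζ hζK r hr0 hr1.1).trans (le_of_eq (Real.circleAverage_congr_sphere ?_))
  intro x hx
  rw [abs_of_pos hr0, mem_sphere] at hx
  refine (hE (hδU (mem_cthickening_of_dist_le x z _ _ hz ?_))).symm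
  have : dist ζ z < 1 / (n + 1) := hζ
  linarith [dist_triangle x ζ z]

theorem integrable_mul_exp_of_bounded {h V : ℂ → ℝ} (hc : Continuous h) (hs : HasCompactSupport h)
    (hV : Measurable V) {C : ℝ} (hC : ∀ z, |V z| ≤ C) :
    Integrable fun z => h z * Real.exp (V z) := by
  refine Integrable.mul_bdd (c := Real.exp C) (hc.integrable_of_hasCompactSupport hs)
    (Real.measurable_exp.comp hV).aestronglyMeasurable (ae_of_all _ fun z => ?_)
  rw [Real.norm_eq_abs, abs_of_pos (Real.exp_pos _)]
  exact Real.exp_le_exp.2 (abs_le.1 (hC z)).2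

theorem tendsto_integral_mollify {h V : ℂ → ℝ} (hc : Continuous h) (hs : HasCompactSupport h)
    (hV : Measurable V) {C : ℝ} (hC : ∀ z, |V z| ≤ C) :
    Tendsto (fun n => ∫ z, h z * Real.exp (mollify n V z)) atTop
      (𝓝 (∫ z, h z * Real.exp (V z))) := by
  have hl := locallyIntegrable_of_bounded hV hC
  refine tendsto_integral_of_dominated_convergence (fun z => ‖h z‖ * Real.exp C) (fun n => ?_)
    ((hc.integrable_of_hasCompactSupport hs).norm.mul_const _) (fun n => ?_) ?_
  · exact (hc.mul (Real.continuous_exp.comp (contDiff_mollify hl n).continuous)).aestronglyMeasurable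
  · refine ae_of_all _ fun z => ?_
    rw [norm_mul, Real.norm_eq_abs (Real.exp _), abs_of_pos (Real.exp_pos _)]
    gcongr
    exact mollify_le hV hC (fun z => (abs_le.1 (hC z)).2) n z
  · filter_upwards [mollify_tendsto_ae hl] with z hz
    exact ((Real.continuous_exp.tendsto _).comp hz).const_mul _

/-- A bounded Borel modification of `v` off a neighbourhood of a compact set. -/
theorem BSub.exists_nhd_ext {v : ℂ → ℝ} {Ω K : Set ℂ} (h : BSub v Ω) (hK : IsCompact K)
    (hKΩ : K ⊆ Ω) : ∃ U V C, IsOpen U ∧ K ⊆ U ∧ U ⊆ Ω ∧ Measurable V ∧ (∀ z, |V z| ≤ C) ∧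
      EqOn V v U := by
  obtain ⟨L, hL, hKL, hLΩ⟩ := exists_compact_between hK h.isOpen hKΩ
  obtain ⟨V, hV, ⟨C, hC⟩, hE⟩ := h.exists_ext hL hLΩ
  exact ⟨interior L, V, C, isOpen_interior, hKL, interior_subset.trans hLΩ, hV.measurable, hC,
    hE.mono interior_subset⟩

theorem mul_exp_congr {h V v : ℂ → ℝ} {U : Set ℂ} (hE : EqOn V v U) (hU : tsupport h ⊆ U) :
    (fun z => h z * Real.exp (V z)) = fun z => h z * Real.exp (v z) := by
  ext z
  by_cases hz : z ∈ tsupport h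
  · rw [hE (hU hz)]
  · simp [image_eq_zero_of_notMem_tsupport hz]

theorem BSub.integrable_mul_exp {v h : ℂ → ℝ} {Ω : Set ℂ} (hv : BSub v Ω) (hc : Continuous h)
    (hs : HasCompactSupport h) (hh : tsupport h ⊆ Ω) :
    Integrable fun z => h z * Real.exp (v z) := by
  obtain ⟨U, V, C, -, hKU, -, hVm, hC, hE⟩ := hv.exists_nhd_ext hs hh
  rw [← mul_exp_congr hE hKU]
  exact integrable_mul_exp_of_bounded hc hs hVm hC

theorem BSub.basic_inequality {v w σ : ℂ → ℝ} {b : ℂ → ℂ} {Ω : Set ℂ} (hv : BSub v Ω)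
    (hw : ContDiff ℝ ∞ w) (hσ : ContDiff ℝ ∞ σ) (hb : ContDiff ℝ ∞ b)
    (hbc : HasCompactSupport b) (hbΩ : tsupport b ⊆ Ω) (hw0 : ∀ z ∈ tsupport b, 0 ≤ w z) :
    ∫ z, (w z * qlap σ z - qlap w z) * ‖b z‖ ^ 2 * Real.exp (v z + σ z) ≤
      (∫ z, w z * ‖dzb b z‖ ^ 2 * Real.exp (v z + σ z)) +
      2 * ∫ z, ‖dzb (fun z => (w z : ℂ)) z‖ * ‖b z‖ * ‖dzb b z‖ * Real.exp (v z + σ z) := by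
  obtain ⟨U, V, C, hU, hKU, hUΩ, hVm, hC, hE⟩ := hv.exists_nhd_ext hbc hbΩ
  have hl := locallyIntegrable_of_bounded hVm hC
  have hcb : Continuous (dzb b) := hb.dzb_smooth.continuous
  have hcw : Continuous (dzb (fun z => (w z : ℂ))) := hw.ofReal_comp.dzb_smooth.continuous
  have hqs := hσ.qlap_smooth.continuous
  have hqw := hw.qlap_smooth.continuous
  have hw0' := hw.continuous
  set h1 : ℂ → ℝ := fun z => (w z * qlap σ z - qlap w z) * ‖b z‖ ^ 2 * Real.exp (σ z)
  set h2 : ℂ → ℝ := fun z => w z * ‖dzb b z‖ ^ 2 * Real.exp (σ z)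
  set h3 : ℂ → ℝ := fun z => ‖dzb (fun z => (w z : ℂ)) z‖ * ‖b z‖ * ‖dzb b z‖ * Real.exp (σ z)
  have hd : ∀ z, z ∉ tsupport b → dzb b z = 0 := fun z hz =>
    image_eq_zero_of_notMem_tsupport fun h => hz (tsupport_dzb_subset b h)
  have t1 : tsupport h1 ⊆ tsupport b := closure_minimal (fun z hz => by
    by_contra hn
    exact hz (by simp [h1, image_eq_zero_of_notMem_tsupport hn])) (isClosed_tsupport b)
  have t2 : tsupport h2 ⊆ tsupport b := closure_minimal (fun z hz => by
    by_contra hn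
    exact hz (by simp [h2, hd z hn])) (isClosed_tsupport b)
  have t3 : tsupport h3 ⊆ tsupport b := closure_minimal (fun z hz => by
    by_contra hn
    exact hz (by simp [h3, hd z hn])) (isClosed_tsupport b)
  have c1 : HasCompactSupport h1 := hbc.mono' (subset_closure.trans t1)
  have c2 : HasCompactSupport h2 := hbc.mono' (subset_closure.trans t2)
  have c3 : HasCompactSupport h3 := hbc.mono' (subset_closure.trans t3)
  have e1 : Continuous h1 := by fun_prop
  have e2 : Continuous h2 := by fun_prop
  have e3 : Continuous h3 := by fun_prop
  have key : (∫ z, h1 z * Real.exp (V z)) ≤ (∫ z, h2 z * Real.exp (V z)) +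
      2 * ∫ z, h3 z * Real.exp (V z) := by
    refine le_of_tendsto_of_tendsto (tendsto_integral_mollify e1 c1 hVm hC)
      ((tendsto_integral_mollify e2 c2 hVm hC).add
        ((tendsto_integral_mollify e3 c3 hVm hC).const_mul 2)) ?_
    filter_upwards [hv.eventually_qlap_mollify_nonneg hbc hKU hU hUΩ hVm hC hE] with n hn
    have sm := contDiff_mollify hl n
    have hB := basic_inequality_smooth hw (sm.add hσ) hb hbc hw0
    have eh : ∀ (g : ℂ → ℝ) z, g z * Real.exp (mollify n V z + σ z) =
        g z * Real.exp (σ z) * Real.exp (mollify n V z) := by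
      intro g z; rw [add_comm, Real.exp_add]; ring
    have hq : ∀ z, qlap (fun z => mollify n V z + σ z) z = qlap (mollify n V) z + qlap σ z := by
      intro z
      simp only [qlap]
      rw [← Complex.add_re]
      congr 1
      have : dz (fun z => ((mollify n V z + σ z : ℝ) : ℂ)) =
          fun z => dz (fun z => (mollify n V z : ℂ)) z + dz (fun z => (σ z : ℂ)) z := by
        ext z
        have := ((sm.ofReal_comp.hasW z).add (hσ.ofReal_comp.hasW z)).dz_eq
        simpa using this
      rw [this]
      exact ((sm.ofReal_comp.dz_smooth.hasW z).add (hσ.ofReal_comp.dz_smooth.hasW z)).dzb_eq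
    have hm : ∫ z, h1 z * Real.exp (mollify n V z) ≤
        ∫ z, (w z * qlap (fun z => mollify n V z + σ z) z - qlap w z) * ‖b z‖ ^ 2 *
          Real.exp (mollify n V z + σ z) := by
      have s1 := sm.continuous
      have s2 := (sm.add hσ).qlap_smooth.continuous
      apply integral_mono
      · exact (e1.mul (Real.continuous_exp.comp s1)).integrable_of_hasCompactSupport c1.mul_right
      · refine Continuous.integrable_of_hasCompactSupport (by fun_prop) ?_
        refine hbc.mono' fun z hz => ?_
        by_contra hn'
        exact hz (by simp [image_eq_zero_of_notMem_tsupport hn'])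
      · intro z
        simp only [h1]
        rw [eh (fun z => (w z * qlap (fun z => mollify n V z + σ z) z - qlap w z) * ‖b z‖ ^ 2)]
        by_cases hz : z ∈ tsupport b
        · rw [hq]
          have h5 := mul_nonneg (hw0 z hz) (hn z hz)
          refine mul_le_mul_of_nonneg_right (mul_le_mul_of_nonneg_right (mul_le_mul_of_nonneg_right
            ?_ (by positivity)) (Real.exp_pos _).le) (Real.exp_pos _).le
          linarith
        · simp [image_eq_zero_of_notMem_tsupport hz]
    refine hm.trans (hB.trans (le_of_eq ?_))
    simp only [eh (fun z => w z * ‖dzb b z‖ ^ 2), eh (fun z => ‖dzb (fun z => (w z : ℂ)) z‖ *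
      ‖b z‖ * ‖dzb b z‖), h2, h3]
  rw [mul_exp_congr hE (t1.trans hKU), mul_exp_congr hE (t2.trans hKU),
    mul_exp_congr hE (t3.trans hKU)] at key
  have eh : ∀ (g : ℂ → ℝ) z, g z * Real.exp (v z + σ z) =
        g z * Real.exp (σ z) * Real.exp (v z) := by
      intro g z; rw [add_comm, Real.exp_add]; ring
  simp only [eh (fun z => w z * ‖dzb b z‖ ^ 2), eh (fun z => ‖dzb (fun z => (w z : ℂ)) z‖ *
      ‖b z‖ * ‖dzb b z‖), eh (fun z => (w z * qlap σ z - qlap w z) * ‖b z‖ ^ 2)]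
  exact key

theorem SubharmonicOn.coe_truncation {u : ℂ → EReal} {Ω : Set ℂ} (hu : SubharmonicOn u Ω) (N : ℝ)
    {z : ℂ} (hz : z ∈ Ω) : (((max (u z) N).toReal : ℝ) : EReal) = max (u z) N :=
  EReal.coe_toReal (by simp [hu.2.2.1 z hz]) (by simp)

theorem SubharmonicOn.exists_bound {u : ℂ → EReal} {Ω K : Set ℂ} (hu : SubharmonicOn u Ω)
    (hK : IsCompact K) (hKΩ : K ⊆ Ω) : ∃ M : ℝ, ∀ z ∈ K, u z ≤ M := by
  obtain ⟨M, hM⟩ := UpperSemicontinuousOn.bddAbove_of_isCompact hK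
    ((hu.bsub_truncation 0).usc.mono hKΩ)
  refine ⟨M, fun z hz => ?_⟩
  have h1 : (max (u z) (0 : ℝ)).toReal ≤ M := hM ⟨z, hz, rfl⟩
  have h2 := hu.coe_truncation 0 (hKΩ hz)
  calc u z ≤ max (u z) (0 : ℝ) := le_max_left _ _
    _ = _ := h2.symm
    _ ≤ M := by exact_mod_cast h1

theorem integral_ball_ge_of_submean {v : ℂ → ℝ} {z : ℂ} {s : ℝ}
    (hi : IntegrableOn v (ball z s))
    (hv : ∀ r, 0 < r → r < s → CircleIntegrable v z r ∧ v z ≤ Real.circleAverage v z r) :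
    v z * (volume (ball z s)).toReal ≤ ∫ ζ in ball z s, v ζ := by
  have h := integral_radial_nonneg (k := fun _ => 1) (fun _ => zero_le_one) hv
  have h1 := integral_add_left_eq_self (μ := (volume : Measure ℂ))
    (fun ζ => (ball z s).indicator (fun ζ => v ζ - v z) ζ) z
  have h2 : (fun ζ => (ball z s).indicator (fun ζ => v ζ - v z) (z + ζ)) =
      fun ζ => (ball (0 : ℂ) s).indicator (fun ζ => 1 * (v (z + ζ) - v z)) ζ := by
    ext ζ
    by_cases hζ : ζ ∈ ball (0 : ℂ) s
    · have : z + ζ ∈ ball z s := by simpa using hζ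
      simp [hζ, this]
    · have : z + ζ ∉ ball z s := by simpa using hζ
      simp only [indicator_of_notMem hζ, indicator_of_notMem this]
  rw [h2] at h1
  rw [h1, integral_indicator measurableSet_ball, integral_sub hi
    (integrableOn_const (measure_ball_lt_top.ne)), setIntegral_const] at h
  rw [smul_eq_mul, mul_comm] at h
  have : volume.real (ball z s) = (volume (ball z s)).toReal := rfl
  rw [this] at h
  linarith

theorem SubharmonicOn.null_near {u : ℂ → EReal} {Ω : Set ℂ} (hu : SubharmonicOn u Ω) {z : ℂ}
    {s : ℝ} (hs : 0 < s) (hz : closedBall z s ⊆ Ω) (huz : u z ≠ ⊥) :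
    volume {ζ ∈ ball z s | u ζ = ⊥} = 0 := by
  obtain ⟨M, hM⟩ := hu.exists_bound (isCompact_closedBall z s) hz
  have hzΩ : z ∈ Ω := hz (mem_closedBall_self hs.le)
  set a := (u z).toReal
  have ha : ((a : ℝ) : EReal) = u z := EReal.coe_toReal (hu.2.2.1 z hzΩ) huz
  set B := (volume (ball z s)).toReal with hB
  have key : ∀ n : ℕ, (volume {ζ ∈ ball z s | u ζ = ⊥}) ≤
      ENNReal.ofReal ((|M| - a) * B / (n + 1)) := by
    intro n
    set v : ℂ → ℝ := fun z => (max (u z) ((-(n + 1 : ℝ) : ℝ) : EReal)).toReal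
    have hb := hu.bsub_truncation (-(n + 1 : ℝ))
    obtain ⟨V, hV, ⟨C, hC⟩, hE⟩ := hb.exists_ext (isCompact_closedBall z s) hz
    have hVv : ∀ ζ ∈ ball z s, V ζ = v ζ := fun ζ hζ => hE (ball_subset_closedBall hζ)
    have hcv : ∀ ζ ∈ ball z s, ((v ζ : ℝ) : EReal) = max (u ζ) ((-(n + 1 : ℝ) : ℝ) : EReal) :=
      fun ζ hζ => hu.coe_truncation _ (hz (ball_subset_closedBall hζ))
    have hVi : IntegrableOn V (ball z s) :=
      (locallyIntegrable_of_bounded hV.measurable hC).integrableOn_isCompact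
        (isCompact_closedBall z s) |>.mono_set ball_subset_closedBall
    have h1 : V z * B ≤ ∫ ζ in ball z s, V ζ := by
      refine integral_ball_ge_of_submean hVi fun r hr hrs =>
        ⟨circleIntegrable_of_bounded hV.measurable hC z r, ?_⟩
      have hsub := SubmeanOn.truncation_le hu.2.2.1 hu.2.2.2.2 (-(n + 1 : ℝ)) hr
        ((closedBall_subset_closedBall hrs.le).trans hz) rfl hb.usc
      rw [hVv z (mem_ball_self hs)]
      refine hsub.trans (le_of_eq (Real.circleAverage_congr_sphere fun x hx => ?_))
      rw [abs_of_pos hr] at hx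
      exact (hE (closedBall_subset_closedBall hrs.le (sphere_subset_closedBall hx))).symm
    have h2 : a ≤ V z := by
      rw [hVv z (mem_ball_self hs)]
      have : ((a : ℝ) : EReal) ≤ (v z : ℝ) := by
        rw [hcv z (mem_ball_self hs), ha]; exact le_max_left _ _
      exact_mod_cast this
    have hVM : ∀ ζ ∈ ball z s, V ζ ≤ |M| := fun ζ hζ => by
      rw [hVv ζ hζ]
      have : ((v ζ : ℝ) : EReal) ≤ (|M| : ℝ) := by
        rw [hcv ζ hζ]
        refine max_le ((hM ζ (ball_subset_closedBall hζ)).trans ?_) ?_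
        · exact_mod_cast le_abs_self M
        · have : -((n : ℝ) + 1) ≤ |M| := by
            have := abs_nonneg M
            have : (0 : ℝ) ≤ n := Nat.cast_nonneg n
            linarith
          exact_mod_cast this
      exact_mod_cast this
    set E := {ζ | V ζ ≤ -(n + 1 : ℝ)} ∩ ball z s
    have hEm : MeasurableSet E :=
      (measurableSet_le hV.measurable measurable_const).inter measurableSet_ball
    have hEf : volume E ≠ ⊤ :=
      ((measure_mono inter_subset_right).trans_lt measure_ball_lt_top).ne
    have h3 : ∫ ζ in ball z s, V ζ ≤ |M| * B - (n + 1) * (volume E).toReal := by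
      calc ∫ ζ in ball z s, V ζ ≤ ∫ ζ in ball z s, (|M| + E.indicator (fun _ => -(n + 1 : ℝ)) ζ) := by
            apply setIntegral_mono_on hVi
            · refine (integrableOn_const measure_ball_lt_top.ne).add ?_
              exact ((integrable_indicator_iff hEm).2 (integrableOn_const hEf)).integrableOn
            · exact measurableSet_ball
            · intro ζ hζ
              by_cases hζE : ζ ∈ E
              · simp only [indicator_of_mem hζE]
                have : V ζ ≤ -(n + 1 : ℝ) := hζE.1
                linarith [abs_nonneg M]
              · simp only [indicator_of_notMem hζE]
                linarith [hVM ζ hζ]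
        _ = _ := by
            have hcM : IntegrableOn (fun _ : ℂ => |M|) (ball z s) :=
              integrableOn_const measure_ball_lt_top.ne
            rw [integral_add hcM.integrable
              ((integrable_indicator_iff hEm).2 (integrableOn_const hEf)).integrableOn,
              setIntegral_const, setIntegral_indicator hEm, setIntegral_const,
              show ball z s ∩ E = E from inter_eq_right.2 inter_subset_right]
            simp only [smul_eq_mul, hB, Measure.real]
            ring
    have h4 : (volume E).toReal ≤ (|M| - a) * B / (n + 1) := by
      rw [le_div_iff₀ (by positivity)]
      have : a * B ≤ V z * B := mul_le_mul_of_nonneg_right h2 ENNReal.toReal_nonneg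
      linarith
    have h5 : volume E ≤ ENNReal.ofReal ((|M| - a) * B / (n + 1)) := by
      rw [← ENNReal.ofReal_toReal hEf]; exact ENNReal.ofReal_le_ofReal h4
    refine (measure_mono fun ζ hζ => ?_).trans h5
    refine ⟨?_, hζ.1⟩
    have : v ζ = -(n + 1 : ℝ) := by
      have := hcv ζ hζ.1
      rw [hζ.2, max_eq_right bot_le] at this
      exact_mod_cast this
    rw [mem_ofPred_eq, hVv ζ hζ.1, this]
  have hlim : Tendsto (fun n : ℕ => ENNReal.ofReal ((|M| - a) * B / (n + 1))) atTop (𝓝 0) := by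
    rw [← ENNReal.ofReal_zero]
    apply ENNReal.tendsto_ofReal
    have := (tendsto_one_div_add_atTop_nhds_zero_nat (𝕜 := ℝ)).const_mul ((|M| - a) * B)
    simpa [div_eq_mul_inv] using this
  exact le_antisymm (ge_of_tendsto' hlim key) bot_le

theorem SubharmonicOn.volume_eq_bot {u : ℂ → EReal} {Ω : Set ℂ} (hu : SubharmonicOn u Ω) :
    volume {z ∈ Ω | u z = ⊥} = 0 := by
  set P : Set ℂ := {z | ∃ s > 0, closedBall z s ⊆ Ω ∧ volume {ζ ∈ ball z s | u ζ = ⊥} = 0}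
  have hP : IsOpen P := by
    rw [Metric.isOpen_iff]
    rintro z ⟨s, hs, hsΩ, h⟩
    refine ⟨s / 2, by positivity, fun w hw => ⟨s / 4, by positivity, ?_, ?_⟩⟩
    · refine (closedBall_subset_closedBall' ?_).trans hsΩ
      rw [mem_ball] at hw; linarith
    · refine measure_mono_null ?_ h
      refine fun ζ hζ => ⟨?_, hζ.2⟩
      refine ball_subset_ball' ?_ hζ.1
      rw [mem_ball] at hw; linarith
  have hmem : ∀ z ∈ Ω, z ∈ P := fun z hz => by
    obtain ⟨w, hw, hwb⟩ := hu.2.2.2.1 z hz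
    have hwΩ := connectedComponentIn_subset Ω z hw
    refine (isPreconnected_connectedComponentIn.subset_of_closure_inter_subset hP
      ⟨w, hw, ?_⟩ ?_) (mem_connectedComponentIn hz)
    · obtain ⟨s, hs, h⟩ := Metric.nhds_basis_closedBall.mem_iff.1 (hu.1.mem_nhds hwΩ)
      exact ⟨s, hs, h, hu.null_near hs h hwb⟩
    · rintro x ⟨hxc, hx⟩
      have hxΩ := connectedComponentIn_subset Ω z hx
      obtain ⟨s, hs, h⟩ := Metric.nhds_basis_closedBall.mem_iff.1 (hu.1.mem_nhds hxΩ)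
      obtain ⟨y, ⟨t, ht, htΩ, hty⟩, hyx⟩ := Metric.mem_closure_iff.1 hxc (s / 4) (by positivity)
      obtain ⟨q, hq, hqb⟩ : ∃ q ∈ ball y (min t (s / 4)), u q ≠ ⊥ := by
        by_contra! hcon
        have h1 : ball y (min t (s / 4)) ⊆ {ζ ∈ ball y t | u ζ = ⊥} := fun ζ hζ =>
          ⟨ball_subset_ball (min_le_left _ _) hζ, hcon ζ hζ⟩
        have h2 := measure_mono_null h1 hty
        exact (measure_ball_pos volume y (by positivity)).ne' h2
      have hqx : dist q x < s / 2 := by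
        have : dist q y < s / 4 := (lt_min_iff.1 hq).2
        rw [dist_comm] at hyx
        linarith [dist_triangle q y x]
      have h3 := hu.null_near (z := q) (s := s / 2) (by positivity)
        ((closedBall_subset_closedBall' (by linarith)).trans h) hqb
      refine ⟨s / 2 - dist q x, by linarith, ?_, measure_mono_null ?_ h3⟩
      · exact (closedBall_subset_closedBall (by linarith [dist_nonneg (x := q) (y := x)])).trans h
      · refine fun ζ hζ => ⟨?_, hζ.2⟩
        refine ball_subset_ball' ?_ hζ.1
        rw [dist_comm x q]; linarith
  apply measure_null_of_locally_null
  rintro z ⟨hz, -⟩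
  obtain ⟨s, hs, -, h⟩ := hmem z hz
  refine ⟨{ζ ∈ ball z s | u ζ = ⊥}, ?_, h⟩
  filter_upwards [mem_nhdsWithin_of_mem_nhds (ball_mem_nhds z hs), self_mem_nhdsWithin] with ζ h1 h2
  exact ⟨h1, h2.2⟩

theorem PolarSet.volume_eq_zero {E : Set ℂ} (hE : PolarSet E) : volume E = 0 := by
  obtain ⟨Ω, hEΩ, u, hu, h⟩ := hE
  refine measure_mono_null ?_ hu.volume_eq_bot
  exact fun z hz => ⟨hEΩ hz, h z hz⟩

theorem PolarSet.mono {E F : Set ℂ} (hE : PolarSet E) (h : F ⊆ E) : PolarSet F := by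
  obtain ⟨Ω, hEΩ, u, hu, h'⟩ := hE
  exact ⟨Ω, h.trans hEΩ, u, hu, fun z hz => h' z (h hz)⟩

theorem exists_cutoff {K U : Set ℂ} (hK : IsCompact K) (hU : IsOpen U) (hKU : K ⊆ U) :
    ∃ χ : ℂ → ℝ, ContDiff ℝ ∞ χ ∧ HasCompactSupport χ ∧ tsupport χ ⊆ U ∧ (∀ z, 0 ≤ χ z) ∧
      (∀ z, χ z ≤ 1) ∧ ∃ O, IsOpen O ∧ K ⊆ O ∧ ∀ z ∈ O, χ z = 1 := by
  obtain ⟨δ, hδ, hδU⟩ := hK.exists_cthickening_subset_open hU hKU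
  obtain ⟨n, hn⟩ := exists_nat_one_div_lt (show 0 < δ / 4 by positivity)
  set A := cthickening (δ / 2) K
  have hV : Measurable (A.indicator fun _ => (1 : ℝ)) :=
    measurable_const.indicator isClosed_cthickening.measurableSet
  have hC : ∀ z, |A.indicator (fun _ => (1 : ℝ)) z| ≤ 1 := by
    intro z; by_cases hz : z ∈ A <;> simp [hz]
  have hts : tsupport (mollify n (A.indicator fun _ => (1 : ℝ))) ⊆ cthickening δ K := by
    refine closure_minimal (fun z hz => ?_) isClosed_cthickening
    by_contra hn'
    refine hz (mollify_eq_of_const fun ζ hζ => indicator_of_notMem (fun hζA => hn' ?_) _)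
    have h1 := cthickening_cthickening_subset (ε := δ / 2) (δ := δ / 2) (by positivity)
      (by positivity) K
    rw [add_halves] at h1
    refine h1 (mem_cthickening_of_dist_le z ζ _ _ hζA ?_)
    rw [dist_comm]
    have : dist ζ z < 1 / (n + 1) := hζ
    linarith
  refine ⟨_, contDiff_mollify (locallyIntegrable_of_bounded hV hC) n,
    (hK.cthickening (r := δ)).of_isClosed_subset (isClosed_tsupport _) hts, hts.trans hδU,
    le_mollify hV hC (fun z => ?_) n, mollify_le hV hC (fun z => ?_) n,
    thickening (δ / 4) K, isOpen_thickening, self_subset_thickening (by positivity) K,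
    fun z hz => mollify_eq_of_const fun ζ hζ => indicator_of_mem ?_ _⟩
  · by_cases hz : z ∈ A <;> simp [hz]
  · by_cases hz : z ∈ A <;> simp [hz]
  · obtain ⟨x, hx, hxz⟩ := mem_thickening_iff.1 hz
    refine mem_cthickening_of_dist_le ζ x _ _ hx ?_
    have : dist ζ z < 1 / (n + 1) := hζ
    linarith [dist_triangle ζ z x]

theorem integral_mul_dzb {A B : ℂ → ℂ} (hA : ContDiff ℝ ∞ A) (hAc : HasCompactSupport A)
    (hB : ContDiff ℝ ∞ B) : ∫ z, A z * dzb B z = - ∫ z, dzb A z * B z := by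
  have h := integral_dzb_eq_zero (hA.mul hB) hAc.mul_right
  have h1 : dzb (fun z => A z * B z) = fun z => dzb A z * B z + A z * dzb B z := by
    ext z; exact ((hA.hasW z).mul (hB.hasW z)).dzb_eq
  rw [h1, integral_add] at h
  · rw [eq_neg_iff_add_eq_zero, add_comm]; exact h
  · exact (hA.dzb_smooth.continuous.mul hB.continuous).integrable_of_hasCompactSupport
      hAc.dzb_compact.mul_right
  · exact (hA.continuous.mul hB.dzb_smooth.continuous).integrable_of_hasCompactSupport
      hAc.mul_right

theorem integral_mul_dz {A B : ℂ → ℂ} (hA : ContDiff ℝ ∞ A) (hAc : HasCompactSupport A)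
    (hB : ContDiff ℝ ∞ B) : ∫ z, A z * dz B z = - ∫ z, dz A z * B z := by
  have h := integral_dz_eq_zero (hA.mul hB) hAc.mul_right
  have h1 : dz (fun z => A z * B z) = fun z => dz A z * B z + A z * dz B z := by
    ext z; exact ((hA.hasW z).mul (hB.hasW z)).dz_eq
  rw [h1, integral_add] at h
  · rw [eq_neg_iff_add_eq_zero, add_comm]; exact h
  · exact (hA.dz_smooth.continuous.mul hB.continuous).integrable_of_hasCompactSupport
      hAc.dz_compact.mul_right
  · exact (hA.continuous.mul hB.dz_smooth.continuous).integrable_of_hasCompactSupport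
      hAc.mul_right

theorem integral_mul_qlap {A P : ℂ → ℝ} (hA : ContDiff ℝ ∞ A) (hAc : HasCompactSupport A)
    (hP : ContDiff ℝ ∞ P) : ∫ z, A z * qlap P z = ∫ z, P z * qlap A z := by
  have sA := hA.ofReal_comp
  have sP := hP.ofReal_comp
  have hAc' : HasCompactSupport fun z => (A z : ℂ) :=
    hAc.comp_left (g := Complex.ofReal) (by simp)
  have h1 := integral_mul_dzb sA hAc' sP.dz_smooth
  have h2 := integral_mul_dz sA.dzb_smooth hAc'.dzb_compact sP
  rw [h2, neg_neg] at h1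
  have h3 : (((∫ z, A z * qlap P z) : ℝ) : ℂ) = ((∫ z, P z * qlap A z : ℝ) : ℂ) := by
    rw [← integral_complex_ofReal, ← integral_complex_ofReal]
    simp only [Complex.ofReal_mul, qlap_im hA, qlap_im hP]
    rw [h1]
    refine integral_congr_ae (ae_of_all _ fun z => ?_)
    simp only [dz_dzb_comm sA]
    ring
  exact_mod_cast h3

theorem qlap_sq_add {w : ℂ → ℝ} (hw : ContDiff ℝ ∞ w) (z : ℂ) :
    qlap (fun z => w z ^ 2 + 2 * w z) z =
      2 * ‖dzb (fun z => (w z : ℂ)) z‖ ^ 2 + 2 * (w z + 1) * qlap w z := by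
  set W : ℂ → ℂ := fun z => (w z : ℂ)
  have sW : ContDiff ℝ ∞ W := hw.ofReal_comp
  have h1 : dz (fun z => ((w z ^ 2 + 2 * w z : ℝ) : ℂ)) = fun z => (2 * W z + 2) * dz W z := by
    ext z
    have h := ((sW.hasW z).mul (sW.hasW z)).add ((HasW.const 2 z).mul (sW.hasW z))
    have h' := h.dz_eq
    have e : (fun z => ((w z ^ 2 + 2 * w z : ℝ) : ℂ)) = fun z => W z * W z + 2 * W z := by
      ext z; simp [W]; ring
    rw [e, h']; ring
  have h2 : dzb (fun z => (2 * W z + 2) * dz W z) z =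
      2 * dzb W z * dz W z + (2 * W z + 2) * dzb (dz W) z := by
    have h := (((HasW.const 2 z).mul (sW.hasW z)).add (HasW.const 2 z)).mul
      (sW.dz_smooth.hasW z)
    rw [h.dzb_eq]; ring
  rw [qlap, h1, h2, ← qlap_im hw, dz_eq_conj_dzb hw, mul_assoc 2, Complex.mul_conj,
    Complex.normSq_eq_norm_sq]
  simp only [W]
  norm_cast
  ring

theorem energy_estimate {w χ : ℂ → ℝ} (hw : ContDiff ℝ ∞ w) (hχ : ContDiff ℝ ∞ χ)
    (hχc : HasCompactSupport χ) (h1 : ∀ z ∈ tsupport χ, -1 ≤ w z)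
    (hq : ∀ z ∈ tsupport χ, 0 ≤ qlap w z) :
    2 * ∫ z, χ z ^ 2 * ‖dzb (fun z => (w z : ℂ)) z‖ ^ 2 ≤
      ∫ z, (w z ^ 2 + 2 * w z) * qlap (fun z => χ z ^ 2) z := by
  have sP : ContDiff ℝ ∞ fun z => w z ^ 2 + 2 * w z := by fun_prop
  have hc2 : HasCompactSupport fun z => χ z ^ 2 := hχc.comp_left (g := fun x => x ^ 2) (by simp)
  rw [← integral_mul_qlap (by fun_prop) hc2 sP, ← integral_const_mul]
  have hcd := hw.ofReal_comp.dzb_smooth.continuous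
  have hcq := sP.qlap_smooth.continuous
  apply integral_mono
  · refine Continuous.integrable_of_hasCompactSupport (by fun_prop) ?_
    exact (hc2.mul_right (f' := fun z => ‖dzb (fun z => (w z : ℂ)) z‖ ^ 2)).mul_left
  · exact Continuous.integrable_of_hasCompactSupport (by fun_prop) hc2.mul_right
  · intro z
    simp only
    by_cases hz : z ∈ tsupport χ
    · rw [qlap_sq_add hw]
      have := mul_nonneg (mul_nonneg (sq_nonneg (χ z)) (show 0 ≤ w z + 1 by linarith [h1 z hz]))
        (hq z hz)
      nlinarith
    · simp [image_eq_zero_of_notMem_tsupport hz]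

theorem PolarSet.exists_approximants {K : Set ℂ} (hK : IsCompact K) (hp : PolarSet K) :
    ∃ χ : ℂ → ℝ, ContDiff ℝ ∞ χ ∧ HasCompactSupport χ ∧ (∀ z, 0 ≤ χ z) ∧ (∀ z, χ z ≤ 1) ∧
      (∃ O, IsOpen O ∧ K ⊆ O ∧ ∀ z ∈ O, χ z = 1) ∧
      ∀ η > 0, ∃ w : ℂ → ℝ, ContDiff ℝ ∞ w ∧ (∀ z, -1 ≤ w z) ∧ (∀ z, w z ≤ 0) ∧
        (∃ O, IsOpen O ∧ K ⊆ O ∧ ∀ z ∈ O, w z = -1) ∧ (∀ z ∈ tsupport χ, 0 ≤ qlap w z) ∧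
        ∫ z in tsupport χ, |w z| ≤ η := by
  obtain ⟨Ω, hKΩ, u, hu, hbot⟩ := hp
  obtain ⟨L, hL, hKL, hLΩ⟩ := exists_compact_between hK hu.1 hKΩ
  obtain ⟨χ, hχ, hχc, hχL, hχ0, hχ1, hχO⟩ := exists_cutoff hK isOpen_interior hKL
  refine ⟨χ, hχ, hχc, hχ0, hχ1, hχO, fun η hη => ?_⟩
  set S := tsupport χ
  have hSf : volume S ≠ ⊤ := hχc.isCompact.measure_lt_top.ne
  obtain ⟨m, hm⟩ := hu.exists_bound hL hLΩ
  set a : ℕ → ℝ := fun N => m - (N + 1) with ha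
  set b : ℕ → ℂ → ℝ := fun N z =>
    1 / ((N : ℝ) + 1) * ((max (u z) ((a N : ℝ) : EReal)).toReal + -m) with hb
  have hbs : ∀ N, BSub (b N) Ω := fun N =>
    ((hu.bsub_truncation (a N)).add (bsub_const (-m) hu.1)).const_mul (by positivity)
  have hval : ∀ N, ∀ z ∈ L, a N ≤ (max (u z) ((a N : ℝ) : EReal)).toReal ∧
      (max (u z) ((a N : ℝ) : EReal)).toReal ≤ m := by
    intro N z hz
    have h := hu.coe_truncation (a N) (hLΩ hz)
    constructor
    · have : ((a N : ℝ) : EReal) ≤ ((max (u z) ((a N : ℝ) : EReal)).toReal : ℝ) := by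
        rw [h]; exact le_max_right _ _
      exact_mod_cast this
    · have : (((max (u z) ((a N : ℝ) : EReal)).toReal : ℝ) : EReal) ≤ m := by
        rw [h]
        refine max_le (hm z hz) ?_
        have : a N ≤ m := by
          have : (0 : ℝ) ≤ N := Nat.cast_nonneg N
          simp only [ha]; linarith
        exact_mod_cast this
      exact_mod_cast this
  have hb1 : ∀ N, ∀ z ∈ L, -1 ≤ b N z ∧ b N z ≤ 0 := fun N z hz => by
    obtain ⟨h1, h2⟩ := hval N z hz
    have hN : (0 : ℝ) < N + 1 := by positivity
    simp only [hb, ha] at h1 h2 ⊢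
    rw [one_div, inv_mul_eq_div]
    constructor
    · rw [le_div_iff₀ hN]; linarith
    · exact div_nonpos_of_nonpos_of_nonneg (by linarith) hN.le
  choose V hV hVC hVE using fun N => (hbs N).exists_ext hL hLΩ
  set V' : ℕ → ℂ → ℝ := fun N => L.indicator (V N) with hV'
  have hV'm : ∀ N, Measurable (V' N) := fun N => (hV N).measurable.indicator hL.measurableSet
  have hV'b : ∀ N z, z ∈ L → V' N z = b N z := fun N z hz => by
    simp only [hV', indicator_of_mem hz]; exact hVE N hz
  have hV'1 : ∀ N z, -1 ≤ V' N z ∧ V' N z ≤ 0 := fun N z => by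
    by_cases hz : z ∈ L
    · rw [hV'b N z hz]; exact hb1 N z hz
    · simp [hV', hz]
  have hV'C : ∀ N z, |V' N z| ≤ 1 := fun N z =>
    abs_le.2 ⟨(hV'1 N z).1, (hV'1 N z).2.trans zero_le_one⟩
  have hSL : S ⊆ L := hχL.trans interior_subset
  have hlim1 : Tendsto (fun N => ∫ z in S, |V' N z|) atTop (𝓝 (∫ z in S, (0 : ℝ))) := by
    refine tendsto_integral_of_dominated_convergence (fun _ => 1) (fun N => ?_)
      (integrableOn_const hSf) (fun N => ae_of_all _ fun z => by simpa using hV'C N z) ?_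
    · exact (hV'm N).abs.aestronglyMeasurable
    · have h0 : ∀ᵐ z ∂(volume.restrict S), ¬ (z ∈ Ω ∧ u z = ⊥) :=
        ae_restrict_of_ae (measure_eq_zero_iff_ae_notMem.1 hu.volume_eq_bot)
      filter_upwards [h0, ae_restrict_mem hχc.isCompact.measurableSet] with z hz hzS
      have hzL := hSL hzS
      have huz : u z ≠ ⊥ := fun h => hz ⟨hLΩ hzL, h⟩
      set x := (u z).toReal
      have hx : ((x : ℝ) : EReal) = u z := EReal.coe_toReal (hu.2.2.1 z (hLΩ hzL)) huz
      obtain ⟨N0, hN0⟩ := exists_nat_gt (m - x)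
      have hev : ∀ᶠ N : ℕ in atTop, |1 / ((N : ℝ) + 1) * (x + -m)| = |V' N z| := by
        filter_upwards [eventually_ge_atTop N0] with N hN
        rw [hV'b N z hzL]
        simp only [hb]
        have h1 : a N ≤ x := by
          have : (N0 : ℝ) ≤ N := by exact_mod_cast hN
          simp only [ha]; linarith
        rw [← hx, max_eq_left (by exact_mod_cast h1), EReal.toReal_coe]
      refine Tendsto.congr' hev ?_
      have := ((tendsto_one_div_add_atTop_nhds_zero_nat (𝕜 := ℝ)).mul_const (x + -m)).abs
      simpa using this
  simp only [integral_zero] at hlim1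
  obtain ⟨N, hN⟩ := (hlim1.eventually_lt_const hη).exists
  have hloc := locallyIntegrable_of_bounded (hV'm N) (hV'C N)
  have hlim2 : Tendsto (fun n => ∫ z in S, |mollify n (V' N) z|) atTop
      (𝓝 (∫ z in S, |V' N z|)) := by
    refine tendsto_integral_of_dominated_convergence (fun _ => 1) (fun n => ?_)
      (integrableOn_const hSf) (fun n => ae_of_all _ fun z => ?_) ?_
    · exact (contDiff_mollify hloc n).continuous.abs.aestronglyMeasurable
    · rw [Real.norm_eq_abs, abs_abs, abs_le]
      exact ⟨le_mollify (hV'm N) (hV'C N) (fun z => (hV'1 N z).1) n z,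
        (mollify_le (hV'm N) (hV'C N) (fun z => (hV'1 N z).2) n z).trans zero_le_one⟩
    · filter_upwards [ae_restrict_of_ae (mollify_tendsto_ae hloc)] with z hz using hz.abs
  set T : Set ℂ := {z ∈ interior L | u z < a N}
  have hTo : IsOpen T := by
    rw [isOpen_iff_mem_nhds]
    rintro z ⟨hz, hzu⟩
    have h1 := hu.2.1 z (hLΩ (interior_subset hz)) _ hzu
    rw [hu.1.nhdsWithin_eq (hLΩ (interior_subset hz))] at h1
    filter_upwards [h1, isOpen_interior.mem_nhds hz] with x hx hx' using ⟨hx', hx⟩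
  have hKT : K ⊆ T := fun z hz => ⟨hKL hz, by rw [hbot z hz]; exact EReal.bot_lt_coe _⟩
  have hVT : ∀ z ∈ T, V' N z = -1 := by
    rintro z ⟨hz, hzu⟩
    rw [hV'b N z (interior_subset hz)]
    simp only [hb]
    rw [max_eq_right hzu.le, EReal.toReal_coe]
    have hN : (N : ℝ) + 1 ≠ 0 := by positivity
    simp only [ha]; field_simp; ring
  obtain ⟨δ, hδ, hδT⟩ := hK.exists_cthickening_subset_open hTo hKT
  have hev : ∀ᶠ n : ℕ in atTop, 1 / ((n : ℝ) + 1) < δ / 2 :=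
    tendsto_one_div_add_atTop_nhds_zero_nat.eventually_lt_const (by positivity)
  obtain ⟨n, hn1, hn2, hn3⟩ := (hev.and ((hlim2.eventually_lt_const hN).and
    ((hbs N).eventually_qlap_mollify_nonneg hχc.isCompact hχL isOpen_interior
      (interior_subset.trans hLΩ) (hV'm N) (hV'C N)
      (fun z hz => hV'b N z (interior_subset hz))))).exists
  refine ⟨mollify n (V' N), contDiff_mollify hloc n,
    le_mollify (hV'm N) (hV'C N) (fun z => (hV'1 N z).1) n,
    mollify_le (hV'm N) (hV'C N) (fun z => (hV'1 N z).2) n,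
    ⟨thickening (δ / 2) K, isOpen_thickening, self_subset_thickening (by positivity) K,
      fun z hz => mollify_eq_of_const fun ζ hζ => hVT ζ (hδT ?_)⟩, hn3, hn2.le⟩
  obtain ⟨x, hx, hxz⟩ := mem_thickening_iff.1 hz
  refine mem_cthickening_of_dist_le ζ x _ _ hx ?_
  have : dist ζ z < 1 / (n + 1) := hζ
  linarith [dist_triangle ζ z x]

/-- If `∫ g X` is a fixed number for test functions `X` of arbitrarily small `L²` norm, it is
zero. -/
theorem eq_zero_of_small_tests {g : ℂ → ℂ} {S : Set ℂ} (hS : IsCompact S)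
    (hg : MemLp g 2 (volume.restrict S)) {a : ℂ}
    (h : ∀ ε > 0, ∃ X : ℂ → ℂ, Continuous X ∧ (∀ z ∉ S, X z = 0) ∧ ∫ z, g z * X z = a ∧
      ∫ z, ‖X z‖ ^ 2 ≤ ε) : a = 0 := by
  have hg2 : IntegrableOn (fun z => ‖g z‖ ^ 2) S := hg.integrable_norm_pow (by norm_num)
  set G := ∫ z in S, ‖g z‖ ^ 2
  have key : ∀ s > 0, ‖a‖ ≤ s * (G + 1) := fun s hs => by
    obtain ⟨X, hX, hXS, hXa, hXε⟩ := h (s ^ 2) (by positivity)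
    have hXc : HasCompactSupport X := HasCompactSupport.intro hS hXS
    have hi : Integrable fun z => ‖X z‖ ^ 2 :=
      Continuous.integrable_of_hasCompactSupport (by fun_prop)
        (hXc.comp_left (g := fun x => ‖x‖ ^ 2) (by simp))
    have e1 : ∫ z in S, g z * X z = a := by
      rw [← hXa]
      exact setIntegral_eq_integral_of_forall_compl_eq_zero fun z hz => by simp [hXS z hz]
    rw [← e1]
    calc ‖∫ z in S, g z * X z‖ ≤ ∫ z in S, ‖g z * X z‖ := norm_integral_le_integral_norm _
      _ ≤ ∫ z in S, (s * ‖g z‖ ^ 2 + s⁻¹ * ‖X z‖ ^ 2) := by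
          refine integral_mono_of_nonneg (ae_of_all _ fun z => norm_nonneg _)
            ((hg2.const_mul s).add (hi.integrableOn.const_mul _)) (ae_of_all _ fun z => ?_)
          simp only [norm_mul]
          have h1 : 0 ≤ s⁻¹ * ((s * ‖g z‖ - ‖X z‖) ^ 2 + s ^2 * ‖g z‖ ^ 2 + ‖X z‖ ^ 2) := by
            positivity
          have h2 : s⁻¹ * ((s * ‖g z‖ - ‖X z‖) ^ 2 + s ^2 * ‖g z‖ ^ 2 + ‖X z‖ ^ 2) =
              2 * (s * ‖g z‖ ^ 2 + s⁻¹ * ‖X z‖ ^ 2 - ‖g z‖ * ‖X z‖) := by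
            field_simp; ring
          linarith
      _ = s * G + s⁻¹ * ∫ z in S, ‖X z‖ ^ 2 := by
          rw [integral_add (hg2.const_mul s) (hi.integrableOn.const_mul _), integral_const_mul,
            integral_const_mul]
      _ ≤ s * G + s⁻¹ * s ^ 2 := by
          gcongr
          exact (setIntegral_le_integral hi (ae_of_all _ fun z => by positivity)).trans hXε
      _ = s * (G + 1) := by field_simp
  have : ‖a‖ ≤ 0 := by
    refine le_of_forall_pos_le_add fun ε hε => ?_
    have := key (ε / (G + 1)) (by positivity)
    rw [div_mul_cancel₀ _ (by positivity)] at this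
    linarith
  simpa using this

theorem PolarSet.removable {K : Set ℂ} (hK : IsCompact K) (hp : PolarSet K) {g γ : ℂ → ℂ}
    (hγ : ContDiff ℝ ∞ γ) (hγc : HasCompactSupport γ)
    (hg : MemLp g 2 (volume.restrict (tsupport γ)))
    (h : ∀ β : ℂ → ℂ, ContDiff ℝ ∞ β → tsupport β ⊆ tsupport γ \ K → ∫ z, g z * dzb β z = 0) :
    ∫ z, g z * dzb γ z = 0 := by
  obtain ⟨χ, hχ, hχc, hχ0, hχ1, ⟨O, hO, hKO, hχO⟩, hw⟩ := hp.exists_approximants hK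
  obtain ⟨C1, hC1⟩ := hγc.exists_bound_of_continuous hγ.continuous
  obtain ⟨C2, hC2⟩ := hγc.dzb_compact.exists_bound_of_continuous hγ.dzb_smooth.continuous
  have sX : ContDiff ℝ ∞ fun z => (χ z : ℂ) := hχ.ofReal_comp
  have cX : HasCompactSupport fun z => (χ z : ℂ) := hχc.comp_left (g := Complex.ofReal) (by simp)
  obtain ⟨C3, hC3⟩ := cX.dzb_compact.exists_bound_of_continuous sX.dzb_smooth.continuous
  have c2 : HasCompactSupport fun z => χ z ^ 2 := hχc.comp_left (g := fun x => x ^ 2) (by simp)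
  have s2 : ContDiff ℝ ∞ fun z => χ z ^ 2 := by fun_prop
  have c2q : HasCompactSupport (qlap fun z => χ z ^ 2) := by
    have e : HasCompactSupport fun z => ((χ z ^ 2 : ℝ) : ℂ) :=
      c2.comp_left (g := Complex.ofReal) (by simp)
    exact e.dz_compact.dzb_compact.comp_left (g := Complex.re) (by simp)
  have t2q : ∀ z ∉ tsupport χ, qlap (fun z => χ z ^ 2) z = 0 := fun z hz => by
    have h1 : (fun z => ((χ z ^ 2 : ℝ) : ℂ)) =ᶠ[𝓝 z] fun _ => 0 := by
      filter_upwards [notMem_tsupport_iff_eventuallyEq.1 hz] with x hx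
      simp [hx]
    have h2 : dz (fun z => ((χ z ^ 2 : ℝ) : ℂ)) =ᶠ[𝓝 z] fun _ => 0 := by
      filter_upwards [h1.eventuallyEq_nhds] with x hx
      rw [dz_eventuallyEq hx, (HasW.const 0 x).dz_eq]
    simp only [qlap]
    rw [dzb_eventuallyEq h2, (HasW.const 0 z).dzb_eq, Complex.zero_re]
  obtain ⟨C4, hC4⟩ := c2q.exists_bound_of_continuous s2.qlap_smooth.continuous
  have hC4' : 0 ≤ C4 := (norm_nonneg _).trans (hC4 0)
  have hdX : ∀ z ∉ tsupport χ, dzb (fun z => (χ z : ℂ)) z = 0 := fun z hz => by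
    have h1 : (fun z => (χ z : ℂ)) =ᶠ[𝓝 z] fun _ => 0 := by
      filter_upwards [notMem_tsupport_iff_eventuallyEq.1 hz] with x hx
      simp [hx]
    rw [dzb_eventuallyEq h1, (HasW.const 0 z).dzb_eq]
  suffices hs : -∫ z, g z * dzb γ z = 0 by simpa using hs
  refine eq_zero_of_small_tests hγc.isCompact hg fun ε hε => ?_
  set M := 3 * (C2 ^ 2 + C1 ^ 2 * C3 ^ 2 + C1 ^ 2 * (3 * C4)) + 1 with hM
  have hMpos : 0 < M := by positivity
  obtain ⟨w, hws, hw1, hw0, ⟨O', hO', hKO', hwO'⟩, hwq, hwi⟩ := hw (ε / M) (by positivity)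
  have sW := hws.ofReal_comp
  set Y : ℂ → ℂ := fun z => γ z * ((χ z : ℂ) * (w z : ℂ)) with hY
  have sY : ContDiff ℝ ∞ Y := hγ.mul (sX.mul sW)
  have hYt : tsupport Y ⊆ tsupport γ := closure_mono fun z hz hz' => hz (by simp [hY, hz'])
  have hYc : HasCompactSupport Y := hγc.mono' (subset_closure.trans hYt)
  have hdY : ∀ z, dzb Y z = dzb γ z * (χ z * w z) + γ z * (dzb (fun z => (χ z : ℂ)) z * w z +
      χ z * dzb (fun z => (w z : ℂ)) z) := fun z =>
    ((hγ.hasW z).mul ((sX.hasW z).mul (sW.hasW z))).dzb_eq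
  have hgl : ∀ {X : ℂ → ℂ}, Continuous X → tsupport X ⊆ tsupport γ →
      Integrable fun z => g z * X z := by
    intro X hX hXt
    have h1 : IntegrableOn g (tsupport γ) := by
      have : IsFiniteMeasure (volume.restrict (tsupport γ)) :=
        ⟨by simpa using hγc.isCompact.measure_lt_top⟩
      exact hg.integrable (by norm_num)
    obtain ⟨C, hC⟩ := (hγc.mono' (subset_closure.trans hXt)).exists_bound_of_continuous hX
    have h2 : IntegrableOn (fun z => g z * X z) (tsupport γ) :=
      Integrable.mul_bdd (c := C) h1 hX.aestronglyMeasurable (ae_of_all _ hC)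
    refine (integrableOn_iff_integrable_of_support_subset fun z hz => ?_).1 h2
    exact hXt (subset_closure fun h0 => hz (by simp [h0]))
  refine ⟨dzb Y, sY.dzb_smooth.continuous, fun z hz => image_eq_zero_of_notMem_tsupport
    fun h' => hz (hYt (tsupport_dzb_subset Y h')), ?_, ?_⟩
  · have hb := h (fun z => γ z + Y z) (hγ.add sY) ?_
    · have e : ∀ z, dzb (fun z => γ z + Y z) z = dzb γ z + dzb Y z := fun z =>
        ((hγ.hasW z).add (sY.hasW z)).dzb_eq
      simp only [e, mul_add] at hb
      rw [integral_add (hgl hγ.dzb_smooth.continuous (tsupport_dzb_subset γ))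
        (hgl sY.dzb_smooth.continuous ((tsupport_dzb_subset Y).trans hYt))] at hb
      rw [eq_neg_iff_add_eq_zero, add_comm]; exact hb
    · intro z hz
      refine ⟨?_, fun hzK => ?_⟩
      · refine closure_minimal (fun x hx => ?_) (isClosed_tsupport γ) hz
        by_contra hn
        exact hx (by simp [hY, image_eq_zero_of_notMem_tsupport hn])
      · refine notMem_tsupport_iff_eventuallyEq.2 ?_ hz
        filter_upwards [hO.mem_nhds (hKO hzK), hO'.mem_nhds (hKO' hzK)] with x hx hx'
        simp [hY, hχO x hx, hwO' x hx']
  · have hE := energy_estimate hws hχ hχc (fun z _ => hw1 z) hwq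
    have hcdw := sW.dzb_smooth.continuous
    have hiw : IntegrableOn (fun z => |w z|) (tsupport χ) :=
      (by fun_prop : Continuous fun z => |w z|).continuousOn.integrableOn_compact hχc.isCompact
    have hiwI : Integrable ((tsupport χ).indicator fun z => |w z|) :=
      (integrable_indicator_iff (isClosed_tsupport χ).measurableSet).2 hiw
    have hw2 : ∀ z, w z ^ 2 ≤ |w z| := fun z => by
      rw [abs_of_nonpos (hw0 z)]; nlinarith [hw1 z, hw0 z]
    have hE2 : ∫ z, (w z ^ 2 + 2 * w z) * qlap (fun z => χ z ^ 2) z ≤ 3 * C4 * (ε / M) := by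
      calc _ ≤ ∫ z, 3 * C4 * (tsupport χ).indicator (fun z => |w z|) z := by
            apply integral_mono
            · have := s2.qlap_smooth.continuous
              exact Continuous.integrable_of_hasCompactSupport (by fun_prop) c2q.mul_left
            · exact hiwI.const_mul _
            · intro z
              simp only
              by_cases hz : z ∈ tsupport χ
              · rw [indicator_of_mem hz]
                refine (le_abs_self _).trans ?_
                rw [abs_mul]
                have h3 : |w z ^ 2 + 2 * w z| ≤ 3 * |w z| := by
                  rw [abs_of_nonpos (hw0 z), abs_le]
                  constructor <;> nlinarith [hw1 z, hw0 z]
                have h4 : |qlap (fun z => χ z ^ 2) z| ≤ C4 := hC4 z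
                calc _ ≤ 3 * |w z| * C4 := by gcongr
                  _ = _ := by ring
              · rw [t2q z hz, indicator_of_notMem hz]; simp
        _ = 3 * C4 * ∫ z in tsupport χ, |w z| := by
            rw [integral_const_mul, integral_indicator (isClosed_tsupport χ).measurableSet]
        _ ≤ _ := by gcongr
    have hiE : Integrable fun z => χ z ^ 2 * ‖dzb (fun z => (w z : ℂ)) z‖ ^ 2 :=
      Continuous.integrable_of_hasCompactSupport (by fun_prop) c2.mul_right
    calc ∫ z, ‖dzb Y z‖ ^ 2 ≤ ∫ z, (3 * (C2 ^ 2 + C1 ^ 2 * C3 ^ 2) *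
          (tsupport χ).indicator (fun z => |w z|) z +
          3 * C1 ^ 2 * (χ z ^ 2 * ‖dzb (fun z => (w z : ℂ)) z‖ ^ 2)) := by
          have hcd := sY.dzb_smooth.continuous
          apply integral_mono
          · exact Continuous.integrable_of_hasCompactSupport (by fun_prop)
              (hYc.dzb_compact.comp_left (g := fun x => ‖x‖ ^ 2) (by simp))
          · exact (hiwI.const_mul _).add (hiE.const_mul _)
          · intro z
            simp only
            rw [hdY]
            by_cases hz : z ∈ tsupport χ
            · rw [indicator_of_mem hz]
              have n1 : ‖dzb γ z * (χ z * w z)‖ ≤ C2 * |w z| := by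
                rw [norm_mul, norm_mul, Complex.norm_real, Complex.norm_real, Real.norm_eq_abs,
                  Real.norm_eq_abs, abs_of_nonneg (hχ0 z)]
                calc _ ≤ C2 * (1 * |w z|) := by
                      exact mul_le_mul (hC2 z) (mul_le_mul_of_nonneg_right (hχ1 z) (abs_nonneg _))
                        (mul_nonneg (hχ0 z) (abs_nonneg _)) ((norm_nonneg _).trans (hC2 z))
                  _ = _ := by ring
              have n2 : ‖γ z * (dzb (fun z => (χ z : ℂ)) z * w z)‖ ≤ C1 * (C3 * |w z|) := by
                rw [norm_mul, norm_mul, Complex.norm_real, Real.norm_eq_abs]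
                gcongr
                · exact (norm_nonneg _).trans (hC1 z)
                · exact hC1 z
                · exact hC3 z
              have n3 : ‖γ z * (χ z * dzb (fun z => (w z : ℂ)) z)‖ ≤
                  C1 * (χ z * ‖dzb (fun z => (w z : ℂ)) z‖) := by
                rw [norm_mul, norm_mul, Complex.norm_real, Real.norm_eq_abs,
                  abs_of_nonneg (hχ0 z)]
                gcongr
                · exact mul_nonneg (hχ0 z) (norm_nonneg _)
                · exact hC1 z
              have n4 : ‖dzb γ z * (χ z * w z) + γ z * (dzb (fun z => (χ z : ℂ)) z * w z +
                  χ z * dzb (fun z => (w z : ℂ)) z)‖ ≤ C2 * |w z| + C1 * (C3 * |w z|) +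
                  C1 * (χ z * ‖dzb (fun z => (w z : ℂ)) z‖) := by
                rw [mul_add (γ z), ← add_assoc]
                exact (norm_add₃_le).trans (add_le_add (add_le_add n1 n2) n3)
              have n5 : ∀ x y t : ℝ, (x + y + t) ^ 2 ≤ 3 * (x ^ 2 + y ^ 2 + t ^ 2) := by
                intro x y t; nlinarith [sq_nonneg (x - y), sq_nonneg (x - t), sq_nonneg (y - t)]
              have n6 : (C2 ^ 2 + C1 ^ 2 * C3 ^ 2) * |w z| ^ 2 ≤
                  (C2 ^ 2 + C1 ^ 2 * C3 ^ 2) * |w z| := by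
                rw [sq_abs]; exact mul_le_mul_of_nonneg_left (hw2 z) (by positivity)
              calc _ ≤ (C2 * |w z| + C1 * (C3 * |w z|) +
                  C1 * (χ z * ‖dzb (fun z => (w z : ℂ)) z‖)) ^ 2 := by gcongr
                _ ≤ _ := n5 _ _ _
                _ ≤ _ := by linarith
            · rw [indicator_of_notMem hz, hdX z hz, image_eq_zero_of_notMem_tsupport hz]
              simp
      _ = 3 * (C2 ^ 2 + C1 ^ 2 * C3 ^ 2) * (∫ z in tsupport χ, |w z|) +
          3 * C1 ^ 2 * ∫ z, χ z ^ 2 * ‖dzb (fun z => (w z : ℂ)) z‖ ^ 2 := by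
          rw [integral_add (hiwI.const_mul _) (hiE.const_mul _), integral_const_mul,
            integral_const_mul, integral_indicator (isClosed_tsupport χ).measurableSet]
      _ ≤ 3 * (C2 ^ 2 + C1 ^ 2 * C3 ^ 2) * (ε / M) + 3 * C1 ^ 2 * (3 * C4 * (ε / M)) := by
          have h7 : 0 ≤ ∫ z, χ z ^ 2 * ‖dzb (fun z => (w z : ℂ)) z‖ ^ 2 := by positivity
          gcongr
          linarith
      _ = (M - 1) * (ε / M) := by rw [hM]; ring
      _ ≤ M * (ε / M) := by gcongr; linarith
      _ = ε := by field_simp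

/-! ### The Cauchy transform -/

theorem integrableOn_norm_inv (R : ℝ) : IntegrableOn (fun z : ℂ => ‖z‖⁻¹) (ball 0 R) := by
  rw [← integrable_indicator_iff measurableSet_ball]
  have h := (integrable_fun_norm_addHaar (volume : Measure ℂ)
    (f := (Iio R).indicator fun t : ℝ => t⁻¹)).2 ?_
  · refine h.congr (.of_forall fun z => ?_)
    by_cases hz : ‖z‖ < R <;> simp [indicator, hz]
  · simp only [Complex.finrank_real_complex]
    rw [← integrable_indicator_iff measurableSet_Ioi]
    refine Integrable.mono' (g := (Ioo 0 R).indicator fun _ => (1 : ℝ)) ?_ ?_ ?_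
    · rw [integrable_indicator_iff measurableSet_Ioo]
      exact integrableOn_const (by simp)
    · refine Measurable.aestronglyMeasurable ?_
      refine Measurable.indicator ?_ measurableSet_Ioi
      exact (measurable_id.pow_const _).smul (measurable_inv.indicator measurableSet_Iio)
    · refine .of_forall fun t => ?_
      by_cases h0 : 0 < t
      · have h2 : t * t⁻¹ = 1 := mul_inv_cancel₀ h0.ne'
        by_cases h1 : t < R <;> simp [indicator, h0, h1, h2]
      · by_cases h1 : t < R <;> simp [indicator, h0, h1]

theorem integrableOn_inv_of_isBounded {S : Set ℂ} (hS : Bornology.IsBounded S) (z : ℂ) :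
    IntegrableOn (fun ζ : ℂ => (ζ - z)⁻¹) S := by
  obtain ⟨R, hR⟩ := hS.subset_ball z
  refine IntegrableOn.mono_set ?_ hR
  rw [← integrable_indicator_iff measurableSet_ball]
  have h : Integrable ((ball (0 : ℂ) R).indicator fun ζ : ℂ => ζ⁻¹) := by
    rw [integrable_indicator_iff measurableSet_ball]
    refine Integrable.mono' (integrableOn_norm_inv R) (by fun_prop) (.of_forall fun ζ => ?_)
    simp
  refine (h.comp_sub_right z).congr (.of_forall fun ζ => ?_)
  simp only
  by_cases hz : ζ ∈ ball z R
  · rw [indicator_of_mem hz, indicator_of_mem (by simpa [dist_eq_norm] using hz)]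
  · rw [indicator_of_notMem hz, indicator_of_notMem (by simpa [dist_eq_norm] using hz)]

theorem locallyIntegrable_inv : LocallyIntegrable (fun z : ℂ => z⁻¹) volume := by
  intro x
  refine ⟨ball x 1, ball_mem_nhds x one_pos, ?_⟩
  simpa using integrableOn_inv_of_isBounded (isBounded_ball (x := x) (r := 1)) 0

theorem integrableOn_poisson_kernel :
    IntegrableOn (fun r : ℝ => 2 * r / (r ^ 2 + 1) ^ 2) (Ioi 0) ∧
      ∫ r in Ioi (0 : ℝ), 2 * r / (r ^ 2 + 1) ^ 2 = 1 := by
  have hd : ∀ x ∈ Ici (0 : ℝ), HasDerivAt (fun r : ℝ => -(r ^ 2 + 1)⁻¹)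
      (2 * x / (x ^ 2 + 1) ^ 2) x := by
    intro x _
    have h := ((hasDerivAt_id x).pow 2).add_const 1
    have := (h.inv (by simp; positivity)).neg
    refine this.congr_deriv ?_
    simp; ring
  have ht : Tendsto (fun r : ℝ => -(r ^ 2 + 1)⁻¹) atTop (𝓝 0) := by
    rw [← neg_zero]
    exact (tendsto_inv_atTop_zero.comp
      (tendsto_atTop_add_const_right _ _ (tendsto_pow_atTop two_ne_zero))).neg
  have hp : ∀ x ∈ Ioi (0 : ℝ), 0 ≤ 2 * x / (x ^ 2 + 1) ^ 2 := fun x hx => by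
    have : 0 < x := hx
    positivity
  have h1 := integrableOn_Ioi_deriv_of_nonneg' hd hp ht
  refine ⟨h1, ?_⟩
  rw [integral_Ioi_of_hasDerivAt_of_tendsto' hd h1 ht]
  simp

theorem integrable_cauchy_kernel : Integrable (fun z : ℂ => ((‖z‖ ^ 2 + 1) ^ 2)⁻¹) := by
  refine (integrable_fun_norm_addHaar (volume : Measure ℂ)
    (f := fun t : ℝ => ((t ^ 2 + 1) ^ 2)⁻¹)).2 ?_
  have := integrableOn_poisson_kernel.1.div_const 2
  refine this.congr (.of_forall fun x => ?_)
  simp; field_simp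

theorem integral_cauchy_kernel : ∫ z : ℂ, ((‖z‖ ^ 2 + 1) ^ 2)⁻¹ = Real.pi := by
  have h := integral_fun_norm_addHaar (volume : Measure ℂ) (fun t : ℝ => ((t ^ 2 + 1) ^ 2)⁻¹)
  rw [h]
  have h2 := integrableOn_poisson_kernel.2
  have h3 : ∫ y in Ioi (0 : ℝ), y ^ (Module.finrank ℝ ℂ - 1) • ((y ^ 2 + 1) ^ 2)⁻¹ = 2⁻¹ := by
    have h4 : ∫ y in Ioi (0 : ℝ), y ^ (Module.finrank ℝ ℂ - 1) • ((y ^ 2 + 1) ^ 2)⁻¹ =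
        2⁻¹ * ∫ r in Ioi (0 : ℝ), 2 * r / (r ^ 2 + 1) ^ 2 := by
      rw [← integral_const_mul]
      clear h h2
      congr 1
      ext y
      simp; field_simp
    rw [h4, h2, mul_one]
  rw [h3]
  simp [Measure.real]
  ring

/-- The regularized Cauchy kernel `z̄ / (|z|² + ε²)`. -/
noncomputable def regKer (ε : ℝ) (z : ℂ) : ℂ := conj z * (z * conj z + (ε : ℂ) ^ 2)⁻¹

theorem regKer_denom (ε : ℝ) (z : ℂ) :
    z * conj z + (ε : ℂ) ^ 2 = ((‖z‖ ^ 2 + ε ^ 2 : ℝ) : ℂ) := by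
  rw [Complex.mul_conj, Complex.normSq_eq_norm_sq]; push_cast; ring

theorem regKer_denom_ne {ε : ℝ} (hε : 0 < ε) (z : ℂ) : z * conj z + (ε : ℂ) ^ 2 ≠ 0 := by
  rw [regKer_denom]
  exact_mod_cast (by positivity : ‖z‖ ^ 2 + ε ^ 2 ≠ 0)

theorem hasW_regKer {ε : ℝ} (hε : 0 < ε) (z : ℂ) :
    HasW (regKer ε) (-(conj z) ^ 2 * ((z * conj z + (ε : ℂ) ^ 2) ^ 2)⁻¹)
      ((ε ^ 2 * ((‖z‖ ^ 2 + ε ^ 2) ^ 2)⁻¹ : ℝ) : ℂ) z := by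
  have hc := (HasW.id z).star_conj
  have hd := ((HasW.id z).mul hc).add (HasW.const ((ε : ℂ) ^ 2) z)
  have hi := HasW.comp_hol (f := fun z => z * conj z + (ε : ℂ) ^ 2) (F := fun x => x⁻¹)
    (hasDerivAt_inv (regKer_denom_ne hε z)) hd
  refine (hc.mul hi).congr' ?_ ?_
  · simp; ring
  · push_cast
    rw [← Complex.ofReal_pow, ← Complex.ofReal_pow, ← Complex.ofReal_add, ← regKer_denom]
    simp
    field_simp
    ring

theorem contDiff_conj : ContDiff ℝ ∞ fun z : ℂ => conj z :=
  (Complex.conjCLE : ℂ →L[ℝ] ℂ).contDiff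

theorem contDiff_regKer {ε : ℝ} (hε : 0 < ε) : ContDiff ℝ ∞ (regKer ε) := by
  unfold regKer
  exact contDiff_conj.mul (((contDiff_id.mul contDiff_conj).add contDiff_const).inv
    (regKer_denom_ne hε))

theorem norm_regKer_le (ε : ℝ) (z : ℂ) : ‖regKer ε z‖ ≤ ‖z‖⁻¹ := by
  unfold regKer
  rw [regKer_denom, norm_mul, norm_inv, Complex.norm_real, Complex.norm_conj,
    Real.norm_of_nonneg (by positivity)]
  rcases eq_or_ne z 0 with rfl | hz
  · simp
  have : 0 < ‖z‖ := norm_pos_iff.2 hz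
  rw [← div_eq_mul_inv, div_le_iff₀ (by positivity)]
  field_simp
  nlinarith [sq_nonneg ε]

theorem cauchy_pompeiu_zero {γ : ℂ → ℂ} (hγ : ContDiff ℝ ∞ γ) (hc : HasCompactSupport γ) :
    ∫ z, dzb γ z * z⁻¹ = -(Real.pi * γ 0) := by
  set e : ℕ → ℝ := fun n => ((n : ℝ) + 1)⁻¹
  have he : ∀ n, 0 < e n := fun n => by positivity
  have he0 : Tendsto e atTop (𝓝 0) := by
    simpa [e, one_div] using tendsto_one_div_add_atTop_nhds_zero_nat (𝕜 := ℝ)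
  have hi : Integrable fun z => dzb γ z * z⁻¹ := by
    have := locallyIntegrable_inv.integrable_smul_left_of_hasCompactSupport
      hγ.dzb_smooth.continuous hc.dzb_compact
    simpa using this
  have h1 : Tendsto (fun n => ∫ z, dzb γ z * regKer (e n) z) atTop (𝓝 (∫ z, dzb γ z * z⁻¹)) := by
    refine tendsto_integral_of_dominated_convergence (fun z => ‖dzb γ z * z⁻¹‖) ?_ hi.norm ?_ ?_
    · intro n
      exact (hγ.dzb_smooth.continuous.mul (contDiff_regKer (he n)).continuous).aestronglyMeasurable
    · intro n
      refine .of_forall fun z => ?_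
      rw [norm_mul, norm_mul, norm_inv]
      exact mul_le_mul_of_nonneg_left (norm_regKer_le _ _) (norm_nonneg _)
    · have : ∀ᵐ z : ℂ, z ≠ 0 := by simp [ae_iff]
      filter_upwards [this] with z hz
      refine Tendsto.const_mul _ ?_
      have h2 : Tendsto (fun n => conj z * (z * conj z + (e n : ℂ) ^ 2)⁻¹) atTop
          (𝓝 (conj z * (z * conj z + (0 : ℝ) ^ 2)⁻¹)) := by
        refine Tendsto.const_mul _ (Tendsto.inv₀ (Tendsto.const_add _ (Tendsto.pow ?_ 2)) ?_)
        · exact (Complex.continuous_ofReal.tendsto _).comp he0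
        · simpa using hz
      have : conj z ≠ 0 := by simpa using hz
      convert h2 using 2
      · rfl
      · rw [Complex.ofReal_zero]; field_simp; simp
  have h3 : ∀ n, ∫ z, dzb γ z * regKer (e n) z =
      -∫ u, γ (e n • u) * (((‖u‖ ^ 2 + 1) ^ 2)⁻¹ : ℝ) := by
    intro n
    rw [eq_neg_iff_add_eq_zero, ← eq_neg_iff_add_eq_zero.1
      (integral_mul_dzb hγ hc (contDiff_regKer (he n))), add_comm]
    congr 1
    have h4 := Measure.integral_comp_smul (volume : Measure ℂ)
      (fun z => γ z * dzb (regKer (e n)) z) (e n)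
    have h5 : (∫ z, γ z * dzb (regKer (e n)) z) =
      (e n ^ 2) • ∫ x, γ (e n • x) * dzb (regKer (e n)) (e n • x) := by
      rw [h4, smul_smul]
      have : e n ^ 2 * |(e n ^ Module.finrank ℝ ℂ)⁻¹| = 1 := by
        rw [Complex.finrank_real_complex, abs_of_pos (by have := he n; positivity)]
        have := (he n).ne'
        field_simp
      rw [this, one_smul]
    rw [h5, ← integral_smul]
    congr 1
    ext u
    rw [(hasW_regKer (he n) _).dzb_eq, norm_smul, Real.norm_of_nonneg (he n).le, Complex.real_smul]
    have := (he n).ne'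
    rw [Complex.real_smul, mul_left_comm, ← Complex.ofReal_mul]
    congr 2
    field_simp
  have h6 : Tendsto (fun n => ∫ u, γ (e n • u) * (((‖u‖ ^ 2 + 1) ^ 2)⁻¹ : ℝ)) atTop
      (𝓝 (∫ u : ℂ, γ 0 * (((‖u‖ ^ 2 + 1) ^ 2)⁻¹ : ℝ))) := by
    obtain ⟨C, hC⟩ := hc.exists_bound_of_continuous hγ.continuous
    refine tendsto_integral_of_dominated_convergence
      (fun u : ℂ => C * ((‖u‖ ^ 2 + 1) ^ 2)⁻¹) ?_ (integrable_cauchy_kernel.const_mul C) ?_ ?_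
    · intro n
      have h7 : Continuous fun u : ℂ => ((‖u‖ ^ 2 + 1) ^ 2)⁻¹ :=
        Continuous.inv₀ (by fun_prop) (fun u => by positivity)
      have := hγ.continuous
      exact Continuous.aestronglyMeasurable (by fun_prop)
    · intro n
      refine .of_forall fun u => ?_
      rw [norm_mul, Complex.norm_real, Real.norm_of_nonneg (by positivity)]
      exact mul_le_mul_of_nonneg_right (hC _) (by positivity)
    · refine .of_forall fun u => Tendsto.mul_const _ ?_
      have : Tendsto (fun n => e n • u) atTop (𝓝 ((0 : ℝ) • u)) := he0.smul_const u
      rw [zero_smul] at this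
      exact (hγ.continuous.tendsto 0).comp this
  have h8 := h6.neg
  simp_rw [← h3] at h8
  rw [tendsto_nhds_unique h1 h8, integral_const_mul, integral_complex_ofReal,
    integral_cauchy_kernel]
  ring

theorem dzb_comp_add (γ : ℂ → ℂ) (z ζ : ℂ) : dzb (fun ζ => γ (ζ + z)) ζ = dzb γ (ζ + z) := by
  simp only [dzb, fderiv_comp_add_right]

theorem cauchy_pompeiu {γ : ℂ → ℂ} (hγ : ContDiff ℝ ∞ γ) (hc : HasCompactSupport γ) (z : ℂ) :
    ∫ ζ, dzb γ ζ * (ζ - z)⁻¹ = -(Real.pi * γ z) := by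
  have h := cauchy_pompeiu_zero (γ := fun ζ => γ (ζ + z)) (by fun_prop)
    (hc.comp_homeomorph (Homeomorph.addRight z))
  rw [zero_add] at h
  rw [← h, ← integral_sub_right_eq_self (fun ζ => dzb (fun ζ => γ (ζ + z)) ζ * ζ⁻¹) z]
  congr 1
  ext ζ
  rw [dzb_comp_add, sub_add_cancel]

/-- The solution `(1/π) ∫ γ(z) / (ζ - z)` of `∂G/∂ζ̄ = γ`. -/
noncomputable def cauchyPot (γ : ℂ → ℂ) (ζ : ℂ) : ℂ := (Real.pi : ℂ)⁻¹ * ∫ z, γ z * (ζ - z)⁻¹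

theorem cauchyPot_eq (γ : ℂ → ℂ) : cauchyPot γ = fun ζ => (Real.pi : ℂ)⁻¹ *
    convolution (fun z : ℂ => z⁻¹) γ (ContinuousLinearMap.mul ℝ ℂ) volume ζ := by
  ext ζ
  rw [cauchyPot, convolution, ← integral_sub_left_eq_self _ _ ζ]
  congr 2
  ext t
  simp [mul_comm]

theorem contDiff_cauchyPot {γ : ℂ → ℂ} (hγ : ContDiff ℝ ∞ γ) (hc : HasCompactSupport γ) :
    ContDiff ℝ ∞ (cauchyPot γ) := by
  rw [cauchyPot_eq]
  exact contDiff_const.mul (hc.contDiff_convolution_right _ locallyIntegrable_inv hγ)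

theorem dzb_cauchyPot {γ : ℂ → ℂ} (hγ : ContDiff ℝ ∞ γ) (hc : HasCompactSupport γ) (ζ : ℂ) :
    dzb (cauchyPot γ) ζ = γ ζ := by
  have h1 := hc.hasFDerivAt_convolution_right (ContinuousLinearMap.mul ℝ ℂ) locallyIntegrable_inv
    (hγ.of_le (by simp)) ζ
  have h2 := h1.const_mul (Real.pi : ℂ)⁻¹
  have hap : ∀ v, (convolution (fun z : ℂ => z⁻¹) (fderiv ℝ γ)
      ((ContinuousLinearMap.mul ℝ ℂ).precompR ℂ) volume ζ) v =
      ∫ t : ℂ, t⁻¹ * fderiv ℝ γ (ζ - t) v := by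
    intro v
    rw [convolution_precompR_apply _ locallyIntegrable_inv (hc.fderiv ℝ)
      (hγ.continuous_fderiv (by simp))]
    rfl
  have hi : ∀ v, Integrable fun t : ℂ => t⁻¹ * fderiv ℝ γ (ζ - t) v := fun v => by
    have hcf := hγ.continuous_fderiv (by simp)
    have h3 : HasCompactSupport fun t => fderiv ℝ γ (ζ - t) v :=
      ((hc.fderiv ℝ).comp_left (g := fun L : ℂ →L[ℝ] ℂ => L v) (by simp)).comp_homeomorph
        (Homeomorph.subLeft ζ)
    have := locallyIntegrable_inv.integrable_smul_left_of_hasCompactSupport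
      (g := fun t => fderiv ℝ γ (ζ - t) v) (by fun_prop) h3
    simpa [mul_comm] using this
  rw [cauchyPot_eq, dzb, h2.fderiv]
  simp only [smul_apply, hap, smul_eq_mul]
  have h4 : ∫ t : ℂ, t⁻¹ * dzb γ (ζ - t) = ((∫ t : ℂ, t⁻¹ * fderiv ℝ γ (ζ - t) 1) +
      Complex.I * ∫ t : ℂ, t⁻¹ * fderiv ℝ γ (ζ - t) Complex.I) / 2 := by
    rw [← integral_const_mul, ← integral_add (hi _) ((hi _).const_mul _), ← integral_div]
    congr 1
    ext t
    simp only [dzb]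
    ring
  have h5 := cauchy_pompeiu hγ hc ζ
  rw [← integral_sub_left_eq_self _ _ ζ] at h5
  have h6 : ∫ t : ℂ, t⁻¹ * dzb γ (ζ - t) = Real.pi * γ ζ := by
    rw [← neg_neg (Real.pi * γ ζ), ← h5, ← integral_neg]
    congr 1
    ext t
    simp [mul_comm]
  have h7 : γ ζ = (Real.pi : ℂ)⁻¹ * ∫ t : ℂ, t⁻¹ * dzb γ (ζ - t) := by
    rw [h6]; field_simp
  rw [h7, h4]
  ring

/-- The Cauchy transform `(1/π) ∫ g(ζ) / (z - ζ)`. -/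
noncomputable def cauchyT (g : ℂ → ℂ) (z : ℂ) : ℂ := (Real.pi : ℂ)⁻¹ * ∫ ζ, g ζ * (z - ζ)⁻¹

theorem integrable_cauchy_prod {g : ℂ → ℂ} (hg : Integrable g) {R : ℝ}
    (hS : ∀ ζ, R ≤ ‖ζ‖ → g ζ = 0) (R' : ℝ) :
    Integrable (fun p : ℂ × ℂ => (ball (0 : ℂ) R').indicator 1 p.1 * (g p.2 * (p.1 - p.2)⁻¹))
      (volume.prod volume) := by
  have hk : Integrable ((ball (0 : ℂ) (R' + R)).indicator fun z => z⁻¹) := by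
    rw [integrable_indicator_iff measurableSet_ball]
    simpa using integrableOn_inv_of_isBounded (isBounded_ball (x := (0 : ℂ)) (r := R' + R)) 0
  have h := hg.convolution_integrand (ContinuousLinearMap.mul ℝ ℂ) hk
  have hm : Measurable fun p : ℂ × ℂ => (ball (0 : ℂ) R').indicator (1 : ℂ → ℂ) p.1 :=
    (measurable_one.indicator measurableSet_ball).comp measurable_fst
  refine (h.bdd_mul (c := 1) hm.aestronglyMeasurable (.of_forall fun p => ?_)).congr
    (.of_forall fun p => ?_)
  · by_cases hp : p.1 ∈ ball (0 : ℂ) R' <;> simp [hp]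
  · simp only [ContinuousLinearMap.mul_apply']
    by_cases hp : p.1 ∈ ball (0 : ℂ) R'
    · by_cases hq : R ≤ ‖p.2‖
      · simp [hS _ hq]
      · rw [indicator_of_mem (s := ball (0 : ℂ) (R' + R))]
        rw [mem_ball_zero_iff] at hp ⊢
        exact (norm_sub_le _ _).trans_lt (add_lt_add hp (not_le.1 hq))
    · simp [hp]

theorem locallyIntegrable_cauchyT {g : ℂ → ℂ} (hg : Integrable g) {R : ℝ}
    (hS : ∀ ζ, R ≤ ‖ζ‖ → g ζ = 0) : LocallyIntegrable (cauchyT g) volume := by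
  intro x
  refine ⟨ball 0 (‖x‖ + 1), isOpen_ball.mem_nhds (by simp), ?_⟩
  have h := (integrable_cauchy_prod hg hS (‖x‖ + 1)).integral_prod_left
  rw [← integrable_indicator_iff measurableSet_ball]
  refine (h.const_mul (Real.pi : ℂ)⁻¹).congr (.of_forall fun z => ?_)
  by_cases hz : z ∈ ball (0 : ℂ) (‖x‖ + 1)
  · simp only [indicator_of_mem hz, cauchyT, Pi.one_apply, one_mul]
  · simp only [indicator_of_notMem hz, zero_mul, integral_zero, mul_zero]

theorem integral_mul_cauchyPot {g γ : ℂ → ℂ} (hg : Integrable g) {R : ℝ}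
    (hS : ∀ ζ, R ≤ ‖ζ‖ → g ζ = 0) (hγ : Continuous γ) (hc : HasCompactSupport γ) :
    ∫ ζ, g ζ * cauchyPot γ ζ = - ∫ z, γ z * cauchyT g z := by
  obtain ⟨R', hR'⟩ := hc.isCompact.isBounded.subset_ball 0
  obtain ⟨C, hC⟩ := hc.exists_bound_of_continuous hγ
  have h := integrable_cauchy_prod hg hS R'
  have h1 : Integrable (fun p : ℂ × ℂ => (Real.pi : ℂ)⁻¹ * (γ p.1 * (g p.2 * (p.1 - p.2)⁻¹)))
      (volume.prod volume) := by
    refine ((h.bdd_mul (c := C) (f := fun p : ℂ × ℂ => γ p.1)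
      (hγ.comp continuous_fst).aestronglyMeasurable (.of_forall fun p => hC _)).congr
      (.of_forall fun p => ?_)).const_mul _
    simp only
    by_cases hp : p.1 ∈ ball (0 : ℂ) R'
    · simp [hp]
    · rw [image_eq_zero_of_notMem_tsupport (fun hh => hp (hR' hh))]
      simp
  have h2 := integral_integral_swap (f := fun z ζ => (Real.pi : ℂ)⁻¹ * (γ z * (g ζ * (z - ζ)⁻¹))) h1
  have h3 : ∫ z, γ z * cauchyT g z = ∫ z, ∫ ζ, (Real.pi : ℂ)⁻¹ * (γ z * (g ζ * (z - ζ)⁻¹)) := by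
    congr 1; ext z
    rw [integral_const_mul, integral_const_mul, cauchyT]
    ring
  rw [h3, h2, ← integral_neg]
  congr 1; ext ζ
  rw [cauchyPot, ← integral_const_mul, ← integral_const_mul, ← integral_neg]
  congr 1; ext z
  rw [← neg_sub z ζ, inv_neg]
  ring

theorem weyl {f χ : ℂ → ℂ} {D : Set ℂ} (hf : ∀ K ⊆ D, IsCompact K → IntegrableOn f K)
    (h : ∀ γ : ℂ → ℂ, ContDiff ℝ ∞ γ → HasCompactSupport γ → tsupport γ ⊆ D →
      ∫ z, f z * dzb γ z = 0)
    (hχ : ContDiff ℝ ∞ χ) (hχc : HasCompactSupport χ) (hχD : tsupport χ ⊆ D) :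
    Integrable (fun ζ => f ζ * dzb χ ζ) ∧
    ∀ᵐ z, f z * χ z = cauchyT (fun ζ => f ζ * dzb χ ζ) z := by
  have hint : ∀ η : ℂ → ℂ, Continuous η → HasCompactSupport η → tsupport η ⊆ D →
      Integrable fun z => f z * η z := by
    intro η hη hηc hηD
    obtain ⟨C, hC⟩ := hηc.exists_bound_of_continuous hη
    have h1 := (hf _ hηD hηc.isCompact).mul_bdd (c := C) hη.aestronglyMeasurable
      (.of_forall hC)
    have h1 := (integrable_indicator_iff (isClosed_tsupport η).measurableSet).2 h1
    refine h1.congr (.of_forall fun z => ?_)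
    by_cases hz : z ∈ tsupport η
    · simp [hz]
    · simp [hz, image_eq_zero_of_notMem_tsupport hz]
  have hg := hint _ hχ.dzb_smooth.continuous hχc.dzb_compact ((tsupport_dzb_subset χ).trans hχD)
  refine ⟨hg, ?_⟩
  obtain ⟨R, hR⟩ := hχc.isCompact.isBounded.subset_ball 0
  have hS : ∀ ζ, R ≤ ‖ζ‖ → f ζ * dzb χ ζ = 0 := fun ζ hζ => by
    rw [image_eq_zero_of_notMem_tsupport (f := dzb χ), mul_zero]
    intro hh
    have := hR (tsupport_dzb_subset χ hh)
    rw [mem_ball_zero_iff] at this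
    exact absurd hζ (not_le.2 this)
  refine ae_eq_of_integral_contDiff_smul_eq (hint _ hχ.continuous hχc hχD).locallyIntegrable
    (locallyIntegrable_cauchyT hg hS) ?_
  intro γ hγ hγc
  have sγ : ContDiff ℝ ∞ fun z => (γ z : ℂ) := hγ.ofReal_comp
  have cγ : HasCompactSupport fun z => (γ z : ℂ) := hγc.comp_left (g := Complex.ofReal) (by simp)
  have hG := contDiff_cauchyPot sγ cγ
  have h1 := h (fun z => χ z * cauchyPot (fun z => (γ z : ℂ)) z) (hχ.mul hG) hχc.mul_right
    ((tsupport_mul_subset_left).trans hχD)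
  have h2 : ∀ z, f z * dzb (fun z => χ z * cauchyPot (fun z => (γ z : ℂ)) z) z =
      f z * dzb χ z * cauchyPot (fun z => (γ z : ℂ)) z + (γ z : ℂ) * (f z * χ z) := by
    intro z
    rw [((hχ.hasW z).mul (hG.hasW z)).dzb_eq, dzb_cauchyPot sγ cγ]
    ring
  simp_rw [h2] at h1
  rw [integral_add, integral_mul_cauchyPot hg hS sγ.continuous cγ] at h1
  · simp only [Complex.real_smul]
    linear_combination h1
  · refine (hint (fun z => dzb χ z * cauchyPot (fun z => (γ z : ℂ)) z)
      (hχ.dzb_smooth.continuous.mul hG.continuous) hχc.dzb_compact.mul_right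
      (tsupport_mul_subset_left.trans ((tsupport_dzb_subset χ).trans hχD))).congr
      (.of_forall fun z => ?_)
    simp [mul_assoc]
  · refine (hint (fun z => χ z * (γ z : ℂ)) (hχ.continuous.mul sγ.continuous) hχc.mul_right
      (tsupport_mul_subset_left.trans hχD)).congr (.of_forall fun z => ?_)
    simp only
    ring

theorem norm_fderiv_le_of_bound {E : Type*} [NormedAddCommGroup E] [NormedSpace ℂ E] {F : E → ℂ}
    {p₀ p : E} {r C : ℝ} (hr : 0 < r) (hF : DifferentiableOn ℂ F (ball p₀ (2 * r)))
    (hC : ∀ q ∈ ball p₀ (2 * r), ‖F q‖ ≤ C) (hp : p ∈ ball p₀ r) : ‖fderiv ℂ F p‖ ≤ C / r := by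
  have hsub : ∀ v : E, ‖v‖ ≤ r → p + v ∈ ball p₀ (2 * r) := fun v hv => by
    rw [mem_ball, dist_eq_norm] at hp ⊢
    rw [show p + v - p₀ = (p - p₀) + v by abel]
    linarith [norm_add_le (p - p₀) v]
  have hC0 : 0 ≤ C := (norm_nonneg _).trans (hC (p + 0) (hsub 0 (by simpa using hr.le)))
  refine ContinuousLinearMap.opNorm_le_bound _ (by positivity) fun v => ?_
  rcases eq_or_ne v 0 with rfl | hv
  · simp
  have hv' : 0 < ‖v‖ := norm_pos_iff.2 hv
  have hfd : HasFDerivAt F (fderiv ℂ F p) p := by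
    have : p ∈ ball p₀ (2 * r) := by simpa using hsub 0 (by simpa using hr.le)
    exact (hF.differentiableAt (isOpen_ball.mem_nhds this)).hasFDerivAt
  have hd : HasDerivAt (fun t : ℂ => F (p + t • v)) (fderiv ℂ F p v) 0 := by
    have h1 : HasDerivAt (fun t : ℂ => p + t • v) v 0 := by
      simpa using ((hasDerivAt_id (0 : ℂ)).smul_const v).const_add p
    have h2 : HasFDerivAt F (fderiv ℂ F p) (p + (0 : ℂ) • v) := by simpa using hfd
    exact h2.comp_hasDerivAt (0 : ℂ) h1
  have hsub' : ∀ t ∈ closedBall (0 : ℂ) (r / ‖v‖), p + t • v ∈ ball p₀ (2 * r) := fun t ht => by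
    apply hsub
    rw [mem_closedBall_zero_iff] at ht
    rw [norm_smul]
    exact (le_div_iff₀ hv').1 ht
  have hdc : DiffContOnCl ℂ (fun t : ℂ => F (p + t • v)) (ball 0 (r / ‖v‖)) := by
    refine DifferentiableOn.diffContOnCl_ball (U := closedBall 0 (r / ‖v‖)) ?_ subset_rfl
    exact hF.comp (by fun_prop) hsub'
  have := Complex.norm_deriv_le_of_forall_mem_sphere_norm_le (C := C) (by positivity) hdc
    (fun t ht => hC _ (hsub' t (sphere_subset_closedBall ht)))
  rw [hd.deriv] at this
  calc _ ≤ C / (r / ‖v‖) := this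
    _ = _ := by field_simp

theorem differentiableOn_integral_param {α : Type*} [MeasurableSpace α] {μ : Measure α}
    {U : Set (ℂ × ℂ)} (hU : IsOpen U) {F : ℂ × ℂ → α → ℂ} {H : α → ℝ}
    (hF : ∀ a, DifferentiableOn ℂ (fun p => F p a) U)
    (hm : ∀ p ∈ U, AEStronglyMeasurable (F p) μ) (hH : Integrable H μ)
    (hb : ∀ a, ∀ p ∈ U, ‖F p a‖ ≤ H a) : DifferentiableOn ℂ (fun p => ∫ a, F p a ∂μ) U := by
  intro p₀ hp₀
  obtain ⟨s, hs, hsU⟩ := isOpen_iff.1 hU p₀ hp₀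
  set r := s / 2 with hr
  have hr0 : 0 < r := by positivity
  have hball : ball p₀ (2 * r) ⊆ U := by rw [hr]; convert hsU using 2; ring
  have hball' : ball p₀ r ⊆ U := (ball_subset_ball (by linarith)).trans hball
  have hfd : ∀ a, ∀ p ∈ U, HasFDerivAt (fun p => F p a) (fderiv ℂ (fun p => F p a) p) p :=
    fun a p hp => ((hF a).differentiableAt (hU.mem_nhds hp)).hasFDerivAt
  have hmeas : ∀ v : ℂ × ℂ, ‖v‖ ≤ 1 →
      AEStronglyMeasurable (fun a => fderiv ℂ (fun p => F p a) p₀ v) μ := by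
    intro v hv
    set c : ℕ → ℂ := fun n => (((n : ℝ) + 1) / r : ℝ)
    have hc : Tendsto (fun n => ‖c n‖) atTop atTop := by
      have : (fun n => ‖c n‖) = fun n : ℕ => ((n : ℝ) + 1) / r := by
        ext n; simp only [c]; rw [Complex.norm_real, Real.norm_of_nonneg (by positivity)]
      rw [this]
      exact (tendsto_atTop_add_const_right _ _ tendsto_natCast_atTop_atTop).atTop_div_const hr0
    have hin : ∀ n, p₀ + (c n)⁻¹ • v ∈ U := fun n => by
      apply hball
      rw [mem_ball, dist_eq_norm, add_sub_cancel_left, norm_smul, norm_inv]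
      have h1 : ‖c n‖⁻¹ ≤ r := by
        simp only [c]; rw [Complex.norm_real, Real.norm_of_nonneg (by positivity), inv_div]
        exact div_le_self hr0.le (by linarith [Nat.cast_nonneg (α := ℝ) n])
      calc _ ≤ r * 1 := by gcongr
        _ < _ := by linarith
    refine aestronglyMeasurable_of_tendsto_ae atTop
      (f := fun n a => c n • (F (p₀ + (c n)⁻¹ • v) a - F p₀ a)) (fun n => ?_)
      (.of_forall fun a => (hfd a p₀ hp₀).lim v hc)
    exact ((hm _ (hin n)).sub (hm _ hp₀)).const_smul (c n)
  have hmf : AEStronglyMeasurable (fun a => fderiv ℂ (fun p => F p a) p₀) μ := by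
    have h1 : ∀ L : ℂ × ℂ →L[ℂ] ℂ, L = L (1, 0) • ContinuousLinearMap.fst ℂ ℂ ℂ +
        L (0, 1) • ContinuousLinearMap.snd ℂ ℂ ℂ := by
      intro L
      ext <;> simp
    rw [show (fun a => fderiv ℂ (fun p => F p a) p₀) = _ from funext fun a => h1 _]
    refine AEStronglyMeasurable.add ?_ ?_
    · exact (hmeas (1, 0) (by simp [Prod.norm_def])).smul_const _
    · exact (hmeas (0, 1) (by simp [Prod.norm_def])).smul_const _
  have := hasFDerivAt_integral_of_dominated_of_fderiv_le (μ := μ) (𝕜 := ℂ) (F := F)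
    (F' := fun p a => fderiv ℂ (fun p => F p a) p) (bound := fun a => H a / r)
    (ball_mem_nhds p₀ hr0) ?_ ?_ hmf ?_ (hH.div_const r) ?_
  · exact this.differentiableAt.differentiableWithinAt
  · filter_upwards [hU.mem_nhds hp₀] with p hp using hm p hp
  · exact hH.mono' (hm p₀ hp₀) (.of_forall fun a => hb a p₀ hp₀)
  · exact .of_forall fun a p hp => norm_fderiv_le_of_bound hr0 ((hF a).mono hball)
      (fun q hq => hb a q (hball hq)) hp
  · exact .of_forall fun a p hp => hfd a p (hball' hp)

theorem sq_norm_mul_area_le {h : ℂ → ℂ} {w : ℂ} {r : ℝ} (hr : 0 < r)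
    (hh : DifferentiableOn ℂ h (ball w r)) (hi : IntegrableOn (fun z => ‖h z‖ ^ 2) (ball w r)) :
    ‖h w‖ ^ 2 * (Real.pi * r ^ 2) ≤ ∫ z in ball w r, ‖h z‖ ^ 2 := by
  have hm := integral_ball_ge_of_submean hi ?_
  · have hv : (volume (ball w r)).toReal = Real.pi * r ^ 2 := by
      rw [Complex.volume_ball, ENNReal.toReal_mul, ENNReal.toReal_pow, ENNReal.toReal_ofReal hr.le]
      simp [mul_comm]
    rwa [hv] at hm
  · intro t ht htr
    have hsub : closedBall w t ⊆ ball w r := closedBall_subset_ball htr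
    have hc : ContinuousOn h (sphere w |t|) := by
      rw [abs_of_pos ht]
      exact hh.continuousOn.mono (sphere_subset_closedBall.trans hsub)
    have hci : CircleIntegrable (fun z => ‖h z‖ ^ 2) w t :=
      ContinuousOn.circleIntegrable' (hc.norm.pow 2)
    refine ⟨hci, ?_⟩
    have h2 : DiffContOnCl ℂ (fun z => h z ^ 2) (ball w |t|) := by
      rw [abs_of_pos ht]
      exact DifferentiableOn.diffContOnCl_ball (U := ball w r) (hh.pow 2) hsub
    have h3 := h2.circleAverage
    rw [← norm_pow, ← h3, Real.circleAverage_def, Real.circleAverage_def, norm_smul, smul_eq_mul,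
      Real.norm_of_nonneg (by positivity)]
    refine mul_le_mul_of_nonneg_left ?_ (by positivity)
    refine (intervalIntegral.norm_integral_le_integral_norm (by positivity)).trans (le_of_eq ?_)
    simp

theorem contDiff_mul_of_differentiableOn {h β : ℂ → ℂ} {W : Set ℂ} (hW : IsOpen W)
    (hh : DifferentiableOn ℂ h W) (hβ : ContDiff ℝ ∞ β) (hs : tsupport β ⊆ W) :
    ContDiff ℝ ∞ (fun z => h z * β z) := by
  rw [contDiff_iff_contDiffAt]
  intro z
  by_cases hz : z ∈ W
  · exact (((hh.contDiffOn hW).contDiffAt (hW.mem_nhds hz)).restrict_scalars ℝ).mul hβ.contDiffAt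
  · have : (fun z => h z * β z) =ᶠ[𝓝 z] fun _ => 0 := by
      filter_upwards [notMem_tsupport_iff_eventuallyEq.1 fun h => hz (hs h)] with x hx
      simp [hx]
    exact contDiffAt_const.congr_of_eventuallyEq this

theorem integral_mul_dzb_eq_zero {h β : ℂ → ℂ} {W : Set ℂ} (hW : IsOpen W)
    (hh : DifferentiableOn ℂ h W) (hβ : ContDiff ℝ ∞ β) (hβc : HasCompactSupport β)
    (hs : tsupport β ⊆ W) : ∫ z, h z * dzb β z = 0 := by
  rw [← integral_dzb_eq_zero (contDiff_mul_of_differentiableOn hW hh hβ hs) hβc.mul_left]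
  congr 1
  ext z
  by_cases hz : z ∈ W
  · have h1 := HasW.of_hasDerivAt (hh.differentiableAt (hW.mem_nhds hz)).hasDerivAt
    rw [(h1.mul (hβ.hasW z)).dzb_eq]
    ring
  · have h0 := notMem_tsupport_iff_eventuallyEq.1 fun h => hz (hs h)
    have h2 : dzb β z = 0 := by
      rw [dzb_eventuallyEq (g := fun _ => 0) h0]
      simp [dzb]
    have h3 : dzb (fun z => h z * β z) z = 0 := by
      rw [dzb_eventuallyEq (g := fun _ => 0) (by filter_upwards [h0] with x hx; simp [hx])]
      simp [dzb]
    rw [h2, h3, mul_zero]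

theorem polarSet_empty : PolarSet ∅ :=
  ⟨∅, subset_rfl, fun _ => ⊥, ⟨isOpen_empty, fun _ h => h.elim, fun _ h => h.elim,
    fun _ h => h.elim, fun _ _ hr h => (h (mem_closedBall_self hr.le)).elim⟩, fun _ h => h.elim⟩

/-- Weak removability of polar sets for square-integrable holomorphic functions. -/
theorem PolarSet.integral_indicator_mul_dzb {h γ : ℂ → ℂ} {B D : Set ℂ}
    (hB : IsOpen B) (hD : IsOpen D) (hp : PolarSet (B \ D)) (hh : DifferentiableOn ℂ h (B ∩ D))
    (hi : MemLp h 2 (volume.restrict (B ∩ D))) (hγ : ContDiff ℝ ∞ γ) (hγc : HasCompactSupport γ)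
    (hs : tsupport γ ⊆ B) : ∫ z, (B ∩ D).indicator h z * dzb γ z = 0 := by
  have hW : IsOpen (B ∩ D) := hB.inter hD
  have hK : IsCompact (tsupport γ \ D) := hγc.isCompact.diff hD
  refine PolarSet.removable hK (hp.mono (sdiff_subset_sdiff_left hs)) hγ hγc ?_ ?_
  · exact ((memLp_indicator_iff_restrict hW.measurableSet).2 hi).restrict _
  · intro β hβ hβs
    have hβW : tsupport β ⊆ B ∩ D := fun z hz => by
      have := hβs hz
      by_contra hc
      exact this.2 ⟨this.1, fun hd => hc ⟨hs this.1, hd⟩⟩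
    have hβc : HasCompactSupport β :=
      hγc.isCompact.of_isClosed_subset (isClosed_tsupport β) (hβs.trans sdiff_subset)
    rw [← integral_mul_dzb_eq_zero hW hh hβ hβc hβW]
    congr 1
    ext z
    by_cases hz : z ∈ B ∩ D
    · simp [hz]
    · rw [image_eq_zero_of_notMem_tsupport (f := dzb β)
        (fun hc => hz (hβW (tsupport_dzb_subset β hc)))]
      simp

theorem PolarSet.inter_nonempty {E D U : Set ℂ} (hp : PolarSet (E \ D)) (hU : IsOpen U)
    (hne : U.Nonempty) (hUE : U ⊆ E) : (U ∩ D).Nonempty := by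
  by_contra hc
  rw [not_nonempty_iff_eq_empty] at hc
  have h1 : U ⊆ E \ D := fun z hz => ⟨hUE hz, fun hd => by
    have : z ∈ U ∩ D := ⟨hz, hd⟩
    rw [hc] at this; exact this⟩
  exact (hU.measure_pos volume hne).ne' (measure_mono_null h1 hp.volume_eq_zero)

/-- Extension of square-integrable holomorphic functions across polar sets on boxes. -/
theorem exists_local_extension {f : ℂ × ℂ → ℂ} {D : Set ℂ} (hD : IsOpen D) {a b : ℂ} {s R : ℝ}
    (hs : 0 < s) (hb : ‖b‖ < R) (hp : PolarSet (ball a s \ D))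
    (hf : DifferentiableOn ℂ f ((ball a s ∩ D) ×ˢ ball 0 R))
    (hi : IntegrableOn (fun z => ‖f z‖ ^ 2) ((ball a s ∩ D) ×ˢ ball 0 R)) :
    ∃ s' > 0, s' ≤ s ∧ ∃ r > 0, ball b r ⊆ ball 0 R ∧ ∃ F : ℂ × ℂ → ℂ,
      DifferentiableOn ℂ F (ball a s' ×ˢ ball b r) ∧
      EqOn F f ((ball a s' ∩ D) ×ˢ ball b r) := by
  set W := ball a s ∩ D
  have hWo : IsOpen W := isOpen_ball.inter hD
  set r := (R - ‖b‖) / 3 with hr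
  have hr0 : 0 < r := by rw [hr]; linarith
  have hbr : closedBall b (2 * r) ⊆ ball 0 R := by
    intro w hw
    rw [mem_closedBall, dist_eq_norm] at hw
    rw [mem_ball_zero_iff]
    have := norm_add_le (w - b) b
    rw [sub_add_cancel] at this
    linarith
  have hbr' : ball b (2 * r) ⊆ ball 0 R := ball_subset_closedBall.trans hbr
  have hbr1 : ball b r ⊆ ball b (2 * r) := ball_subset_ball (by linarith)
  have hfv : ∀ ζ ∈ W, DifferentiableOn ℂ (fun w => f (ζ, w)) (ball 0 R) := fun ζ hζ =>
    hf.comp (by fun_prop) fun w hw => ⟨hζ, hw⟩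
  have hfh : ∀ w ∈ ball (0 : ℂ) R, DifferentiableOn ℂ (fun ζ => f (ζ, w)) W := fun w hw =>
    hf.comp (by fun_prop) fun ζ hζ => ⟨hζ, hw⟩
  set M : ℂ → ℝ := fun ζ => ∫ w in ball b (2 * r), ‖f (ζ, w)‖ ^ 2
  have hMi : IntegrableOn M W := by
    have h1 : IntegrableOn (fun z => ‖f z‖ ^ 2) (W ×ˢ ball b (2 * r)) :=
      hi.mono_set (prod_mono subset_rfl hbr')
    rw [IntegrableOn, Measure.volume_eq_prod, ← Measure.prod_restrict] at h1
    exact h1.integral_prod_left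
  set P := Real.pi * r ^ 2
  have hP0 : 0 < P := by positivity
  have hMb : ∀ ζ ∈ W, ∀ w ∈ ball b r, ‖f (ζ, w)‖ ^ 2 ≤ M ζ / P := fun ζ hζ w hw => by
    have hsub : ball w r ⊆ ball b (2 * r) := by
      apply ball_subset_ball'
      rw [mem_ball] at hw
      linarith
    have hint : IntegrableOn (fun w => ‖f (ζ, w)‖ ^ 2) (ball b (2 * r)) := by
      refine IntegrableOn.mono_set (ContinuousOn.integrableOn_compact
        (isCompact_closedBall b (2 * r)) ?_) ball_subset_closedBall
      exact ((hfv ζ hζ).continuousOn.mono hbr).norm.pow 2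
    rw [le_div_iff₀ hP0]
    refine (sq_norm_mul_area_le hr0 ((hfv ζ hζ).mono (hsub.trans hbr'))
      (hint.mono_set hsub)).trans ?_
    exact setIntegral_mono_set hint (.of_forall fun _ => by positivity) hsub.eventuallyLE
  have hWfin : IntegrableOn (fun _ : ℂ => (1 : ℝ)) W :=
    integrableOn_const ((measure_mono inter_subset_left).trans_lt measure_ball_lt_top).ne
  obtain ⟨χ₀, hχ₀, hχ₀c, hχ₀s, -, -, O, hO, hOK, hχO⟩ := exists_cutoff
    (isCompact_closedBall a (s / 2)) isOpen_ball (closedBall_subset_ball (half_lt_self hs))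
  set χ : ℂ → ℂ := fun z => (χ₀ z : ℂ) with hχd
  have hχ : ContDiff ℝ ∞ χ := hχ₀.ofReal_comp
  have hχc : HasCompactSupport χ := hχ₀c.comp_left (g := Complex.ofReal) (by simp)
  have hχs : tsupport χ ⊆ ball a s :=
    (closure_mono (Function.support_comp_subset Complex.ofReal_zero χ₀)).trans hχ₀s
  obtain ⟨C, hC⟩ := hχc.dzb_compact.exists_bound_of_continuous hχ.dzb_smooth.continuous
  have hdz : ∀ ζ ∈ closedBall a (s / 2), dzb χ ζ = 0 := fun ζ hζ => by
    rw [dzb_eventuallyEq (g := fun _ => 1)]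
    · simp [dzb]
    · filter_upwards [hO.mem_nhds (hOK hζ)] with x hx
      simp [hχd, hχO x hx]
  set F : ℂ × ℂ → ℂ := fun p =>
    cauchyT (fun ζ => W.indicator (fun ζ => f (ζ, p.2)) ζ * dzb χ ζ) p.1 with hF
  have hFd : DifferentiableOn ℂ F (ball a (s / 4) ×ˢ ball b r) := by
    refine DifferentiableOn.const_mul (differentiableOn_integral_param (μ := volume)
      (isOpen_ball.prod isOpen_ball)
      (F := fun p ζ => W.indicator (fun ζ => f (ζ, p.2)) ζ * dzb χ ζ * (p.1 - ζ)⁻¹)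
      (H := W.indicator fun ζ => (1 + M ζ / P) * C * (s / 4)⁻¹) ?_ ?_ ?_ ?_) _
    · intro ζ
      by_cases hζ : ζ ∈ W
      · by_cases hζ2 : ζ ∈ closedBall a (s / 2)
        · simp only [hdz ζ hζ2, mul_zero, zero_mul]
          exact differentiableOn_const _
        · simp only [indicator_of_mem hζ]
          refine DifferentiableOn.mul (DifferentiableOn.mul_const ?_ _) ?_
          · exact hf.comp (by fun_prop) fun p hp => ⟨hζ, hbr' (hbr1 hp.2)⟩
          · refine DifferentiableOn.inv (by fun_prop) ?_
            intro p hp h0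
            apply hζ2
            rw [← sub_eq_zero.1 h0]
            exact ball_subset_closedBall (ball_subset_ball (by linarith) hp.1)
      · simp only [indicator_of_notMem hζ, zero_mul]
        exact differentiableOn_const _
    · intro p hp
      refine (AEStronglyMeasurable.mul ?_ hχ.dzb_smooth.continuous.aestronglyMeasurable).mul
        (Measurable.aestronglyMeasurable (by fun_prop))
      rw [aestronglyMeasurable_indicator_iff hWo.measurableSet]
      exact (hfh p.2 (hbr' (hbr1 hp.2))).continuousOn.aestronglyMeasurable hWo.measurableSet
    · rw [integrable_indicator_iff hWo.measurableSet]
      exact ((hWfin.add (hMi.div_const P)).mul_const C).mul_const _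
    · intro ζ p hp
      by_cases hζ : ζ ∈ W
      · by_cases hζ2 : ζ ∈ closedBall a (s / 2)
        · rw [hdz ζ hζ2, mul_zero, zero_mul, norm_zero, indicator_of_mem hζ]
          have h1 : 0 ≤ M ζ := by positivity
          have h2 : 0 ≤ C := (norm_nonneg _).trans (hC 0)
          positivity
        · rw [indicator_of_mem hζ, indicator_of_mem hζ, norm_mul, norm_mul, norm_inv]
          have h1 := hMb ζ hζ p.2 hp.2
          have h2 : s / 4 ≤ ‖p.1 - ζ‖ := by
            rw [mem_closedBall, not_le] at hζ2
            have h3 := mem_ball.1 hp.1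
            have := dist_triangle ζ p.1 a
            rw [← dist_eq_norm, dist_comm]
            linarith
          have h3 : ‖f (ζ, p.2)‖ ≤ 1 + M ζ / P := by
            nlinarith [sq_nonneg (‖f (ζ, p.2)‖ - 1)]
          have h4 : ‖p.1 - ζ‖⁻¹ ≤ (s / 4)⁻¹ := inv_anti₀ (by positivity) h2
          have h5 : 0 ≤ 1 + M ζ / P := (norm_nonneg _).trans h3
          have h6 : 0 ≤ C := (norm_nonneg _).trans (hC 0)
          exact mul_le_mul (mul_le_mul h3 (hC ζ) (norm_nonneg _) h5) h4 (by positivity)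
            (by positivity)
      · simp [indicator_of_notMem hζ]
  refine ⟨s / 4, by positivity, by linarith, r, hr0, hbr1.trans hbr', F, hFd, ?_⟩
  rintro ⟨z, w⟩ ⟨hz, hw⟩
  have hwR := hbr' (hbr1 hw)
  have hsq : IntegrableOn (fun ζ => ‖f (ζ, w)‖ ^ 2) W := by
    refine Integrable.mono' (hMi.div_const P) ?_ ?_
    · exact (((hfh w hwR).continuousOn.norm).pow 2).aestronglyMeasurable hWo.measurableSet
    · rw [ae_restrict_iff' hWo.measurableSet]
      refine .of_forall fun ζ hζ => ?_
      rw [Real.norm_of_nonneg (by positivity)]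
      exact hMb ζ hζ w hw
  have hmem : MemLp (fun ζ => f (ζ, w)) 2 (volume.restrict W) := by
    rw [memLp_two_iff_integrable_sq_norm
      ((hfh w hwR).continuousOn.aestronglyMeasurable hWo.measurableSet)]
    exact hsq
  have hmem' := (memLp_indicator_iff_restrict (f := fun ζ => f (ζ, w)) hWo.measurableSet).2 hmem
  have hweyl := weyl (f := W.indicator fun ζ => f (ζ, w)) (χ := χ) (D := ball a s) ?_ ?_ hχ hχc hχs
  · have hO1 : IsOpen (ball a (s / 4) ∩ D) := isOpen_ball.inter hD
    have hsubW : ball a (s / 4) ∩ D ⊆ W := inter_subset_inter_left _ (ball_subset_ball (by linarith))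
    have hae : (fun z => F (z, w)) =ᵐ[volume.restrict (ball a (s / 4) ∩ D)] fun z => f (z, w) := by
      filter_upwards [ae_restrict_of_ae hweyl.2, ae_restrict_mem hO1.measurableSet] with ζ h1 h2
      rw [hF]
      simp only
      rw [← h1, indicator_of_mem (hsubW h2), hχd]
      simp only
      rw [hχO ζ (hOK (ball_subset_closedBall (ball_subset_ball (by linarith) h2.1)))]
      simp
    refine Measure.eqOn_open_of_ae_eq hae hO1 ?_ ((hfh w hwR).continuousOn.mono hsubW) hz
    exact (hFd.comp (f := fun z => (z, w)) (by fun_prop)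
      fun ζ hζ => ⟨hζ.1, hw⟩).continuousOn
  · intro K _ hK
    have : IsFiniteMeasure (volume.restrict K) := isFiniteMeasure_restrict.2 hK.measure_lt_top.ne
    exact (hmem'.restrict K).integrable (by norm_num)
  · intro γ hγ hγc hγs
    exact PolarSet.integral_indicator_mul_dzb isOpen_ball hD hp (hfh w hwR) hmem hγ hγc hγs

theorem elog_lt_coe_iff {x c : ℝ} : elog x < (c : EReal) ↔ x < Real.exp c := by
  unfold elog
  split_ifs with h
  · exact ⟨fun _ => h.trans_lt (Real.exp_pos c), fun _ => EReal.bot_lt_coe c⟩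
  · rw [EReal.coe_lt_coe_iff, Real.log_lt_iff_lt_exp (not_le.1 h)]

theorem exists_of_elog_lt_neg {x : ℝ} {t : EReal} (h : elog x < -t) :
    ∃ c : ℝ, x < Real.exp (-c) ∧ t < c := by
  obtain ⟨c, h1, h2⟩ := EReal.lt_iff_exists_real_btwn.1 (EReal.lt_neg_comm.1 h)
  refine ⟨c, ?_, h1⟩
  rw [← elog_lt_coe_iff, EReal.coe_neg]
  exact EReal.lt_neg_comm.1 h2

theorem elog_lt_neg_of_le {x c : ℝ} {t : EReal} (hx : x < Real.exp (-c)) (ht : t ≤ c) :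
    elog x < -t := by
  refine (elog_lt_coe_iff.2 hx).trans_le ?_
  rw [EReal.coe_neg]
  exact EReal.neg_le_neg_iff.2 ht

theorem elog_norm_lt_neg_coe_iff {x c : ℝ} : elog x < -(c : EReal) ↔ x < Real.exp (-c) := by
  rw [← EReal.coe_neg, elog_lt_coe_iff]

/-- Each point of the hull has a box around it on which `ρ` is bounded above. -/
theorem exists_local_box {D : Set ℂ} (hD : IsOpen D) {ρ : ℂ → EReal}
    (hρ : UpperSemicontinuousOn ρ D) {p : ℂ × ℂ} (hp : p ∈ hartogs (DHat D ρ) (rhoHat D ρ)) :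
    ∃ s > 0, ∃ c : ℝ, ‖p.2‖ < Real.exp (-c) ∧ PolarSet (ball p.1 s \ D) ∧
      ∀ z ∈ ball p.1 s ∩ D, ρ z < c := by
  obtain ⟨h1, h2⟩ := hp
  obtain ⟨c, hc, hc'⟩ := exists_of_elog_lt_neg h2
  unfold rhoHat at hc'
  split_ifs at hc' with ha
  · have h3 := hρ p.1 ha c hc'
    rw [hD.nhdsWithin_eq ha] at h3
    obtain ⟨s, hs, hs'⟩ := eventually_nhds_iff_ball.1 (h3.and (hD.mem_nhds ha))
    refine ⟨s, hs, c, hc, ?_, fun z hz => (hs' z hz.1).1⟩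
    rw [sdiff_eq_bot_iff.2 (fun z hz => (hs' z hz).2)]
    exact polarSet_empty
  · rcases h1 with h1 | ⟨⟨-, U, hU, haU, hUp⟩, -⟩
    · exact (ha h1).elim
    · have h3 := eventually_lt_of_limsup_lt hc'
      rw [eventually_nhdsWithin_iff] at h3
      obtain ⟨s, hs, hs'⟩ := eventually_nhds_iff_ball.1 (h3.and (hU.mem_nhds haU))
      exact ⟨s, hs, c, hc, hUp.mono (sdiff_subset_sdiff_left fun z hz => (hs' z hz).2),
        fun z hz => (hs' z hz.1).1 hz.2⟩

theorem box_subset_hartogs {D W : Set ℂ} {ρ : ℂ → EReal} {c : ℝ} (hW : W ⊆ D)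
    (h : ∀ z ∈ W, ρ z ≤ c) : W ×ˢ ball 0 (Real.exp (-c)) ⊆ hartogs D ρ := by
  rintro ⟨z, w⟩ ⟨hz, hw⟩
  exact ⟨hW hz, elog_lt_neg_of_le (mem_ball_zero_iff.1 hw) (h z hz)⟩

theorem mem_closure_of_polar {D U : Set ℂ} (hU : IsOpen U) (hp : PolarSet (U \ D)) {z : ℂ}
    (hz : z ∈ U) : z ∈ closure D := by
  rw [_root_.mem_closure_iff]
  intro V hV hzV
  obtain ⟨x, hx, hxD⟩ := hp.inter_nonempty (hV.inter hU) ⟨z, hzV, hz⟩ inter_subset_right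
  exact ⟨x, hx.1, hxD⟩

theorem rhoHat_le_of_box {D U : Set ℂ} (hD : IsOpen D) {ρ : ℂ → EReal} {c : ℝ} (hU : IsOpen U)
    (hp : PolarSet (U \ D)) (h : ∀ z ∈ U ∩ D, ρ z ≤ c) {z : ℂ} (hz : z ∈ U) :
    z ∈ DHat D ρ ∧ rhoHat D ρ z ≤ c := by
  by_cases hzD : z ∈ D
  · refine ⟨Or.inl hzD, ?_⟩
    rw [rhoHat, if_pos hzD]
    exact h z ⟨hz, hzD⟩
  · have hcl := mem_closure_of_polar hU hp hz
    have : (𝓝[D] z).NeBot := mem_closure_iff_nhdsWithin_neBot.1 hcl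
    have h1 : limsup ρ (𝓝[D] z) ≤ c := by
      refine limsup_le_of_le (by isBoundedDefault) ?_
      rw [eventually_nhdsWithin_iff]
      filter_upwards [hU.mem_nhds hz] with x hx hxD using h x ⟨hx, hxD⟩
    refine ⟨Or.inr ⟨⟨?_, U, hU, hz, hp⟩, h1.trans_lt (EReal.coe_lt_top c)⟩, ?_⟩
    · rw [hD.frontier_eq]
      exact ⟨hcl, hzD⟩
    · rw [rhoHat, if_neg hzD]
      exact h1

theorem box_subset_hull {D U : Set ℂ} (hD : IsOpen D) {ρ : ℂ → EReal} {c : ℝ} (hU : IsOpen U)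
    (hp : PolarSet (U \ D)) (h : ∀ z ∈ U ∩ D, ρ z ≤ c) :
    U ×ˢ ball 0 (Real.exp (-c)) ⊆ hartogs (DHat D ρ) (rhoHat D ρ) :=
  box_subset_hartogs (D := DHat D ρ) (fun _ hz => (rhoHat_le_of_box hD hU hp h hz).1)
    fun _ hz => (rhoHat_le_of_box hD hU hp h hz).2

theorem hartogs_subset_hull (D : Set ℂ) (ρ : ℂ → EReal) :
    hartogs D ρ ⊆ hartogs (DHat D ρ) (rhoHat D ρ) := by
  rintro p ⟨h1, h2⟩
  refine ⟨Or.inl h1, ?_⟩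
  rwa [rhoHat, if_pos h1]

theorem hull_inter (D : Set ℂ) (ρ : ℂ → EReal) {p : ℂ × ℂ}
    (hp : p ∈ hartogs (DHat D ρ) (rhoHat D ρ)) (hpD : p.1 ∈ D) : p ∈ hartogs D ρ := by
  refine ⟨hpD, ?_⟩
  have := hp.2
  rwa [rhoHat, if_pos hpD] at this

theorem isOpen_hull {D : Set ℂ} (hD : IsOpen D) {ρ : ℂ → EReal} (hρ : UpperSemicontinuousOn ρ D) :
    IsOpen (hartogs (DHat D ρ) (rhoHat D ρ)) := by
  rw [isOpen_iff_mem_nhds]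
  intro p hp
  obtain ⟨s, hs, c, hc, hpo, hbd⟩ := exists_local_box hD hρ hp
  refine mem_of_superset ((isOpen_ball.prod isOpen_ball).mem_nhds
    (⟨mem_ball_self hs, mem_ball_zero_iff.2 hc⟩ : p ∈ ball p.1 s ×ˢ ball 0 (Real.exp (-c)))) ?_
  exact box_subset_hull hD isOpen_ball hpo fun z hz => (hbd z hz).le

theorem isOpen_hartogs {D : Set ℂ} (hD : IsOpen D) {ρ : ℂ → EReal}
    (hρ : UpperSemicontinuousOn ρ D) : IsOpen (hartogs D ρ) := by
  have : hartogs D ρ = hartogs (DHat D ρ) (rhoHat D ρ) ∩ Prod.fst ⁻¹' D := by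
    ext p
    exact ⟨fun h => ⟨hartogs_subset_hull D ρ h, h.1⟩, fun h => hull_inter D ρ h.1 h.2⟩
  rw [this]
  exact (isOpen_hull hD hρ).inter (hD.preimage continuous_fst)

/-- Every square-integrable holomorphic function extends to the hull. -/
theorem exists_extension_hull {D : Set ℂ} (hD : IsOpen D) {ρ : ℂ → EReal}
    (hρ : UpperSemicontinuousOn ρ D) {f : ℂ × ℂ → ℂ} (hf : f ∈ L2h (hartogs D ρ)) :
    ∃ F : ℂ × ℂ → ℂ, DifferentiableOn ℂ F (hartogs (DHat D ρ) (rhoHat D ρ)) ∧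
      EqOn F f (hartogs D ρ) := by
  have key : ∀ p ∈ hartogs (DHat D ρ) (rhoHat D ρ), ∃ Q : Set (ℂ × ℂ), IsOpen Q ∧ p ∈ Q ∧
      Q ⊆ closure (hartogs D ρ) ∧ ∃ F₀ : ℂ × ℂ → ℂ, DifferentiableOn ℂ F₀ Q ∧
        EqOn F₀ f (Q ∩ hartogs D ρ) := by
    intro p hp
    obtain ⟨s, hs, c, hc, hpo, hbd⟩ := exists_local_box hD hρ hp
    have hbox : (ball p.1 s ∩ D) ×ˢ ball 0 (Real.exp (-c)) ⊆ hartogs D ρ :=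
      box_subset_hartogs inter_subset_right fun z hz => (hbd z hz).le
    obtain ⟨s', hs', hss', r, hr, hrR, F₀, hF₀, hEq⟩ :=
      exists_local_extension hD hs hc hpo (hf.1.mono hbox) (hf.2.mono_set hbox)
    refine ⟨ball p.1 s' ×ˢ ball p.2 r, isOpen_ball.prod isOpen_ball,
      ⟨mem_ball_self hs', mem_ball_self hr⟩, ?_, F₀, hF₀, ?_⟩
    · have hsub : (ball p.1 s ∩ D) ×ˢ ball p.2 r ⊆ hartogs D ρ :=
        (prod_mono subset_rfl hrR).trans hbox
      refine subset_trans ?_ (closure_mono hsub)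
      rw [closure_prod_eq]
      rintro ⟨z, w⟩ ⟨hz, hw⟩
      refine ⟨?_, subset_closure hw⟩
      have hz' := ball_subset_ball hss' hz
      exact mem_closure_of_polar isOpen_ball (by rwa [sdiff_self_inter]) hz'
    · rintro ⟨z, w⟩ ⟨⟨hz, hw⟩, hG⟩
      exact hEq ⟨⟨hz, hG.1⟩, hw⟩
  have hlim : ∀ (p : ℂ × ℂ) (Q : Set (ℂ × ℂ)), IsOpen Q → Q ⊆ closure (hartogs D ρ) →
      ∀ F₀ : ℂ × ℂ → ℂ, DifferentiableOn ℂ F₀ Q → EqOn F₀ f (Q ∩ hartogs D ρ) → p ∈ Q →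
        limUnder (𝓝[hartogs D ρ] p) f = F₀ p := by
    intro p Q hQ hQG F₀ hF₀ hEq hpQ
    have : (𝓝[hartogs D ρ] p).NeBot := mem_closure_iff_nhdsWithin_neBot.1 (hQG hpQ)
    refine Tendsto.limUnder_eq ?_
    have h1 : Tendsto F₀ (𝓝[hartogs D ρ] p) (𝓝 (F₀ p)) :=
      ((hF₀.differentiableAt (hQ.mem_nhds hpQ)).continuousAt).tendsto.mono_left
        nhdsWithin_le_nhds
    refine h1.congr' ?_
    filter_upwards [mem_nhdsWithin_of_mem_nhds (hQ.mem_nhds hpQ), self_mem_nhdsWithin]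
      with x hx1 hx2 using hEq ⟨hx1, hx2⟩
  refine ⟨fun p => limUnder (𝓝[hartogs D ρ] p) f, ?_, ?_⟩
  · intro p hp
    obtain ⟨Q, hQ, hpQ, hQG, F₀, hF₀, hEq⟩ := key p hp
    refine DifferentiableAt.differentiableWithinAt ?_
    refine (hF₀.differentiableAt (hQ.mem_nhds hpQ)).congr_of_eventuallyEq ?_
    filter_upwards [hQ.mem_nhds hpQ] with x hx using hlim x Q hQ hQG F₀ hF₀ hEq hx
  · intro p hp
    obtain ⟨Q, hQ, hpQ, hQG, F₀, hF₀, hEq⟩ := key p (hartogs_subset_hull D ρ hp)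
    exact (hlim p Q hQ hQG F₀ hF₀ hEq hpQ).trans (hEq ⟨hpQ, hp⟩)

/-- The nonnegative extended number `log⁺ (1/x)`. -/
noncomputable def negLog (x : ℝ) : ENNReal := (-ENNReal.log (ENNReal.ofReal x)).toENNReal

theorem continuous_negLog : Continuous negLog :=
  EReal.continuous_toENNReal.comp (continuous_neg.comp
    (ENNReal.continuous_log.comp ENNReal.continuous_ofReal))

theorem negLog_zero : negLog 0 = ⊤ := by simp [negLog]

theorem negLog_of_pos {x : ℝ} (hx : 0 < x) : negLog x = ENNReal.ofReal (-Real.log x) := by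
  rw [negLog, ENNReal.log_ofReal_of_pos hx, ← EReal.coe_neg, EReal.toENNReal_of_ne_top (by simp)]
  simp

theorem negLog_div_mul {x S T : ℝ} (hx : 0 ≤ x) (hS : 0 < S) (hT : 1 ≤ T) (hxS : x ≤ S) :
    negLog (x / (S * T)) = negLog (x / S) + ENNReal.ofReal (Real.log T) := by
  rcases hx.eq_or_lt with rfl | h
  · simp [negLog_zero]
  · have hT0 : 0 < T := by linarith
    rw [negLog_of_pos (by positivity), negLog_of_pos (by positivity),
      ← ENNReal.ofReal_add _ (Real.log_nonneg hT)]
    · rw [Real.log_div h.ne' (by positivity), Real.log_mul hS.ne' hT0.ne',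
        Real.log_div h.ne' hS.ne']
      congr 1
      ring
    · rw [neg_nonneg]
      exact Real.log_nonpos (by positivity) ((div_le_one hS).2 hxS)

theorem lintegral_negLog_le {c ζ : ℂ} {r T : ℝ} (hr : 0 < r) (hT : 0 < T)
    (h : ∀ θ : ℝ, ‖c + r * Complex.exp (θ * Complex.I) - ζ‖ ≤ T) {L : ℝ}
    (hL : L ≤ Real.circleAverage (fun z => Real.log ‖z - ζ‖) c r) :
    ∫⁻ θ in Ioc 0 (2 * Real.pi), negLog (‖c + r * Complex.exp (θ * Complex.I) - ζ‖ / T) ≤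
      ENNReal.ofReal (2 * Real.pi) * ENNReal.ofReal (Real.log T - L) := by
  have hci : CircleIntegrable (fun z => Real.log ‖z - ζ‖) c r :=
    circleIntegrable_log_norm_sub_const r
  have hint : IntegrableOn (fun θ : ℝ => Real.log ‖c + r * Complex.exp (θ * Complex.I) - ζ‖)
      (Ioc 0 (2 * Real.pi)) :=
    (intervalIntegrable_iff_integrableOn_Ioc_of_le Real.two_pi_pos.le).1 hci
  have hne : ∀ᵐ θ : ℝ ∂volume.restrict (Ioc 0 (2 * Real.pi)),
      c + r * Complex.exp (θ * Complex.I) - ζ ≠ 0 := by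
    refine ae_restrict_of_ae ?_
    have h1 : (circleMap c r ⁻¹' {ζ}).Countable :=
      (countable_singleton ζ).preimage_circleMap c hr.ne'
    filter_upwards [h1.ae_notMem volume] with θ hθ h0
    exact hθ (sub_eq_zero.1 h0)
  have h2 : ∫⁻ θ in Ioc 0 (2 * Real.pi), negLog (‖c + r * Complex.exp (θ * Complex.I) - ζ‖ / T) =
      ∫⁻ θ in Ioc 0 (2 * Real.pi), ENNReal.ofReal
        (Real.log T - Real.log ‖c + r * Complex.exp (θ * Complex.I) - ζ‖) := by
    refine lintegral_congr_ae ?_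
    filter_upwards [hne] with θ hθ
    have h3 : 0 < ‖c + r * Complex.exp (θ * Complex.I) - ζ‖ := norm_pos_iff.2 hθ
    rw [negLog_of_pos (by positivity), Real.log_div h3.ne' hT.ne']
    congr 1
    ring
  have hcst : IntegrableOn (fun _ : ℝ => Real.log T) (Ioc 0 (2 * Real.pi)) :=
    integrableOn_const measure_Ioc_lt_top.ne
  rw [h2, ← ofReal_integral_eq_lintegral_ofReal (f := fun θ : ℝ =>
    Real.log T - Real.log ‖c + r * Complex.exp (θ * Complex.I) - ζ‖) (hcst.sub hint),
    ← ENNReal.ofReal_mul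
    Real.two_pi_pos.le]
  · apply ENNReal.ofReal_le_ofReal
    rw [integral_sub hcst hint]
    rw [Real.circleAverage_def, intervalIntegral.integral_of_le Real.two_pi_pos.le, smul_eq_mul]
      at hL
    simp only [circleMap] at hL
    rw [← div_eq_inv_mul, le_div_iff₀ Real.two_pi_pos] at hL
    simp only [integral_const, MeasurableSet.univ, measureReal_restrict_apply, univ_inter,
      Real.volume_real_Ioc, smul_eq_mul]
    rw [max_eq_left (by linarith [Real.two_pi_pos])]
    nlinarith
  · filter_upwards [hne] with θ hθ
    exact sub_nonneg.2 (Real.log_le_log (norm_pos_iff.2 hθ) (h θ))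

theorem log_le_circleAverage {c ζ : ℂ} {r : ℝ} (hr : 0 < r) (h : c ≠ ζ) :
    Real.log ‖c - ζ‖ ≤ Real.circleAverage (fun z => Real.log ‖z - ζ‖) c r := by
  rw [circleAverage_log_norm_sub_const_eq_log_radius_add_posLog hr.ne']
  have h0 : 0 < ‖c - ζ‖ := norm_pos_iff.2 (sub_ne_zero.2 h)
  have : Real.log (r⁻¹ * ‖c - ζ‖) ≤ Real.posLog (r⁻¹ * ‖c - ζ‖) := le_max_right _ _
  rw [Real.log_mul (by positivity) h0.ne', Real.log_inv] at this
  linarith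

theorem ofReal_integral_le_lintegral {α : Type*} [MeasurableSpace α] {μ : Measure α} {f : α → ℝ}
    (hf : Integrable f μ) : ENNReal.ofReal (∫ x, f x ∂μ) ≤ ∫⁻ x, ENNReal.ofReal (f x) ∂μ := by
  have h1 := ofReal_integral_eq_lintegral_ofReal hf.pos_part (.of_forall fun _ => le_max_right _ _)
  have h2 : ∀ x, ENNReal.ofReal (max (f x) 0) = ENNReal.ofReal (f x) := fun x => by
    rw [ENNReal.ofReal_max, ENNReal.ofReal_zero, max_eq_left zero_le]
  simp only [h2] at h1
  rw [← h1]
  exact ENNReal.ofReal_le_ofReal (integral_mono hf hf.pos_part fun x => le_max_left _ _)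

/-- A logarithmic potential of a countable discrete measure. -/
theorem subharmonicOn_potential {ι : Type*} [Countable ι] {w T : ι → ℝ} {ζ : ι → ℂ}
    (hw : ∀ i, 0 ≤ w i) (hT : ∀ i, 1 ≤ T i) (hζ : ∀ i, ‖ζ i‖ ≤ T i - 1) (hws : Summable w)
    (hwT : Summable fun i => w i * Real.log (T i)) :
    SubharmonicOn (fun z => (((∑' i, w i) * Real.log (1 + ‖z‖) + ∑' i, w i * Real.log (T i) : ℝ) :
      EReal) + -((∑' i, ENNReal.ofReal (w i) * negLog (‖z - ζ i‖ / ((1 + ‖z‖) * T i)) : ENNReal) :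
        EReal)) univ := by
  set S₀ := ∑' i, w i with hS₀
  set S₁ := ∑' i, w i * Real.log (T i)
  have hS₀0 : 0 ≤ S₀ := tsum_nonneg hw
  set G : ℂ → ENNReal := fun z =>
    ∑' i, ENNReal.ofReal (w i) * negLog (‖z - ζ i‖ / ((1 + ‖z‖) * T i)) with hG
  have hT0 : ∀ i, 0 < T i := fun i => zero_lt_one.trans_le (hT i)
  have hle : ∀ i z, ‖z - ζ i‖ ≤ (1 + ‖z‖) * T i := fun i z => by
    have := norm_sub_le z (ζ i)
    nlinarith [hζ i, hT i, norm_nonneg z]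
  have hren : ∀ R z, ‖z‖ ≤ R →
      ∑' i, ENNReal.ofReal (w i) * negLog (‖z - ζ i‖ / ((1 + R) * T i)) =
        G z + ENNReal.ofReal (S₀ * (Real.log (1 + R) - Real.log (1 + ‖z‖))) := by
    intro R z hz
    have h1 : 0 < 1 + ‖z‖ := by positivity
    have h2 : 1 ≤ (1 + R) / (1 + ‖z‖) := (one_le_div h1).2 (by linarith)
    have h3 : Real.log ((1 + R) / (1 + ‖z‖)) = Real.log (1 + R) - Real.log (1 + ‖z‖) :=
      Real.log_div (by linarith) h1.ne'
    rw [ENNReal.ofReal_mul hS₀0, hS₀, ENNReal.ofReal_tsum_of_nonneg hw hws, ← ENNReal.tsum_mul_right,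
      hG, ← ENNReal.tsum_add]
    refine tsum_congr fun i => ?_
    rw [← h3, ← mul_add, ← negLog_div_mul (norm_nonneg _) (mul_pos h1 (hT0 i)) h2 (hle i z)]
    congr 3
    field_simp
  have hGm : ∀ T' : ι → ℝ, ∀ c : ℂ, ∀ r : ℝ, ∀ i, Measurable fun θ : ℝ => ENNReal.ofReal (w i) *
      negLog (‖c + r * Complex.exp (θ * Complex.I) - ζ i‖ / T' i) := by
    intro T' c r i
    exact (continuous_negLog.measurable.comp (by fun_prop)).const_mul _
  have hcont : ∀ i, Continuous fun z : ℂ =>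
      ENNReal.ofReal (w i) * negLog (‖z - ζ i‖ / ((1 + ‖z‖) * T i)) := by
    intro i
    refine (ENNReal.continuous_const_mul ENNReal.ofReal_ne_top).comp (continuous_negLog.comp ?_)
    refine Continuous.div (by fun_prop) (by fun_prop) fun z => ?_
    have := hT0 i
    positivity
  have hGl : LowerSemicontinuous G := lowerSemicontinuous_tsum fun i => (hcont i).lowerSemicontinuous
  refine ⟨isOpen_univ, ?_, ?_, ?_, ?_⟩
  · rw [upperSemicontinuousOn_univ_iff]
    refine UpperSemicontinuous.add' (Continuous.upperSemicontinuous ?_) ?_ ?_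
    · refine continuous_coe_real_ereal.comp (.add (.mul continuous_const ?_) continuous_const)
      exact Continuous.log (by fun_prop) fun z => by positivity
    · have h1 : LowerSemicontinuous fun z => ((G z : ENNReal) : EReal) :=
        continuous_coe_ennreal_ereal.comp_lowerSemicontinuous hGl
          fun _ _ h => EReal.coe_ennreal_le_coe_ennreal_iff.2 h
      exact continuous_neg.comp_lowerSemicontinuous_antitone h1
        fun _ _ h => EReal.neg_le_neg_iff.2 h
    · intro z
      exact EReal.continuousAt_add (Or.inl (EReal.coe_ne_top _)) (Or.inl (EReal.coe_ne_bot _))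
  · intro z _
    refine (EReal.add_lt_top (EReal.coe_ne_top _) ?_).ne
    rw [Ne, EReal.neg_eq_top_iff]
    exact EReal.coe_ennreal_ne_bot _
  · intro z _
    rw [(isPreconnected_univ (α := ℂ)).connectedComponentIn (mem_univ z)]
    have h1 : ∫⁻ θ in Ioc (0 : ℝ) (2 * Real.pi), ∑' i, ENNReal.ofReal (w i) *
        negLog (‖0 + (1 : ℝ) * Complex.exp (θ * Complex.I) - ζ i‖ / (2 * T i)) ≠ ⊤ := by
      rw [lintegral_tsum fun i => (hGm (fun i => 2 * T i) 0 1 i).aemeasurable]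
      refine ne_top_of_le_ne_top (b := ENNReal.ofReal (2 * Real.pi) *
        ∑' i, ENNReal.ofReal (w i * Real.log 2 + w i * Real.log (T i))) ?_ ?_
      · refine ENNReal.mul_ne_top ENNReal.ofReal_ne_top ?_
        refine Summable.tsum_ofReal_ne_top ?_
        exact (hws.mul_right _).add hwT
      · rw [← ENNReal.tsum_mul_left]
        refine ENNReal.tsum_le_tsum fun i => ?_
        have hT0 := hT0 i
        rw [lintegral_const_mul' _ _ ENNReal.ofReal_ne_top]
        have h2 := lintegral_negLog_le (c := 0) (ζ := ζ i) (r := 1) (T := 2 * T i) (L := 0)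
          one_pos (by positivity) ?_ ?_
        · refine (mul_le_mul_right h2 _).trans (le_of_eq ?_)
          rw [mul_left_comm, ← ENNReal.ofReal_mul (hw i), sub_zero, Real.log_mul two_ne_zero hT0.ne',
            mul_add]
        · intro θ
          refine (hle i _).trans (le_of_eq ?_)
          rw [zero_add, Complex.ofReal_one, one_mul, Complex.norm_exp_ofReal_mul_I]
          norm_num
        · rw [circleAverage_log_norm_sub_const_eq_posLog]
          exact Real.posLog_nonneg
    have h3 := ae_lt_top' (.tsum fun i => (hGm (fun i => 2 * T i) 0 1 i).aemeasurable) h1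
    have h4 : (volume.restrict (Ioc (0 : ℝ) (2 * Real.pi))) ≠ 0 := by
      rw [Ne, Measure.restrict_eq_zero, Real.volume_Ioc, ENNReal.ofReal_eq_zero, not_le, sub_zero]
      exact Real.two_pi_pos
    have : (ae (volume.restrict (Ioc (0 : ℝ) (2 * Real.pi)))).NeBot := ae_neBot.2 h4
    obtain ⟨θ, hθ⟩ := h3.exists
    refine ⟨0 + (1 : ℝ) * Complex.exp (θ * Complex.I), mem_univ _, ?_⟩
    rw [Ne, EReal.add_eq_bot_iff, not_or]
    refine ⟨EReal.coe_ne_bot _, ?_⟩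
    rw [EReal.neg_eq_bot_iff, EReal.coe_ennreal_eq_top_iff]
    refine ne_top_of_le_ne_top hθ.ne (le_of_eq ?_)
    simp only [zero_add, Complex.ofReal_one, one_mul, Complex.norm_exp_ofReal_mul_I]
    norm_num
  · intro c r hr _ φ hφ hle'
    by_cases hGc : G c = ⊤
    · change _ + -((G c : ENNReal) : EReal) ≤ _
      rw [hGc]
      simp
    set R := ‖c‖ + r
    have hcR : ‖c‖ ≤ R := by linarith
    have hzR : ∀ θ : ℝ, ‖c + r * Complex.exp (θ * Complex.I)‖ ≤ R := fun θ => by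
      refine (norm_add_le _ _).trans ?_
      rw [norm_mul, Complex.norm_exp_ofReal_mul_I, Complex.norm_real, Real.norm_of_nonneg hr.le,
        mul_one]
    set a := S₀ * Real.log (1 + R) + S₁ with ha
    have h1 : ∀ θ : ℝ, ENNReal.ofReal (a - φ θ) ≤ ∑' i, ENNReal.ofReal (w i) *
        negLog (‖c + r * Complex.exp (θ * Complex.I) - ζ i‖ / ((1 + R) * T i)) := by
      intro θ
      rw [hren R _ (hzR θ)]
      have h2 := hle' θ
      set z := c + r * Complex.exp (θ * Complex.I) with hz
      by_cases hGz : G z = ⊤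
      · simp [hGz]
      · have h3 : G z = ENNReal.ofReal (G z).toReal := (ENNReal.ofReal_toReal hGz).symm
        have hl : Real.log (1 + ‖z‖) ≤ Real.log (1 + R) :=
          Real.log_le_log (by positivity) (by linarith [hzR θ])
        rw [h3, ← ENNReal.ofReal_add ENNReal.toReal_nonneg (mul_nonneg hS₀0 (sub_nonneg.2 hl))]
        apply ENNReal.ofReal_le_ofReal
        change _ + -((G z : ENNReal) : EReal) ≤ _ at h2
        rw [h3, EReal.coe_ennreal_ofReal, max_eq_left ENNReal.toReal_nonneg, ← EReal.coe_neg,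
          ← EReal.coe_add, EReal.coe_le_coe_iff] at h2
        rw [ha]
        linarith
    have h2 : ∫⁻ θ in Ioc (0 : ℝ) (2 * Real.pi), ENNReal.ofReal (a - φ θ) ≤
        ENNReal.ofReal (2 * Real.pi) *
          (G c + ENNReal.ofReal (S₀ * (Real.log (1 + R) - Real.log (1 + ‖c‖)))) := by
      refine (lintegral_mono h1).trans ?_
      rw [lintegral_tsum fun i => (hGm (fun i => (1 + R) * T i) c r i).aemeasurable,
        ← hren R c hcR, ← ENNReal.tsum_mul_left]
      refine ENNReal.tsum_le_tsum fun i => ?_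
      have hT0 := hT0 i
      rw [lintegral_const_mul' _ _ ENNReal.ofReal_ne_top, mul_left_comm]
      refine mul_le_mul_right ?_ _
      by_cases hci : c = ζ i
      · rw [hci, sub_self, norm_zero, zero_div, negLog_zero, ENNReal.mul_top]
        · exact le_top
        · simp [Real.pi_pos]
      · have h0 : 0 < ‖c - ζ i‖ := norm_pos_iff.2 (sub_ne_zero.2 hci)
        refine (lintegral_negLog_le hr (by positivity) (fun θ => ?_)
          (log_le_circleAverage hr hci)).trans (le_of_eq ?_)
        · refine (hle i _).trans ?_
          exact mul_le_mul_of_nonneg_right (by linarith [hzR θ]) hT0.le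
        · rw [negLog_of_pos (by positivity), Real.log_div h0.ne' (by positivity)]
          congr 2
          ring
    have hφi : IntegrableOn φ (Ioc 0 (2 * Real.pi)) := hφ.integrableOn_Ioc
    have hcst : IntegrableOn (fun _ : ℝ => a) (Ioc 0 (2 * Real.pi)) :=
      integrableOn_const measure_Ioc_lt_top.ne
    have h3 := (ofReal_integral_le_lintegral (hcst.sub hφi)).trans h2
    have hl : Real.log (1 + ‖c‖) ≤ Real.log (1 + R) :=
      Real.log_le_log (by positivity) (by linarith)
    have h5 : G c = ENNReal.ofReal (G c).toReal := (ENNReal.ofReal_toReal hGc).symm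
    have h6 : 0 ≤ S₀ * (Real.log (1 + R) - Real.log (1 + ‖c‖)) :=
      mul_nonneg hS₀0 (sub_nonneg.2 hl)
    rw [h5, ← ENNReal.ofReal_add ENNReal.toReal_nonneg h6, ← ENNReal.ofReal_mul
      Real.two_pi_pos.le, ENNReal.ofReal_le_ofReal_iff (by positivity)] at h3
    have h7 := integral_sub hcst hφi
    simp only [Pi.sub_apply] at h3
    rw [h7] at h3
    simp only [integral_const, MeasurableSet.univ, measureReal_restrict_apply, univ_inter,
      Real.volume_real_Ioc, smul_eq_mul] at h3
    rw [max_eq_left (by linarith [Real.two_pi_pos])] at h3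
    change _ + -((G c : ENNReal) : EReal) ≤ _
    rw [h5, EReal.coe_ennreal_ofReal, max_eq_left ENNReal.toReal_nonneg, ← EReal.coe_neg,
      ← EReal.coe_add, EReal.coe_le_coe_iff, intervalIntegral.integral_of_le Real.two_pi_pos.le,
      ← div_eq_inv_mul, le_div_iff₀ Real.two_pi_pos]
    rw [ha] at h3
    linarith

/-- Positivity of the logarithmic capacity, phrased with monic polynomials with zeros in `K`. -/
def CapPos (K : Set ℂ) : Prop :=
  ∃ ε > 0, ∀ (n : ℕ) (ζ : Fin n → ℂ), (∀ i, ζ i ∈ K) → ∃ z ∈ K, ε ^ n ≤ ∏ i, ‖z - ζ i‖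

theorem sum_negLog_ge {n : ℕ} {x : Fin n → ℝ} {w S a : ℝ} (hw : 0 < w) (hx : ∀ i, 0 ≤ x i)
    (hS : 1 ≤ S) (h : ∏ i, x i ≤ Real.exp (-a)) :
    ENNReal.ofReal (w * a) ≤ ∑ i, ENNReal.ofReal w * negLog (x i / S) := by
  by_cases h0 : ∃ i, x i = 0
  · obtain ⟨i, hi⟩ := h0
    refine le_trans ?_ (Finset.single_le_sum (f := fun i => ENNReal.ofReal w * negLog (x i / S))
      (fun _ _ => zero_le) (Finset.mem_univ i))
    simp [hi, negLog_zero, ENNReal.mul_top, hw]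
  · push Not at h0
    have hx0 : ∀ i, 0 < x i := fun i => (hx i).lt_of_ne' (h0 i)
    have hS0 : 0 < S := by linarith
    have h1 : a ≤ ∑ i, -Real.log (x i) := by
      rw [Finset.sum_neg_distrib, ← Real.log_prod fun i _ => h0 i]
      have := Real.log_le_log (Finset.prod_pos fun i _ => hx0 i) h
      rw [Real.log_exp] at this
      linarith
    have h2 : ∀ i, ENNReal.ofReal w * ENNReal.ofReal (-Real.log (x i)) ≤
        ENNReal.ofReal w * negLog (x i / S) := by
      intro i
      refine mul_le_mul_right ?_ _
      rw [negLog_of_pos (div_pos (hx0 i) hS0)]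
      apply ENNReal.ofReal_le_ofReal
      rw [Real.log_div (h0 i) hS0.ne']
      linarith [Real.log_nonneg hS]
    refine le_trans ?_ (Finset.sum_le_sum fun i _ => h2 i)
    rw [← Finset.mul_sum, ENNReal.ofReal_mul hw.le]
    refine mul_le_mul_right ?_ _
    refine (ENNReal.ofReal_le_ofReal h1).trans ?_
    exact Finset.le_sum_of_subadditive _ ENNReal.ofReal_zero.le (fun _ _ => ENNReal.ofReal_add_le) _ _

theorem polarSet_of_not_capPos {E : Set ℂ} {K : ℕ → Set ℂ}
    (hK : ∀ k : ℕ, K k ⊆ closedBall 0 k) (hc : ∀ k, ¬ CapPos (K k))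
    (hE : ∀ z ∈ E, ∃ k₀, ∀ k ≥ k₀, z ∈ K k) : PolarSet E := by
  have h1 : ∀ k : ℕ, ∃ (n : ℕ) (ζ : Fin n → ℂ), (∀ i, ζ i ∈ K k) ∧
      ∀ z ∈ K k, ∏ i, ‖z - ζ i‖ < Real.exp (-4 ^ k) ^ n := by
    intro k
    have := hc k
    unfold CapPos at this
    push Not at this
    exact this _ (Real.exp_pos _)
  choose n ζ hζ hlt using h1
  set w : (Σ k, Fin (n k)) → ℝ := fun p => (1 / 2) ^ p.1 / n p.1 with hw
  set T : (Σ k, Fin (n k)) → ℝ := fun p => 1 + p.1 with hT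
  have hw0 : ∀ p, 0 ≤ w p := fun p => by positivity
  have hT1 : ∀ p, 1 ≤ T p := fun p => by simp [hT]
  have hsum : ∀ k : ℕ, ∀ c : ℝ, 0 ≤ c → ∑' i : Fin (n k), w ⟨k, i⟩ * c ≤ (1 / 2) ^ k * c := by
    intro k c hc
    rw [tsum_fintype]
    simp only [hw, Finset.sum_const, Finset.card_univ, Fintype.card_fin, nsmul_eq_mul]
    rcases (n k).eq_zero_or_pos with h | h
    · simp only [h, Nat.cast_zero, zero_mul]
      positivity
    · have : (0 : ℝ) < n k := by exact_mod_cast h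
      apply le_of_eq
      field_simp
  have hws : Summable w := by
    refine (summable_sigma_of_nonneg hw0).2 ⟨fun k => Summable.of_finite, ?_⟩
    refine Summable.of_nonneg_of_le (fun k => tsum_nonneg fun i => hw0 _) (fun k => ?_)
      (summable_geometric_of_lt_one (r := (1 / 2 : ℝ)) (by norm_num) (by norm_num))
    simpa using hsum k 1 zero_le_one
  have hwT : Summable fun p => w p * Real.log (T p) := by
    have hl : ∀ p, 0 ≤ w p * Real.log (T p) := fun p => mul_nonneg (hw0 p) (Real.log_nonneg (hT1 p))
    refine (summable_sigma_of_nonneg hl).2 ⟨fun k => Summable.of_finite, ?_⟩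
    have hg : Summable fun k : ℕ => (k : ℝ) ^ 1 * (1 / 2 : ℝ) ^ k :=
      summable_pow_mul_geometric_of_norm_lt_one 1 (by norm_num)
    refine Summable.of_nonneg_of_le (fun k => tsum_nonneg fun i => hl _) (fun k => ?_) hg
    refine (hsum k (Real.log (1 + k)) (Real.log_nonneg (by simp))).trans ?_
    rw [mul_comm, pow_one]
    refine mul_le_mul_of_nonneg_right ?_ (by positivity)
    have := Real.log_le_sub_one_of_pos (x := 1 + (k : ℝ)) (by positivity)
    linarith
  refine ⟨univ, subset_univ _, _, subharmonicOn_potential (ζ := fun p => ζ p.1 p.2) hw0 hT1 ?_ hws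
    hwT, ?_⟩
  · intro p
    have := hK p.1 (hζ p.1 p.2)
    rw [mem_closedBall_zero_iff] at this
    simpa [hT] using this
  · intro z hz
    obtain ⟨k₀, hk₀⟩ := hE z hz
    have hge : ∀ k ≥ k₀, ENNReal.ofReal (2 ^ k) ≤ ∑' p : Σ k, Fin (n k), ENNReal.ofReal (w p) *
        negLog (‖z - ζ p.1 p.2‖ / ((1 + ‖z‖) * T p)) := by
      intro k hk
      have hzk := hk₀ k hk
      have hlt' := hlt k z hzk
      rw [ENNReal.tsum_sigma (fun k i => ENNReal.ofReal (w ⟨k, i⟩) *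
        negLog (‖z - ζ k i‖ / ((1 + ‖z‖) * T ⟨k, i⟩)))]
      refine le_trans ?_ (ENNReal.le_tsum k)
      have hn : 0 < n k := by
        rcases (n k).eq_zero_or_pos with h | h
        · exfalso
          have : IsEmpty (Fin (n k)) := by rw [h]; infer_instance
          rw [Fintype.prod_empty, h, pow_zero] at hlt'
          exact lt_irrefl _ hlt'
        · exact h
      have hn' : (0 : ℝ) < n k := by exact_mod_cast hn
      rw [tsum_fintype]
      have h2 := sum_negLog_ge (x := fun i => ‖z - ζ k i‖) (w := (1 / 2) ^ k / n k)
        (S := (1 + ‖z‖) * (1 + k)) (a := n k * 4 ^ k) (by positivity) (fun i => norm_nonneg _) ?_ ?_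
      · refine le_trans (le_of_eq ?_) h2
        congr 1
        field_simp
        rw [← mul_pow]
        norm_num
      · nlinarith [norm_nonneg z, (Nat.cast_nonneg k : (0 : ℝ) ≤ k)]
      · refine hlt'.le.trans (le_of_eq ?_)
        rw [← Real.exp_nat_mul]
        congr 1
        ring
    have htop : ∑' p : Σ k, Fin (n k), ENNReal.ofReal (w p) *
        negLog (‖z - ζ p.1 p.2‖ / ((1 + ‖z‖) * T p)) = ⊤ := by
      by_contra hne
      have h3 : ∀ k ≥ k₀, (2 : ℝ) ^ k ≤ (∑' p : Σ k, Fin (n k), ENNReal.ofReal (w p) *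
        negLog (‖z - ζ p.1 p.2‖ / ((1 + ‖z‖) * T p))).toReal := fun k hk =>
        (ENNReal.ofReal_le_iff_le_toReal hne).1 (hge k hk)
      obtain ⟨k, hk⟩ := (((tendsto_pow_atTop_atTop_of_one_lt (one_lt_two (α := ℝ))).eventually_gt_atTop
        _).and (eventually_ge_atTop k₀)).exists
      exact absurd (h3 k hk.2) (not_le.2 hk.1)
    simp only [htop]
    simp

/-- The sequence whose `n`-th term is `F n` applied to the previous terms. -/
noncomputable def courseRec (F : (n : ℕ) → (Fin n → ℂ) → ℂ) : ℕ → ℂ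
  | n => F n fun i => courseRec F i
decreasing_by exact i.2

theorem CapPos.exists_seq {K : Set ℂ} (h : CapPos K) : ∃ ε : ℝ, 0 < ε ∧ ε ≤ 1 ∧ ∃ ζ : ℕ → ℂ,
    (∀ n, ζ n ∈ K) ∧ ∀ n, ε ^ n ≤ ∏ i ∈ Finset.range n, ‖ζ n - ζ i‖ := by
  obtain ⟨ε, hε, hK⟩ := h
  have h1 : ∀ (n : ℕ) (ζ : Fin n → ℂ), ∃ z, (∀ i, ζ i ∈ K) → z ∈ K ∧ ε ^ n ≤ ∏ i, ‖z - ζ i‖ := by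
    intro n ζ
    by_cases hc : ∀ i, ζ i ∈ K
    · obtain ⟨z, hz⟩ := hK n ζ hc
      exact ⟨z, fun _ => hz⟩
    · exact ⟨0, fun h => (hc h).elim⟩
  choose F hF using h1
  have h2 : ∀ n, courseRec F n = F n fun i => courseRec F i := fun n => by rw [courseRec]
  have h3 : ∀ n, courseRec F n ∈ K := fun n => by
    induction n using Nat.strong_induction_on with
    | _ n ih =>
      rw [h2]
      exact (hF n _ fun i => ih i i.2).1
  refine ⟨min ε 1, by positivity, min_le_right _ _, courseRec F, h3, fun n => ?_⟩
  rw [Finset.prod_range fun i => ‖courseRec F n - courseRec F i‖, h2]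
  exact (pow_le_pow_left₀ (by positivity) (min_le_left _ _) n).trans (hF n _ fun i => h3 i).2

theorem double_sum_le {f : ℕ → ℕ → ℝ} {b c : ℝ} (hs : ∀ i j, f i j = f j i)
    (hd : ∀ i, f i i ≤ b) (hc : ∀ n : ℕ, ∑ i ∈ Finset.range n, f n i ≤ n * c) (N : ℕ) :
    ∑ i ∈ Finset.range N, ∑ j ∈ Finset.range N, f i j ≤ N * (N - 1) * c + N * b := by
  induction N with
  | zero => simp
  | succ N ih =>
    rw [Finset.sum_range_succ, Finset.sum_range_succ]
    have h1 : ∑ i ∈ Finset.range N, ∑ j ∈ Finset.range (N + 1), f i j =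
        (∑ i ∈ Finset.range N, ∑ j ∈ Finset.range N, f i j) + ∑ i ∈ Finset.range N, f N i := by
      rw [← Finset.sum_add_distrib]
      refine Finset.sum_congr rfl fun i _ => ?_
      rw [Finset.sum_range_succ, hs i N]
    rw [h1]
    push_cast
    have := hd N
    have := hc N
    linarith

theorem lintegral_radial_kernel_le {ρ δ : ℝ} (hδ : 0 < δ) (hρ : δ ≤ ρ) :
    ∫⁻ z in ball (0 : ℂ) ρ, ENNReal.ofReal ((‖z‖ * max ‖z‖ δ)⁻¹) ≤
      ENNReal.ofReal (2 * Real.pi * (1 + Real.log (ρ / δ))) := by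
  set k : ℝ → ℝ := (Iio ρ).indicator fun y => (y * max y δ)⁻¹ with hk
  have hρ0 : 0 < ρ := hδ.trans_le hρ
  have hcont : Continuous fun y : ℝ => (max y δ)⁻¹ :=
    (continuous_id.max continuous_const).inv₀ fun y => (lt_max_of_lt_right hδ).ne'
  have hEq : ∀ y ∈ Ioi (0 : ℝ), y ^ (Module.finrank ℝ ℂ - 1) • k y =
      (Iio ρ).indicator (fun y => (max y δ)⁻¹) y := by
    intro y hy
    rw [Complex.finrank_real_complex, hk, smul_eq_mul, pow_one]
    by_cases h : y ∈ Iio ρ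
    · rw [indicator_of_mem h, indicator_of_mem h, mul_inv, mul_inv_cancel_left₀ (ne_of_gt hy)]
    · simp [indicator_of_notMem h]
  have hset : Ioi (0 : ℝ) ∩ Iio ρ = Ioo 0 ρ := Ioi_inter_Iio
  have hi1 : IntegrableOn (fun y : ℝ => (max y δ)⁻¹) (Ioo 0 ρ) :=
    (hcont.integrableOn_Icc (a := 0) (b := ρ)).mono_set Ioo_subset_Icc_self
  have hi : IntegrableOn (fun y => y ^ (Module.finrank ℝ ℂ - 1) • k y) (Ioi (0 : ℝ)) := by
    rw [integrableOn_congr_fun hEq measurableSet_Ioi, IntegrableOn,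
      integrable_indicator_iff measurableSet_Iio, IntegrableOn, Measure.restrict_restrict
      measurableSet_Iio, inter_comm, hset]
    exact hi1
  have hint : Integrable fun z : ℂ => k ‖z‖ := (integrable_fun_norm_addHaar volume).2 hi
  have hval := integral_fun_norm_addHaar (volume : Measure ℂ) k
  rw [setIntegral_congr_fun measurableSet_Ioi hEq, setIntegral_indicator measurableSet_Iio, hset,
    ← integral_Ioc_eq_integral_Ioo, ← intervalIntegral.integral_of_le hρ0.le,
    ← intervalIntegral.integral_add_adjacent_intervals (b := δ) (hcont.intervalIntegrable _ _)
      (hcont.intervalIntegrable _ _)] at hval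
  have e1 : ∫ y in (0 : ℝ)..δ, (max y δ)⁻¹ = 1 := by
    rw [intervalIntegral.integral_congr (g := fun _ => δ⁻¹)]
    · simp [hδ.ne']
    · intro y hy
      rw [uIcc_of_le hδ.le] at hy
      simp only
      rw [max_eq_right hy.2]
  have e2 : ∫ y in δ..ρ, (max y δ)⁻¹ = Real.log (ρ / δ) := by
    rw [intervalIntegral.integral_congr (g := fun y => y⁻¹)]
    · exact integral_inv_of_pos hδ hρ0
    · intro y hy
      rw [uIcc_of_le hρ] at hy
      simp only
      rw [max_eq_left hy.1]
  rw [e1, e2, Complex.finrank_real_complex] at hval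
  have hv : volume.real (ball (0 : ℂ) 1) = Real.pi := by
    simp [Measure.real, Complex.volume_ball]
  rw [hv] at hval
  have hk0 : ∀ z : ℂ, 0 ≤ k ‖z‖ := fun z => by
    rw [hk, indicator_apply]
    split_ifs
    · have : 0 ≤ max ‖z‖ δ := le_max_of_le_left (norm_nonneg z)
      positivity
    · exact le_rfl
  calc ∫⁻ z in ball (0 : ℂ) ρ, ENNReal.ofReal ((‖z‖ * max ‖z‖ δ)⁻¹)
      = ∫⁻ z in ball (0 : ℂ) ρ, ENNReal.ofReal (k ‖z‖) := by
        refine setLIntegral_congr_fun measurableSet_ball fun z hz => ?_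
        rw [hk, indicator_of_mem (show ‖z‖ ∈ Iio ρ from mem_ball_zero_iff.1 hz)]
    _ ≤ ∫⁻ z, ENNReal.ofReal (k ‖z‖) := setLIntegral_le_lintegral _ _
    _ = ENNReal.ofReal (∫ z : ℂ, k ‖z‖) :=
        (ofReal_integral_eq_lintegral_ofReal hint (.of_forall hk0)).symm
    _ ≤ _ := by
        rw [hval]
        apply ENNReal.ofReal_le_ofReal
        simp only [nsmul_eq_mul, smul_eq_mul]
        push_cast
        linarith

theorem lintegral_two_pole_le {ζ η : ℂ} {R ρ : ℝ} (hζ : ‖ζ‖ ≤ ρ) (hη : ‖η‖ ≤ ρ) (hR : 0 < R)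
    (hne : ζ ≠ η) : ∫⁻ z in ball (0 : ℂ) R, ENNReal.ofReal ((‖z - ζ‖ * ‖z - η‖)⁻¹) ≤
      ENNReal.ofReal (4 * Real.pi * (1 + Real.log (2 * (R + ρ) / ‖ζ - η‖))) := by
  set δ := ‖ζ - η‖ / 2 with hδ
  have hδ0 : 0 < δ := half_pos (norm_pos_iff.2 (sub_ne_zero.2 hne))
  have hδρ : δ ≤ R + ρ := by
    have := norm_sub_le ζ η
    rw [hδ]
    linarith
  have hk : ∀ ξ : ℂ, ‖ξ‖ ≤ ρ →
      ∫⁻ z in ball (0 : ℂ) R, ENNReal.ofReal ((‖z - ξ‖ * max ‖z - ξ‖ δ)⁻¹) ≤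
        ENNReal.ofReal (2 * Real.pi * (1 + Real.log ((R + ρ) / δ))) := by
    intro ξ hξ
    refine le_trans ?_ (lintegral_radial_kernel_le hδ0 hδρ)
    have hpre : (fun z : ℂ => z - ξ) ⁻¹' ball (0 : ℂ) (R + ρ) = ball ξ (R + ρ) := by
      ext z
      simp [dist_eq_norm]
    have := (measurePreserving_sub_right (volume : Measure ℂ) ξ).setLIntegral_comp_preimage
      (f := fun z : ℂ => ENNReal.ofReal ((‖z‖ * max ‖z‖ δ)⁻¹)) (s := ball 0 (R + ρ))
      measurableSet_ball (by fun_prop)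
    rw [← this, hpre]
    refine lintegral_mono_set (ball_subset_ball' ?_)
    rw [dist_zero_left]
    linarith
  have h0 : 0 ≤ 2 * Real.pi * (1 + Real.log ((R + ρ) / δ)) := by
    have := Real.log_nonneg ((one_le_div hδ0).2 hδρ)
    positivity
  calc ∫⁻ z in ball (0 : ℂ) R, ENNReal.ofReal ((‖z - ζ‖ * ‖z - η‖)⁻¹)
      ≤ ∫⁻ z in ball (0 : ℂ) R, (ENNReal.ofReal ((‖z - ζ‖ * max ‖z - ζ‖ δ)⁻¹) +
          ENNReal.ofReal ((‖z - η‖ * max ‖z - η‖ δ)⁻¹)) := by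
        refine lintegral_mono fun z => ?_
        have htri : 2 * δ ≤ ‖z - ζ‖ + ‖z - η‖ := by
          have := norm_sub_le (z - η) (z - ζ)
          rw [sub_sub_sub_cancel_left] at this
          rw [hδ]
          linarith
        have key : ∀ x y : ℝ, 0 ≤ x → x ≤ y → 2 * δ ≤ x + y → (x * y)⁻¹ ≤ (x * max x δ)⁻¹ := by
          intro x y hx hxy h
          rcases hx.eq_or_lt with rfl | hx
          · simp
          · have : δ ≤ y := by linarith
            exact inv_anti₀ (by positivity) (mul_le_mul_of_nonneg_left (max_le hxy this) hx.le)
        rcases le_total ‖z - ζ‖ ‖z - η‖ with h | h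
        · exact (ENNReal.ofReal_le_ofReal (key _ _ (norm_nonneg _) h htri)).trans le_self_add
        · rw [mul_comm ‖z - ζ‖ ‖z - η‖]
          exact (ENNReal.ofReal_le_ofReal (key _ _ (norm_nonneg _) h (by linarith))).trans
            le_add_self
    _ ≤ ENNReal.ofReal (2 * Real.pi * (1 + Real.log ((R + ρ) / δ))) +
          ENNReal.ofReal (2 * Real.pi * (1 + Real.log ((R + ρ) / δ))) := by
        rw [lintegral_add_left (by fun_prop)]
        exact add_le_add (hk ζ hζ) (hk η hη)
    _ ≤ _ := by
        rw [← ENNReal.ofReal_add h0 h0]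
        apply ENNReal.ofReal_le_ofReal
        have : (R + ρ) / δ = 2 * (R + ρ) / ‖ζ - η‖ := by
          rw [hδ]
          field_simp
        rw [this]
        linarith

/-- The Cauchy transform of `φ ν` for a measure `ν` on a set `K`. -/
noncomputable def cauchyMeas {K : Set ℂ} (ν : Measure K) (φ : ℂ → ℂ) (z : ℂ) : ℂ :=
  ∫ ζ, φ ζ * (z - ζ)⁻¹ ∂ν

theorem exists_bound_on_compact {K : Set ℂ} (hK : IsCompact K) {φ : ℂ → ℂ} (hφ : Continuous φ) :
    ∃ M > 0, ∀ ζ ∈ K, ‖φ ζ‖ ≤ M := by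
  obtain ⟨M, hM⟩ := hK.exists_bound_of_continuousOn hφ.continuousOn
  exact ⟨max M 1, by positivity, fun ζ hζ => (hM ζ hζ).trans (le_max_left _ _)⟩

theorem differentiableOn_cauchyMeas {K : Set ℂ} (hK : IsCompact K) (ν : Measure K)
    [IsFiniteMeasure ν] {φ : ℂ → ℂ} (hφ : Continuous φ) :
    DifferentiableOn ℂ (cauchyMeas ν φ) Kᶜ := by
  intro z₀ hz₀
  refine DifferentiableAt.differentiableWithinAt ?_
  obtain ⟨δ, hδ, hδK⟩ := isOpen_iff.1 hK.isClosed.isOpen_compl z₀ hz₀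
  obtain ⟨M, hM0, hM⟩ := exists_bound_on_compact hK hφ
  have hdist : ∀ z ∈ ball z₀ (δ / 2), ∀ ζ : K, δ / 2 ≤ ‖z - ζ‖ := fun z hz ζ => by
    by_contra hc
    refine hδK (?_ : (ζ : ℂ) ∈ ball z₀ δ) ζ.2
    rw [not_le, ← dist_eq_norm, dist_comm] at hc
    have := dist_triangle (ζ : ℂ) z z₀
    rw [mem_ball] at hz ⊢
    linarith
  have key : DifferentiableOn ℂ (fun p : ℂ × ℂ => ∫ ζ : K, φ ζ * (p.1 - ζ)⁻¹ ∂ν)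
      (ball z₀ (δ / 2) ×ˢ univ) := by
    refine differentiableOn_integral_param (isOpen_ball.prod isOpen_univ)
      (F := fun p (ζ : K) => φ ζ * (p.1 - ζ)⁻¹) (H := fun _ => M * (δ / 2)⁻¹) ?_ ?_
      (integrable_const _) ?_
    · intro ζ
      refine DifferentiableOn.const_mul (DifferentiableOn.inv (by fun_prop) ?_) _
      rintro p ⟨hp, -⟩ h0
      have := hdist _ hp ζ
      rw [h0, norm_zero] at this
      linarith
    · intro p hp
      exact Measurable.aestronglyMeasurable
        ((hφ.measurable.comp measurable_subtype_coe).mul (by fun_prop))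
    · rintro ζ p ⟨hp, -⟩
      rw [norm_mul, norm_inv]
      exact mul_le_mul (hM ζ ζ.2) (inv_anti₀ (by positivity) (hdist _ hp ζ)) (by positivity) hM0.le
  have h2 : DifferentiableOn ℂ (fun z : ℂ => (z, (0 : ℂ))) (ball z₀ (δ / 2)) := by fun_prop
  exact (key.comp h2 fun z hz => ⟨hz, mem_univ _⟩).differentiableAt
    (ball_mem_nhds z₀ (half_pos hδ))

/-- A sequence with bounded discrete energy has a limit distribution. -/
theorem exists_limit_measure {K : Set ℂ} (hK : IsCompact K) {ζ : ℕ → ℂ} (hζ : ∀ n, ζ n ∈ K) :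
    ∃ ν : Measure K, IsProbabilityMeasure ν ∧ ∃ N : ℕ → ℕ, (∀ k, 0 < N k) ∧
      Tendsto N atTop atTop ∧ ∀ g : ℂ → ℂ, ContinuousOn g K →
        Tendsto (fun k => ((N k : ℂ))⁻¹ * ∑ i ∈ Finset.range (N k), g (ζ i)) atTop
          (𝓝 (∫ x, g x ∂ν)) := by
  have : CompactSpace K := isCompact_iff_compactSpace.1 hK
  set ζ' : ℕ → K := fun n => ⟨ζ n, hζ n⟩ with hζ'
  have hp : ∀ N : ℕ, IsProbabilityMeasure
      (((N + 1 : ℕ) : ENNReal)⁻¹ • ∑ i ∈ Finset.range (N + 1), Measure.dirac (ζ' i)) := by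
    intro N
    constructor
    rw [Measure.smul_apply, Measure.finsetSum_apply]
    simp only [measure_univ, Finset.sum_const, Finset.card_range, nsmul_eq_mul, mul_one, smul_eq_mul]
    exact ENNReal.inv_mul_cancel (by simp) (ENNReal.natCast_ne_top _)
  set P : ℕ → ProbabilityMeasure K := fun N => ⟨_, hp N⟩
  obtain ⟨ν, s, hs, hν⟩ := CompactSpace.tendsto_subseq P
  refine ⟨ν, inferInstance, fun k => s k + 1, fun k => Nat.succ_pos _,
    tendsto_atTop_mono (fun k => Nat.le_succ _) hs.tendsto_atTop, fun g hg => ?_⟩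
  have hg' : Continuous fun x : K => g x := continuousOn_iff_continuous_domRestrict.1 hg
  have h1 := (ProbabilityMeasure.tendsto_iff_forall_integral_rclike_tendsto ℂ).1 hν
    (BoundedContinuousFunction.mkOfCompact ⟨_, hg'⟩)
  refine h1.congr fun k => ?_
  change ∫ x : K, g x ∂(((s k + 1 : ℕ) : ENNReal)⁻¹ •
    ∑ i ∈ Finset.range (s k + 1), Measure.dirac (ζ' i)) = _
  rw [integral_smul_measure, integral_finsetSum_measure, ENNReal.toReal_inv,
    ENNReal.toReal_natCast]
  · simp [hζ']
  · intro i _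
    exact integrable_dirac (by simp)

/-- Sequences satisfying the product condition with respect to capacity. -/
theorem energy_facts {ε : ℝ} (hε : 0 < ε) {ζ : ℕ → ℂ}
    (h : ∀ n, ε ^ n ≤ ∏ i ∈ Finset.range n, ‖ζ n - ζ i‖) (n : ℕ) :
    (∀ i ∈ Finset.range n, 0 < ‖ζ n - ζ i‖) ∧
      n * Real.log ε ≤ ∑ i ∈ Finset.range n, Real.log ‖ζ n - ζ i‖ := by
  have h0 : ∀ i ∈ Finset.range n, ‖ζ n - ζ i‖ ≠ 0 :=
    Finset.prod_ne_zero_iff.1 ((pow_pos hε n).trans_le (h n)).ne'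
  refine ⟨fun i hi => (norm_nonneg _).lt_of_ne' (h0 i hi), ?_⟩
  rw [← Real.log_prod h0, ← Real.log_pow]
  exact Real.log_le_log (pow_pos hε n) (h n)

theorem energy_ne {ε : ℝ} (hε : 0 < ε) {ζ : ℕ → ℂ}
    (h : ∀ n, ε ^ n ≤ ∏ i ∈ Finset.range n, ‖ζ n - ζ i‖) {i j : ℕ} (hij : i ≠ j) :
    ζ i ≠ ζ j := by
  wlog hlt : i < j generalizing i j
  · exact (this hij.symm (by omega)).symm
  intro h0
  have := (energy_facts hε h j).1 i (Finset.mem_range.2 hlt)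
  rw [h0, sub_self, norm_zero] at this
  exact this.false

theorem sum_sq_dist_ge {ε : ℝ} (hε : 0 < ε) {ζ : ℕ → ℂ}
    (h : ∀ n, ε ^ n ≤ ∏ i ∈ Finset.range n, ‖ζ n - ζ i‖) (c : ℂ) (N : ℕ) :
    N * (N - 1) * ε ^ 2 ≤ 4 * N * ∑ i ∈ Finset.range N, ‖ζ i - c‖ ^ 2 := by
  have h1 := double_sum_le (f := fun i j => -‖ζ i - ζ j‖ ^ 2) (b := 0) (c := -ε ^ 2)
    (fun i j => by simp only [norm_sub_rev]) (fun i => by simp) (fun n => by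
      obtain ⟨h0, h2⟩ := energy_facts hε h n
      have h3 : ∀ i ∈ Finset.range n,
          -‖ζ n - ζ i‖ ^ 2 ≤ -ε ^ 2 * (1 - 2 * Real.log ε) - ε ^ 2 * 2 * Real.log ‖ζ n - ζ i‖ := by
        intro i hi
        have hx := h0 i hi
        have h4 := Real.log_le_sub_one_of_pos (pow_pos (div_pos hx hε) 2)
        rw [Real.log_pow, Real.log_div hx.ne' hε.ne', div_pow, le_sub_iff_add_le,
          le_div_iff₀ (by positivity)] at h4
        push_cast at h4
        nlinarith
      refine (Finset.sum_le_sum h3).trans ?_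
      rw [Finset.sum_sub_distrib, Finset.sum_const, Finset.card_range, nsmul_eq_mul,
        ← Finset.mul_sum]
      nlinarith [mul_le_mul_of_nonneg_left h2 (by positivity : (0 : ℝ) ≤ ε ^ 2 * 2)]) N
  have h2 : ∑ i ∈ Finset.range N, ∑ j ∈ Finset.range N, -‖ζ i - ζ j‖ ^ 2 ≥
      ∑ i ∈ Finset.range N, ∑ j ∈ Finset.range N, (-2 * ‖ζ i - c‖ ^ 2 - 2 * ‖ζ j - c‖ ^ 2) := by
    refine Finset.sum_le_sum fun i _ => Finset.sum_le_sum fun j _ => ?_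
    have := norm_sub_le (ζ i - c) (ζ j - c)
    rw [sub_sub_sub_cancel_right] at this
    nlinarith [sq_nonneg (‖ζ i - c‖ - ‖ζ j - c‖), norm_nonneg (ζ i - ζ j)]
  simp only [Finset.sum_sub_distrib, Finset.sum_const, Finset.card_range, nsmul_eq_mul,
    ← Finset.mul_sum] at h2
  linarith

theorem lintegral_sq_average_le {K : Set ℂ} {ε : ℝ} (hε : 0 < ε) (hε1 : ε ≤ 1) {ζ : ℕ → ℂ}
    (hζ : ∀ n, ζ n ∈ K) (h : ∀ n, ε ^ n ≤ ∏ i ∈ Finset.range n, ‖ζ n - ζ i‖)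
    {ρ R δ M : ℝ} (hρ : 1 ≤ ρ) (hKρ : ∀ ζ ∈ K, ‖ζ‖ ≤ ρ) (hR : 0 < R) (hδ : 0 < δ)
    {φ : ℂ → ℂ} (hφ : ∀ ζ ∈ K, ‖φ ζ‖ ≤ M) {N : ℕ} (hN : 0 < N) :
    ∫⁻ z in ball 0 R \ thickening δ K,
      ENNReal.ofReal (‖(N : ℂ)⁻¹ * ∑ i ∈ Finset.range N, φ (ζ i) * (z - ζ i)⁻¹‖ ^ 2) ≤
      ENNReal.ofReal (M ^ 2 * (4 * Real.pi * (1 + Real.log (2 * (R + ρ) / ε)) +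
        volume.real (ball (0 : ℂ) R) * (δ⁻¹) ^ 2 / N)) := by
  set b := volume.real (ball (0 : ℂ) R) * (δ⁻¹) ^ 2 with hb
  have hb0 : 0 ≤ b := by positivity
  set f : ℕ → ℕ → ℝ := fun i j => if i = j then b else
    4 * Real.pi * (1 + Real.log (2 * (R + ρ) / ‖ζ i - ζ j‖)) with hf
  have hRρ : 0 < 2 * (R + ρ) := by linarith
  have hf0 : ∀ i j, 0 ≤ f i j := fun i j => by
    simp only [hf]
    split_ifs with hij
    · exact hb0
    · have h1 : 0 < ‖ζ i - ζ j‖ := norm_pos_iff.2 (sub_ne_zero.2 (energy_ne hε h hij))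
      have h2 : 0 ≤ Real.log (2 * (R + ρ) / ‖ζ i - ζ j‖) := by
        refine Real.log_nonneg ((one_le_div h1).2 ?_)
        have := norm_sub_le (ζ i) (ζ j)
        linarith [hKρ _ (hζ i), hKρ _ (hζ j)]
      have := Real.pi_pos
      positivity
  have hS : MeasurableSet (ball (0 : ℂ) R \ thickening δ K) :=
    measurableSet_ball.diff isOpen_thickening.measurableSet
  have hint : ∀ i j, ∫⁻ z in ball 0 R \ thickening δ K,
      ENNReal.ofReal ((‖z - ζ i‖ * ‖z - ζ j‖)⁻¹) ≤ ENNReal.ofReal (f i j) := by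
    intro i j
    simp only [hf]
    split_ifs with hij
    · subst hij
      calc _ ≤ ∫⁻ z in ball (0 : ℂ) R \ thickening δ K, ENNReal.ofReal ((δ⁻¹) ^ 2) := by
            refine setLIntegral_mono' hS fun z hz => ENNReal.ofReal_le_ofReal ?_
            have h1 : δ ≤ ‖z - ζ i‖ := by
              by_contra hc
              exact hz.2 (mem_thickening_iff.2 ⟨ζ i, hζ i, by rwa [dist_eq_norm, ← not_le]⟩)
            rw [mul_inv, ← sq]
            gcongr
        _ ≤ _ := by
            rw [setLIntegral_const, hb, mul_comm, ENNReal.ofReal_mul measureReal_nonneg,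
              ofReal_measureReal measure_ball_lt_top.ne]
            gcongr
            exact sdiff_subset
    · exact (lintegral_mono_set sdiff_subset).trans
        (lintegral_two_pole_le (hKρ _ (hζ i)) (hKρ _ (hζ j)) hR (energy_ne hε h hij))
  have hsum := double_sum_le (f := f) (b := b)
    (c := 4 * Real.pi * (1 + Real.log (2 * (R + ρ) / ε)))
    (fun i j => by simp only [hf, norm_sub_rev, eq_comm]) (fun i => by simp [hf]) (fun n => by
      obtain ⟨h0, h2⟩ := energy_facts hε h n
      have h3 : ∀ i ∈ Finset.range n, f n i =
          4 * Real.pi * (1 + Real.log (2 * (R + ρ))) - 4 * Real.pi * Real.log ‖ζ n - ζ i‖ := by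
        intro i hi
        have : n ≠ i := by have := Finset.mem_range.1 hi; omega
        simp only [hf, this, if_false]
        rw [Real.log_div hRρ.ne' (h0 i hi).ne']
        ring
      rw [Finset.sum_congr rfl h3, Finset.sum_sub_distrib, Finset.sum_const,
        Finset.card_range, nsmul_eq_mul, ← Finset.mul_sum, Real.log_div hRρ.ne' hε.ne']
      nlinarith [mul_le_mul_of_nonneg_left h2 (by positivity : (0 : ℝ) ≤ 4 * Real.pi)]) N
  have hc0 : 0 ≤ 4 * Real.pi * (1 + Real.log (2 * (R + ρ) / ε)) := by
    have : 0 ≤ Real.log (2 * (R + ρ) / ε) := by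
      refine Real.log_nonneg ((one_le_div hε).2 ?_)
      linarith
    positivity
  set c := 4 * Real.pi * (1 + Real.log (2 * (R + ρ) / ε)) with hc
  have hN' : (0 : ℝ) < N := Nat.cast_pos.2 hN
  have hpt : ∀ z : ℂ, ENNReal.ofReal
      (‖(N : ℂ)⁻¹ * ∑ i ∈ Finset.range N, φ (ζ i) * (z - ζ i)⁻¹‖ ^ 2) ≤
      ENNReal.ofReal (M ^ 2 * ((N : ℝ)⁻¹) ^ 2) * ∑ i ∈ Finset.range N, ∑ j ∈ Finset.range N,
        ENNReal.ofReal ((‖z - ζ i‖ * ‖z - ζ j‖)⁻¹) := by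
    intro z
    rw [Finset.sum_congr rfl fun i _ => (ENNReal.ofReal_sum_of_nonneg fun j _ =>
        (by positivity : 0 ≤ (‖z - ζ i‖ * ‖z - ζ j‖)⁻¹)).symm,
      ← ENNReal.ofReal_sum_of_nonneg fun i _ => Finset.sum_nonneg fun j _ => by positivity,
      ← ENNReal.ofReal_mul (by positivity)]
    refine ENNReal.ofReal_le_ofReal ?_
    have h1 : ‖(N : ℂ)⁻¹ * ∑ i ∈ Finset.range N, φ (ζ i) * (z - ζ i)⁻¹‖ ≤
        (N : ℝ)⁻¹ * (M * ∑ i ∈ Finset.range N, ‖z - ζ i‖⁻¹) := by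
      rw [norm_mul, norm_inv, Complex.norm_natCast, Finset.mul_sum]
      gcongr
      refine (norm_sum_le _ _).trans (Finset.sum_le_sum fun i _ => ?_)
      rw [norm_mul, norm_inv]
      gcongr
      exact hφ _ (hζ i)
    refine (pow_le_pow_left₀ (norm_nonneg _) h1 2).trans (le_of_eq ?_)
    simp only [mul_inv, ← Finset.mul_sum, ← Finset.sum_mul]
    ring
  calc _ ≤ ∫⁻ z in ball 0 R \ thickening δ K, ENNReal.ofReal (M ^ 2 * ((N : ℝ)⁻¹) ^ 2) *
        ∑ i ∈ Finset.range N, ∑ j ∈ Finset.range N,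
        ENNReal.ofReal ((‖z - ζ i‖ * ‖z - ζ j‖)⁻¹) := lintegral_mono hpt
    _ = ENNReal.ofReal (M ^ 2 * ((N : ℝ)⁻¹) ^ 2) * ∑ i ∈ Finset.range N, ∑ j ∈ Finset.range N,
        ∫⁻ z in ball 0 R \ thickening δ K, ENNReal.ofReal ((‖z - ζ i‖ * ‖z - ζ j‖)⁻¹) := by
        rw [lintegral_const_mul _ (by fun_prop), lintegral_finsetSum _ (by fun_prop)]
        exact congrArg _ (Finset.sum_congr rfl fun i _ => lintegral_finsetSum _ (by fun_prop))
    _ ≤ ENNReal.ofReal (M ^ 2 * ((N : ℝ)⁻¹) ^ 2) * ∑ i ∈ Finset.range N, ∑ j ∈ Finset.range N,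
        ENNReal.ofReal (f i j) := by
        gcongr with i _ j _
        exact hint i j
    _ = ENNReal.ofReal (M ^ 2 * ((N : ℝ)⁻¹) ^ 2 *
        ∑ i ∈ Finset.range N, ∑ j ∈ Finset.range N, f i j) := by
        rw [Finset.sum_congr rfl fun i _ =>
            (ENNReal.ofReal_sum_of_nonneg fun j _ => hf0 i j).symm,
          ← ENNReal.ofReal_sum_of_nonneg fun i _ => Finset.sum_nonneg fun j _ => hf0 i j,
          ← ENNReal.ofReal_mul (by positivity)]
    _ ≤ _ := by
        refine ENNReal.ofReal_le_ofReal ?_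
        calc _ ≤ M ^ 2 * ((N : ℝ)⁻¹) ^ 2 * (N * (N - 1) * c + N * b) := by gcongr
          _ ≤ M ^ 2 * ((N : ℝ)⁻¹) ^ 2 * (N * N * c + N * b) := by
              gcongr
              linarith
          _ = _ := by field_simp

/-- The equilibrium-like measure of a compact set of positive capacity. -/
theorem CapPos.exists_measure {K : Set ℂ} (hK : IsCompact K) (h : CapPos K) :
    ∃ ν : Measure K, IsProbabilityMeasure ν ∧
      (∀ c : ℂ, ∫ ζ : K, (((‖(ζ : ℂ) - c‖ ^ 2 : ℝ)) : ℂ) ∂ν ≠ 0) ∧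
      ∀ φ : ℂ → ℂ, Continuous φ → ∀ R : ℝ,
        IntegrableOn (fun z => ‖cauchyMeas ν φ z‖ ^ 2) (ball 0 R \ K) := by
  obtain ⟨ε, hε, hε1, ζ, hζ, hprod⟩ := h.exists_seq
  obtain ⟨ν, hν, N, hN0, hN, hlim⟩ := exists_limit_measure hK hζ
  refine ⟨ν, hν, fun c h0 => ?_, fun φ hφ R => ?_⟩
  · have h1 := hlim (fun z => ((‖z - c‖ ^ 2 : ℝ) : ℂ)) (by fun_prop)
    rw [h0] at h1
    have h2 := (Complex.continuous_re.tendsto _).comp h1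
    have h3 : ε ^ 2 / 8 ≤ 0 := by
      refine ge_of_tendsto h2 ?_
      filter_upwards [hN.eventually_ge_atTop 2] with k hk
      have h4 := sum_sq_dist_ge hε hprod c (N k)
      have h5 : (2 : ℝ) ≤ N k := by exact_mod_cast hk
      simp only [Function.comp_apply]
      rw [← Complex.ofReal_sum, ← Complex.ofReal_natCast, ← Complex.ofReal_inv,
        ← Complex.ofReal_mul, Complex.ofReal_re, inv_mul_eq_div, le_div_iff₀ (by linarith)]
      have h6 : ((N k : ℝ) - 1) * ε ^ 2 ≤ 4 * ∑ i ∈ Finset.range (N k), ‖ζ i - c‖ ^ 2 := by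
        refine le_of_mul_le_mul_left ?_ (by linarith : (0 : ℝ) < N k)
        linarith
      nlinarith [sq_nonneg ε]
    have : 0 < ε ^ 2 := by positivity
    linarith
  · rcases le_or_gt R 0 with hR | hR
    · simp [ball_eq_empty.2 hR]
    obtain ⟨ρ, hρ1, hρ⟩ : ∃ ρ : ℝ, 1 ≤ ρ ∧ ∀ ζ ∈ K, ‖ζ‖ ≤ ρ := by
      obtain ⟨ρ, hρ⟩ := hK.isBounded.exists_norm_le
      exact ⟨max ρ 1, le_max_right _ _, fun ζ hζ => (hρ ζ hζ).trans (le_max_left _ _)⟩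
    obtain ⟨M, hM0, hM⟩ := exists_bound_on_compact hK hφ
    set c := 4 * Real.pi * (1 + Real.log (2 * (R + ρ) / ε))
    set S : ℕ → Set ℂ := fun m => ball 0 R \ thickening ((m : ℝ) + 1)⁻¹ K
    have hSm : ∀ m, MeasurableSet (S m) := fun m =>
      measurableSet_ball.diff isOpen_thickening.measurableSet
    have hSK : ∀ m, S m ⊆ Kᶜ := fun m z hz hzK => hz.2 (self_subset_thickening (by positivity) _ hzK)
    have hSmono : Monotone S := by
      intro m n hmn
      refine sdiff_subset_sdiff_right (thickening_mono ?_ _)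
      gcongr
    have hSU : ⋃ m, S m = ball 0 R \ K := by
      refine Subset.antisymm (iUnion_subset fun m z hz => ⟨hz.1, hSK m hz⟩) ?_
      rintro z ⟨hz, hzK⟩
      obtain ⟨δ, hδ, hδK⟩ := isOpen_iff.1 hK.isClosed.isOpen_compl z hzK
      obtain ⟨m, hm⟩ := exists_nat_one_div_lt hδ
      refine mem_iUnion.2 ⟨m, hz, fun hz' => ?_⟩
      obtain ⟨w, hw, hzw⟩ := mem_thickening_iff.1 hz'
      refine hδK (?_ : w ∈ ball z δ) hw
      rw [mem_ball, dist_comm]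
      rw [one_div] at hm
      linarith
    have hcont : ContinuousOn (fun z => ‖cauchyMeas ν φ z‖ ^ 2) (ball 0 R \ K) :=
      (((differentiableOn_cauchyMeas hK ν hφ).continuousOn.norm).pow 2).mono fun z hz => hz.2
    have hmeas : MeasurableSet (ball (0 : ℂ) R \ K) := measurableSet_ball.diff hK.measurableSet
    have hbound : ∀ m, ∫⁻ z in S m, ENNReal.ofReal (‖cauchyMeas ν φ z‖ ^ 2) ≤
        ENNReal.ofReal (M ^ 2 * (c + 1)) := by
      intro m
      have h1 : ∀ z ∈ S m, Tendsto (fun k => ENNReal.ofReal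
          (‖(N k : ℂ)⁻¹ * ∑ i ∈ Finset.range (N k), φ (ζ i) * (z - ζ i)⁻¹‖ ^ 2)) atTop
          (𝓝 (ENNReal.ofReal (‖cauchyMeas ν φ z‖ ^ 2))) := by
        intro z hz
        refine (ENNReal.continuous_ofReal.tendsto _).comp (((hlim (fun w => φ w * (z - w)⁻¹)
          ?_).norm).pow 2)
        refine hφ.continuousOn.mul (ContinuousOn.inv₀ (by fun_prop) fun w hw h0 => ?_)
        rw [sub_eq_zero] at h0
        exact hSK m hz (h0 ▸ hw)
      calc _ = ∫⁻ z in S m, liminf (fun k => ENNReal.ofReal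
          (‖(N k : ℂ)⁻¹ * ∑ i ∈ Finset.range (N k), φ (ζ i) * (z - ζ i)⁻¹‖ ^ 2)) atTop :=
            setLIntegral_congr_fun (hSm m) fun z hz => (h1 z hz).liminf_eq.symm
        _ ≤ liminf (fun k => ∫⁻ z in S m, ENNReal.ofReal
          (‖(N k : ℂ)⁻¹ * ∑ i ∈ Finset.range (N k), φ (ζ i) * (z - ζ i)⁻¹‖ ^ 2)) atTop :=
            lintegral_liminf_le fun k => by fun_prop
        _ ≤ _ := by
            refine liminf_le_of_frequently_le' (Eventually.frequently ?_)
            have h2 : Tendsto (fun k => volume.real (ball (0 : ℂ) R) *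
                ((((m : ℝ) + 1)⁻¹)⁻¹) ^ 2 / (N k : ℝ)) atTop (𝓝 0) :=
              tendsto_const_nhds.div_atTop (tendsto_natCast_atTop_atTop.comp hN)
            filter_upwards [h2.eventually (gt_mem_nhds one_pos)] with k hk
            refine (lintegral_sq_average_le hε hε1 hζ hprod hρ1 hρ hR (by positivity) hM
              (hN0 k)).trans (ENNReal.ofReal_le_ofReal ?_)
            gcongr
    refine ⟨hcont.aestronglyMeasurable hmeas, ?_⟩
    rw [hasFiniteIntegral_iff_ofReal (.of_forall fun z => by positivity), ← hSU,
      setLIntegral_iUnion_of_directed _ hSmono.directed_le]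
    exact (iSup_le hbound).trans_lt ENNReal.ofReal_lt_top

section CauchyMeas

variable {K : Set ℂ}

theorem integrable_of_continuousOn_compact (hK : IsCompact K) (ν : Measure K) [IsFiniteMeasure ν]
    {g : ℂ → ℂ} (hg : ContinuousOn g K) : Integrable (fun ζ : K => g ζ) ν := by
  have : CompactSpace K := isCompact_iff_compactSpace.1 hK
  exact (continuousOn_iff_continuous_domRestrict.1 hg).integrable_of_hasCompactSupport
    (HasCompactSupport.of_compactSpace _)

theorem continuousOn_cauchy_integrand {φ : ℂ → ℂ} (hφ : Continuous φ) {z : ℂ} (hz : z ∉ K) :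
    ContinuousOn (fun ζ => φ ζ * (z - ζ)⁻¹) K := by
  refine hφ.continuousOn.mul (ContinuousOn.inv₀ (by fun_prop) fun w hw h0 => ?_)
  rw [sub_eq_zero] at h0
  exact hz (h0 ▸ hw)

theorem sub_mul_cauchyMeas (hK : IsCompact K) (ν : Measure K) [IsFiniteMeasure ν]
    {φ : ℂ → ℂ} (hφ : Continuous φ) {z : ℂ} (hz : z ∉ K) (c : ℂ) :
    (z - c) * cauchyMeas ν φ z =
      (∫ ζ : K, φ ζ ∂ν) + cauchyMeas ν (fun ζ => φ ζ * (ζ - c)) z := by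
  rw [cauchyMeas, cauchyMeas, ← integral_const_mul, ← integral_add
    (integrable_of_continuousOn_compact hK ν hφ.continuousOn)
    (integrable_of_continuousOn_compact hK ν
      (continuousOn_cauchy_integrand (φ := fun ζ => φ ζ * (ζ - c)) (by fun_prop) hz))]
  refine integral_congr_ae (.of_forall fun ζ => ?_)
  have : z - ζ ≠ 0 := fun h => hz (by rw [sub_eq_zero.1 h]; exact ζ.2)
  field_simp
  ring

theorem cauchyMeas_sub (hK : IsCompact K) (ν : Measure K) [IsFiniteMeasure ν]
    {φ ψ : ℂ → ℂ} (hφ : Continuous φ) (hψ : Continuous ψ) {z : ℂ} (hz : z ∉ K) :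
    cauchyMeas ν (fun ζ => φ ζ - ψ ζ) z = cauchyMeas ν φ z - cauchyMeas ν ψ z := by
  rw [cauchyMeas, cauchyMeas, cauchyMeas, ← integral_sub
    (integrable_of_continuousOn_compact hK ν (continuousOn_cauchy_integrand hφ hz))
    (integrable_of_continuousOn_compact hK ν (continuousOn_cauchy_integrand hψ hz))]
  simp only [sub_mul]

theorem cauchyMeas_congr (ν : Measure K) {φ ψ : ℂ → ℂ} (h : ∀ ζ ∈ K, φ ζ = ψ ζ) (z : ℂ) :
    cauchyMeas ν φ z = cauchyMeas ν ψ z :=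
  integral_congr_ae (.of_forall fun ζ => by simp only [h ζ ζ.2])

theorem cauchyMeas_const_mul (ν : Measure K) (φ : ℂ → ℂ) (c z : ℂ) :
    cauchyMeas ν (fun ζ => c * φ ζ) z = c * cauchyMeas ν φ z := by
  simp only [cauchyMeas, mul_assoc, integral_const_mul]

theorem exists_cauchyMeas_bound (hK : IsCompact K) (ν : Measure K) [IsProbabilityMeasure ν]
    {φ : ℂ → ℂ} (hφ : Continuous φ) :
    ∃ M > 0, ∃ ρ > 0, ∀ z, ρ ≤ ‖z‖ → z ∉ K ∧ ‖cauchyMeas ν φ z‖ ≤ M / (1 + ‖z‖) := by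
  obtain ⟨M, hM0, hM⟩ := exists_bound_on_compact hK hφ
  obtain ⟨ρ, hρ0, hρ⟩ : ∃ ρ : ℝ, 0 ≤ ρ ∧ ∀ ζ ∈ K, ‖ζ‖ ≤ ρ := by
    obtain ⟨ρ, hρ⟩ := hK.isBounded.exists_norm_le
    exact ⟨max ρ 0, le_max_right _ _, fun ζ hζ => (hρ ζ hζ).trans (le_max_left _ _)⟩
  refine ⟨2 * M, by positivity, 2 * ρ + 1, by positivity, fun z hz => ⟨fun hzK => ?_, ?_⟩⟩
  · linarith [hρ z hzK]
  have h1 : ∀ ζ : K, ‖φ ζ * (z - ζ)⁻¹‖ ≤ 2 * M / (1 + ‖z‖) := fun ζ => by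
    have h2 := norm_sub_norm_le z (ζ : ℂ)
    have h3 := hρ ζ ζ.2
    have h4 : (1 + ‖z‖) / 2 ≤ ‖z - ζ‖ := by linarith
    rw [norm_mul, norm_inv]
    calc _ ≤ M * ((1 + ‖z‖) / 2)⁻¹ := by
          gcongr
          exact hM ζ ζ.2
      _ = _ := by
          field_simp
  simpa [cauchyMeas] using norm_integral_le_of_norm_le_const (μ := ν) (.of_forall h1)

theorem tendsto_cauchyMeas (hK : IsCompact K) (ν : Measure K) [IsProbabilityMeasure ν]
    {φ : ℂ → ℂ} (hφ : Continuous φ) : Tendsto (cauchyMeas ν φ) (cocompact ℂ) (𝓝 0) := by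
  obtain ⟨M, hM, ρ, hρ, h⟩ := exists_cauchyMeas_bound hK ν hφ
  have h1 : Tendsto (fun z : ℂ => M / (1 + ‖z‖)) (cocompact ℂ) (𝓝 0) :=
    tendsto_const_nhds.div_atTop (tendsto_atTop_add_const_left _ _ (tendsto_norm_cocompact_atTop))
  refine squeeze_zero_norm' ?_ h1
  filter_upwards [(tendsto_norm_cocompact_atTop (E := ℂ)).eventually_ge_atTop ρ] with z hz
  exact (h z hz).2

theorem tendsto_sub_mul_cauchyMeas (hK : IsCompact K) (ν : Measure K) [IsProbabilityMeasure ν]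
    {φ : ℂ → ℂ} (hφ : Continuous φ) (c : ℂ) :
    Tendsto (fun z => (z - c) * cauchyMeas ν φ z) (cocompact ℂ) (𝓝 (∫ ζ : K, φ ζ ∂ν)) := by
  have h1 := (tendsto_cauchyMeas hK ν (φ := fun ζ => φ ζ * (ζ - c)) (by fun_prop)).const_add
    (∫ ζ : K, φ ζ ∂ν)
  rw [add_zero] at h1
  refine h1.congr' ?_
  filter_upwards [hK.compl_mem_cocompact] with z hz
  exact (sub_mul_cauchyMeas hK ν hφ hz c).symm

theorem cauchyMeas_mem_L2h (hK : IsCompact K) (ν : Measure K) [IsProbabilityMeasure ν]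
    {φ : ℂ → ℂ} (hφ : Continuous φ) (h0 : ∫ ζ : K, φ ζ ∂ν = 0)
    (hL : ∀ R : ℝ, IntegrableOn (fun z => ‖cauchyMeas ν φ z‖ ^ 2) (ball 0 R \ K)) :
    cauchyMeas ν φ ∈ L2h Kᶜ := by
  refine ⟨differentiableOn_cauchyMeas hK ν hφ, ?_⟩
  obtain ⟨M, hM, ρ, hρ, h⟩ := exists_cauchyMeas_bound hK ν (φ := fun ζ => φ ζ * (ζ - 0))
    (by fun_prop)
  have hR : Kᶜ ⊆ (ball 0 (max ρ 1) \ K) ∪ {z | max ρ 1 ≤ ‖z‖} := by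
    intro z hz
    by_cases h1 : ‖z‖ < max ρ 1
    · exact Or.inl ⟨mem_ball_zero_iff.2 h1, hz⟩
    · exact Or.inr (not_lt.1 h1)
  refine IntegrableOn.mono_set (IntegrableOn.union (hL _) ?_) hR
  have hmeas : MeasurableSet {z : ℂ | max ρ 1 ≤ ‖z‖} :=
    (isClosed_le continuous_const continuous_norm).measurableSet
  have hint : Integrable fun z : ℂ => (2 * M) ^ 2 * (1 + ‖z‖) ^ (-4 : ℝ) :=
    (integrable_one_add_norm (by simp; norm_num)).const_mul _
  refine hint.integrableOn.mono' ?_ ?_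
  · refine ContinuousOn.aestronglyMeasurable ?_ hmeas
    refine (((differentiableOn_cauchyMeas hK ν hφ).continuousOn.norm).pow 2).mono fun z hz => ?_
    exact (h z ((le_max_left _ _).trans hz)).1
  · refine (ae_restrict_iff' hmeas).2 (.of_forall fun z hz => ?_)
    obtain ⟨hzK, hb⟩ := h z ((le_max_left _ _).trans hz)
    have hz1 : 1 ≤ ‖z‖ := (le_max_right _ _).trans hz
    have h2 := sub_mul_cauchyMeas hK ν hφ hzK 0
    rw [h0, zero_add] at h2
    rw [← h2, sub_zero, norm_mul, le_div_iff₀ (by positivity)] at hb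
    have h3 : ‖cauchyMeas ν φ z‖ * (1 + ‖z‖) ^ 2 ≤ 2 * M := by
      have : ‖cauchyMeas ν φ z‖ * (1 + ‖z‖) ^ 2 ≤
          2 * (‖z‖ * ‖cauchyMeas ν φ z‖ * (1 + ‖z‖)) := by
        have := mul_nonneg (norm_nonneg (cauchyMeas ν φ z)) (by positivity : 0 ≤ 1 + ‖z‖)
        nlinarith
      linarith
    rw [Real.norm_of_nonneg (by positivity), Real.rpow_neg (by positivity),
      show (4 : ℝ) = (4 : ℕ) by norm_num, Real.rpow_natCast, ← div_eq_mul_inv,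
      le_div_iff₀ (by positivity)]
    calc _ = (‖cauchyMeas ν φ z‖ * (1 + ‖z‖) ^ 2) ^ 2 := by ring
      _ ≤ _ := by gcongr

/-- Division of a density by `q - ζ`. -/
theorem exists_continuous_div (hK : IsCompact K) {φ : ℂ → ℂ} (hφ : Continuous φ) {q : ℂ}
    (hq : q ∉ K) : ∃ ψ : ℂ → ℂ, Continuous ψ ∧ ∀ ζ ∈ K, ψ ζ = φ ζ * (q - ζ)⁻¹ := by
  obtain ⟨δ, hδ, hδK⟩ := isOpen_iff.1 hK.isClosed.isOpen_compl q hq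
  refine ⟨fun ζ => φ ζ * (conj (q - ζ) * ((max (‖q - ζ‖ ^ 2) (δ ^ 2))⁻¹ : ℝ)), ?_, ?_⟩
  · have : Continuous fun ζ : ℂ => (max (‖q - ζ‖ ^ 2) (δ ^ 2))⁻¹ :=
      Continuous.inv₀ (by fun_prop) fun ζ => (lt_max_of_lt_right (by positivity)).ne'
    exact hφ.mul ((Complex.continuous_conj.comp (by fun_prop)).mul
      (Complex.continuous_ofReal.comp this))
  · intro ζ hζ
    have : δ ≤ ‖q - ζ‖ := by
      by_contra hc
      exact hδK (show ζ ∈ ball q δ by rwa [mem_ball, dist_comm, dist_eq_norm, ← not_le]) hζ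
    simp only
    rw [max_eq_left (by gcongr), Complex.inv_def, Complex.normSq_eq_norm_sq]

/-- A function holomorphic off a compact set `K` that extends over `K` is constant if it has a
limit at infinity. -/
theorem eq_of_extension {Δ : Set ℂ} (hK : IsCompact K) (hΔ : IsOpen Δ) (hKΔ : K ⊆ Δ)
    {h g : ℂ → ℂ} (hh : DifferentiableOn ℂ h Kᶜ) (hg : DifferentiableOn ℂ g Δ)
    (hgh : ∀ z ∈ Δ \ K, g z = h z) {L : ℂ} (hL : Tendsto h (cocompact ℂ) (𝓝 L)) :
    ∀ z ∉ K, h z = L := by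
  classical
  set F : ℂ → ℂ := fun z => if z ∈ Δ then g z else h z with hF
  have hFh : ∀ z ∉ K, F z = h z := fun z hz => by
    by_cases hzΔ : z ∈ Δ
    · simp only [hF, hzΔ, if_true, hgh z ⟨hzΔ, hz⟩]
    · simp only [hF, hzΔ, if_false]
  have hd : Differentiable ℂ F := by
    intro z
    by_cases hz : z ∈ K
    · refine ((hg.differentiableAt (hΔ.mem_nhds (hKΔ hz)))).congr_of_eventuallyEq ?_
      filter_upwards [hΔ.mem_nhds (hKΔ hz)] with w hw
      simp only [hF, hw, if_true]
    · have hn := hK.isClosed.isOpen_compl.mem_nhds hz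
      refine (hh.differentiableAt hn).congr_of_eventuallyEq ?_
      filter_upwards [hn] with w hw
      exact hFh w hw
  have hFL : Tendsto F (cocompact ℂ) (𝓝 L) := by
    refine hL.congr' ?_
    filter_upwards [hK.compl_mem_cocompact] with z hz
    exact (hFh z hz).symm
  intro z hz
  rw [← hFh z hz]
  exact hd.apply_eq_of_tendsto_cocompact z hFL

end CauchyMeas

/-- Square integrable functions off a compact set of positive capacity have no common zero. -/
theorem CapPos.exists_ne_zero {K : Set ℂ} (hK : IsCompact K) (h : CapPos K) {q : ℂ} (hq : q ∉ K) :
    ∃ f ∈ L2h Kᶜ, f q ≠ 0 := by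
  obtain ⟨ν, hν, hvar, hL⟩ := h.exists_measure hK
  have hint : ∀ {g : ℂ → ℂ}, Continuous g → Integrable (fun ζ : K => g ζ) ν := fun hg =>
    integrable_of_continuousOn_compact hK ν hg.continuousOn
  set c : ℂ := ∫ ζ : K, (ζ : ℂ) ∂ν with hc
  have hc0 : ∫ ζ : K, ((ζ : ℂ) - c) ∂ν = 0 := by
    rw [integral_sub (f := fun ζ : K => (ζ : ℂ)) (hint continuous_id) (integrable_const _), ← hc]
    simp
  have hc1 : ∫ ζ : K, conj ((ζ : ℂ) - c) ∂ν = 0 := by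
    rw [integral_conj, hc0, map_zero]
  set V : ℂ := ∫ ζ : K, (((‖(ζ : ℂ) - c‖ ^ 2 : ℝ)) : ℂ) ∂ν with hV
  have hV0 : V ≠ 0 := hvar c
  set β : ℂ := (q - c) / V with hβ
  set φ : ℂ → ℂ := fun ζ => (q - ζ) * (1 + β * conj (ζ - c)) with hφ
  have hcc : Continuous fun ζ : ℂ => conj (ζ - c) := Complex.continuous_conj.comp (by fun_prop)
  have hφc : Continuous φ := by fun_prop
  have h0 : ∫ ζ : K, φ ζ ∂ν = 0 := by
    have h1 : ∀ ζ : K, φ ζ = (q - c) - ((ζ : ℂ) - c) + (q - c) * β * conj ((ζ : ℂ) - c) -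
        β * (((‖(ζ : ℂ) - c‖ ^ 2 : ℝ)) : ℂ) := by
      intro ζ
      rw [Complex.ofReal_pow, ← Complex.mul_conj']
      simp only [hφ]
      ring
    simp only [h1]
    have i1 : Integrable (fun ζ : K => (q - c) - ((ζ : ℂ) - c)) ν :=
      hint (g := fun ζ => (q - c) - (ζ - c)) (by fun_prop)
    have i2 : Integrable (fun ζ : K => (q - c) * β * conj ((ζ : ℂ) - c)) ν :=
      (hint hcc).const_mul _
    have i3 : Integrable (fun ζ : K => β * (((‖(ζ : ℂ) - c‖ ^ 2 : ℝ)) : ℂ)) ν :=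
      (hint (g := fun ζ => (((‖ζ - c‖ ^ 2 : ℝ)) : ℂ)) (by fun_prop)).const_mul _
    have i4 : Integrable (fun ζ : K => (ζ : ℂ) - c) ν := hint (g := fun ζ => ζ - c) (by fun_prop)
    rw [integral_sub (f := fun ζ : K => (q - c) - ((ζ : ℂ) - c) +
        (q - c) * β * conj ((ζ : ℂ) - c)) (i1.add i2) i3, integral_add i1 i2, integral_sub (integrable_const _) i4,
      integral_const_mul, integral_const_mul, hc0, hc1, ← hV, hβ]
    simp
    field_simp
    ring
  refine ⟨cauchyMeas ν φ, cauchyMeas_mem_L2h hK ν hφc h0 (hL φ hφc), ?_⟩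
  have h2 : cauchyMeas ν φ q = ∫ ζ : K, (1 + β * conj ((ζ : ℂ) - c)) ∂ν := by
    refine integral_congr_ae (.of_forall fun ζ => ?_)
    have : q - ζ ≠ 0 := fun h => hq (by rw [sub_eq_zero.1 h]; exact ζ.2)
    simp only [hφ]
    field_simp
  rw [h2, integral_add (integrable_const _) ((hint hcc).const_mul _), integral_const_mul, hc1]
  simp

/-- Not all square integrable functions off a compact set of positive capacity extend across it. -/
theorem CapPos.exists_not_extend {K : Set ℂ} (hK : IsCompact K) (h : CapPos K) {Δ : Set ℂ}
    (hΔ : IsOpen Δ) (hΔc : IsPreconnected Δ) (hKΔ : K ⊆ Δ) {a : ℂ} (ha : a ∈ Δ) (haK : a ∉ K) :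
    ∃ f ∈ L2h Kᶜ, ¬ ∃ g, DifferentiableOn ℂ g Δ ∧ g =ᶠ[𝓝 a] f := by
  obtain ⟨ν, hν, hvar, hL⟩ := h.exists_measure hK
  by_contra! hcon
  have hint : ∀ {g : ℂ → ℂ}, Continuous g → Integrable (fun ζ : K => g ζ) ν := fun hg =>
    integrable_of_continuousOn_compact hK ν hg.continuousOn
  have haK' : Kᶜ ∈ 𝓝 a := hK.isClosed.isOpen_compl.mem_nhds haK
  set H : ℂ → ℂ := cauchyMeas ν fun _ => 1
  have huniq : ∀ {g₁ g₂ : ℂ → ℂ}, DifferentiableOn ℂ g₁ Δ → DifferentiableOn ℂ g₂ Δ →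
      g₁ =ᶠ[𝓝 a] g₂ → EqOn g₁ g₂ Δ := fun h₁ h₂ h₁₂ =>
    (h₁.analyticOnNhd hΔ).eqOn_of_preconnected_of_eventuallyEq (h₂.analyticOnNhd hΔ) hΔc ha h₁₂
  have hHd : DifferentiableOn ℂ H Kᶜ := differentiableOn_cauchyMeas hK ν continuous_const
  have key : ∀ φ : ℂ → ℂ, Continuous φ → ∀ q ∉ K, ∃ G : ℂ → ℂ, DifferentiableOn ℂ G Δ ∧
      (G =ᶠ[𝓝 a] fun z => cauchyMeas ν φ z + cauchyMeas ν φ q * (z - q) * H z) ∧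
      G q = cauchyMeas ν φ q := by
    intro φ hφ q hq
    obtain ⟨ψ, hψ, hψφ⟩ := exists_continuous_div hK hφ hq
    set lam := cauchyMeas ν φ q
    have hψint : ∫ ζ : K, ψ ζ ∂ν = lam :=
      integral_congr_ae (.of_forall fun ζ => hψφ ζ ζ.2)
    have hc : Continuous fun ζ => ψ ζ - lam * 1 := by fun_prop
    have h0 : ∫ ζ : K, (ψ ζ - lam * 1) ∂ν = 0 := by
      rw [integral_sub (hint hψ) (integrable_const _), hψint]
      simp
    obtain ⟨g, hg, hgf⟩ := hcon _ (cauchyMeas_mem_L2h hK ν hc h0 (hL _ hc))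
    refine ⟨fun z => lam - (z - q) * g z, by fun_prop, ?_, by simp⟩
    filter_upwards [hgf, haK'] with z hz hzK
    rw [hz, cauchyMeas_sub hK ν hψ (by fun_prop) hzK, cauchyMeas_const_mul, mul_sub,
      sub_mul_cauchyMeas hK ν hψ hzK q, hψint,
      cauchyMeas_congr ν (φ := fun ζ => ψ ζ * (ζ - q)) (ψ := fun ζ => (-1) * φ ζ) ?_,
      cauchyMeas_const_mul]
    · ring
    · intro ζ hζ
      have : q - ζ ≠ 0 := fun h => hq (by rw [sub_eq_zero.1 h]; exact hζ)
      rw [hψφ ζ hζ]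
      field_simp
      ring
  have hlimH : Tendsto (fun z => (z - 0) * H z) (cocompact ℂ) (𝓝 1) := by
    simpa using tendsto_sub_mul_cauchyMeas hK ν (φ := fun _ => 1) continuous_const 0
  have hHne : ∃ q ∉ K, H q ≠ 0 := by
    by_contra! h0
    have : Tendsto (fun z => (z - 0) * H z) (cocompact ℂ) (𝓝 0) := by
      refine tendsto_const_nhds.congr' ?_
      filter_upwards [hK.compl_mem_cocompact] with z hz
      rw [h0 z hz, mul_zero]
    exact one_ne_zero (tendsto_nhds_unique hlimH this)
  obtain ⟨q₀, hq₀, hHq₀⟩ := hHne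
  by_cases hdet : ∀ q ∉ K, H q - H q₀ + H q * H q₀ * (q - q₀) = 0
  · set c := q₀ - (H q₀)⁻¹ with hc
    have hpole : ∀ q ∉ K, (q - c) * H q = 1 := fun q hq => by
      have h1 : H q₀ * ((q - c) * H q) = H q₀ * 1 := by
        rw [hc, sub_sub_eq_add_sub, add_sub_right_comm, add_mul, mul_add, ← mul_assoc (H q₀),
          ← mul_assoc (H q₀) _ (H q), mul_inv_cancel₀ hHq₀]
        linear_combination hdet q hq
      exact mul_left_cancel₀ hHq₀ h1
    set φ : ℂ → ℂ := fun ζ => conj (ζ - c) with hφ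
    have hφc : Continuous φ := Complex.continuous_conj.comp (by fun_prop)
    have hφc' : Continuous fun ζ => φ ζ * (ζ - c) := by fun_prop
    obtain ⟨G₀, hG₀, hG₀a, -⟩ := key φ hφc q₀ hq₀
    set g : ℂ → ℂ := fun z => (z - c) * G₀ z - cauchyMeas ν φ q₀ * (z - q₀) with hg
    have hgd : DifferentiableOn ℂ g Δ := by fun_prop
    have hga : g =ᶠ[𝓝 a] fun z => (z - c) * cauchyMeas ν φ z := by
      filter_upwards [hG₀a, haK'] with z hz hzK
      simp only [hg, hz]
      linear_combination cauchyMeas ν φ q₀ * (z - q₀) * hpole z hzK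
    have hgq : ∀ q ∈ Δ \ K, g q = (q - c) * cauchyMeas ν φ q := by
      rintro q ⟨hqΔ, hqK⟩
      obtain ⟨G, hG, hGa, hGq⟩ := key φ hφc q hqK
      have h1 : EqOn (fun z => (z - c) * G z) (fun z => g z + cauchyMeas ν φ q * (z - q)) Δ := by
        refine huniq (by fun_prop) (by fun_prop) ?_
        filter_upwards [hGa, hga, haK'] with z hz hz' hzK
        rw [hz, hz']
        linear_combination cauchyMeas ν φ q * (z - q) * hpole z hzK
      have h2 := h1 hqΔ
      simp only [sub_self, mul_zero, add_zero, hGq] at h2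
      exact h2.symm
    have hconst := eq_of_extension hK hΔ hKΔ
      (h := fun z => (z - c) * cauchyMeas ν φ z)
      (DifferentiableOn.mul (by fun_prop) (differentiableOn_cauchyMeas hK ν hφc)) hgd hgq
      (tendsto_sub_mul_cauchyMeas hK ν hφc c)
    refine hvar c ?_
    have h3 := tendsto_sub_mul_cauchyMeas hK ν hφc' 0
    have h4 : Tendsto (fun z => (z - 0) * cauchyMeas ν (fun ζ => φ ζ * (ζ - c)) z) (cocompact ℂ)
        (𝓝 0) := by
      refine tendsto_const_nhds.congr' ?_
      filter_upwards [hK.compl_mem_cocompact] with z hz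
      have h5 := sub_mul_cauchyMeas hK ν hφc hz c
      rw [hconst z hz, left_eq_add] at h5
      rw [h5, mul_zero]
    rw [← tendsto_nhds_unique h3 h4]
    refine integral_congr_ae (.of_forall fun ζ => ?_)
    simp only [hφ]
    rw [mul_comm, Complex.mul_conj', Complex.ofReal_pow]
  · push Not at hdet
    obtain ⟨q₁, hq₁, hd⟩ := hdet
    obtain ⟨G₀, hG₀, hG₀a, -⟩ := key _ continuous_const q₀ hq₀
    obtain ⟨G₁, hG₁, hG₁a, -⟩ := key _ continuous_const q₁ hq₁
    set d := H q₁ - H q₀ + H q₁ * H q₀ * (q₁ - q₀) with hdd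
    set g : ℂ → ℂ := fun z => d⁻¹ * (H q₁ * G₀ z - H q₀ * G₁ z) with hg
    have hgd : DifferentiableOn ℂ g Δ := by fun_prop
    have hga : g =ᶠ[𝓝 a] H := by
      filter_upwards [hG₀a, hG₁a] with z hz₀ hz₁
      simp only [hg]
      rw [inv_mul_eq_iff_eq_mul₀ hd, hz₀, hz₁, hdd]
      ring
    have hgq : ∀ q ∈ Δ \ K, g q = H q := by
      rintro q ⟨hqΔ, hqK⟩
      obtain ⟨G, hG, hGa, hGq⟩ := key _ continuous_const q hqK
      have h1 : EqOn G (fun z => g z + H q * (z - q) * g z) Δ := by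
        refine huniq hG (by fun_prop) ?_
        filter_upwards [hGa, hga] with z hz hz'
        rw [hz, hz']
      have h2 := h1 hqΔ
      simp only [sub_self, mul_zero, zero_mul, add_zero, hGq] at h2
      exact h2.symm
    have hconst := eq_of_extension hK hΔ hKΔ hHd hgd hgq (tendsto_cauchyMeas hK ν continuous_const)
    exact hHq₀ (hconst q₀ hq₀)

theorem contDiff_normSq_sub (z₀ : ℂ) : ContDiff ℝ ∞ fun z : ℂ => ‖z - z₀‖ ^ 2 :=
  (contDiff_id.sub contDiff_const).norm_sq ℝ

theorem hasW_normSq_sub (z₀ z : ℂ) :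
    HasW (fun z => ((‖z - z₀‖ ^ 2 : ℝ) : ℂ)) (conj (z - z₀)) (z - z₀) z := by
  have h1 : HasW (fun z => z - z₀) 1 0 z :=
    ((HasW.id z).sub (HasW.const z₀ z)).congr' (by simp) (by simp)
  have h2 := h1.mul h1.star_conj
  refine (h2.congr' (by simp) (by simp)).congr_of_eventuallyEq (.of_forall fun w => ?_)
  simp only [Complex.mul_conj']
  push_cast
  rfl

section Radial

variable {F F₁ F₂ : ℝ → ℝ} (z₀ : ℂ)

theorem hasW_radial (hF : ∀ t, 0 ≤ t → HasDerivAt F (F₁ t) t) (z : ℂ) :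
    HasW (fun z => ((F (‖z - z₀‖ ^ 2) : ℝ) : ℂ)) (F₁ (‖z - z₀‖ ^ 2) * conj (z - z₀))
      (F₁ (‖z - z₀‖ ^ 2) * (z - z₀)) z :=
  HasW.comp_real (u := fun z => ‖z - z₀‖ ^ 2) (hF _ (by positivity)) (hasW_normSq_sub z₀ z)

theorem dzb_radial (hF : ∀ t, 0 ≤ t → HasDerivAt F (F₁ t) t) (z : ℂ) :
    dzb (fun z => ((F (‖z - z₀‖ ^ 2) : ℝ) : ℂ)) z = F₁ (‖z - z₀‖ ^ 2) * (z - z₀) :=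
  (hasW_radial z₀ hF z).dzb_eq

theorem qlap_radial (hF : ∀ t, 0 ≤ t → HasDerivAt F (F₁ t) t)
    (hF₁ : ∀ t, 0 ≤ t → HasDerivAt F₁ (F₂ t) t) (z : ℂ) :
    qlap (fun z => F (‖z - z₀‖ ^ 2)) z =
      F₂ (‖z - z₀‖ ^ 2) * ‖z - z₀‖ ^ 2 + F₁ (‖z - z₀‖ ^ 2) := by
  have h1 : dz (fun z => ((F (‖z - z₀‖ ^ 2) : ℝ) : ℂ)) =
      fun z => F₁ (‖z - z₀‖ ^ 2) * conj (z - z₀) := by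
    ext w
    exact (hasW_radial z₀ hF w).dz_eq
  have h2 : HasW (fun z => conj (z - z₀)) 0 1 z :=
    (((HasW.id z).sub (HasW.const z₀ z)).star_conj).congr' (by simp) (by simp)
  have h3 := (hasW_radial z₀ hF₁ z).mul h2
  rw [qlap, h1, h3.dzb_eq, mul_assoc, Complex.mul_conj']
  norm_cast
  simp

end Radial

/-- The first weight. -/
theorem qlap_log_one_add (B : ℝ) (z₀ z : ℂ) :
    qlap (fun z => B * Real.log (1 + ‖z - z₀‖ ^ 2)) z = B / (1 + ‖z - z₀‖ ^ 2) ^ 2 := by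
  have h := qlap_radial (F := fun t => B * Real.log (1 + t)) (F₁ := fun t => B / (1 + t))
    (F₂ := fun t => -B / (1 + t) ^ 2) z₀ (fun t ht => ?_) (fun t ht => ?_) z
  · rw [h]
    field_simp
    ring
  · have := ((hasDerivAt_id t).const_add 1).log (by simp only [id]; positivity)
    exact (this.const_mul B).congr_deriv (by simp [div_eq_mul_inv])
  · have := ((hasDerivAt_id t).const_add 1).inv (by simp only [id]; positivity)
    refine (this.const_mul B).congr_deriv ?_
    simp only [id]
    ring

/-- The regularized logarithmic pole. -/
noncomputable def poleWeight (e : ℝ) (z₀ z : ℂ) : ℝ :=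
  Real.log (1 + (‖z - z₀‖ ^ 2 + e) ^ 2) / 2 - Real.log (‖z - z₀‖ ^ 2 + e)

theorem hasDerivAt_poleWeight_aux {e t : ℝ} (he : 0 < e) (ht : 0 ≤ t) :
    HasDerivAt (fun t => Real.log (1 + (t + e) ^ 2) / 2 - Real.log (t + e))
      ((t + e) / (1 + (t + e) ^ 2) - (t + e)⁻¹) t ∧
    HasDerivAt (fun t => (t + e) / (1 + (t + e) ^ 2) - (t + e)⁻¹)
      ((1 - (t + e) ^ 2) / (1 + (t + e) ^ 2) ^ 2 + ((t + e) ^ 2)⁻¹) t := by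
  have h1 : HasDerivAt (fun t => t + e) 1 t := (hasDerivAt_id t).add_const e
  have h2 : HasDerivAt (fun t => 1 + (t + e) ^ 2) (2 * (t + e)) t :=
    ((h1.pow 2).const_add 1).congr_deriv (by simp)
  have h3 : t + e ≠ 0 := by positivity
  have h4 : 1 + (t + e) ^ 2 ≠ 0 := by positivity
  refine ⟨(((h2.log h4).div_const 2).sub (h1.log h3)).congr_deriv ?_,
    ((h1.div h2 h4).sub (h1.inv h3)).congr_deriv ?_⟩
  · field_simp
  · field_simp
    ring

theorem contDiff_poleWeight {e : ℝ} (he : 0 < e) (z₀ : ℂ) : ContDiff ℝ ∞ (poleWeight e z₀) := by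
  have h := contDiff_normSq_sub z₀
  refine ContDiff.sub (ContDiff.div_const (ContDiff.log (by fun_prop) fun z => ?_) 2)
    (ContDiff.log (by fun_prop) fun z => ?_) <;> positivity

theorem poleWeight_bounds {e : ℝ} (he : 0 < e) (he1 : e ≤ 1) (z₀ z : ℂ) :
    0 ≤ poleWeight e z₀ z ∧ poleWeight e z₀ z ≤ (‖z - z₀‖ ^ 2 + e)⁻¹ ∧
    ‖dzb (fun z => (poleWeight e z₀ z : ℂ)) z‖ =
      ‖z - z₀‖ / ((‖z - z₀‖ ^ 2 + e) * (1 + (‖z - z₀‖ ^ 2 + e) ^ 2)) ∧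
    e / (‖z - z₀‖ ^ 2 + e) ^ 2 ≤ -qlap (poleWeight e z₀) z +
      8 * ((1 + ‖z - z₀‖ ^ 2) ^ 3)⁻¹ + e := by
  set t := ‖z - z₀‖ ^ 2 with ht
  set τ := t + e with hτ
  have hτ0 : 0 < τ := by positivity
  have hw : poleWeight e z₀ z = Real.log (1 + τ ^ 2) / 2 - Real.log τ := rfl
  have e1 := dzb_radial z₀ (fun t ht => (hasDerivAt_poleWeight_aux he ht).1) z
  have e2 := qlap_radial z₀ (fun t ht => (hasDerivAt_poleWeight_aux he ht).1)
    (fun t ht => (hasDerivAt_poleWeight_aux he ht).2) z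
  rw [← ht, ← hτ] at e1 e2
  refine ⟨?_, ?_, ?_, ?_⟩
  · have : Real.log (τ ^ 2) ≤ Real.log (1 + τ ^ 2) :=
      Real.log_le_log (by positivity) (by linarith)
    rw [Real.log_pow] at this
    push_cast at this
    rw [hw]
    linarith
  · have h1 : Real.log (1 + τ ^ 2) ≤ Real.log ((1 + τ) ^ 2) :=
      Real.log_le_log (by positivity) (by nlinarith)
    have h2 := Real.log_le_sub_one_of_pos (show 0 < (1 + τ) / τ by positivity)
    rw [Real.log_div (by positivity) hτ0.ne'] at h2
    rw [Real.log_pow] at h1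
    push_cast at h1
    have h3 : (1 + τ) / τ - 1 = τ⁻¹ := by field_simp; ring
    rw [hw]
    linarith
  · change dzb (fun z => (poleWeight e z₀ z : ℂ)) z = _ at e1
    rw [e1, norm_mul, Complex.norm_real]
    have : τ / (1 + τ ^ 2) - τ⁻¹ = -(τ * (1 + τ ^ 2))⁻¹ := by
      field_simp
      ring
    rw [this, norm_neg, Real.norm_of_nonneg (by positivity)]
    field_simp
  · change qlap (poleWeight e z₀) z = _ at e2
    have h1 : e / τ ^ 2 + qlap (poleWeight e z₀) z = (t + τ + e * τ ^ 2) / (1 + τ ^ 2) ^ 2 := by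
      rw [e2, show t = τ - e by rw [hτ]; ring]
      field_simp
      ring
    have h2 : (t + τ) / (1 + τ ^ 2) ^ 2 ≤ 8 * ((1 + t) ^ 3)⁻¹ := by
      rw [div_le_iff₀ (by positivity), mul_assoc, mul_comm _ (_ ^ 2), ← mul_assoc,
        ← div_eq_mul_inv, le_div_iff₀ (by positivity)]
      have h3 : (1 + τ) ^ 2 ≤ 2 * (1 + τ ^ 2) := by nlinarith [sq_nonneg (τ - 1)]
      calc (t + τ) * (1 + t) ^ 3 ≤ (2 * (1 + τ)) * (1 + τ) ^ 3 := by
            gcongr <;> linarith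
        _ = 2 * ((1 + τ) ^ 2) ^ 2 := by ring
        _ ≤ 2 * (2 * (1 + τ ^ 2)) ^ 2 := by gcongr
        _ = _ := by ring
    have h5 : e * τ ^ 2 / (1 + τ ^ 2) ^ 2 ≤ e := by
      rw [div_le_iff₀ (by positivity)]
      gcongr
      nlinarith [sq_nonneg τ]
    rw [add_div] at h1
    linarith

theorem BSub.eventually_exp_mean {v : ℂ → ℝ} {Ω : Set ℂ} (hv : BSub v Ω) {z : ℂ} (hz : z ∈ Ω) :
    ∃ s > 0, ball z s ⊆ Ω ∧ ∀ r, 0 < r → r < s → IntegrableOn (fun ζ => Real.exp (v ζ)) (ball z r) ∧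
      Real.exp (v z) * (Real.pi * r ^ 2) ≤ ∫ ζ in ball z r, Real.exp (v ζ) := by
  obtain ⟨s, hs, hsub⟩ := hv.submean z hz
  obtain ⟨U, V, C, hU, hzU, hUΩ, hVm, hC, hE⟩ :=
    hv.exists_nhd_ext (isCompact_singleton (x := z)) (by simpa using hz)
  obtain ⟨s', hs', hs'U⟩ := isOpen_iff.1 hU z (hzU rfl)
  refine ⟨min s s', by positivity, (ball_subset_ball (min_le_right _ _)).trans (hs'U.trans hUΩ),
    fun r hr hrs => ?_⟩
  have hrU : ball z r ⊆ U :=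
    (ball_subset_ball (hrs.le.trans (min_le_right _ _))).trans hs'U
  have hfin : volume (ball z r) ≠ ⊤ := measure_ball_lt_top.ne
  have hbi : ∀ {g : ℂ → ℝ} {M : ℝ}, Measurable g → (∀ z, |g z| ≤ M) → IntegrableOn g (ball z r) :=
    fun hg hM => Measure.integrableOn_of_bounded hfin hg.aestronglyMeasurable
      (.of_forall hM)
  have i1 : IntegrableOn (fun ζ => Real.exp (v ζ)) (ball z r) := by
    refine IntegrableOn.congr_fun (f := fun ζ => Real.exp (V ζ)) (hbi (M := Real.exp C)
      (Real.measurable_exp.comp hVm) fun ζ => ?_) (fun ζ hζ => by simp only [hE (hrU hζ)])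
      measurableSet_ball
    rw [abs_of_pos (Real.exp_pos _)]
    exact Real.exp_le_exp.2 (abs_le.1 (hC ζ)).2
  have i2 : IntegrableOn v (ball z r) :=
    IntegrableOn.congr_fun (f := V) (hbi hVm hC) (fun ζ hζ => hE (hrU hζ)) measurableSet_ball
  refine ⟨i1, ?_⟩
  have h1 := integral_ball_ge_of_submean i2 fun r' hr' hr'r => by
    refine ⟨hv.circleIntegrable ?_, hsub z (mem_ball_self hs) r' hr'
      (hr'r.trans (hrs.trans_le (min_le_left _ _)))⟩
    rw [abs_of_pos hr']
    exact fun ζ hζ => hUΩ (hrU (by rw [mem_ball, mem_sphere.1 hζ]; exact hr'r))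
  have hvol : (volume (ball z r)).toReal = Real.pi * r ^ 2 := by
    rw [Complex.volume_ball]
    simp [hr.le, mul_comm]
  rw [hvol] at h1
  have i3 : IntegrableOn (fun ζ => Real.exp (v z) * (1 - v z) + Real.exp (v z) * v ζ) (ball z r) :=
    Integrable.add (integrableOn_const hfin) (i2.const_mul _)
  have i0 : IntegrableOn (fun _ : ℂ => Real.exp (v z) * (1 - v z)) (ball z r) :=
    integrableOn_const hfin
  have i2' : IntegrableOn (fun ζ => Real.exp (v z) * v ζ) (ball z r) := i2.const_mul _
  calc _ ≤ ∫ ζ in ball z r, (Real.exp (v z) * (1 - v z) + Real.exp (v z) * v ζ) := by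
        rw [integral_add (f := fun _ => Real.exp (v z) * (1 - v z))
          (g := fun ζ => Real.exp (v z) * v ζ) i0 i2', setIntegral_const,
          integral_const_mul, measureReal_def, hvol, smul_eq_mul]
        nlinarith [mul_le_mul_of_nonneg_left h1 (Real.exp_pos (v z)).le]
    _ ≤ _ := by
        refine setIntegral_mono i3 i1 fun ζ => ?_
        have := Real.add_one_le_exp (v ζ - v z)
        have h2 : Real.exp (v ζ) = Real.exp (v z) * Real.exp (v ζ - v z) := by
          rw [← Real.exp_add]; ring_nf
        simp only [h2]
        nlinarith [Real.exp_pos (v z)]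

theorem integral_weight_le_of_comparison {u v : ℂ → ℝ} {D : Set ℂ} (hv : BSub v D) (hu : BSub u D)
    {A C₁ : ℝ} (hA : 0 < A) (z₀ : ℂ)
    (h : ∀ z ∈ D, |u z - v z + A / 2 * Real.log (1 + ‖z - z₀‖ ^ 2)| ≤ C₁) :
    ∃ C ≥ 0, ∃ N : ℝ, ∀ a ≥ N, ∀ b : ℂ → ℂ, ContDiff ℝ ∞ b → HasCompactSupport b →
      tsupport b ⊆ D →
      ∫ z, ((1 + ‖z - z₀‖ ^ 2) ^ 3)⁻¹ * ‖b z‖ ^ 2 * Real.exp (a * v z) ≤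
        C * ∫ z, (1 + ‖z - z₀‖ ^ 2)⁻¹ * ‖dzb b z‖ ^ 2 * Real.exp (a * v z) := by
  set N : ℝ := 4 / A with hN
  have hN0 : 0 ≤ N := by positivity
  refine ⟨Real.exp (2 * (N * C₁)), (Real.exp_pos _).le, N, fun a ha b hb hbc hbD => ?_⟩
  have hv' := (hv.const_mul (sub_nonneg.2 ha)).add (hu.const_mul hN0)
  have hσ : ContDiff ℝ ∞ fun z : ℂ => 1 * Real.log (1 + ‖z - z₀‖ ^ 2) :=
    contDiff_const.mul (ContDiff.log (contDiff_const.add (contDiff_normSq_sub z₀))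
      fun z => by positivity)
  have key := hv'.basic_inequality (w := fun _ => 1) contDiff_const hσ hb hbc hbD
    (fun _ _ => zero_le_one)
  have hd : ∀ z, dzb (fun _ => ((1 : ℝ) : ℂ)) z = 0 := fun z => (HasW.const _ z).dzb_eq
  have hq : ∀ z : ℂ, qlap (fun _ => 1) z = 0 := fun z => by
    have : dz (fun _ => ((1 : ℝ) : ℂ)) = fun _ => 0 := by
      ext w; exact (HasW.const _ w).dz_eq
    rw [qlap, this, (HasW.const _ z).dzb_eq, Complex.zero_re]
  have hl : ∀ z, qlap (fun z => Real.log (1 + ‖z - z₀‖ ^ 2)) z = 1 / (1 + ‖z - z₀‖ ^ 2) ^ 2 :=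
    fun z => by simpa only [one_mul] using qlap_log_one_add 1 z₀ z
  simp only [hd, hq, norm_zero, zero_mul, integral_zero, mul_zero, add_zero,
    sub_zero, one_mul, hl] at key
  have hva := hv.const_mul (hN0.trans ha)
  have ht0 : ∀ z : ℂ, 0 < 1 + ‖z - z₀‖ ^ 2 := fun z => by positivity
  have hlog : ∀ z, Real.exp (Real.log (1 + ‖z - z₀‖ ^ 2)) = 1 + ‖z - z₀‖ ^ 2 := fun z =>
    Real.exp_log (ht0 z)
  have hct : Continuous fun z : ℂ => 1 + ‖z - z₀‖ ^ 2 := by fun_prop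
  have hexp : ∀ z ∈ D, Real.exp (-(N * C₁)) * ((1 + ‖z - z₀‖ ^ 2)⁻¹ * Real.exp (a * v z)) ≤
      Real.exp ((a - N) * v z + N * u z + Real.log (1 + ‖z - z₀‖ ^ 2)) ∧
      Real.exp ((a - N) * v z + N * u z + Real.log (1 + ‖z - z₀‖ ^ 2)) ≤
      Real.exp (N * C₁) * ((1 + ‖z - z₀‖ ^ 2)⁻¹ * Real.exp (a * v z)) := fun z hz => by
    have e1 : (1 + ‖z - z₀‖ ^ 2)⁻¹ = Real.exp (-Real.log (1 + ‖z - z₀‖ ^ 2)) := by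
      rw [Real.exp_neg, hlog]
    obtain ⟨h1, h2⟩ := abs_le.1 (h z hz)
    have e2 : (a - N) * v z + N * u z + Real.log (1 + ‖z - z₀‖ ^ 2) =
        N * (u z - v z + A / 2 * Real.log (1 + ‖z - z₀‖ ^ 2)) +
          (-Real.log (1 + ‖z - z₀‖ ^ 2) + a * v z) := by
      have : N * (A / 2) = 2 := by rw [hN]; field_simp; norm_num
      linear_combination Real.log (1 + ‖z - z₀‖ ^ 2) * (-this)
    rw [e1, ← Real.exp_add, ← Real.exp_add, ← Real.exp_add, e2]
    refine ⟨Real.exp_le_exp.2 ?_, Real.exp_le_exp.2 ?_⟩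
    · nlinarith
    · nlinarith
  have hb0 := hb.continuous
  have hcb := hb.dzb_smooth.continuous
  have hout : ∀ z ∉ D, b z = 0 ∧ dzb b z = 0 := fun z hz =>
    ⟨image_eq_zero_of_notMem_tsupport fun h => hz (hbD h),
      image_eq_zero_of_notMem_tsupport fun h => hz (hbD (tsupport_dzb_subset b h))⟩
  have i1 : Integrable fun z => (((1 + ‖z - z₀‖ ^ 2) ^ 3)⁻¹ * ‖b z‖ ^ 2) * Real.exp (a * v z) := by
    refine hva.integrable_mul_exp ((hct.pow 3).inv₀ (fun z => (pow_pos (ht0 z) 3).ne') |>.mul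
      (hb0.norm.pow 2)) (HasCompactSupport.mul_left (hbc.norm.comp_left (g := fun x => x ^ 2)
      (by simp))) ((closure_mono fun z hz => ?_).trans hbD)
    rw [Function.mem_support] at hz ⊢
    rintro h0
    simp [h0] at hz
  have i2 : Integrable fun z => ((1 + ‖z - z₀‖ ^ 2)⁻¹ * ‖dzb b z‖ ^ 2) * Real.exp (a * v z) := by
    refine hva.integrable_mul_exp (hct.inv₀ (fun z => (ht0 z).ne') |>.mul
      (hcb.norm.pow 2)) (HasCompactSupport.mul_left (hbc.dzb_compact.norm.comp_left
      (g := fun x => x ^ 2) (by simp))) ((closure_mono fun z hz => ?_).trans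
        ((tsupport_dzb_subset b).trans hbD))
    rw [Function.mem_support] at hz ⊢
    rintro h0
    simp [h0] at hz
  have i3 : Integrable fun z => (1 / (1 + ‖z - z₀‖ ^ 2) ^ 2 * ‖b z‖ ^ 2 *
      (1 + ‖z - z₀‖ ^ 2)) * Real.exp ((a - N) * v z + N * u z) := by
    refine hv'.integrable_mul_exp (((continuous_const.div (hct.pow 2)
      (fun z => (pow_pos (ht0 z) 2).ne')).mul (hb0.norm.pow 2)).mul hct)
      (HasCompactSupport.mul_right (HasCompactSupport.mul_left (hbc.norm.comp_left
        (g := fun x => x ^ 2) (by simp)))) ((closure_mono fun z hz => ?_).trans hbD)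
    rw [Function.mem_support] at hz ⊢
    rintro h0
    simp [h0] at hz
  have i4 : Integrable fun z => (‖dzb b z‖ ^ 2 *
      (1 + ‖z - z₀‖ ^ 2)) * Real.exp ((a - N) * v z + N * u z) := by
    refine hv'.integrable_mul_exp ((hcb.norm.pow 2).mul hct)
      (HasCompactSupport.mul_right (hbc.dzb_compact.norm.comp_left
        (g := fun x => x ^ 2) (by simp))) ((closure_mono fun z hz => ?_).trans
          ((tsupport_dzb_subset b).trans hbD))
    rw [Function.mem_support] at hz ⊢
    rintro h0
    simp [h0] at hz
  have k1 : Real.exp (-(N * C₁)) *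
      ∫ z, ((1 + ‖z - z₀‖ ^ 2) ^ 3)⁻¹ * ‖b z‖ ^ 2 * Real.exp (a * v z) ≤
      ∫ z, 1 / (1 + ‖z - z₀‖ ^ 2) ^ 2 * ‖b z‖ ^ 2 *
        Real.exp ((a - N) * v z + N * u z + Real.log (1 + ‖z - z₀‖ ^ 2)) := by
    rw [← integral_const_mul]
    refine integral_mono (i1.const_mul _) (i3.congr (.of_forall fun z => ?_)) fun z => ?_
    · simp only [Real.exp_add, hlog]; ring
    · simp only
      by_cases hz : z ∈ D
      · calc _ = 1 / (1 + ‖z - z₀‖ ^ 2) ^ 2 * ‖b z‖ ^ 2 *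
            (Real.exp (-(N * C₁)) * ((1 + ‖z - z₀‖ ^ 2)⁻¹ * Real.exp (a * v z))) := by
              have := (ht0 z).ne'
              field_simp
          _ ≤ _ := mul_le_mul_of_nonneg_left (hexp z hz).1 (by positivity)
      · simp [(hout z hz).1]
  have k2 : ∫ z, ‖dzb b z‖ ^ 2 *
      Real.exp ((a - N) * v z + N * u z + Real.log (1 + ‖z - z₀‖ ^ 2)) ≤ Real.exp (N * C₁) *
      ∫ z, (1 + ‖z - z₀‖ ^ 2)⁻¹ * ‖dzb b z‖ ^ 2 * Real.exp (a * v z) := by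
    rw [← integral_const_mul]
    refine integral_mono (i4.congr (.of_forall fun z => ?_)) (i2.const_mul _) fun z => ?_
    · simp only [Real.exp_add, hlog]; ring
    · simp only
      by_cases hz : z ∈ D
      · calc _ ≤ ‖dzb b z‖ ^ 2 * _ := mul_le_mul_of_nonneg_left (hexp z hz).2 (by positivity)
          _ = _ := by ring
      · simp [(hout z hz).2]
  have k3 := k1.trans (key.trans k2)
  have k4 := mul_le_mul_of_nonneg_left k3 (Real.exp_pos (N * C₁)).le
  rw [← mul_assoc, ← mul_assoc, ← Real.exp_add, ← Real.exp_add] at k4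
  simpa [two_mul] using k4

theorem BSub.integrable_bounded_mul_exp {v h : ℂ → ℝ} {Ω K : Set ℂ} (hv : BSub v Ω)
    (hK : IsCompact K) (hKΩ : K ⊆ Ω) (hm : Measurable h) {M : ℝ} (hM : ∀ z, |h z| ≤ M)
    (hh : ∀ z ∉ K, h z = 0) : Integrable fun z => h z * Real.exp (v z) := by
  obtain ⟨χ, hχ, hχc, hχΩ, -, -, O, hO, hKO, hχ1⟩ := exists_cutoff hK hv.isOpen hKΩ
  have h1 := hv.integrable_mul_exp hχ.continuous hχc hχΩ
  refine (h1.bdd_mul (c := M) (f := h) hm.aestronglyMeasurable (.of_forall fun z => hM z)).congr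
    (.of_forall fun z => ?_)
  by_cases hz : z ∈ K
  · simp only [hχ1 z (hKO hz), one_mul]
  · simp only [hh z hz, zero_mul]

theorem BSub.point_inequality {v : ℂ → ℝ} {D : Set ℂ} (hv : BSub v D) {C : ℝ} (hC : 0 ≤ C)
    {z₀ : ℂ} (hz₀ : z₀ ∈ D) {b : ℂ → ℂ} (hb : ContDiff ℝ ∞ b) (hbc : HasCompactSupport b)
    (hbD : tsupport b ⊆ D)
    (h2 : ∫ z, ((1 + ‖z - z₀‖ ^ 2) ^ 3)⁻¹ * ‖b z‖ ^ 2 * Real.exp (v z) ≤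
        C * ∫ z, (1 + ‖z - z₀‖ ^ 2)⁻¹ * ‖dzb b z‖ ^ 2 * Real.exp (v z))
    {L : ℝ} (hL : ∀ z, ‖dzb b z‖ ≤ L * ‖z - z₀‖) :
    ‖b z₀‖ ^ 2 * Real.exp (v z₀) ≤ 8 / Real.pi * (2 + 12 * C) *
      ∫ z, ‖dzb b z‖ ^ 2 * (‖z - z₀‖ ^ 2)⁻¹ * Real.exp (v z) := by
  have hb0 := hb.continuous
  have hcb := hb.dzb_smooth.continuous
  have hdK : ∀ z ∉ tsupport b, dzb b z = 0 := fun z hz =>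
    image_eq_zero_of_notMem_tsupport fun h => hz (tsupport_dzb_subset b h)
  have hbK : ∀ z ∉ tsupport b, b z = 0 := fun z hz => image_eq_zero_of_notMem_tsupport hz
  have int : ∀ {h : ℂ → ℝ}, Continuous h → (∀ z ∉ tsupport b, h z = 0) →
      Integrable fun z => h z * Real.exp (v z) := fun {h} hh h0 => by
    have hs : tsupport h ⊆ tsupport b :=
      closure_minimal (fun z hz => by_contra fun h' => hz (h0 z h')) (isClosed_tsupport b)
    exact hv.integrable_mul_exp hh (hbc.of_isClosed_subset (isClosed_tsupport h) hs)
      (hs.trans hbD)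
  have hct : Continuous fun z : ℂ => 1 + ‖z - z₀‖ ^ 2 := by fun_prop
  have ht0 : ∀ z : ℂ, 0 < 1 + ‖z - z₀‖ ^ 2 := fun z => by positivity
  have hq : ∀ z, ‖dzb b z‖ ^ 2 * (‖z - z₀‖ ^ 2)⁻¹ ≤ L ^ 2 := fun z => by
    rw [← div_eq_mul_inv]
    refine div_le_of_le_mul₀ (by positivity) (by positivity) ?_
    rw [← mul_pow]
    exact pow_le_pow_left₀ (norm_nonneg _) (hL z) 2
  have iJ : Integrable fun z => ‖dzb b z‖ ^ 2 * (‖z - z₀‖ ^ 2)⁻¹ * Real.exp (v z) := by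
    refine hv.integrable_bounded_mul_exp hbc hbD (h := fun z => ‖dzb b z‖ ^ 2 * (‖z - z₀‖ ^ 2)⁻¹)
      (M := L ^ 2) ?_ (fun z => ?_) fun z hz => by simp [hdK z hz]
    · exact (hcb.norm.pow 2).measurable.mul (by fun_prop : Measurable fun z : ℂ => ‖z - z₀‖ ^ 2).inv
    · rw [abs_of_nonneg (by positivity)]; exact hq z
  have iD : Integrable fun z => (1 + ‖z - z₀‖ ^ 2)⁻¹ * ‖dzb b z‖ ^ 2 * Real.exp (v z) :=
    int ((hct.inv₀ fun z => (ht0 z).ne').mul (hcb.norm.pow 2)) fun z hz => by simp [hdK z hz]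
  have i3 : Integrable fun z => ((1 + ‖z - z₀‖ ^ 2) ^ 3)⁻¹ * ‖b z‖ ^ 2 * Real.exp (v z) :=
    int (((hct.pow 3).inv₀ fun z => (pow_pos (ht0 z) 3).ne').mul (hb0.norm.pow 2))
      fun z hz => by simp [hbK z hz]
  have iI : Integrable fun z => ‖b z‖ ^ 2 * Real.exp (v z) :=
    int (hb0.norm.pow 2) fun z hz => by simp [hbK z hz]
  set J := ∫ z, ‖dzb b z‖ ^ 2 * (‖z - z₀‖ ^ 2)⁻¹ * Real.exp (v z) with hJ
  set I := ∫ z, ‖b z‖ ^ 2 * Real.exp (v z) with hI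
  set I₃ := ∫ z, ((1 + ‖z - z₀‖ ^ 2) ^ 3)⁻¹ * ‖b z‖ ^ 2 * Real.exp (v z) with hI3
  have hJ0 : 0 ≤ J := integral_nonneg fun z => by positivity
  have hd0 : ∀ z, ‖z - z₀‖ = 0 → dzb b z = 0 := fun z hz => by
    have := hL z
    rw [hz, mul_zero] at this
    exact norm_le_zero_iff.1 this
  have h3 : I₃ ≤ C * J := by
    refine h2.trans (mul_le_mul_of_nonneg_left (integral_mono iD iJ fun z => ?_) hC)
    simp only
    rcases (norm_nonneg (z - z₀)).eq_or_lt with h | h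
    · simp [hd0 z h.symm]
    · rw [mul_comm (‖dzb b z‖ ^ 2)]
      gcongr
      linarith
  have main : ∀ e : ℝ, 0 < e → e ≤ 1 →
      ∫ z, e / (‖z - z₀‖ ^ 2 + e) ^ 2 * ‖b z‖ ^ 2 * Real.exp (v z) ≤
        (2 + 12 * C) * J + e * I := fun e he he1 => by
    have hw := contDiff_poleWeight he z₀
    have hB := fun z => poleWeight_bounds he he1 z₀ z
    have key := hv.basic_inequality hw (contDiff_const (c := (0 : ℝ))) hb hbc hbD
      fun z _ => (hB z).1
    have hq : ∀ z : ℂ, qlap (fun _ => 0) z = 0 := fun z => by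
      have : dz (fun _ => ((0 : ℝ) : ℂ)) = fun _ => 0 := by
        ext w; exact (HasW.const _ w).dz_eq
      rw [qlap, this, (HasW.const _ z).dzb_eq, Complex.zero_re]
    simp only [hq, mul_zero, zero_sub, add_zero] at key
    have hcw := hw.continuous
    have hcdw := hw.ofReal_comp.dzb_smooth.continuous
    have hcq := hw.qlap_smooth.continuous
    have j1 : Integrable fun z => -qlap (poleWeight e z₀) z * ‖b z‖ ^ 2 * Real.exp (v z) :=
      int (hcq.neg.mul (hb0.norm.pow 2)) fun z hz => by simp [hbK z hz]
    have j2 : Integrable fun z => poleWeight e z₀ z * ‖dzb b z‖ ^ 2 * Real.exp (v z) :=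
      int (hcw.mul (hcb.norm.pow 2)) fun z hz => by simp [hdK z hz]
    have j3 : Integrable fun z => ‖dzb (fun z => (poleWeight e z₀ z : ℂ)) z‖ * ‖b z‖ *
        ‖dzb b z‖ * Real.exp (v z) :=
      int ((hcdw.norm.mul hb0.norm).mul hcb.norm) fun z hz => by simp [hbK z hz]
    have j4 : Integrable fun z => e / (‖z - z₀‖ ^ 2 + e) ^ 2 * ‖b z‖ ^ 2 * Real.exp (v z) :=
      int ((continuous_const.div (by fun_prop) fun z => by positivity).mul (hb0.norm.pow 2))
        fun z hz => by simp [hbK z hz]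
    have t1 : ∫ z, poleWeight e z₀ z * ‖dzb b z‖ ^ 2 * Real.exp (v z) ≤ J := by
      refine integral_mono j2 iJ fun z => ?_
      simp only
      rcases (norm_nonneg (z - z₀)).eq_or_lt with h | h
      · simp [hd0 z h.symm]
      · rw [mul_comm (‖dzb b z‖ ^ 2)]
        gcongr
        refine (hB z).2.1.trans ?_
        gcongr
        linarith
    have t2 : 2 * (∫ z, ‖dzb (fun z => (poleWeight e z₀ z : ℂ)) z‖ * ‖b z‖ *
        ‖dzb b z‖ * Real.exp (v z)) ≤ J + 4 * I₃ := by
      rw [← integral_const_mul, hJ, hI3, ← integral_const_mul, ← integral_add iJ (i3.const_mul 4)]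
      refine integral_mono (j3.const_mul 2) (iJ.add (i3.const_mul 4)) fun z => ?_
      simp only
      set n := ‖z - z₀‖
      rcases (norm_nonneg (z - z₀)).eq_or_lt with h | h
      · simp only [hd0 z h.symm, norm_zero, mul_zero, zero_mul]
        positivity
      · rw [(hB z).2.2.1]
        have a1 : n * (n / ((n ^ 2 + e) * (1 + (n ^ 2 + e) ^ 2))) ≤ (1 + (n ^ 2) ^ 2)⁻¹ := by
          rw [← mul_div_assoc, ← one_div, div_le_div_iff₀ (by positivity) (by positivity)]
          have b1 : n * n ≤ n ^ 2 + e := by nlinarith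
          have b2 : 1 + (n ^ 2) ^ 2 ≤ 1 + (n ^ 2 + e) ^ 2 := by gcongr; linarith
          calc _ ≤ (n ^ 2 + e) * (1 + (n ^ 2 + e) ^ 2) :=
                mul_le_mul b1 b2 (by positivity) (by positivity)
            _ = _ := by ring
        have a2 : ((1 + (n ^ 2) ^ 2)⁻¹) ^ 2 ≤ 4 * ((1 + n ^ 2) ^ 3)⁻¹ := by
          rw [inv_pow, ← one_div, ← div_eq_mul_inv, div_le_div_iff₀ (by positivity) (by positivity)]
          nlinarith [sq_nonneg (n ^ 2 - 1), sq_nonneg ((n ^ 2) ^ 2 - 1), sq_nonneg n,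
            pow_nonneg h.le 4, pow_nonneg h.le 6, pow_nonneg h.le 8]
        set d := n / ((n ^ 2 + e) * (1 + (n ^ 2 + e) ^ 2))
        have hd0 : 0 ≤ d := by positivity
        have a3 : 2 * (d * ‖b z‖ * ‖dzb b z‖) ≤
            ‖dzb b z‖ ^ 2 * (n ^ 2)⁻¹ + (n * d) ^ 2 * ‖b z‖ ^ 2 := by
          have := two_mul_le_add_sq (‖dzb b z‖ * n⁻¹) (n * d * ‖b z‖)
          have e1 : 2 * (‖dzb b z‖ * n⁻¹) * (n * d * ‖b z‖) = 2 * (d * ‖b z‖ * ‖dzb b z‖) := by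
            have hn0 : n ≠ 0 := h.ne'
            field_simp
          rw [e1] at this
          simpa [mul_pow] using this
        have a4 : (n * d) ^ 2 * ‖b z‖ ^ 2 ≤ 4 * ((1 + n ^ 2) ^ 3)⁻¹ * ‖b z‖ ^ 2 := by
          gcongr
          exact (pow_le_pow_left₀ (by positivity) a1 2).trans a2
        have := mul_le_mul_of_nonneg_right (a3.trans (add_le_add_right a4 _))
          (Real.exp_pos (v z)).le
        nlinarith
    have t3 : ∫ z, e / (‖z - z₀‖ ^ 2 + e) ^ 2 * ‖b z‖ ^ 2 * Real.exp (v z) ≤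
        (∫ z, -qlap (poleWeight e z₀) z * ‖b z‖ ^ 2 * Real.exp (v z)) + (8 * I₃ + e * I) := by
      rw [hI, hI3, ← integral_const_mul, ← integral_const_mul,
        ← integral_add (i3.const_mul 8) (iI.const_mul e),
        ← integral_add (g := fun a => 8 * (((1 + ‖a - z₀‖ ^ 2) ^ 3)⁻¹ * ‖b a‖ ^ 2 *
          Real.exp (v a)) + e * (‖b a‖ ^ 2 * Real.exp (v a))) j1
          ((i3.const_mul 8).add (iI.const_mul e))]
      refine integral_mono j4 (j1.add ((i3.const_mul 8).add (iI.const_mul e))) fun z => ?_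
      simp only
      have := mul_le_mul_of_nonneg_right (hB z).2.2.2
        (by positivity : 0 ≤ ‖b z‖ ^ 2 * Real.exp (v z))
      nlinarith
    linarith
  by_cases hbz : b z₀ = 0
  · rw [hbz, norm_zero, zero_pow two_ne_zero, zero_mul]
    exact mul_nonneg (by positivity) hJ0
  obtain ⟨s, hs, -, hmean⟩ := hv.eventually_exp_mean hz₀
  have hbz' : 0 < ‖b z₀‖ ^ 2 := by positivity
  obtain ⟨δ, hδ, hδb⟩ := Metric.eventually_nhds_iff.1
    (((hb0.norm.pow 2).tendsto z₀).eventually (lt_mem_nhds (half_lt_self hbz')))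
  have fin : ∀ᶠ r in 𝓝[>] (0 : ℝ), ‖b z₀‖ ^ 2 * Real.exp (v z₀) * (Real.pi / 8) ≤
      (2 + 12 * C) * J + r ^ 2 * I := by
    filter_upwards [Ioo_mem_nhdsGT (show 0 < min (min s δ) 1 by positivity)] with r hr
    have hr0 : 0 < r := hr.1
    obtain ⟨⟨hrs, hrδ⟩, hr1⟩ : (r < s ∧ r < δ) ∧ r < 1 := by simpa using hr.2
    obtain ⟨m1, m2⟩ := hmean r hr0 hrs
    refine le_trans ?_ (main (r ^ 2) (by positivity) (by nlinarith))
    have j4 : Integrable fun z => r ^ 2 / (‖z - z₀‖ ^ 2 + r ^ 2) ^ 2 * ‖b z‖ ^ 2 *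
        Real.exp (v z) :=
      int ((continuous_const.div (by fun_prop) fun z => by positivity).mul (hb0.norm.pow 2))
        fun z hz => by simp [hbK z hz]
    calc _ = (‖b z₀‖ ^ 2 / 2 * (4 * r ^ 2)⁻¹) * (Real.exp (v z₀) * (Real.pi * r ^ 2)) := by
          field_simp; ring
      _ ≤ (‖b z₀‖ ^ 2 / 2 * (4 * r ^ 2)⁻¹) * ∫ ζ in ball z₀ r, Real.exp (v ζ) := by gcongr
      _ = ∫ ζ in ball z₀ r, (‖b z₀‖ ^ 2 / 2 * (4 * r ^ 2)⁻¹) * Real.exp (v ζ) := by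
          rw [integral_const_mul]
      _ ≤ ∫ z in ball z₀ r, r ^ 2 / (‖z - z₀‖ ^ 2 + r ^ 2) ^ 2 * ‖b z‖ ^ 2 * Real.exp (v z) := by
          refine setIntegral_mono_on (Integrable.const_mul m1 _) j4.integrableOn measurableSet_ball
            fun z hz => ?_
          have hz' : ‖z - z₀‖ < r := by simpa [dist_eq_norm] using hz
          have c1 := hδb (show dist z z₀ < δ from (mem_ball.1 hz).trans hrδ)
          rw [mul_comm (‖b z₀‖ ^ 2 / 2)]
          gcongr
          · rw [← one_div, div_le_div_iff₀ (by positivity) (by positivity)]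
            have : ‖z - z₀‖ ^ 2 ≤ r ^ 2 := by gcongr
            calc 1 * (‖z - z₀‖ ^ 2 + r ^ 2) ^ 2 ≤ 1 * (r ^ 2 + r ^ 2) ^ 2 := by gcongr
              _ = _ := by ring
          · exact c1.le
      _ ≤ _ := setIntegral_le_integral j4 (.of_forall fun z => by positivity)
  have lim : Tendsto (fun r : ℝ => (2 + 12 * C) * J + r ^ 2 * I) (𝓝[>] 0)
      (𝓝 ((2 + 12 * C) * J + 0 ^ 2 * I)) :=
    Tendsto.mono_left (Continuous.tendsto (by fun_prop) 0) nhdsWithin_le_nhds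
  have := ge_of_tendsto lim fin
  have h8 : 0 < 8 / Real.pi := by positivity
  have h9 := mul_le_mul_of_nonneg_left this h8.le
  have e9 : 8 / Real.pi * (‖b z₀‖ ^ 2 * Real.exp (v z₀) * (Real.pi / 8)) =
      ‖b z₀‖ ^ 2 * Real.exp (v z₀) := by
    have := Real.pi_pos.ne'
    field_simp
  rw [e9] at h9
  linarith

theorem differentiableOn_cauchyT {g : ℂ → ℂ} (hg : Integrable g) {a : ℂ} {s : ℝ} (hs : 0 < s)
    (h0 : ∀ ζ ∈ ball a (2 * s), g ζ = 0) : DifferentiableOn ℂ (cauchyT g) (ball a s) := by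
  have h1 : DifferentiableOn ℂ (fun p : ℂ × ℂ => ∫ ζ, g ζ * (p.1 - ζ)⁻¹) (ball a s ×ˢ univ) := by
    have hne : ∀ ζ ∉ ball a (2 * s), ∀ p ∈ ball a s ×ˢ (univ : Set ℂ), s ≤ ‖p.1 - ζ‖ := by
      intro ζ hζ p hp
      have h1 : dist p.1 a < s := hp.1
      have h2 : 2 * s ≤ dist ζ a := not_lt.1 hζ
      have h3 := dist_triangle_left ζ a p.1
      rw [← dist_eq_norm]
      linarith
    refine differentiableOn_integral_param (μ := volume) (isOpen_ball.prod isOpen_univ)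
      (F := fun p ζ => g ζ * (p.1 - ζ)⁻¹) (H := fun ζ => ‖g ζ‖ * s⁻¹) (fun ζ => ?_) (fun p _ => ?_)
      (hg.norm.mul_const _) fun ζ p hp => ?_
    · by_cases hζ : ζ ∈ ball a (2 * s)
      · simp [h0 ζ hζ, differentiableOn_const]
      · refine DifferentiableOn.const_mul (DifferentiableOn.inv (by fun_prop) fun p hp => ?_) _
        exact norm_pos_iff.1 (hs.trans_le (hne ζ hζ p hp))
    · exact hg.aestronglyMeasurable.mul (by fun_prop : Measurable fun ζ =>
        (p.1 - ζ)⁻¹).aestronglyMeasurable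
    · by_cases hζ : ζ ∈ ball a (2 * s)
      · simp [h0 ζ hζ]
      · rw [norm_mul, norm_inv]
        gcongr
        exact hne ζ hζ p hp
  exact (h1.comp (f := fun z : ℂ => (z, (0 : ℂ))) (by fun_prop)
    fun z hz => ⟨hz, mem_univ _⟩).const_mul _

theorem exists_holomorphic_rep {f : ℂ → ℂ} {D : Set ℂ} (hD : IsOpen D)
    (hf : ∀ K ⊆ D, IsCompact K → IntegrableOn f K)
    (h : ∀ γ : ℂ → ℂ, ContDiff ℝ ∞ γ → HasCompactSupport γ → tsupport γ ⊆ D →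
      ∫ z, f z * dzb γ z = 0) :
    ∃ g : ℂ → ℂ, DifferentiableOn ℂ g D ∧ (∀ᵐ z, z ∈ D → f z = g z) ∧
      ∀ z ∈ D, ∃ χ : ℂ → ℂ, ContDiff ℝ ∞ χ ∧ HasCompactSupport χ ∧ tsupport χ ⊆ D ∧ χ z = 1 ∧
        (∀ᶠ ζ in 𝓝 z, dzb χ ζ = 0) ∧ g z = cauchyT (fun ζ => f ζ * dzb χ ζ) z := by
  have loc : ∀ z : ℂ, ∃ χ : ℂ → ℂ, ∃ s > 0, z ∈ D → ContDiff ℝ ∞ χ ∧ HasCompactSupport χ ∧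
      tsupport χ ⊆ D ∧ (∀ ζ ∈ ball z (2 * s), χ ζ = 1) := by
    intro z
    by_cases hz : z ∈ D
    · obtain ⟨χ, hχ, hχc, hχD, -, -, O, hO, hzO, hχ1⟩ :=
        exists_cutoff (isCompact_singleton (x := z)) hD (by simpa using hz)
      obtain ⟨s, hs, hsO⟩ := isOpen_iff.1 hO z (hzO rfl)
      refine ⟨fun z => (χ z : ℂ), s / 2, by positivity, fun _ => ⟨hχ.ofReal_comp,
        hχc.comp_left (g := Complex.ofReal) (by simp),
        (closure_mono (Function.support_comp_subset Complex.ofReal_zero χ)).trans hχD,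
        fun ζ hζ => ?_⟩⟩
      rw [mul_div_cancel₀ _ two_ne_zero] at hζ
      simp [hχ1 ζ (hsO hζ)]
    · exact ⟨0, 1, one_pos, fun h => absurd h hz⟩
  choose χ s hs hχ using loc
  have hball : ∀ z ∈ D, ball z (2 * s z) ⊆ D := fun z hz ζ hζ =>
    (hχ z hz).2.2.1 (subset_tsupport _ (by simp [(hχ z hz).2.2.2 ζ hζ]))
  have hb1 : ∀ z : ℂ, ball z (s z) ⊆ ball z (2 * s z) := fun z =>
    ball_subset_ball (by linarith [hs z])
  have hdz : ∀ z ∈ D, ∀ ζ ∈ ball z (2 * s z), dzb (χ z) ζ = 0 := fun z hz ζ hζ => by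
    rw [dzb_eventuallyEq (g := fun _ => 1)]
    · exact (HasW.const _ _).dzb_eq
    · filter_upwards [isOpen_ball.mem_nhds hζ] with x hx using (hχ z hz).2.2.2 x hx
  set G : ℂ → ℂ → ℂ := fun z => cauchyT (fun ζ => f ζ * dzb (χ z) ζ)
  have hw := fun z (hz : z ∈ D) => weyl hf h (hχ z hz).1 (hχ z hz).2.1 (hχ z hz).2.2.1
  have hGd : ∀ z ∈ D, DifferentiableOn ℂ (G z) (ball z (s z)) := fun z hz =>
    differentiableOn_cauchyT (hw z hz).1 (hs z) fun ζ hζ => by simp [hdz z hz ζ hζ]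
  have hGf : ∀ z ∈ D, ∀ᵐ ζ, ζ ∈ ball z (s z) → f ζ = G z ζ := fun z hz => by
    filter_upwards [(hw z hz).2] with ζ h1 h2
    change f ζ = cauchyT (fun ζ => f ζ * dzb (χ z) ζ) ζ
    rw [← h1, (hχ z hz).2.2.2 ζ (hb1 z h2), mul_one]
  have hEq : ∀ z ∈ D, ∀ w ∈ ball z (s z), G w w = G z w := fun z hz w hw' => by
    have hwD := hball z hz (hb1 z hw')
    have h1 : EqOn (G w) (G z) (ball w (s w) ∩ ball z (s z)) := by
      refine Measure.eqOn_open_of_ae_eq (μ := volume) ?_ (isOpen_ball.inter isOpen_ball)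
        ((hGd w hwD).continuousOn.mono inter_subset_left)
        ((hGd z hz).continuousOn.mono inter_subset_right)
      refine (ae_restrict_iff' (isOpen_ball.inter isOpen_ball).measurableSet).2 ?_
      filter_upwards [hGf w hwD, hGf z hz] with ζ h1 h2 h3
      rw [← h1 h3.1, ← h2 h3.2]
    exact h1 ⟨mem_ball_self (hs w), hw'⟩
  refine ⟨fun z => G z z, fun z hz => ?_, ?_, fun z hz => ⟨χ z, (hχ z hz).1, (hχ z hz).2.1,
    (hχ z hz).2.2.1, (hχ z hz).2.2.2 z (mem_ball_self (by linarith [hs z])), ?_, rfl⟩⟩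
  · refine (((hGd z hz).differentiableAt (isOpen_ball.mem_nhds (mem_ball_self (hs z)))
      ).congr_of_eventuallyEq ?_).differentiableWithinAt
    filter_upwards [isOpen_ball.mem_nhds (mem_ball_self (hs z))] with w hw' using hEq z hz w hw'
  · rw [ae_iff]
    refine measure_null_of_locally_null _ fun z hz => ?_
    have hzD : z ∈ D := (Classical.not_imp.1 hz).1
    refine ⟨_ ∩ ball z (s z), inter_mem_nhdsWithin _ (isOpen_ball.mem_nhds (mem_ball_self (hs z))),
      measure_mono_null ?_ (ae_iff.1 (hGf z hzD))⟩
    rintro w ⟨hw1, hw2⟩ hw3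
    exact (Classical.not_imp.1 hw1).2 ((hw3 hw2).trans (hEq z hzD w hw2).symm)
  · filter_upwards [isOpen_ball.mem_nhds (mem_ball_self (by linarith [hs z] : 0 < 2 * s z))] with
      w hw' using hdz z hz w hw'

theorem exists_riesz_of_le {S H : Type*} [AddCommGroup S] [Module ℂ S] [NormedAddCommGroup H]
    [InnerProductSpace ℂ H] [CompleteSpace H] (T : S →ₗ[ℂ] H) (l : S →ₗ[ℂ] ℂ) {K : ℝ} (hK : 0 ≤ K)
    (h : ∀ s, ‖l s‖ ≤ K * ‖T s‖) : ∃ F : H, ‖F‖ ≤ K ∧ ∀ s, l s = inner ℂ F (T s) := by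
  have hker : LinearMap.ker T ≤ LinearMap.ker l := fun s hs => by
    have := h s
    rw [LinearMap.mem_ker.1 hs, norm_zero, mul_zero] at this
    exact norm_le_zero_iff.1 this
  set g : LinearMap.range T →ₗ[ℂ] ℂ :=
    ((LinearMap.ker T).liftQ l hker) ∘ₗ T.quotKerEquivRange.symm.toLinearMap with hg
  have hgT : ∀ s, g ⟨T s, LinearMap.mem_range_self T s⟩ = l s := fun s => by
    rw [hg, LinearMap.comp_apply, LinearEquiv.coe_coe, LinearMap.quotKerEquivRange_symm_apply_image]
    rfl
  obtain ⟨G, hG, hGn⟩ := exists_extension_norm_eq (𝕜 := ℂ) (LinearMap.range T)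
    (g.mkContinuous K fun x => by
      obtain ⟨_, s, rfl⟩ := x
      rw [hgT]
      exact h s)
  refine ⟨(InnerProductSpace.toDual ℂ H).symm G, ?_, fun s => ?_⟩
  · rw [LinearIsometryEquiv.norm_map, hGn]
    exact LinearMap.mkContinuous_norm_le _ hK _
  · rw [InnerProductSpace.toDual_symm_apply, ← hgT s]
    exact (hG ⟨T s, LinearMap.mem_range_self T s⟩).symm

theorem BSub.measurable_indicator {v : ℂ → ℝ} {D : Set ℂ} (hv : BSub v D) :
    Measurable (D.indicator v) := by
  refine measurable_of_Iio fun c => ?_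
  have h1 : IsOpen {z | z ∈ D ∧ v z < c} := by
    rw [isOpen_iff_mem_nhds]
    rintro z ⟨hz, hc⟩
    have := hv.usc z hz c hc
    rw [hv.isOpen.nhdsWithin_eq hz] at this
    filter_upwards [this, hv.isOpen.mem_nhds hz] with w h1 h2 using ⟨h2, h1⟩
  have h2 : D.indicator v ⁻¹' Iio c = {z | z ∈ D ∧ v z < c} ∪ (Dᶜ ∩ {_z | 0 < c}) := by
    ext z
    by_cases hz : z ∈ D
    · simp [hz]
    · simp [hz]
  rw [h2]
  exact h1.measurableSet.union (hv.isOpen.measurableSet.compl.inter (MeasurableSet.const _))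

theorem dzb_add_of_contDiff {a b : ℂ → ℂ} (ha : ContDiff ℝ ∞ a) (hb : ContDiff ℝ ∞ b) (z : ℂ) :
    dzb (a + b) z = dzb a z + dzb b z := ((ha.hasW z).add (hb.hasW z)).dzb_eq

theorem dzb_smul_of_contDiff {b : ℂ → ℂ} (hb : ContDiff ℝ ∞ b) (c z : ℂ) :
    dzb (c • b) z = c * dzb b z := by
  have := ((HasW.const c z).mul (hb.hasW z)).dzb_eq
  rw [zero_mul, zero_add] at this
  exact this

theorem dzb_eq_zero_of_notMem_tsupport {b : ℂ → ℂ} {z : ℂ} (hz : z ∉ tsupport b) : dzb b z = 0 :=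
  image_eq_zero_of_notMem_tsupport fun h => hz (closure_minimal
    (subset_closure.trans (tsupport_dzb_subset b)) (isClosed_tsupport b) h)

/-- The test functions on `D` whose `∂̄`-derivative is `O(|z - z₀|)`. -/
def flatTests (D : Set ℂ) (z₀ : ℂ) : Submodule ℂ (ℂ → ℂ) where
  carrier := {b | ContDiff ℝ ∞ b ∧ HasCompactSupport b ∧ tsupport b ⊆ D ∧
    ∃ L : ℝ, ∀ z, ‖dzb b z‖ ≤ L * ‖z - z₀‖}
  zero_mem' := by
    refine ⟨contDiff_const, HasCompactSupport.zero, by simp [tsupport], 0, fun z => ?_⟩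
    have : dzb (0 : ℂ → ℂ) z = 0 := (HasW.const 0 z).dzb_eq
    simp [this]
  add_mem' := by
    rintro a b ⟨ha, hac, haD, L, hL⟩ ⟨hb, hbc, hbD, L', hL'⟩
    refine ⟨ha.add hb, hac.add hbc, (tsupport_add a b).trans (union_subset haD hbD), L + L',
      fun z => ?_⟩
    rw [dzb_add_of_contDiff ha hb, add_mul]
    exact (norm_add_le _ _).trans (add_le_add (hL z) (hL' z))
  smul_mem' := by
    rintro c b ⟨hb, hbc, hbD, L, hL⟩
    refine ⟨contDiff_const.smul hb, hbc.mono (Function.support_const_smul_subset c b),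
      (closure_mono (Function.support_const_smul_subset c b)).trans hbD, ‖c‖ * L, fun z => ?_⟩
    rw [dzb_smul_of_contDiff hb, norm_mul, mul_assoc]
    exact mul_le_mul_of_nonneg_left (hL z) (norm_nonneg c)

theorem BSub.memLp_flat {v : ℂ → ℝ} {D : Set ℂ} (hv : BSub v D) (z₀ : ℂ) {b : ℂ → ℂ}
    (hb : b ∈ flatTests D z₀) :
    MemLp (fun z => dzb b z * ((‖z - z₀‖⁻¹ * Real.exp (D.indicator v z / 2) : ℝ) : ℂ)) 2 := by
  obtain ⟨hb, hbc, hbD, L, hL⟩ := hb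
  have hm : Measurable fun z => (‖z - z₀‖⁻¹ * Real.exp (D.indicator v z / 2) : ℝ) := by
    have := hv.measurable_indicator
    fun_prop
  have hd := hb.dzb_smooth.continuous
  refine (memLp_two_iff_integrable_sq_norm ?_).2 ?_
  · exact (hd.measurable.mul (Complex.measurable_ofReal.comp hm)).aestronglyMeasurable
  have h1 := hv.integrable_bounded_mul_exp hbc hbD
    (h := fun z => ‖dzb b z‖ ^ 2 * (‖z - z₀‖ ^ 2)⁻¹) (by fun_prop) (M := L ^ 2) (fun z => ?_)
    (fun z hz => ?_)
  · refine h1.congr (.of_forall fun z => ?_)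
    by_cases hz : z ∈ D
    · simp only [indicator_of_mem hz, norm_mul, Complex.norm_real, norm_inv, Real.norm_eq_abs,
        mul_pow, sq_abs, abs_norm, inv_pow]
      rw [← Real.exp_nat_mul]
      push_cast
      rw [mul_div_cancel₀ _ (two_ne_zero), mul_assoc]
    · simp [dzb_eq_zero_of_notMem_tsupport (mt (@hbD z) hz)]
  · rw [abs_of_nonneg (by positivity)]
    rcases eq_or_ne z z₀ with rfl | hz
    · simp; positivity
    have h0 : 0 < ‖z - z₀‖ := norm_pos_iff.2 (sub_ne_zero.2 hz)
    rw [← div_eq_mul_inv, div_le_iff₀ (by positivity), ← mul_pow]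
    exact pow_le_pow_left₀ (norm_nonneg _) (hL z) 2
  · simp [dzb_eq_zero_of_notMem_tsupport hz]

theorem BSub.exists_dual {v : ℂ → ℝ} {D : Set ℂ} (hv : BSub v D) {z₀ : ℂ}
    {C : ℝ} (hC : 0 ≤ C)
    (h : ∀ b : ℂ → ℂ, ContDiff ℝ ∞ b → HasCompactSupport b → tsupport b ⊆ D →
      ∀ L : ℝ, (∀ z, ‖dzb b z‖ ≤ L * ‖z - z₀‖) →
      ‖b z₀‖ ^ 2 * Real.exp (v z₀) ≤
        C * ∫ z, ‖dzb b z‖ ^ 2 * (‖z - z₀‖ ^ 2)⁻¹ * Real.exp (v z)) :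
    ∃ F : ℂ → ℂ, MemLp F 2 ∧ ∫ z, ‖F z‖ ^ 2 ≤ C * Real.exp (-v z₀) ∧
      ∀ b ∈ flatTests D z₀, b z₀ =
        ∫ z, conj (F z) * (dzb b z * ((‖z - z₀‖⁻¹ * Real.exp (D.indicator v z / 2) : ℝ) : ℂ)) := by
  set w : ℂ → ℂ := fun z => ((‖z - z₀‖⁻¹ * Real.exp (D.indicator v z / 2) : ℝ) : ℂ) with hw
  have hM : ∀ b : flatTests D z₀, MemLp (fun z => dzb b.1 z * w z) 2 := fun b =>
    hv.memLp_flat z₀ b.2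
  let T : flatTests D z₀ →ₗ[ℂ] Lp ℂ 2 (volume : Measure ℂ) :=
    { toFun := fun b => (hM b).toLp
      map_add' := fun a b => by
        rw [← MemLp.toLp_add]
        refine MemLp.toLp_congr _ _ (.of_forall fun z => ?_)
        simp only [Submodule.coe_add, Pi.add_apply, dzb_add_of_contDiff a.2.1 b.2.1, add_mul]
      map_smul' := fun c b => by
        rw [RingHom.id_apply, ← MemLp.toLp_const_smul]
        refine MemLp.toLp_congr _ _ (.of_forall fun z => ?_)
        simp only [Submodule.coe_smul, Pi.smul_apply, dzb_smul_of_contDiff b.2.1, smul_eq_mul,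
          mul_assoc] }
  let l : flatTests D z₀ →ₗ[ℂ] ℂ :=
    { toFun := fun b => b.1 z₀
      map_add' := fun a b => rfl
      map_smul' := fun c b => rfl }
  have hT : ∀ b, ‖T b‖ ^ 2 = ∫ z, ‖dzb b.1 z‖ ^ 2 * (‖z - z₀‖ ^ 2)⁻¹ * Real.exp (v z) := by
    intro b
    have h1 : ((‖T b‖ ^ 2 : ℝ) : ℂ) = inner ℂ (T b) (T b) := by
      rw [inner_self_eq_norm_sq_to_K]; push_cast; rfl
    rw [L2.inner_def] at h1
    have h2 : ∀ᵐ z, inner ℂ (T b z) (T b z) =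
        ((‖dzb b.1 z‖ ^ 2 * (‖z - z₀‖ ^ 2)⁻¹ * Real.exp (v z) : ℝ) : ℂ) := by
      filter_upwards [(hM b).coeFn_toLp] with z hz
      have : T b z = dzb b.1 z * w z := hz
      rw [this, inner_self_eq_norm_sq_to_K]
      by_cases hz : z ∈ D
      · simp only [hw, indicator_of_mem hz, norm_mul, Complex.norm_real, Real.norm_eq_abs,
          mul_pow, ← Complex.ofReal_pow, RCLike.ofReal_eq_complex_ofReal, sq_abs, inv_pow, ← Real.exp_nat_mul]
        push_cast
        rw [mul_div_cancel₀ _ (two_ne_zero), mul_assoc]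
      · have h3 : dzb b.1 z = 0 := dzb_eq_zero_of_notMem_tsupport fun h' => hz (b.2.2.2.1 h')
        simp [h3]
    rw [integral_congr_ae h2, integral_complex_ofReal] at h1
    exact_mod_cast h1
  set K : ℝ := Real.sqrt (C * Real.exp (-v z₀))
  have hKsq : K ^ 2 = C * Real.exp (-v z₀) := Real.sq_sqrt (by positivity)
  have hle : ∀ b, ‖l b‖ ≤ K * ‖T b‖ := fun b => by
    refine abs_le_of_sq_le_sq' ?_ (by positivity) |>.2
    rw [mul_pow, hKsq, hT]
    obtain ⟨h1, h2, h3, L, hL⟩ := b.2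
    have h4 := h b.1 h1 h2 h3 L hL
    have h5 : ‖l b‖ ^ 2 = ‖b.1 z₀‖ ^ 2 * Real.exp (v z₀) * Real.exp (-v z₀) := by
      rw [mul_assoc, ← Real.exp_add, add_neg_cancel, Real.exp_zero, mul_one]; rfl
    rw [h5, mul_right_comm C]
    exact mul_le_mul_of_nonneg_right h4 (Real.exp_nonneg _)
  obtain ⟨F, hF, hFl⟩ := exists_riesz_of_le T l (by positivity) hle
  refine ⟨F, Lp.memLp F, ?_, fun b hb => ?_⟩
  · rw [← hKsq]
    have h1 : ((‖F‖ ^ 2 : ℝ) : ℂ) = inner ℂ F F := by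
      rw [inner_self_eq_norm_sq_to_K]; push_cast; rfl
    rw [L2.inner_def] at h1
    have h2 : ∀ z, inner ℂ (F z) (F z) = ((‖F z‖ ^ 2 : ℝ) : ℂ) := fun z => by
      rw [inner_self_eq_norm_sq_to_K]; push_cast; rfl
    simp only [h2] at h1
    rw [integral_complex_ofReal] at h1
    have h3 : ‖F‖ ^ 2 = ∫ z, ‖F z‖ ^ 2 := by exact_mod_cast h1
    rw [← h3]
    exact pow_le_pow_left₀ (norm_nonneg _) hF 2
  · have h1 := hFl ⟨b, hb⟩
    rw [L2.inner_def] at h1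
    refine h1.trans (integral_congr_ae ?_)
    filter_upwards [(hM ⟨b, hb⟩).coeFn_toLp] with z hz
    have : T ⟨b, hb⟩ z = dzb b z * w z := hz
    rw [this]
    simp only [RCLike.inner_apply, hw]
    ring

theorem dzb_sub_mul {γ : ℂ → ℂ} (hγ : ContDiff ℝ ∞ γ) (z₀ z : ℂ) :
    dzb (fun z => (z - z₀) * γ z) z = (z - z₀) * dzb γ z := by
  have := (((HasW.id z).sub (HasW.const z₀ z)).mul (hγ.hasW z)).dzb_eq
  simpa using this

theorem exists_lipschitz_bound_of_eventually_zero {φ : ℂ → ℂ} (hφ : Continuous φ)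
    (hc : HasCompactSupport φ) {z₀ : ℂ} (h : ∀ᶠ ζ in 𝓝 z₀, φ ζ = 0) :
    ∃ L : ℝ, ∀ z, ‖φ z‖ ≤ L * ‖z - z₀‖ := by
  obtain ⟨C, hC⟩ := hφ.bounded_above_of_compact_support hc
  obtain ⟨s, hs, hs'⟩ := Metric.eventually_nhds_iff.1 h
  have hC0 : 0 ≤ C := (norm_nonneg _).trans (hC 0)
  refine ⟨C / s, fun z => ?_⟩
  by_cases hz : dist z z₀ < s
  · rw [hs' hz, norm_zero]; positivity
  · rw [← dist_eq_norm]
    refine (hC z).trans ?_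
    rw [div_mul_eq_mul_div, le_div_iff₀ hs]
    exact mul_le_mul_of_nonneg_left (not_lt.1 hz) hC0

theorem BSub.exists_peak {v : ℂ → ℝ} {D : Set ℂ} (hv : BSub v D) {z₀ : ℂ} (hz₀ : z₀ ∈ D)
    {C : ℝ} (hC : 0 ≤ C)
    (h : ∀ b : ℂ → ℂ, ContDiff ℝ ∞ b → HasCompactSupport b → tsupport b ⊆ D →
      ∀ L : ℝ, (∀ z, ‖dzb b z‖ ≤ L * ‖z - z₀‖) →
      ‖b z₀‖ ^ 2 * Real.exp (v z₀) ≤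
        C * ∫ z, ‖dzb b z‖ ^ 2 * (‖z - z₀‖ ^ 2)⁻¹ * Real.exp (v z)) :
    ∃ g : ℂ → ℂ, DifferentiableOn ℂ g D ∧ ‖g z₀‖ = Real.pi⁻¹ ∧
      IntegrableOn (fun z => ‖g z‖ ^ 2 * Real.exp (-v z)) D ∧
      ∫ z in D, ‖g z‖ ^ 2 * Real.exp (-v z) ≤ C * Real.exp (-v z₀) := by
  obtain ⟨F, hF, hFn, hFb⟩ := hv.exists_dual hC h
  have hD := hv.isOpen
  have hVm := hv.measurable_indicator
  set V := D.indicator v with hV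
  set f : ℂ → ℂ := fun z => conj (F z) *
    ((Real.exp (V z / 2) * ‖z - z₀‖⁻¹ : ℝ) * (z - z₀)) with hf
  have hne : ∀ᵐ z : ℂ, z ≠ z₀ := by
    simp [ae_iff]
  have hm : Measurable fun z : ℂ => (((Real.exp (V z / 2) * ‖z - z₀‖⁻¹ : ℝ) : ℂ) * (z - z₀)) := by
    have : Measurable fun z : ℂ => (Real.exp (V z / 2) * ‖z - z₀‖⁻¹ : ℝ) := by fun_prop
    exact (Complex.measurable_ofReal.comp this).mul (by fun_prop)
  have hnorm : ∀ z, z ≠ z₀ → ‖f z‖ = ‖F z‖ * Real.exp (V z / 2) := fun z hz => by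
    have : ‖z - z₀‖ ≠ 0 := norm_ne_zero_iff.2 (sub_ne_zero.2 hz)
    simp only [hf, norm_mul, RCLike.norm_conj, Complex.norm_real, norm_inv, Real.norm_eq_abs,
      Real.abs_exp, abs_norm]
    field_simp
  have hfint : ∀ K ⊆ D, IsCompact K → IntegrableOn f K := fun K hKD hK => by
    obtain ⟨U, V', B, hU, hKU, hUD, hV'm, hB, hE⟩ := hv.exists_nhd_ext hK hKD
    have h1 : IntegrableOn (fun z => conj (F z)) K := by
      have : IsFiniteMeasure (volume.restrict K) := ⟨by
        rw [Measure.restrict_apply_univ]; exact hK.measure_lt_top⟩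
      have := ((hF.restrict K).integrable (by norm_num : (1 : ENNReal) ≤ 2))
      exact (Complex.conjCLE : ℂ →L[ℝ] ℂ).integrable_comp this
    refine Integrable.mul_bdd (c := Real.exp (B / 2)) h1 hm.aestronglyMeasurable ?_
    filter_upwards [ae_restrict_mem hK.measurableSet] with z hz
    simp only [norm_mul, Complex.norm_real, norm_inv, Real.norm_eq_abs, Real.abs_exp, abs_norm,
      mul_assoc]
    have h2 : V z ≤ B := by
      rw [hV, indicator_of_mem (hKD hz), ← hE (hKU hz)]
      exact (le_abs_self _).trans (hB z)
    have h3 : ‖z - z₀‖⁻¹ * ‖z - z₀‖ ≤ 1 := inv_mul_le_one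
    calc _ ≤ Real.exp (V z / 2) * 1 := mul_le_mul_of_nonneg_left h3 (Real.exp_nonneg _)
      _ ≤ _ := by rw [mul_one]; exact Real.exp_le_exp.2 (by linarith)
  have hkey : ∀ b ∈ flatTests D z₀, b z₀ = ∫ z, f z * (z - z₀)⁻¹ * dzb b z := fun b hb => by
    rw [hFb b hb]
    refine integral_congr_ae ?_
    filter_upwards [hne] with z hz
    have : z - z₀ ≠ 0 := sub_ne_zero.2 hz
    simp only [hf]
    push_cast
    field_simp
  have h0 : ∀ γ : ℂ → ℂ, ContDiff ℝ ∞ γ → HasCompactSupport γ → tsupport γ ⊆ D →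
      ∫ z, f z * dzb γ z = 0 := by
    intro γ hγ hγc hγD
    have hsm : ContDiff ℝ ∞ fun z : ℂ => (z - z₀) * γ z :=
      (contDiff_id.sub contDiff_const).mul hγ
    obtain ⟨L, hL⟩ := hγ.dzb_smooth.continuous.bounded_above_of_compact_support hγc.dzb_compact
    have h1 := hkey (fun z => (z - z₀) * γ z) ⟨hsm, hγc.mul_left,
      (tsupport_mul_subset_right (f := fun z => z - z₀) (g := γ)).trans hγD, L, fun z => ?_⟩
    · simp only [sub_self, zero_mul] at h1
      rw [h1]
      refine integral_congr_ae ?_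
      filter_upwards [hne] with z hz
      have : z - z₀ ≠ 0 := sub_ne_zero.2 hz
      simp only [dzb_sub_mul hγ]
      field_simp
    · rw [dzb_sub_mul hγ, norm_mul, mul_comm]
      exact mul_le_mul_of_nonneg_right (hL z) (norm_nonneg _)
  obtain ⟨g, hg, hfg, hgz⟩ := exists_holomorphic_rep hD hfint h0
  have hae : ∀ᵐ z ∂(volume.restrict D), ‖F z‖ ^ 2 = ‖g z‖ ^ 2 * Real.exp (-v z) := by
    filter_upwards [ae_restrict_mem hD.measurableSet, ae_restrict_of_ae hfg,
      ae_restrict_of_ae hne] with z hz h1 h2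
    rw [← h1 hz, hnorm z h2, mul_pow, ← Real.exp_nat_mul, hV, indicator_of_mem hz]
    push_cast
    rw [mul_div_cancel₀ _ (two_ne_zero), mul_assoc, ← Real.exp_add, add_neg_cancel, Real.exp_zero,
      mul_one]
  have hFi : Integrable fun z => ‖F z‖ ^ 2 := (memLp_two_iff_integrable_sq_norm hF.1).1 hF
  refine ⟨g, hg, ?_, hFi.integrableOn.congr hae, ?_⟩
  · obtain ⟨χ, hχ, hχc, hχD, hχ1, hχ0, hgχ⟩ := hgz z₀ hz₀
    obtain ⟨L, hL⟩ := exists_lipschitz_bound_of_eventually_zero hχ.dzb_smooth.continuous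
      hχc.dzb_compact hχ0
    have h1 := hkey χ ⟨hχ, hχc, hχD, L, hL⟩
    have h2 : g z₀ = -(Real.pi : ℂ)⁻¹ := by
      rw [hgχ, cauchyT]
      have : ∫ ζ, f ζ * dzb χ ζ * (z₀ - ζ)⁻¹ = - ∫ z, f z * (z - z₀)⁻¹ * dzb χ z := by
        rw [← integral_neg]
        refine integral_congr_ae (.of_forall fun z => ?_)
        simp only [← neg_sub z z₀, inv_neg]
        ring
      rw [this, ← h1, hχ1, mul_neg_one]
    rw [h2, norm_neg, norm_inv, Complex.norm_real, Real.norm_eq_abs, abs_of_pos Real.pi_pos]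
  · rw [← integral_congr_ae hae]
    exact (setIntegral_le_integral hFi (.of_forall fun z => by positivity)).trans hFn

theorem exists_entire_approx {φ : ℝ → ℝ} (hφ : Continuous φ)
    (hp : Function.Periodic φ (2 * Real.pi)) {ε : ℝ} (hε : 0 < ε) :
    ∃ P : ℂ → ℂ, Differentiable ℂ P ∧
      ∀ θ : ℝ, |φ θ - (P (Complex.exp (θ * Complex.I))).re| ≤ ε := by
  have : Fact (0 < 2 * Real.pi) := ⟨Real.two_pi_pos⟩
  let f : C(AddCircle (2 * Real.pi), ℂ) := ⟨fun x => ((hp.lift x : ℝ) : ℂ), by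
    refine Complex.continuous_ofReal.comp ?_
    exact continuous_coinduced_dom.2 hφ⟩
  have hf : f ∈ (Submodule.span ℂ (range (fourier (T := 2 * Real.pi)))).topologicalClosure := by
    rw [span_fourier_closure_eq_top]; trivial
  obtain ⟨g, hg, hgf⟩ := mem_closure_iff.1 hf ε hε
  have hrep : ∃ P Q : ℂ → ℂ, Differentiable ℂ P ∧ Differentiable ℂ Q ∧ ∀ θ : ℝ,
      g (θ : AddCircle (2 * Real.pi)) =
        P (Complex.exp (θ * Complex.I)) + conj (Q (Complex.exp (θ * Complex.I))) := by
    clear hgf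
    induction hg using Submodule.span_induction with
    | mem x hx =>
      obtain ⟨n, rfl⟩ := hx
      have h1 : ∀ θ : ℝ, fourier n (θ : AddCircle (2 * Real.pi)) =
          Complex.exp (n * (θ * Complex.I)) := fun θ => by
        rw [fourier_coe_apply]
        congr 1
        have := Real.pi_ne_zero
        push_cast
        field_simp
      obtain ⟨k, rfl | rfl⟩ := n.eq_nat_or_neg
      · refine ⟨fun z => z ^ k, 0, by fun_prop, by fun_prop, fun θ => ?_⟩
        rw [h1]
        simp only [← Complex.exp_nat_mul]
        simp
      · refine ⟨0, fun z => z ^ k, by fun_prop, by fun_prop, fun θ => ?_⟩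
        rw [h1]
        simp only [← Complex.exp_nat_mul, ← Complex.exp_conj]
        simp
    | zero => exact ⟨0, 0, by fun_prop, by fun_prop, fun θ => by simp⟩
    | add x y _ _ hx hy =>
      obtain ⟨P, Q, hP, hQ, h⟩ := hx
      obtain ⟨P', Q', hP', hQ', h'⟩ := hy
      refine ⟨P + P', Q + Q', hP.add hP', hQ.add hQ', fun θ => ?_⟩
      simp only [ContinuousMap.add_apply, h, h', Pi.add_apply, map_add]
      ring
    | smul a x _ hx =>
      obtain ⟨P, Q, hP, hQ, h⟩ := hx
      refine ⟨a • P, conj a • Q, hP.const_smul _, hQ.const_smul _, fun θ => ?_⟩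
      simp only [ContinuousMap.smul_apply, h, Pi.smul_apply, smul_eq_mul, map_mul,
        RCLike.conj_conj]
      ring
  obtain ⟨P, Q, hP, hQ, h⟩ := hrep
  refine ⟨P + Q, hP.add hQ, fun θ => ?_⟩
  have h1 := ContinuousMap.dist_lt_iff hε |>.1 hgf (θ : AddCircle (2 * Real.pi))
  rw [dist_eq_norm, h] at h1
  have h2 : f (θ : AddCircle (2 * Real.pi)) = (φ θ : ℂ) := by
    simp [f, Function.Periodic.lift_coe]
  rw [h2] at h1
  refine le_trans ?_ h1.le
  refine le_trans (le_of_eq ?_) (Complex.abs_re_le_norm _)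
  simp

theorem circleAverage_normSq_sub (c z : ℂ) (t : ℝ) :
    Real.circleAverage (fun w => ‖w - c‖ ^ 2) z t = ‖z - c‖ ^ 2 + t ^ 2 := by
  have h1 : Real.circleAverage (fun w : ℂ => (2 * conj (z - c) * (w - z)).re) z t = 0 := by
    have h2 : Real.circleAverage (fun w : ℂ => 2 * conj (z - c) * (w - z)) z t = 0 := by
      have := DiffContOnCl.circleAverage (f := fun w : ℂ => 2 * conj (z - c) * (w - z)) (c := z)
        (R := t) (Differentiable.diffContOnCl (by fun_prop))
      simpa using this
    have h3 := ContinuousLinearMap.circleAverage_comp_comm Complex.reCLM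
      (f := fun w : ℂ => 2 * conj (z - c) * (w - z)) (c := z) (R := t)
      (Continuous.continuousOn (by fun_prop)).circleIntegrable'
    rw [h2] at h3
    simpa [Function.comp_def] using h3
  have h4 : Real.circleAverage (fun w => ‖w - c‖ ^ 2) z t =
      Real.circleAverage (fun w : ℂ => (‖z - c‖ ^ 2 + t ^ 2) + (2 * conj (z - c) * (w - z)).re)
        z t := by
    refine Real.circleAverage_congr_sphere fun w hw => ?_
    have hw' : ‖w - z‖ ^ 2 = t ^ 2 := by
      rw [mem_sphere_iff_norm] at hw
      rw [hw, sq_abs]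
    rw [← hw', Complex.sq_norm, Complex.sq_norm, Complex.sq_norm]
    simp [Complex.normSq_apply]
    ring
  rw [h4, Real.circleAverage_fun_add (circleIntegrable_const _ _ _)
    (Continuous.continuousOn (by fun_prop)).circleIntegrable', h1, Real.circleAverage_const,
    add_zero]

theorem le_circleAverage_of_local {u : ℂ → ℝ} {Ω : Set ℂ} (husc : UpperSemicontinuousOn u Ω)
    (hbd : ∀ K ⊆ Ω, IsCompact K → ∃ m : ℝ, ∀ z ∈ K, m ≤ u z)
    (hloc : ∀ z ∈ Ω, ∃ s > 0, ∀ r, 0 < r → r < s → u z ≤ Real.circleAverage u z r)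
    {c : ℂ} {r : ℝ} (hr : 0 < r) (hc : closedBall c r ⊆ Ω) : u c ≤ Real.circleAverage u c r := by
  obtain ⟨V, hV, ⟨C, hC⟩, hE, φ, hφc, hφg, hper, hlim⟩ := exists_circle_majorants husc hbd hr.le hc
  refine ge_of_tendsto hlim (.of_forall fun n => ?_)
  refine le_of_forall_pos_le_add fun ε hε => ?_
  obtain ⟨P, hP, hPφ⟩ := exists_entire_approx (hφc n) (hper n) (show 0 < ε / 4 by linarith)
  set h : ℂ → ℝ := fun z => (P ((z - c) / r)).re with hh
  have hr' : (r : ℂ) ≠ 0 := by exact_mod_cast hr.ne'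
  have hcm : ∀ θ : ℝ, h (circleMap c r θ) = (P (Complex.exp (θ * Complex.I))).re := fun θ => by
    simp only [hh, circleMap, add_sub_cancel_left]
    rw [mul_div_cancel_left₀ _ hr']
  have hPd : Differentiable ℂ fun z => P ((z - c) / r) :=
    hP.comp ((differentiable_id.sub_const c).div_const (r : ℂ))
  have hhc : Continuous h := Complex.continuous_re.comp hPd.continuous
  have hmean : ∀ z t, Real.circleAverage h z t = h z := fun z t => by
    have h2 := DiffContOnCl.circleAverage (f := fun z => P ((z - c) / r)) (c := z)
        (R := t) hPd.diffContOnCl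
    have h3 := ContinuousLinearMap.circleAverage_comp_comm Complex.reCLM
      (f := fun z => P ((z - c) / r)) (c := z) (R := t) hPd.continuous.continuousOn.circleIntegrable'
    rw [h2] at h3
    exact h3
  set e : ℝ := ε / (4 * r ^ 2) with he
  set f : ℂ → ℝ := fun z => u z + (e * ‖z - c‖ ^ 2 - h z) with hf
  have hfusc : UpperSemicontinuousOn f (closedBall c r) :=
    (husc.mono hc).add (Continuous.continuousOn (by fun_prop)).upperSemicontinuousOn
  obtain ⟨z, hz, hmax⟩ := hfusc.exists_isMaxOn ⟨c, mem_closedBall_self hr.le⟩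
    (isCompact_closedBall c r)
  have hsph : dist z c = r := by
    by_contra hne
    have hlt : dist z c < r := lt_of_le_of_ne hz hne
    obtain ⟨s, hs, hs'⟩ := hloc z (hc hz)
    set t := min (s / 2) ((r - dist z c) / 2)
    have ht0 : 0 < t := lt_min (by linarith) (by linarith)
    have hts : t < s := (min_le_left _ _).trans_lt (by linarith)
    have htr : t ≤ (r - dist z c) / 2 := min_le_right _ _
    have hsub : closedBall z t ⊆ closedBall c r :=
      closedBall_subset_closedBall' (by linarith)
    have hui : CircleIntegrable u z t := by
      refine circleIntegrable_of_sphere (circleIntegrable_of_bounded hV.measurable hC z t) ?_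
      rw [abs_of_pos ht0]
      exact hE.mono (sphere_subset_closedBall.trans hsub)
    have h1 := hs' t ht0 hts
    have hci : CircleIntegrable (fun z => e * ‖z - c‖ ^ 2) z t :=
      (Continuous.continuousOn (by fun_prop)).circleIntegrable'
    have hci' : CircleIntegrable h z t := hhc.continuousOn.circleIntegrable'
    have h2 : Real.circleAverage f z t =
        Real.circleAverage u z t + (e * (‖z - c‖ ^ 2 + t ^ 2) - h z) := by
      have h3 : CircleIntegrable (fun z => e * ‖z - c‖ ^ 2 - h z) z t := hci.sub hci'
      rw [hf, Real.circleAverage_fun_add hui h3, Real.circleAverage_fun_sub hci hci',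
        hmean, ← circleAverage_normSq_sub]
      congr 2
      exact Real.circleAverage_fun_smul (a := e) (f := fun z => ‖z - c‖ ^ 2)
    have h3 : Real.circleAverage f z t ≤ f z := by
      have := Real.circleAverage_mono (f₁ := f) (f₂ := fun _ => f z) (c := z) (R := t)
        (hui.add (hci.sub hci')) (circleIntegrable_const _ _ _) fun w hw => ?_
      · rwa [Real.circleAverage_const] at this
      · rw [abs_of_pos ht0] at hw
        exact hmax (hsub (sphere_subset_closedBall hw))
    have h4 : 0 < e * t ^ 2 := by positivity
    simp only [hf] at h3 h2
    rw [h2] at h3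
    linarith
  have h1 : f c ≤ f z := hmax (mem_closedBall_self hr.le)
  obtain ⟨θ, hθ⟩ : z ∈ range (circleMap c r) := by
    rw [range_circleMap, abs_of_pos hr]; exact hsph
  have h2 : f z ≤ ε / 4 + ε / 4 := by
    have h3 : u z ≤ φ n θ := hθ ▸ hφg n θ
    have h4 := (abs_le.1 (hPφ θ)).2
    rw [← hcm, hθ] at h4
    have h5 : e * ‖z - c‖ ^ 2 = ε / 4 := by
      rw [← dist_eq_norm, hsph, he]; field_simp
    simp only [hf]
    linarith
  have h6 : h c ≤ ((2 * Real.pi)⁻¹ * ∫ θ in (0 : ℝ)..(2 * Real.pi), φ n θ) + ε / 4 := by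
    have h7 : ∫ θ in (0 : ℝ)..(2 * Real.pi), h (circleMap c r θ) ≤
        ∫ θ in (0 : ℝ)..(2 * Real.pi), (φ n θ + ε / 4) := by
      refine intervalIntegral.integral_mono_on Real.two_pi_pos.le
        ((hhc.comp (continuous_circleMap c r)).intervalIntegrable _ _)
        (((hφc n).add continuous_const).intervalIntegrable _ _) fun θ _ => ?_
      rw [hcm]
      linarith [(abs_le.1 (hPφ θ)).1]
    rw [intervalIntegral.integral_add ((hφc n).intervalIntegrable _ _)
      (continuous_const.intervalIntegrable _ _), intervalIntegral.integral_const] at h7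
    rw [← hmean c r, Real.circleAverage_def, smul_eq_mul]
    have h8 := mul_le_mul_of_nonneg_left h7 (inv_nonneg.2 Real.two_pi_pos.le)
    refine h8.trans (le_of_eq ?_)
    have := Real.pi_ne_zero
    simp only [smul_eq_mul, sub_zero]
    field_simp
  simp only [hf, sub_self, norm_zero] at h1 h2
  linarith

theorem bsub_of_local {u : ℂ → ℝ} {Ω : Set ℂ} (hΩ : IsOpen Ω) (husc : UpperSemicontinuousOn u Ω)
    (hbd : ∀ K ⊆ Ω, IsCompact K → ∃ m : ℝ, ∀ z ∈ K, m ≤ u z)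
    (hloc : ∀ z ∈ Ω, ∃ s > 0, ∀ r, 0 < r → r < s → u z ≤ Real.circleAverage u z r) :
    BSub u Ω where
  isOpen := hΩ
  usc := husc
  bddBelow := hbd
  submean z hz := by
    obtain ⟨s, hs, hsΩ⟩ := isOpen_iff.1 hΩ z hz
    refine ⟨s / 2, by linarith, fun c hc r hr hrs => le_circleAverage_of_local husc hbd hloc hr
      ((closedBall_subset_ball' (?_ : r + dist c z < s)).trans hsΩ)⟩
    have : dist c z < s / 2 := hc
    linarith

/-- The logarithmic potential of the area measure on `F`. -/
noncomputable def logPot (F : Set ℂ) (z : ℂ) : ℝ := ∫ ζ in F, Real.log ‖z - ζ‖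

theorem abs_log_sub_log_le {a z ζ : ℂ} {R : ℝ} (hR : 0 ≤ R) (hζ : ‖ζ - a‖ ≤ R) (hz : z ≠ ζ) :
    |Real.log ‖z - ζ‖ - Real.log (1 + ‖z - a‖)| ≤ Real.log (1 + R) + ‖z - ζ‖⁻¹ := by
  have h0 : 0 < ‖z - ζ‖ := norm_pos_iff.2 (sub_ne_zero.2 hz)
  have h1 : ‖z - ζ‖ ≤ ‖z - a‖ + ‖ζ - a‖ := by
    rw [norm_sub_rev ζ a]; exact norm_sub_le_norm_sub_add_norm_sub z a ζ
  have h2 : ‖z - a‖ ≤ ‖z - ζ‖ + ‖ζ - a‖ := norm_sub_le_norm_sub_add_norm_sub z ζ a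
  have h3 := norm_nonneg (z - a)
  have hi : 0 < ‖z - ζ‖⁻¹ := by positivity
  rw [abs_le]
  constructor
  · have h4 : 1 + ‖z - a‖ ≤ (1 + R) * (‖z - ζ‖ * (1 + ‖z - ζ‖⁻¹)) := by
      rw [mul_add, mul_inv_cancel₀ h0.ne']
      nlinarith
    have h5 := Real.log_le_log (by positivity) h4
    rw [Real.log_mul (by positivity) (by positivity), Real.log_mul h0.ne' (by positivity)] at h5
    have h6 := Real.log_le_sub_one_of_pos (show 0 < 1 + ‖z - ζ‖⁻¹ by positivity)
    linarith
  · have h4 : ‖z - ζ‖ ≤ (1 + R) * (1 + ‖z - a‖) := by nlinarith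
    have h5 := Real.log_le_log h0 h4
    rw [Real.log_mul (by positivity) (by positivity)] at h5
    linarith

theorem integrableOn_norm_sub_inv {F : Set ℂ} (hF : IsCompact F) (z : ℂ) :
    IntegrableOn (fun ζ => ‖z - ζ‖⁻¹) F := by
  have := (integrableOn_inv_of_isBounded hF.isBounded z).norm
  simpa [IntegrableOn, norm_sub_rev] using this

theorem exists_integral_norm_sub_inv_le {F : Set ℂ} (hF : IsCompact F) :
    ∃ C, ∀ z, ∫ ζ in F, ‖z - ζ‖⁻¹ ≤ C := by
  refine ⟨(∫ ζ in ball (0 : ℂ) 1, ‖ζ‖⁻¹) + volume.real F, fun z => ?_⟩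
  have hi := integrableOn_norm_inv 1
  have h1 : ∫ ζ in ball (0 : ℂ) 1, ‖ζ‖⁻¹ = ∫ ζ, (ball (0 : ℂ) 1).indicator (fun ζ => ‖ζ‖⁻¹) (z - ζ) := by
    rw [integral_sub_left_eq_self (fun ζ => (ball (0 : ℂ) 1).indicator (fun ζ => ‖ζ‖⁻¹) ζ) volume z,
      integral_indicator measurableSet_ball]
  have h2 : Integrable fun ζ => (ball (0 : ℂ) 1).indicator (fun ζ => ‖ζ‖⁻¹) (z - ζ) :=
    (hi.integrable_indicator measurableSet_ball).comp_sub_left z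
  have h3 : IntegrableOn (fun _ : ℂ => (1 : ℝ)) F :=
    integrableOn_const hF.measure_lt_top.ne
  calc ∫ ζ in F, ‖z - ζ‖⁻¹
      ≤ ∫ ζ in F, ((ball (0 : ℂ) 1).indicator (fun ζ => ‖ζ‖⁻¹) (z - ζ) + 1) := by
        refine integral_mono (integrableOn_norm_sub_inv hF z) (h2.integrableOn.add h3) fun ζ => ?_
        by_cases h : z - ζ ∈ ball (0 : ℂ) 1
        · simp only [indicator_of_mem h]; linarith
        · simp only [indicator_of_notMem h, zero_add]
          rw [mem_ball_zero_iff, not_lt] at h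
          exact inv_le_one_of_one_le₀ h
    _ = (∫ ζ in F, (ball (0 : ℂ) 1).indicator (fun ζ => ‖ζ‖⁻¹) (z - ζ)) + volume.real F := by
        rw [integral_add h2.integrableOn h3]
        simp [Measure.real]
    _ ≤ _ := by
        rw [h1]
        refine add_le_add (setIntegral_le_integral h2 (.of_forall fun ζ => ?_)) le_rfl
        exact indicator_nonneg (fun ζ _ => by positivity) _

theorem integrableOn_log_norm_sub {F : Set ℂ} (hF : IsCompact F) (z : ℂ) :
    IntegrableOn (fun ζ => Real.log ‖z - ζ‖) F := by
  obtain ⟨R, hR⟩ := hF.isBounded.subset_closedBall z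
  have h3 : ∀ c : ℝ, IntegrableOn (fun _ : ℂ => c) F := fun c =>
    integrableOn_const hF.measure_lt_top.ne
  refine Integrable.mono' ((h3 (Real.log (1 + max R 0))).add (integrableOn_norm_sub_inv hF z))
    (Measurable.aestronglyMeasurable (by fun_prop)) ?_
  have hne : ∀ᵐ ζ : ℂ, ζ ≠ z := by simp [ae_iff]
  filter_upwards [ae_restrict_mem hF.measurableSet, ae_restrict_of_ae hne] with ζ hζ hn
  have := abs_log_sub_log_le (a := z) (le_max_right R 0)
    ((mem_closedBall_iff_norm.1 (hR hζ)).trans (le_max_left _ _)) hn.symm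
  simpa using this

theorem exists_logPot_bound {F : Set ℂ} (hF : IsCompact F) (a : ℂ) :
    ∃ C, ∀ z, |logPot F z - volume.real F * Real.log (1 + ‖z - a‖)| ≤ C := by
  obtain ⟨R, hR⟩ := hF.isBounded.subset_closedBall a
  obtain ⟨C, hC⟩ := exists_integral_norm_sub_inv_le hF
  have h3 : ∀ c : ℝ, IntegrableOn (fun _ : ℂ => c) F := fun c =>
    integrableOn_const hF.measure_lt_top.ne
  refine ⟨volume.real F * Real.log (1 + max R 0) + C, fun z => ?_⟩
  have h1 : logPot F z - volume.real F * Real.log (1 + ‖z - a‖) =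
      ∫ ζ in F, (Real.log ‖z - ζ‖ - Real.log (1 + ‖z - a‖)) := by
    rw [integral_sub (integrableOn_log_norm_sub hF z) (h3 _), setIntegral_const, smul_eq_mul]
    rfl
  rw [h1]
  rw [← Real.norm_eq_abs]
  refine (norm_integral_le_of_norm_le (g := fun ζ => Real.log (1 + max R 0) + ‖z - ζ‖⁻¹)
    ((h3 _).add (integrableOn_norm_sub_inv hF z)) ?_).trans ?_
  · have hne : ∀ᵐ ζ : ℂ, ζ ≠ z := by simp [ae_iff]
    filter_upwards [ae_restrict_mem hF.measurableSet, ae_restrict_of_ae hne] with ζ hζ hn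
    exact abs_log_sub_log_le (le_max_right R 0)
      ((mem_closedBall_iff_norm.1 (hR hζ)).trans (le_max_left _ _)) hn.symm
  · rw [integral_add (h3 _) (integrableOn_norm_sub_inv hF z), setIntegral_const, smul_eq_mul]
    gcongr
    exact hC z

theorem exists_holomorphic_logPot {F : Set ℂ} (hF : IsCompact F) {z₁ : ℂ} (hz : z₁ ∉ F) :
    ∃ s > 0, ∃ G : ℂ → ℂ, DifferentiableOn ℂ G (ball z₁ s) ∧
      ∀ z ∈ ball z₁ s, logPot F z = logPot F z₁ + (G z).re := by
  classical
  obtain ⟨t, ht, htF⟩ := isOpen_iff.1 hF.isClosed.isOpen_compl z₁ hz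
  have hdist : ∀ ζ ∈ F, t ≤ ‖z₁ - ζ‖ := fun ζ hζ => by
    rw [norm_sub_rev, ← dist_eq_norm]
    exact not_lt.1 fun h => htF h hζ
  set s := t / 2 with hs
  have hs0 : 0 < s := by positivity
  set k : ℂ × ℂ → ℂ → ℂ := fun p ζ =>
    if ζ ∈ F then Complex.log (1 + (p.1 - z₁) / (z₁ - ζ)) else 0 with hk
  have hsmall : ∀ ζ ∈ F, ∀ z ∈ ball z₁ s, ‖(z - z₁) / (z₁ - ζ)‖ ≤ 1 / 2 := fun ζ hζ z hz => by
    have h1 := hdist ζ hζ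
    have h2 : ‖z - z₁‖ < s := by rwa [← dist_eq_norm]
    rw [norm_div, div_le_iff₀ (by linarith)]
    linarith
  have hslit : ∀ ζ ∈ F, ∀ z ∈ ball z₁ s, 1 + (z - z₁) / (z₁ - ζ) ∈ Complex.slitPlane := by
    intro ζ hζ z hz
    exact Complex.mem_slitPlane_of_norm_lt_one ((hsmall ζ hζ z hz).trans_lt (by norm_num))
  have hb : ∀ ζ, ∀ p ∈ ball z₁ s ×ˢ (univ : Set ℂ), ‖k p ζ‖ ≤ 3 / 2 * (1 / 2) := fun ζ p hp => by
    by_cases hζ : ζ ∈ F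
    · simp only [hk, if_pos hζ]
      have h1 := hsmall ζ hζ p.1 hp.1
      exact (Complex.norm_log_one_add_half_le_self h1).trans (by gcongr)
    · simp only [hk, if_neg hζ, norm_zero]; norm_num
  have : IsFiniteMeasure (volume.restrict F) := ⟨by
    rw [Measure.restrict_apply_univ]; exact hF.measure_lt_top⟩
  have hm : ∀ p, Measurable (k p) := fun p =>
    Measurable.ite hF.measurableSet (by fun_prop) measurable_const
  have hG := differentiableOn_integral_param (μ := volume.restrict F)
    (isOpen_ball.prod isOpen_univ) (F := k) (H := fun _ => 3 / 2 * (1 / 2)) (fun ζ => ?_)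
    (fun p _ => (hm p).aestronglyMeasurable) (integrable_const _) hb
  · refine ⟨s, hs0, fun z => ∫ ζ in F, k (z, 0) ζ, ?_, fun z hz => ?_⟩
    · exact hG.comp (f := fun z => ((z, 0) : ℂ × ℂ)) (by fun_prop) fun z hz => ⟨hz, trivial⟩
    · have hi : Integrable (k (z, 0)) (volume.restrict F) :=
        Integrable.of_bound (hm _).aestronglyMeasurable _ (.of_forall fun ζ => hb ζ (z, 0) ⟨hz, trivial⟩)
      have h1 : (∫ ζ in F, k (z, 0) ζ).re = ∫ ζ in F, (k (z, 0) ζ).re :=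
        (Complex.reCLM.integral_comp_comm hi).symm
      have hre : IntegrableOn (fun ζ => (k (z, 0) ζ).re) F := Complex.reCLM.integrable_comp hi
      rw [h1, logPot, logPot, ← integral_add (integrableOn_log_norm_sub hF z₁) hre]
      refine setIntegral_congr_fun hF.measurableSet fun ζ hζ => ?_
      have h2 : z₁ - ζ ≠ 0 := by
        have := hdist ζ hζ
        exact norm_pos_iff.1 (by linarith)
      have h3 : z - ζ = (z₁ - ζ) * (1 + (z - z₁) / (z₁ - ζ)) := by field_simp; ring
      have h4 := Complex.slitPlane_ne_zero (hslit ζ hζ z hz)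
      simp only [hk, if_pos hζ]
      change _ = _ + (Complex.log (1 + (z - z₁) / (z₁ - ζ))).re
      rw [Complex.log_re, ← Real.log_mul (norm_ne_zero_iff.2 h2) (norm_ne_zero_iff.2 h4),
        ← norm_mul, ← h3]
  · by_cases hζ : ζ ∈ F
    · simp only [hk, if_pos hζ]
      refine DifferentiableOn.clog (by fun_prop) fun p hp => hslit ζ hζ p.1 hp.1
    · simp only [hk, if_neg hζ]
      exact differentiableOn_const _

theorem continuousAt_logPot {F : Set ℂ} (hF : IsCompact F) {z : ℂ} (hz : z ∉ F) :
    ContinuousAt (logPot F) z := by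
  obtain ⟨s, hs, G, hG, h⟩ := exists_holomorphic_logPot hF hz
  have h1 : ContinuousAt (fun w => logPot F z + (G w).re) z :=
    continuousAt_const.add (Complex.continuous_re.continuousAt.comp
      (hG.continuousOn.continuousAt (ball_mem_nhds z hs)))
  refine h1.congr ?_
  filter_upwards [ball_mem_nhds z hs] with w hw using (h w hw).symm

theorem circleAverage_logPot {F : Set ℂ} (hF : IsCompact F) {z : ℂ} (hz : z ∉ F) :
    ∃ s > 0, ∀ r, 0 < r → r < s → Real.circleAverage (logPot F) z r = logPot F z := by
  obtain ⟨s, hs, G, hG, h⟩ := exists_holomorphic_logPot hF hz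
  refine ⟨s, hs, fun r hr hrs => ?_⟩
  have hsub : closedBall z |r| ⊆ ball z s := by
    rw [abs_of_pos hr]; exact closedBall_subset_ball hrs
  have hd : DiffContOnCl ℂ G (ball z |r|) := by
    refine DifferentiableOn.diffContOnCl (hG.mono ?_)
    rw [closure_ball _ (by positivity)]; exact hsub
  have hc : CircleIntegrable G z r :=
    (hG.continuousOn.mono (sphere_subset_closedBall.trans hsub)).circleIntegrable'
  have h3 := ContinuousLinearMap.circleAverage_comp_comm Complex.reCLM hc
  rw [hd.circleAverage] at h3
  have hc' : CircleIntegrable (fun w => (G w).re) z r :=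
    (Complex.continuous_re.comp_continuousOn
      (hG.continuousOn.mono (sphere_subset_closedBall.trans hsub))).circleIntegrable'
  rw [Real.circleAverage_congr_sphere (f₂ := fun w => logPot F z + (G w).re)
    fun w hw => h w (hsub (sphere_subset_closedBall hw)),
    Real.circleAverage_fun_add (circleIntegrable_const _ _ _) hc', Real.circleAverage_const]
  have h4 := h z (mem_ball_self hs)
  have h5 : Real.circleAverage (fun w => (G w).re) z r = (G z).re := h3
  rw [h5]
  exact h4.symm

theorem BSub.exists_compact_superlevel {v : ℂ → ℝ} {D : Set ℂ} (hv : BSub v D) {b : ℂ} (hb : b ∈ D)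
    {c : ℝ} (hc : c < v b) : ∃ F ⊆ D, IsCompact F ∧ 0 < volume.real F ∧ ∀ z ∈ F, c ≤ v z := by
  have hm : MeasurableSet (D ∩ D.indicator v ⁻¹' Ici c) :=
    hv.isOpen.measurableSet.inter (hv.measurable_indicator measurableSet_Ici)
  have hpos : 0 < volume (D ∩ D.indicator v ⁻¹' Ici c) := by
    refine pos_iff_ne_zero.2 fun h0 => ?_
    obtain ⟨s₁, hs₁, hsub⟩ := hv.submean b hb
    obtain ⟨s₂, hs₂, hs₂D⟩ := isOpen_iff.1 hv.isOpen b hb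
    set s := min s₁ s₂ / 2 with hs
    have hs0 : 0 < s := by positivity
    have hss : s < s₁ := by rw [hs]; linarith [min_le_left s₁ s₂]
    have hss2 : s < s₂ := by rw [hs]; linarith [min_le_right s₁ s₂]
    have hcl : closedBall b s ⊆ D := (closedBall_subset_ball hss2).trans hs₂D
    obtain ⟨V, hV, ⟨C, hC⟩, hE⟩ := hv.exists_ext (isCompact_closedBall b s) hcl
    have hiV : IntegrableOn V (ball b s) :=
      Measure.integrableOn_of_bounded (M := C) measure_ball_lt_top.ne
        hV.measurable.aestronglyMeasurable (ae_of_all _ fun z => by simpa using hC z)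
    have hi : IntegrableOn v (ball b s) :=
      hiV.congr_fun (fun z hz => hE (ball_subset_closedBall hz)) measurableSet_ball
    have h1 := integral_ball_ge_of_submean hi fun r hr hrs =>
      ⟨hv.circleIntegrable (by
        rw [abs_of_pos hr]
        exact sphere_subset_closedBall.trans ((closedBall_subset_closedBall hrs.le).trans hcl)),
        hsub b (mem_ball_self hs₁) r hr (hrs.trans hss)⟩
    have h2 : ∫ ζ in ball b s, v ζ ≤ ∫ ζ in ball b s, c := by
      refine integral_mono_ae hi (integrableOn_const measure_ball_lt_top.ne) ?_
      rw [EventuallyLE, ae_restrict_iff' measurableSet_ball]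
      filter_upwards [measure_eq_zero_iff_ae_notMem.1 h0] with z hz hzb
      by_contra hcon
      have hzD := hcl (ball_subset_closedBall hzb)
      refine hz ⟨hzD, ?_⟩
      rw [mem_preimage, indicator_of_mem hzD]
      exact (not_le.1 hcon).le
    rw [setIntegral_const, smul_eq_mul, mul_comm] at h2
    have h3 : 0 < volume.real (ball b s) :=
      ENNReal.toReal_pos (measure_ball_pos _ _ hs0).ne' measure_ball_lt_top.ne
    exact absurd (le_of_mul_le_mul_right (h1.trans h2) h3) (not_le.2 hc)
  obtain ⟨F, hF, hFc, hF0⟩ := hm.exists_lt_isCompact hpos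
  refine ⟨F, hF.trans inter_subset_left, hFc, ENNReal.toReal_pos hF0.ne' hFc.measure_lt_top.ne,
    fun z hz => ?_⟩
  have := (hF hz).2
  rwa [mem_preimage, indicator_of_mem (hF hz).1] at this

theorem circleAverage_log_norm_sub {a z : ℂ} (r : ℝ) (hr : 0 < r) (h : r < ‖z - a‖) :
    Real.circleAverage (fun w => Real.log ‖w - a‖) z r = Real.log ‖z - a‖ := by
  rw [circleAverage_log_norm_sub_const_eq_log_radius_add_posLog hr.ne', Real.posLog_eq_log]
  · rw [Real.log_mul (by positivity) (by linarith), Real.log_inv]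
    ring
  · rw [abs_of_nonneg (by positivity),
      inv_mul_eq_div, le_div_iff₀ hr]
    linarith

theorem bsub_of_continuousAt {f : ℂ → ℝ} {Ω : Set ℂ} (hΩ : IsOpen Ω)
    (hc : ∀ z ∈ Ω, ContinuousAt f z)
    (h : ∀ z ∈ Ω, ∃ s > 0, ∀ r, 0 < r → r < s → f z ≤ Real.circleAverage f z r) : BSub f Ω := by
  have hco : ContinuousOn f Ω := fun z hz => (hc z hz).continuousWithinAt
  refine bsub_of_local hΩ hco.upperSemicontinuousOn (fun K hK hKc => ?_) h
  obtain ⟨m, hm⟩ := (hKc.image_of_continuousOn (hco.mono hK)).bddBelow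
  exact ⟨m, fun z hz => hm (mem_image_of_mem f hz)⟩

theorem bsub_mul_log_norm_sub (c : ℝ) (a : ℂ) : BSub (fun z => c * Real.log ‖z - a‖) {a}ᶜ := by
  refine bsub_of_continuousAt isOpen_compl_singleton (fun z hz => ?_) fun z hz => ?_
  · have : ‖z - a‖ ≠ 0 := norm_ne_zero_iff.2 (sub_ne_zero.2 hz)
    fun_prop (disch := assumption)
  · refine ⟨‖z - a‖, norm_pos_iff.2 (sub_ne_zero.2 hz), fun r hr hrs => le_of_eq ?_⟩
    have := Real.circleAverage_fun_smul (a := c) (f := fun w => Real.log ‖w - a‖) (c := z) (R := r)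
    simp only [smul_eq_mul] at this
    rw [this, circleAverage_log_norm_sub r hr hrs]

theorem bsub_logPot (c k : ℝ) {F : Set ℂ} (hF : IsCompact F) :
    BSub (fun z => c + k * logPot F z) Fᶜ := by
  refine (bsub_const c hF.isClosed.isOpen_compl).add
    (bsub_of_continuousAt hF.isClosed.isOpen_compl
      (fun z hz => continuousAt_const.mul (continuousAt_logPot hF hz)) fun z hz => ?_)
  obtain ⟨s, hs, h⟩ := circleAverage_logPot hF hz
  refine ⟨s, hs, fun r hr hrs => le_of_eq ?_⟩
  have := Real.circleAverage_fun_smul (a := k) (f := logPot F) (c := z) (R := r)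
  simp only [smul_eq_mul] at this
  rw [this, h r hr hrs]

/-- Gluing: `u` agrees with `f₂` near `B`, dominates `f₁` and `f₂` elsewhere, being their maximum. -/
theorem bsub_glue {f₁ f₂ u : ℂ → ℝ} {D F : Set ℂ} {a : ℂ} {s R : ℝ} (hD : IsOpen D)
    (hF : IsCompact F) (hsR : s < R) (hR : 0 < R) (h₁ : BSub f₁ (D \ {a})) (h₂ : BSub f₂ Fᶜ)
    (hFR : ∀ z ∈ F, R ≤ dist z a) (hFD : ∀ z ∈ F, ∀ w, f₂ w ≤ f₁ z)
    (h₂b : ∀ K : Set ℂ, IsCompact K → ∃ m : ℝ, ∀ z ∈ K, m ≤ f₂ z)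
    (hu₂ : ∀ z ∈ ball a R, u z = f₂ z) (hu : ∀ z ∈ D, s ≤ dist z a → u z = max (f₁ z) (f₂ z)) :
    BSub u D := by
  have hge₂ : ∀ z ∈ D, f₂ z ≤ u z := fun z hz => by
    by_cases h : s ≤ dist z a
    · rw [hu z hz h]; exact le_max_right _ _
    · exact (hu₂ z (by rw [mem_ball]; linarith [not_le.1 h])).ge
  have hne : ∀ z, R ≤ dist z a → z ≠ a := by
    rintro z h rfl
    rw [dist_self] at h
    linarith
  have hfar : ∀ z ∈ D, R ≤ dist z a → ∀ᶠ w in 𝓝 z, w ∈ D ∧ s < dist w a := fun z hz h => by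
    have h1 : ContinuousAt (fun w => dist w a) z := by fun_prop
    exact (show ∀ᶠ w in 𝓝 z, w ∈ D from hD.mem_nhds hz).and (h1.eventually (lt_mem_nhds (hsR.trans_le h)))
  have husc : UpperSemicontinuousOn u D := by
    intro z hz
    by_cases hzR : dist z a < R
    · have hzF : z ∉ F := fun h => absurd (hFR z h) (not_le.2 hzR)
      intro y hy
      rw [hu₂ z hzR] at hy
      have h3 := h₂.usc z hzF y hy
      rw [(hF.isClosed.isOpen_compl).nhdsWithin_eq hzF] at h3
      refine mem_nhdsWithin_of_mem_nhds ?_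
      filter_upwards [h3, isOpen_ball.mem_nhds (show z ∈ ball a R from hzR)] with w hw hwR
      rwa [hu₂ w hwR]
    · have hzR' := not_lt.1 hzR
      have hz1 : z ∈ D \ {a} := ⟨hz, hne z hzR'⟩
      intro y hy
      rw [hu z hz (hsR.le.trans hzR'), max_lt_iff] at hy
      have h3 := h₁.usc z hz1 y hy.1
      rw [h₁.isOpen.nhdsWithin_eq hz1] at h3
      refine mem_nhdsWithin_of_mem_nhds ?_
      by_cases hzF : z ∈ F
      · filter_upwards [h3, hfar z hz hzR'] with w hw hwf
        rw [hu w hwf.1 hwf.2.le]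
        exact max_lt hw ((hFD z hzF w).trans_lt hy.1)
      · have h4 := h₂.usc z hzF y hy.2
        rw [(hF.isClosed.isOpen_compl).nhdsWithin_eq hzF] at h4
        filter_upwards [h3, h4, hfar z hz hzR'] with w hw hw2 hwf
        rw [hu w hwf.1 hwf.2.le]
        exact max_lt hw hw2
  have hbd : ∀ K ⊆ D, IsCompact K → ∃ m : ℝ, ∀ z ∈ K, m ≤ u z := fun K hK hKc => by
    obtain ⟨m, hm⟩ := h₂b K hKc
    exact ⟨m, fun z hz => (hm z hz).trans (hge₂ z (hK hz))⟩
  have hint : ∀ z r, closedBall z r ⊆ D → 0 < r → CircleIntegrable u z r := fun z r h hr => by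
    obtain ⟨V, hV, ⟨C, hC⟩, hE⟩ := exists_bounded_usc_extension husc hbd (isCompact_closedBall z r) h
    refine circleIntegrable_of_sphere (circleIntegrable_of_bounded hV.measurable hC z r) ?_
    rw [abs_of_pos hr]
    exact hE.mono sphere_subset_closedBall
  have key : ∀ f : ℂ → ℝ, ∀ Ω, BSub f Ω → ∀ z ∈ Ω, z ∈ D → (∀ᶠ w in 𝓝 z, f w ≤ u w) →
      ∃ t > 0, ∀ r, 0 < r → r < t → f z ≤ Real.circleAverage u z r := by
    intro f Ω hf z hzΩ hzD hle
    obtain ⟨t₁, ht₁, hsub⟩ := hf.submean z hzΩ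
    obtain ⟨t₂, ht₂, hball⟩ := Metric.mem_nhds_iff.1
      (inter_mem (inter_mem (hf.isOpen.mem_nhds hzΩ) (hD.mem_nhds hzD)) hle)
    refine ⟨min t₁ t₂, lt_min ht₁ ht₂, fun r hr hrt => ?_⟩
    have hcb : closedBall z r ⊆ ball z t₂ := closedBall_subset_ball (hrt.trans_le (min_le_right _ _))
    refine (hsub z (mem_ball_self ht₁) r hr (hrt.trans_le (min_le_left _ _))).trans ?_
    refine Real.circleAverage_mono (hf.circleIntegrable ?_)
      (hint z r (fun w hw => (hball (hcb hw)).1.2) hr) fun w hw => ?_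
    · rw [abs_of_pos hr]
      exact fun w hw => (hball (hcb (sphere_subset_closedBall hw))).1.1
    · rw [abs_of_pos hr] at hw
      exact (hball (hcb (sphere_subset_closedBall hw))).2
  refine bsub_of_local hD husc hbd fun z hz => ?_
  have k₂ : z ∉ F → ∃ t > 0, ∀ r, 0 < r → r < t → f₂ z ≤ Real.circleAverage u z r := fun hzF =>
    key f₂ _ h₂ z hzF hz (by filter_upwards [hD.mem_nhds hz] with w hw using hge₂ w hw)
  by_cases hzR : dist z a < R
  · rw [hu₂ z hzR]
    exact k₂ fun h => absurd (hFR z h) (not_le.2 hzR)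
  · have hzR' := not_lt.1 hzR
    obtain ⟨t, ht, hk₁⟩ := key f₁ _ h₁ z ⟨hz, hne z hzR'⟩ hz (by
      filter_upwards [hfar z hz hzR'] with w hw
      rw [hu w hw.1 hw.2.le]
      exact le_max_left _ _)
    rw [hu z hz (hsR.le.trans hzR')]
    by_cases hzF : z ∈ F
    · refine ⟨t, ht, fun r hr hrt => ?_⟩
      rw [max_eq_left (hFD z hzF z)]
      exact hk₁ r hr hrt
    · obtain ⟨t', ht', hk₂⟩ := k₂ hzF
      exact ⟨min t t', lt_min ht ht', fun r hr hrt => max_le (hk₁ r hr (hrt.trans_le (min_le_left _ _)))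
        (hk₂ r hr (hrt.trans_le (min_le_right _ _)))⟩

theorem abs_log_sub_half_log_le (a z₀ z : ℂ) :
    |Real.log (1 + ‖z - a‖) - 1 / 2 * Real.log (1 + ‖z - z₀‖ ^ 2)| ≤
      Real.log (1 + ‖z₀ - a‖) + 1 / 2 * Real.log 2 := by
  have h1 : ‖z - a‖ ≤ ‖z - z₀‖ + ‖z₀ - a‖ := norm_sub_le_norm_sub_add_norm_sub z z₀ a
  have h2 : ‖z - z₀‖ ≤ ‖z - a‖ + ‖z₀ - a‖ := by
    rw [norm_sub_rev z₀ a]; exact norm_sub_le_norm_sub_add_norm_sub z a z₀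
  set x := ‖z - a‖
  set t := ‖z - z₀‖
  set d := ‖z₀ - a‖
  have hx0 : 0 ≤ x := norm_nonneg _
  have ht0 : 0 ≤ t := norm_nonneg _
  have hd0 : 0 ≤ d := norm_nonneg _
  have e1 : Real.log (1 + x) ≤ Real.log (1 + t) + Real.log (1 + d) := by
    rw [← Real.log_mul (by positivity) (by positivity)]
    exact Real.log_le_log (by positivity) (by nlinarith [mul_nonneg ht0 hd0])
  have e2 : Real.log (1 + t) ≤ Real.log (1 + x) + Real.log (1 + d) := by
    rw [← Real.log_mul (by positivity) (by positivity)]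
    exact Real.log_le_log (by positivity) (by nlinarith [mul_nonneg hx0 hd0])
  have e3 : Real.log (1 + t ^ 2) ≤ 2 * Real.log (1 + t) := by
    have := Real.log_pow (n := 2) (x := 1 + t)
    push_cast at this
    rw [← this]
    exact Real.log_le_log (by positivity) (by nlinarith)
  have e4 : 2 * Real.log (1 + t) ≤ Real.log 2 + Real.log (1 + t ^ 2) := by
    have := Real.log_pow (n := 2) (x := 1 + t)
    push_cast at this
    rw [← this, ← Real.log_mul (by positivity) (by positivity)]
    exact Real.log_le_log (by positivity) (by nlinarith [sq_nonneg (t - 1)])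
  have := Real.log_nonneg (show (1 : ℝ) ≤ 2 by norm_num)
  rw [abs_le]
  constructor <;> linarith

theorem BSub.exists_comparison {v : ℂ → ℝ} {D : Set ℂ} (hv : BSub v D) {M : ℝ}
    (hM : ∀ z ∈ D, M ≤ v z) {a b : ℂ} (ha : a ∈ D) (hb : b ∈ D) (hab : v a < v b) (z₀ : ℂ) :
    ∃ (u : ℂ → ℝ) (A C₁ : ℝ), 0 < A ∧ BSub u D ∧
      ∀ z ∈ D, |u z - v z + A / 2 * Real.log (1 + ‖z - z₀‖ ^ 2)| ≤ C₁ := by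
  classical
  obtain ⟨c, hac, hcb⟩ := exists_between hab
  obtain ⟨c', hcc', hcb'⟩ := exists_between hcb
  obtain ⟨F, hFD, hF, hm, hFv⟩ := hv.exists_compact_superlevel hb hcb'
  obtain ⟨CL, hCL⟩ := exists_logPot_bound hF a
  have hnear := hv.usc a ha c hac
  rw [hv.isOpen.nhdsWithin_eq ha] at hnear
  obtain ⟨R, hR, hRD⟩ := Metric.mem_nhds_iff.1 (inter_mem (hv.isOpen.mem_nhds ha) hnear)
  have hvR : ∀ z ∈ ball a R, v z < c := fun z hz => (hRD hz).2
  obtain ⟨S, hS⟩ := hF.isBounded.subset_closedBall a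
  set m := volume.real F
  set s := R / 2 with hs
  have hs0 : 0 < s := by positivity
  set k := CL + m * Real.log (1 + R) - m * Real.log s with hk
  set η := (c' - c) / (|k + CL + m * Real.log (1 + |S|)| + 1) with hη
  have hη0 : 0 < η := div_pos (by linarith) (by positivity)
  have hηk : η * (k + CL + m * Real.log (1 + |S|)) ≤ c' - c := by
    rw [hη, div_mul_eq_mul_div, div_le_iff₀ (by positivity)]
    exact mul_le_mul_of_nonneg_left ((le_abs_self _).trans (by linarith)) (by linarith)
  set f₁ : ℂ → ℝ := fun z => v z + (-(η * m)) * Real.log ‖z - a‖ with hf₁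
  set f₂ : ℂ → ℝ := fun z => (c + η * k) + (-η) * logPot F z with hf₂
  have hCL1 : ∀ z, η * logPot F z ≤ η * (m * Real.log (1 + ‖z - a‖)) + η * CL := fun z => by
    rw [← mul_add]; exact mul_le_mul_of_nonneg_left (by linarith [(abs_le.1 (hCL z)).2]) hη0.le
  have hCL2 : ∀ z, η * (m * Real.log (1 + ‖z - a‖)) - η * CL ≤ η * logPot F z := fun z => by
    rw [← mul_sub]; exact mul_le_mul_of_nonneg_left (by linarith [(abs_le.1 (hCL z)).1]) hη0.le
  have hηm : 0 < η * m := mul_pos hη0 hm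
  set u : ℂ → ℝ := fun z => if dist z a < s then f₂ z else max (f₁ z) (f₂ z) with hu
  have hu₂ : ∀ z ∈ ball a R, u z = f₂ z := fun z hz => by
    by_cases h : dist z a < s
    · simp only [hu, if_pos h]
    · simp only [hu, if_neg h]
      refine max_eq_right ?_
      have h1 := hvR z hz
      rw [mem_ball, dist_eq_norm] at hz
      rw [dist_eq_norm, not_lt] at h
      have h2 : Real.log s ≤ Real.log ‖z - a‖ := Real.log_le_log hs0 h
      have h3 : Real.log (1 + ‖z - a‖) ≤ Real.log (1 + R) :=
        Real.log_le_log (by positivity) (by linarith)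
      have h4 := hCL1 z
      have h5 := mul_le_mul_of_nonneg_left h2 hηm.le
      have h6 := mul_le_mul_of_nonneg_left h3 hηm.le
      simp only [hf₁, hf₂, hk]
      nlinarith
  have hu₁ : ∀ z ∈ D, s ≤ dist z a → u z = max (f₁ z) (f₂ z) := fun z _ h => by
    simp only [hu, if_neg (not_lt.2 h)]
  have hlog0 : ∀ z : ℂ, 0 ≤ Real.log (1 + ‖z - a‖) := fun z =>
    Real.log_nonneg (by linarith [norm_nonneg (z - a)])
  have hB : BSub u D := by
    refine bsub_glue hv.isOpen hF (by linarith : s < R) hR (f₁ := f₁) (f₂ := f₂) ?_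
      (bsub_logPot _ _ hF) (fun z hz => ?_) (fun z hz w => ?_) (fun K hK => ?_) hu₂ hu₁
    · exact (hv.mono sdiff_subset (hv.isOpen.sdiff isClosed_singleton)).add
        ((bsub_mul_log_norm_sub _ a).mono (fun z hz => hz.2) (hv.isOpen.sdiff isClosed_singleton))
    · by_contra h
      linarith [hvR z (not_le.1 h), hFv z hz]
    · have h1 := hCL2 w
      have h2 := hFv z hz
      have h3 : Real.log ‖z - a‖ ≤ Real.log (1 + |S|) := by
        have hza : z ≠ a := by rintro rfl; linarith
        refine Real.log_le_log (norm_pos_iff.2 (sub_ne_zero.2 hza)) ?_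
        have := hS hz
        rw [mem_closedBall, dist_eq_norm] at this
        linarith [le_abs_self S]
      have h5 := mul_le_mul_of_nonneg_left h3 hηm.le
      have h6 := mul_nonneg hηm.le (hlog0 w)
      simp only [hf₁, hf₂]
      nlinarith
    · obtain ⟨T, hT⟩ := hK.isBounded.subset_closedBall a
      refine ⟨c + η * k - (η * (m * Real.log (1 + |T|)) + η * CL), fun z hz => ?_⟩
      have h1 := hCL1 z
      have h3 : Real.log (1 + ‖z - a‖) ≤ Real.log (1 + |T|) := by
        refine Real.log_le_log (by positivity) ?_
        have := hT hz
        rw [mem_closedBall, dist_eq_norm] at this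
        linarith [le_abs_self T]
      have h5 := mul_le_mul_of_nonneg_left h3 hηm.le
      simp only [hf₂]
      nlinarith
  set E := |c| + |M| + η * |k| + η * |CL| + η * m * |Real.log (1 + s) - Real.log s| with hE
  have hEb : ∀ z ∈ D, |u z - v z + η * m * Real.log (1 + ‖z - a‖)| ≤ E := fun z hz => by
    have hv0 := hM z hz
    have h1 := hCL1 z
    have h2 := hCL2 z
    have p1 : η * k ≤ η * |k| := mul_le_mul_of_nonneg_left (le_abs_self _) hη0.le
    have p2 : η * CL ≤ η * |CL| := mul_le_mul_of_nonneg_left (le_abs_self _) hη0.le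
    have p3 : η * -|k| ≤ η * k := mul_le_mul_of_nonneg_left (neg_abs_le _) hη0.le
    have p4 := mul_nonneg hηm.le (abs_nonneg (Real.log (1 + s) - Real.log s))
    have hup₂ : f₂ z - v z + η * m * Real.log (1 + ‖z - a‖) ≤ E := by
      simp only [hf₂, hE]
      linarith [le_abs_self c, neg_abs_le M]
    by_cases h : dist z a < s
    · have hzR : z ∈ ball a R := by rw [mem_ball]; linarith
      rw [hu₂ z hzR, abs_le]
      refine ⟨?_, hup₂⟩
      have := hvR z hzR
      simp only [hf₂, hE]
      linarith [abs_nonneg c, abs_nonneg M]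
    · have hsz : s ≤ ‖z - a‖ := by rw [← dist_eq_norm]; exact not_lt.1 h
      have hz0 : 0 < ‖z - a‖ := hs0.trans_le hsz
      have q1 : Real.log ‖z - a‖ ≤ Real.log (1 + ‖z - a‖) := Real.log_le_log hz0 (by linarith)
      have q2 : Real.log (1 + ‖z - a‖) - Real.log ‖z - a‖ ≤ Real.log (1 + s) - Real.log s := by
        rw [← Real.log_div (by positivity) hz0.ne', ← Real.log_div (by positivity) hs0.ne']
        refine Real.log_le_log (by positivity) ?_
        rw [div_le_div_iff₀ hz0 hs0]
        nlinarith
      have q3 := mul_le_mul_of_nonneg_left (q2.trans (le_abs_self _)) hηm.le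
      have q4 := mul_le_mul_of_nonneg_left q1 hηm.le
      rw [hu₁ z hz (not_lt.1 h), abs_le]
      constructor
      · have := le_max_left (f₁ z) (f₂ z)
        simp only [hf₁, hE] at this ⊢
        linarith [abs_nonneg c, abs_nonneg M]
      · have : f₁ z - v z + η * m * Real.log (1 + ‖z - a‖) ≤ E := by
          simp only [hf₁, hE]
          linarith [abs_nonneg c, abs_nonneg M]
        rcases max_cases (f₁ z) (f₂ z) with h | h <;> rw [h.1] <;> assumption
  refine ⟨u, η * m, E + η * m * (Real.log (1 + ‖z₀ - a‖) + 1 / 2 * Real.log 2), hηm, hB, fun z hz => ?_⟩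
  have h1 := abs_le.1 (hEb z hz)
  have h2 := abs_le.1 (abs_log_sub_half_log_le a z₀ z)
  have h3 := mul_le_mul_of_nonneg_left h2.1 hηm.le
  have h4 := mul_le_mul_of_nonneg_left h2.2 hηm.le
  rw [abs_le]
  constructor <;> nlinarith

/-- For large `t` there are holomorphic functions on `D` in the unit ball of the weighted space
`L²(D, exp (-2 t v))` whose value at `z₀` is at least a fixed multiple of `exp (t * v z₀)`. -/
def HasPeaks (v : ℂ → ℝ) (D : Set ℂ) (z₀ : ℂ) : Prop :=
  ∃ c > 0, ∃ N : ℝ, ∀ t ≥ N, ∃ g : ℂ → ℂ, DifferentiableOn ℂ g D ∧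
    IntegrableOn (fun z => ‖g z‖ ^ 2 * Real.exp (-(2 * t * v z))) D ∧
    (∫ z in D, ‖g z‖ ^ 2 * Real.exp (-(2 * t * v z))) ≤ 1 ∧
    c * Real.exp (t * v z₀) ≤ ‖g z₀‖

theorem BSub.exists_peaks {v : ℂ → ℝ} {D : Set ℂ} (hv : BSub v D) {M : ℝ}
    (hM : ∀ z ∈ D, M ≤ v z) {a b : ℂ} (ha : a ∈ D) (hb : b ∈ D) (hab : v a < v b) {z₀ : ℂ}
    (hz₀ : z₀ ∈ D) : HasPeaks v D z₀ := by
  obtain ⟨u, A, C₁, hA, hu, hcomp⟩ := hv.exists_comparison hM ha hb hab z₀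
  obtain ⟨C, hC, N, hN⟩ := integral_weight_le_of_comparison hv hu hA z₀ hcomp
  set C' := 8 / Real.pi * (2 + 12 * C)
  have hC'0 : 0 < C' := by have := Real.pi_pos; positivity
  refine ⟨Real.pi⁻¹ / √C', by have := Real.pi_pos; positivity, max 0 N, fun t ht => ?_⟩
  have ht0 : 0 ≤ t := (le_max_left _ _).trans ht
  have htN : N ≤ 2 * t := by linarith [(le_max_right 0 N).trans ht]
  obtain ⟨g, hg, hg0, hgi, hgb⟩ := (hv.const_mul (a := 2 * t) (by positivity)).exists_peak hz₀ hC'0.le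
    fun b hb hbc hbD L hL => (hv.const_mul (a := 2 * t) (by positivity)).point_inequality hC hz₀ hb hbc
      hbD (hN _ htN b hb hbc hbD) hL
  set k : ℝ := Real.exp (t * v z₀) / √C' with hk
  have hk0 : 0 < k := by positivity
  have hk2 : k ^ 2 * (C' * Real.exp (-(2 * t * v z₀))) = 1 := by
    have h1 : Real.exp (t * v z₀) ^ 2 * Real.exp (-(2 * t * v z₀)) = 1 := by
      rw [← Real.exp_nat_mul, ← Real.exp_add, Real.exp_eq_one_iff]
      push_cast; ring
    rw [hk, div_pow, Real.sq_sqrt hC'0.le]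
    field_simp
    rw [← h1]
    ring_nf
  have heq : ∀ z, ‖(k : ℂ) * g z‖ ^ 2 * Real.exp (-(2 * t * v z)) =
      k ^ 2 * (‖g z‖ ^ 2 * Real.exp (-(2 * t * v z))) := fun z => by
    rw [norm_mul, Complex.norm_real, Real.norm_of_nonneg hk0.le]; ring
  refine ⟨fun z => k * g z, hg.const_mul _, ?_, ?_, le_of_eq ?_⟩
  · simp only [heq]
    exact hgi.const_mul _
  · simp only [heq]
    rw [integral_const_mul, ← hk2]
    gcongr
  · rw [norm_mul, Complex.norm_real, Real.norm_of_nonneg hk0.le, hg0, hk]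
    ring

/-- The identity theorem, in any number of variables. -/
theorem eqOn_of_isPreconnected {E : Type*} [NormedAddCommGroup E] [NormedSpace ℂ E] {U : Set E}
    (hU : IsOpen U) (hUc : IsPreconnected U) {f g : E → ℂ} (hf : DifferentiableOn ℂ f U)
    (hg : DifferentiableOn ℂ g U) {q : E} (hq : q ∈ U) (h : f =ᶠ[𝓝 q] g) : EqOn f g U := by
  have hS : IsOpen {x | f =ᶠ[𝓝 x] g} := isOpen_iff_mem_nhds.2 fun x hx => hx.eventually_nhds
  refine fun x hx => ((hUc.subset_of_closure_inter_subset hS ⟨q, hq, h⟩ ?_) hx : f =ᶠ[𝓝 x] g).self_of_nhds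
  rintro x ⟨hxS, hxU⟩
  obtain ⟨r, hr, hrU⟩ := isOpen_iff.1 hU x hxU
  obtain ⟨y, hy, hyx⟩ := mem_closure_iff_nhds.1 hxS _ (ball_mem_nhds x hr)
  change f =ᶠ[𝓝 x] g
  filter_upwards [ball_mem_nhds x hr] with w hw
  set L : ℂ → E := fun l => AffineMap.lineMap (k := ℂ) y w l with hL
  have hLd : Differentiable ℂ L := by
    simp only [hL, AffineMap.lineMap_apply_module']
    fun_prop
  have hV : IsOpen (L ⁻¹' ball x r) := isOpen_ball.preimage hLd.continuous
  have hVc : IsPreconnected (L ⁻¹' ball x r) := by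
    have : Convex ℝ (L ⁻¹' ball x r) := by
      intro l hl l' hl' α β hα hβ hαβ
      have h1 : L (α • l + β • l') = α • L l + β • L l' := by
        obtain rfl : β = 1 - α := by linarith
        simp only [hL, AffineMap.lineMap_apply_module', ← Complex.coe_smul]
        push_cast
        module
      rw [mem_preimage, h1]
      exact convex_ball x r hl hl' hα hβ hαβ
    exact this.isPreconnected
  have h0 : L 0 = y := AffineMap.lineMap_apply_zero _ _
  have h1 : L 1 = w := AffineMap.lineMap_apply_one _ _
  have hev : f ∘ L =ᶠ[𝓝 0] g ∘ L := by
    have := hLd.continuous.continuousAt (x := (0 : ℂ))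
    rw [ContinuousAt, h0] at this
    exact this.eventually hyx
  have := ((hf.mono hrU).comp hLd.differentiableOn fun l hl => hl).analyticOnNhd hV
    |>.eqOn_of_preconnected_of_eventuallyEq
      (((hg.mono hrU).comp hLd.differentiableOn fun l hl => hl).analyticOnNhd hV) hVc
      (show (0 : ℂ) ∈ L ⁻¹' ball x r by rw [mem_preimage, h0]; exact hy) hev
      (show (1 : ℂ) ∈ L ⁻¹' ball x r by rw [mem_preimage, h1]; exact hw)
  simpa only [Function.comp_apply, h1] using this

theorem PolarSet.isPreconnected_ball_inter {a : ℂ} {s : ℝ} {D : Set ℂ} (hD : IsOpen D)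
    (hp : PolarSet (ball a s \ D)) : IsPreconnected (ball a s ∩ D) := by
  classical
  have hW : IsOpen (ball a s ∩ D) := isOpen_ball.inter hD
  rw [isPreconnected_iff_subset_of_disjoint]
  intro u w hu hw hsub hdisj
  have hnot : ∀ z ∈ ball a s ∩ D, z ∈ w → z ∉ u := fun z hz hzw hzu => by
    have : z ∈ ball a s ∩ D ∩ (u ∩ w) := ⟨hz, hzu, hzw⟩
    rwa [hdisj] at this
  set h : ℂ → ℂ := u.indicator fun _ => 1 with hh
  have hhm : Measurable h := measurable_const.indicator hu.measurableSet
  have hhb : ∀ z, ‖h z‖ ≤ 1 := fun z => by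
    by_cases hz : z ∈ u <;> simp [hh, hz]
  have hhd : DifferentiableOn ℂ h (ball a s ∩ D) := by
    intro z hz
    refine DifferentiableAt.differentiableWithinAt ?_
    rcases hsub hz with hzu | hzw
    · refine (differentiableAt_const (1 : ℂ)).congr_of_eventuallyEq ?_
      filter_upwards [hu.mem_nhds hzu] with y hy
      simp [hh, hy]
    · refine (differentiableAt_const (0 : ℂ)).congr_of_eventuallyEq ?_
      filter_upwards [hw.mem_nhds hzw, hW.mem_nhds hz] with y hy hyW
      simp [hh, hnot y hyW hy]
  have hfin : IsFiniteMeasure (volume.restrict (ball a s ∩ D)) := ⟨by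
    rw [Measure.restrict_apply_univ]
    exact (measure_mono inter_subset_left).trans_lt measure_ball_lt_top⟩
  have hint := fun γ h1 h2 h3 => hp.integral_indicator_mul_dzb (γ := γ) isOpen_ball hD hhd
    (MemLp.of_bound hhm.aestronglyMeasurable 1 (ae_of_all _ hhb)) h1 h2 h3
  obtain ⟨g, hg, hge, -⟩ := exists_holomorphic_rep (f := (ball a s ∩ D).indicator h) isOpen_ball
    (fun K _ hK => Measure.integrableOn_of_bounded (M := 1) hK.measure_lt_top.ne
      (hhm.indicator hW.measurableSet).aestronglyMeasurable
      (ae_of_all _ fun z => (norm_indicator_le_norm_self _ _).trans (hhb z))) hint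
  have hval : ∀ V : Set ℂ, IsOpen V → V ⊆ ball a s ∩ D → ∀ c : ℂ, (∀ z ∈ V, h z = c) →
      ∀ z ∈ V, g z = c := by
    intro V hV hVs c hc
    have : g =ᵐ[volume.restrict V] fun _ => c := by
      rw [EventuallyEq, ae_restrict_iff' hV.measurableSet]
      filter_upwards [hge] with z hz hzV
      rw [← hz (hVs hzV).1, indicator_of_mem (hVs hzV), hc z hzV]
    exact Measure.eqOn_open_of_ae_eq this hV
      (hg.continuousOn.mono (hVs.trans inter_subset_left)) continuousOn_const
  by_contra! hcon
  obtain ⟨x, hx, hxu⟩ := not_subset.1 hcon.1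
  obtain ⟨y, hy, hyw⟩ := not_subset.1 hcon.2
  have hxw := (hsub hx).resolve_left hxu
  have hyu := (hsub hy).resolve_right hyw
  have hy1 := hval _ (hW.inter hu) inter_subset_left 1 fun z hz => by simp [hh, hz.2]
  have hx0 := hval _ (hW.inter hw) inter_subset_left 0 fun z hz => by simp [hh, hnot z hz.1 hz.2]
  have := eqOn_of_isPreconnected isOpen_ball (convex_ball a s).isPreconnected hg
    (differentiableOn_const 1) hy.1 (by
      filter_upwards [(hW.inter hu).mem_nhds ⟨hy, hyu⟩] with z hz using hy1 z hz) hx.1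
  rw [hx0 x ⟨hx, hxw⟩] at this
  exact zero_ne_one this

theorem exists_peaks_of_const {D : Set ℂ} (hD : IsOpen D) (hp : ¬ PolarSet Dᶜ) {v : ℂ → ℝ} {a : ℝ}
    (hv : ∀ z ∈ D, v z = a) {z₀ : ℂ} (hz₀ : z₀ ∈ D) :
    HasPeaks v D z₀ := by
  obtain ⟨k, hk⟩ : ∃ k : ℕ, CapPos (Dᶜ ∩ closedBall 0 k) := by
    by_contra! hc
    refine hp (polarSet_of_not_capPos (K := fun k : ℕ => Dᶜ ∩ closedBall 0 k)
      (fun k => inter_subset_right) hc fun z hz => ?_)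
    obtain ⟨k₀, hk₀⟩ := exists_nat_ge ‖z‖
    refine ⟨k₀, fun k hk => ⟨hz, ?_⟩⟩
    rw [mem_closedBall_zero_iff]
    exact hk₀.trans (by exact_mod_cast hk)
  have hKc : IsCompact (Dᶜ ∩ closedBall (0 : ℂ) k) :=
    (isCompact_closedBall 0 _).inter_left hD.isClosed_compl
  obtain ⟨f, ⟨hf, hfi⟩, hf0⟩ := hk.exists_ne_zero hKc (q := z₀) fun h => h.1 hz₀
  have hDK : D ⊆ (Dᶜ ∩ closedBall (0 : ℂ) k)ᶜ := fun z hz h => h.1 hz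
  set A := ∫ z in D, ‖f z‖ ^ 2 with hA
  refine ⟨‖f z₀‖ / (A + 1), by positivity, 0, fun t _ =>
    ⟨fun z => ((Real.exp (t * a) / (A + 1) : ℝ) : ℂ) * f z, (hf.mono hDK).const_mul _, ?_⟩⟩
  have hcongr : EqOn (fun z => ‖((Real.exp (t * a) / (A + 1) : ℝ) : ℂ) * f z‖ ^ 2 *
      Real.exp (-(2 * t * v z))) (fun z => ((A + 1) ^ 2)⁻¹ * ‖f z‖ ^ 2) D := fun z hz => by
    simp only [hv z hz, norm_mul, Complex.norm_real, Real.norm_eq_abs]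
    rw [abs_of_nonneg (by positivity), mul_pow, div_pow, ← Real.exp_nat_mul, Real.exp_neg,
      show ((2 : ℕ) : ℝ) * (t * a) = 2 * t * a by push_cast; ring]
    field_simp
  refine ⟨IntegrableOn.congr_fun ((hfi.mono_set hDK).const_mul _) hcongr.symm hD.measurableSet,
    ?_, ?_⟩
  · rw [setIntegral_congr_fun hD.measurableSet hcongr, integral_const_mul, ← hA, inv_mul_le_iff₀
      (by positivity)]
    nlinarith
  · rw [hv z₀ hz₀, norm_mul, Complex.norm_real, Real.norm_eq_abs, abs_of_nonneg (by positivity)]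
    exact le_of_eq (by ring)

/-- Absolutely summable combinations of a locally bounded, `L²`-bounded sequence of holomorphic
functions are holomorphic and square integrable. -/
theorem tsum_mem_L2h {G : Set (ℂ × ℂ)} (hG : IsOpen G) {f : ℕ → ℂ × ℂ → ℂ}
    (hf : ∀ j, DifferentiableOn ℂ (f j) G)
    (hloc : ∀ p ∈ G, ∃ C, ∀ᶠ q in 𝓝 p, ∀ j, ‖f j q‖ ≤ C) {B : ENNReal} (hB : B ≠ ⊤)
    (hL : ∀ j, eLpNorm (f j) 2 (volume.restrict G) ≤ B) {x : ℕ → ℂ}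
    (hx : Summable fun j => ‖x j‖) : (fun p => ∑' j, x j * f j p) ∈ L2h G := by
  have hsum : ∀ p ∈ G, Summable fun j => ‖x j * f j p‖ := fun p hp => by
    obtain ⟨C, hC⟩ := hloc p hp
    refine (hx.mul_right C).of_nonneg_of_le (fun j => norm_nonneg _) fun j => ?_
    rw [norm_mul]
    exact mul_le_mul_of_nonneg_left (hC.self_of_nhds j) (norm_nonneg _)
  have hd : DifferentiableOn ℂ (fun p => ∑' j, x j * f j p) G := fun p hp => by
    obtain ⟨C, hC⟩ := hloc p hp
    obtain ⟨U, hU, hUo, hpU⟩ := _root_.mem_nhds_iff.1 (hC.and (hG.mem_nhds hp))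
    have h1 := differentiableOn_integral_param (μ := Measure.count) hUo
      (F := fun p j => x j * f j p) (H := fun j => ‖x j‖ * C)
      (fun j => ((hf j).mono fun q hq => (hU hq).2).const_mul _)
      (fun q hq => .of_discrete)
      (integrable_count_iff.2 (by simpa [abs_mul] using hx.mul_right |C|)) fun j q hq => by
        rw [norm_mul]
        exact mul_le_mul_of_nonneg_left ((hU hq).1 j) (norm_nonneg _)
    refine ((h1.congr fun q hq => ?_).differentiableAt (hUo.mem_nhds hpU)).differentiableWithinAt
    rw [integral_countable (integrable_count_iff.2 (hsum q (hU hq).2))]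
    simp [Measure.real]
  have hm : ∀ j, AEStronglyMeasurable (x j • f j) (volume.restrict G) := fun j =>
    (((hf j).continuousOn.aestronglyMeasurable hG.measurableSet)).const_smul _
  refine ⟨hd, (memLp_two_iff_integrable_sq_norm
    (hd.continuousOn.aestronglyMeasurable hG.measurableSet)).1
    ⟨hd.continuousOn.aestronglyMeasurable hG.measurableSet, ?_⟩⟩
  have hx' : ∑' j, ‖x j‖ₑ ≠ ⊤ := by
    have := hx.tsum_ofReal_ne_top
    simpa only [ofReal_norm] using this
  refine lt_of_le_of_lt (Lp.eLpNorm_le_of_ae_tendsto (u := atTop)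
    (f := fun n => ∑ j ∈ Finset.range n, x j • f j) (C := (∑' j, ‖x j‖ₑ) * B)
    (.of_forall fun n => ?_) (fun n => ?_) ?_) (ENNReal.mul_lt_top hx'.lt_top hB.lt_top)
  · refine (eLpNorm_sum_le (fun j _ => hm j) one_le_two).trans ?_
    rw [← ENNReal.tsum_mul_right]
    refine (Finset.sum_le_sum fun j _ => ?_).trans (ENNReal.sum_le_tsum _)
    rw [eLpNorm_const_smul]
    exact mul_le_mul_right (hL j) _
  · exact Finset.aestronglyMeasurable_sum _ fun j _ => hm j
  · filter_upwards [ae_restrict_mem hG.measurableSet] with p hp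
    simpa [Finset.sum_apply] using (hsum p hp).of_norm.hasSum.tendsto_sum_nat

theorem eLpNorm_mul_pow_le {D : Set ℂ} {v : ℂ → ℝ} {G : Set (ℂ × ℂ)} (hG : IsOpen G)
    (hGv : ∀ p, p ∈ G ↔ p.1 ∈ D ∧ ‖p.2‖ < Real.exp (-v p.1)) (hD : IsOpen D) {g : ℂ → ℂ}
    (hg : DifferentiableOn ℂ g D) (j : ℕ)
    (hi : IntegrableOn (fun z => ‖g z‖ ^ 2 * Real.exp (-(2 * (j + 1) * v z))) D)
    (h1 : (∫ z in D, ‖g z‖ ^ 2 * Real.exp (-(2 * (j + 1) * v z))) ≤ 1) :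
    eLpNorm (fun p : ℂ × ℂ => g p.1 * p.2 ^ j) 2 (volume.restrict G) ^ 2 ≤ NNReal.pi := by
  have hc : ContinuousOn (fun p : ℂ × ℂ => g p.1 * p.2 ^ j) G :=
    (hg.continuousOn.comp continuousOn_fst fun p hp => ((hGv p).1 hp).1).mul
      (continuous_snd.pow j).continuousOn
  have h2 := eLpNorm_nnreal_pow_eq_lintegral (p := 2) (μ := volume.restrict G)
    (f := fun p : ℂ × ℂ => g p.1 * p.2 ^ j) two_ne_zero
  norm_num at h2
  rw [h2, ← lintegral_indicator hG.measurableSet, Measure.volume_eq_prod, lintegral_prod]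
  · calc _ ≤ ∫⁻ z, D.indicator (fun z => ENNReal.ofReal
          (‖g z‖ ^ 2 * Real.exp (-(2 * (j + 1) * v z))) * NNReal.pi) z := by
          refine lintegral_mono fun z => ?_
          by_cases hz : z ∈ D
          · rw [indicator_of_mem hz]
            calc _ ≤ ∫⁻ w, (ball (0 : ℂ) (Real.exp (-v z))).indicator (fun _ =>
                  ENNReal.ofReal (‖g z‖ ^ 2 * Real.exp (-v z) ^ (2 * j))) w := by
                  refine lintegral_mono fun w => ?_
                  by_cases hp : (z, w) ∈ G
                  · have hw := ((hGv _).1 hp).2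
                    rw [indicator_of_mem hp, indicator_of_mem (mem_ball_zero_iff.2 hw),
                      ← enorm_pow, ← enorm_mul, ← ofReal_norm,
                      ← ENNReal.ofReal_pow (norm_nonneg _)]
                    refine ENNReal.ofReal_le_ofReal ?_
                    rw [norm_mul, norm_pow, mul_pow, ← pow_mul, mul_comm j 2]
                    gcongr
                  · rw [indicator_of_notMem hp]
                    exact zero_le
              _ = _ := by
                  rw [lintegral_indicator_const measurableSet_ball, Complex.volume_ball,
                    ← mul_assoc, ← ENNReal.ofReal_pow (Real.exp_pos _).le,
                    ← ENNReal.ofReal_mul (by positivity), mul_assoc, ← pow_add,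
                    ← Real.exp_nat_mul]
                  push_cast
                  ring_nf
          · rw [indicator_of_notMem hz]
            refine le_of_eq ?_
            rw [← lintegral_zero (μ := (volume : Measure ℂ))]
            congr 1
            ext w
            exact indicator_of_notMem (fun h => hz ((hGv _).1 h).1) _
      _ ≤ _ := by
          rw [lintegral_indicator hD.measurableSet, lintegral_mul_const' _ _ ENNReal.coe_ne_top,
            ← ofReal_integral_eq_lintegral_ofReal hi (.of_forall fun z => by positivity)]
          exact mul_le_of_le_one_left' (ENNReal.ofReal_le_one.2 h1)
  · exact (aemeasurable_indicator_iff hG.measurableSet).2 (by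
      simpa only [enorm_mul, enorm_pow, Measure.volume_eq_prod] using
        (hc.aestronglyMeasurable (μ := volume) hG.measurableSet).enorm.pow_const 2)

theorem norm_mul_pow_le {D : Set ℂ} {v : ℂ → ℝ} {g : ℂ → ℂ}
    (hg : DifferentiableOn ℂ g D) {j : ℕ}
    (hi : IntegrableOn (fun z => ‖g z‖ ^ 2 * Real.exp (-(2 * (j + 1) * v z))) D)
    (h1 : (∫ z in D, ‖g z‖ ^ 2 * Real.exp (-(2 * (j + 1) * v z))) ≤ 1) {z w : ℂ} {r c : ℝ}
    (hr : 0 < r) (hD : ball z r ⊆ D) (hvc : ∀ ζ ∈ ball z r, v ζ ≤ c)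
    (hw : ‖w‖ ≤ Real.exp (-c)) :
    ‖g z * w ^ j‖ ≤ Real.exp c / (√Real.pi * r) := by
  have hle : ∀ ζ ∈ ball z r, ‖g ζ‖ ^ 2 ≤ Real.exp (2 * (j + 1) * c) *
      (‖g ζ‖ ^ 2 * Real.exp (-(2 * (j + 1) * v ζ))) := fun ζ hζ => by
    rw [mul_left_comm, ← Real.exp_add]
    refine le_mul_of_one_le_right (by positivity) (Real.one_le_exp ?_)
    nlinarith [mul_nonneg (by positivity : (0 : ℝ) ≤ 2 * (j + 1)) (sub_nonneg.2 (hvc ζ hζ))]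
  have hi' := (hi.mono_set hD).const_mul (Real.exp (2 * (j + 1) * c))
  have hgi : IntegrableOn (fun ζ => ‖g ζ‖ ^ 2) (ball z r) := by
    refine hi'.mono ((((hg.mono hD).continuousOn.norm.pow 2)).aestronglyMeasurable
      measurableSet_ball) ?_
    filter_upwards [ae_restrict_mem measurableSet_ball] with ζ hζ
    rw [Real.norm_of_nonneg (by positivity), Real.norm_of_nonneg (by positivity)]
    exact hle ζ hζ
  have h2 := (sq_norm_mul_area_le hr (hg.mono hD) hgi).trans
    ((setIntegral_mono_on hgi hi' measurableSet_ball hle).trans_eq (integral_const_mul _ _))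
  have h3 : (∫ ζ in ball z r, ‖g ζ‖ ^ 2 * Real.exp (-(2 * (j + 1) * v ζ))) ≤ 1 :=
    (setIntegral_mono_set hi (.of_forall fun ζ => by positivity)
      (LE.le.eventuallyLE hD)).trans h1
  have h4 : ‖g z‖ ^ 2 * (Real.pi * r ^ 2) ≤ Real.exp (2 * (j + 1) * c) :=
    h2.trans (mul_le_of_le_one_right (Real.exp_pos _).le h3)
  rw [le_div_iff₀ (by positivity)]
  refine le_of_sq_le_sq ?_ (Real.exp_pos c).le
  rw [norm_mul, norm_pow]
  calc _ = ‖g z‖ ^ 2 * (Real.pi * r ^ 2) * (‖w‖ ^ j) ^ 2 := by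
        rw [mul_pow, mul_pow, mul_pow, Real.sq_sqrt Real.pi_pos.le]; ring
    _ ≤ Real.exp (2 * (j + 1) * c) * (Real.exp (-c) ^ j) ^ 2 := by gcongr
    _ = _ := by
        rw [← pow_mul, ← Real.exp_nat_mul, ← Real.exp_nat_mul, ← Real.exp_add]
        push_cast
        ring_nf

theorem exists_local_bound_mul_pow {D : Set ℂ} {v : ℂ → ℝ} (hD : IsOpen D)
    (hv : UpperSemicontinuousOn v D) {g : ℕ → ℂ → ℂ} (hg : ∀ j, DifferentiableOn ℂ (g j) D)
    (hi : ∀ j : ℕ, IntegrableOn (fun z => ‖g j z‖ ^ 2 * Real.exp (-(2 * (j + 1) * v z))) D)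
    (h1 : ∀ j : ℕ, (∫ z in D, ‖g j z‖ ^ 2 * Real.exp (-(2 * (j + 1) * v z))) ≤ 1)
    {p : ℂ × ℂ} (hpD : p.1 ∈ D) (hp : ‖p.2‖ < Real.exp (-v p.1)) :
    ∃ C, ∀ᶠ q in 𝓝 p, ∀ j, ‖g j q.1 * q.2 ^ j‖ ≤ C := by
  obtain ⟨c, hc, hvc⟩ : ∃ c, ‖p.2‖ < Real.exp (-c) ∧ v p.1 < c := by
    have h2 : ContinuousAt (fun c => Real.exp (-c)) (v p.1) := by fun_prop
    exact (((h2.tendsto.eventually (lt_mem_nhds hp)).filter_mono nhdsWithin_le_nhds).and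
      (self_mem_nhdsWithin (s := Ioi (v p.1)))).exists
  have h3 := hv p.1 hpD c hvc
  rw [hD.nhdsWithin_eq hpD] at h3
  obtain ⟨r, hr, hr'⟩ := eventually_nhds_iff_ball.1 (h3.and (hD.mem_nhds hpD))
  refine ⟨Real.exp c / (√Real.pi * (r / 2)), ?_⟩
  filter_upwards [(continuous_fst.tendsto p).eventually (ball_mem_nhds p.1 (half_pos hr)),
    (continuous_snd.norm.tendsto p).eventually (gt_mem_nhds hc)] with q hq hq2 j
  have hsub : ball q.1 (r / 2) ⊆ ball p.1 r := ball_subset_ball' (by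
    have := mem_ball.1 hq; linarith)
  exact norm_mul_pow_le (hg j) (hi j) (h1 j) (half_pos hr) (fun ζ hζ => (hr' ζ (hsub hζ)).2)
    (fun ζ hζ => (hr' ζ (hsub hζ)).1.le) hq2.le

/-- A uniform bound, from the closed graph theorem, for the analytic continuations of a bounded
sequence all of whose absolutely summable combinations can be continued. -/
theorem exists_bound_of_extension {a : ℂ → ℕ → ℂ} {r R C : ℝ} (hr : 0 < r) (hR : 1 < R)
    (ha : ∀ s ∈ ball (0 : ℂ) r, ∀ j, ‖a s j‖ ≤ C)
    (hext : ∀ x : ℕ → ℂ, (Summable fun j => ‖x j‖) → ∃ e : ℂ → ℂ,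
      DifferentiableOn ℂ e (ball 0 R) ∧ ∀ s ∈ ball (0 : ℂ) r, e s = ∑' j, x j * a s j) :
    ∃ C', ∀ j, ∀ e : ℂ → ℂ, DifferentiableOn ℂ e (ball 0 R) →
      (∀ s ∈ ball (0 : ℂ) r, e s = a s j) → ‖e 1‖ ≤ C' := by
  have huniq : ∀ {R' : ℝ} {e₁ e₂ : ℂ → ℂ}, 0 < R' → DifferentiableOn ℂ e₁ (ball 0 R') →
      DifferentiableOn ℂ e₂ (ball 0 R') → (∀ s ∈ ball (0 : ℂ) r ∩ ball 0 R', e₁ s = e₂ s) →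
      EqOn e₁ e₂ (ball 0 R') := fun hR' h₁ h₂ h =>
    eqOn_of_isPreconnected isOpen_ball (convex_ball _ _).isPreconnected h₁ h₂
      (mem_ball_self hR') (by
        filter_upwards [ball_mem_nhds (0 : ℂ) hr, ball_mem_nhds (0 : ℂ) hR'] with s h₃ h₄
        exact h s ⟨h₃, h₄⟩)
  let X := lp (fun _ : ℕ => ℂ) 1
  have hsm : ∀ x : X, HasSum (fun j => ‖x j‖) ‖x‖ := fun x => by
    simpa using lp.hasSum_norm (p := 1) (by norm_num) x
  have hsa : ∀ s ∈ ball (0 : ℂ) r, ∀ x : X, Summable fun j => ‖x j * a s j‖ := fun s hs x =>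
    ((hsm x).summable.mul_right C).of_nonneg_of_le (fun j => norm_nonneg _) fun j => by
      rw [norm_mul]
      exact mul_le_mul_of_nonneg_left (ha s hs j) (norm_nonneg _)
  choose e he hea using fun x : X => hext x (hsm x).summable
  have hcb : closedBall (0 : ℂ) 1 ⊆ ball 0 R := closedBall_subset_ball hR
  have hadd : ∀ x y : X, EqOn (e (x + y)) (fun s => e x s + e y s) (ball 0 R) := fun x y =>
    huniq (one_pos.trans hR) (he _) ((he x).add (he y)) fun s hs => by
      rw [hea _ s hs.1, hea _ s hs.1, hea _ s hs.1,
        ← (hsa s hs.1 x).of_norm.tsum_add (hsa s hs.1 y).of_norm]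
      exact tsum_congr fun j => add_mul _ _ _
  have hsmul : ∀ (c : ℂ) (x : X), EqOn (e (c • x)) (fun s => c * e x s) (ball 0 R) := fun c x =>
    huniq (one_pos.trans hR) (he _) ((he x).const_mul c) fun s hs => by
      rw [hea _ s hs.1, hea _ s hs.1, ← tsum_mul_left]
      exact tsum_congr fun j => mul_assoc _ _ _
  let T : X →ₗ[ℂ] C(closedBall (0 : ℂ) 1, ℂ) :=
    { toFun := fun x => ⟨fun s => e x s, ((he x).continuousOn.mono hcb).domRestrict⟩
      map_add' := fun x y => ContinuousMap.ext fun s => hadd x y (hcb s.2)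
      map_smul' := fun c x => ContinuousMap.ext fun s => hsmul c x (hcb s.2) }
  have hT : Continuous T := T.continuous_of_seq_closed_graph fun u x y hu hy => by
    have hy' := ContinuousMap.tendsto_iff_tendstoUniformly.1 hy
    set Y : ℂ → ℂ := Function.extend Subtype.val y 0
    have hYy : ∀ s : closedBall (0 : ℂ) 1, Y s = y s := fun s =>
      Subtype.val_injective.extend_apply _ _ _
    have hun : TendstoUniformlyOn (fun n => e (u n)) Y atTop (closedBall 0 1) := by
      rw [tendstoUniformlyOn_iff_tendstoUniformly_comp_coe]
      rw [show ⇑y = Y ∘ Subtype.val from (funext hYy).symm] at hy'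
      exact hy'
    have hYc : ContinuousOn Y (closedBall 0 1) := by
      rw [continuousOn_iff_continuous_domRestrict]
      convert y.continuous using 1
      exact funext hYy
    have hYd : DifferentiableOn ℂ Y (ball 0 1) :=
      (hun.mono ball_subset_closedBall).tendstoLocallyUniformlyOn.differentiableOn
        (.of_forall fun n => (he (u n)).mono (ball_subset_closedBall.trans hcb)) isOpen_ball
    have hEq : EqOn Y (e x) (ball 0 1) := huniq one_pos hYd
      ((he x).mono (ball_subset_closedBall.trans hcb)) fun s hs => by
        refine tendsto_nhds_unique (hun.tendsto_at (ball_subset_closedBall hs.2)) ?_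
        rw [tendsto_iff_norm_sub_tendsto_zero]
        have hu' := (tendsto_iff_norm_sub_tendsto_zero.1 hu).mul_const C
        rw [zero_mul] at hu'
        refine squeeze_zero (fun n => norm_nonneg _) (fun n => ?_) hu'
        have h1 : e (u n) s - e x s = ∑' j, (u n - x) j * a s j := by
          rw [hea _ s hs.1, hea _ s hs.1,
            ← (hsa s hs.1 (u n)).of_norm.tsum_sub (hsa s hs.1 x).of_norm]
          exact tsum_congr fun j => (sub_mul _ _ _).symm
        rw [h1]
        refine tsum_of_norm_bounded ((hsm (u n - x)).mul_right C) fun j => ?_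
        rw [norm_mul]
        exact mul_le_mul_of_nonneg_left (ha s hs.1 j) (norm_nonneg _)
    have hEq' : EqOn Y (e x) (closedBall 0 1) := hEq.of_subset_closure hYc
      ((he x).continuousOn.mono hcb) ball_subset_closedBall (closure_ball _ one_ne_zero).ge
    exact ContinuousMap.ext fun s => (hYy s).symm.trans (hEq' s.2)
  refine ⟨‖(⟨T, hT⟩ : X →L[ℂ] C(closedBall (0 : ℂ) 1, ℂ))‖, fun j e' he' hea' => ?_⟩
  have h1 : EqOn e' (e (lp.single 1 j 1)) (ball 0 R) := huniq (one_pos.trans hR) he' (he _)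
    fun s hs => by
      rw [hea' s hs.1, hea _ s hs.1, tsum_eq_single j fun i hi => by
        simp [lp.single_apply, hi]]
      simp [lp.single_apply]
  have h2 := (⟨T, hT⟩ : X →L[ℂ] C(closedBall (0 : ℂ) 1, ℂ)).le_opNorm (lp.single 1 j 1)
  rw [lp.norm_single one_pos, norm_one, mul_one] at h2
  rw [h1 (mem_ball_zero_iff.2 (by simpa using hR))]
  exact (ContinuousMap.norm_coe_le_norm (T (lp.single 1 j 1)) ⟨1, by simp⟩).trans h2

theorem exists_L2h_extension_hull {D : Set ℂ} (hD : IsOpen D) {ρ : ℂ → EReal}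
    (hρ : UpperSemicontinuousOn ρ D) {f : ℂ × ℂ → ℂ} (hf : f ∈ L2h (hartogs D ρ)) :
    ∃ F ∈ L2h (hartogs (DHat D ρ) (rhoHat D ρ)), EqOn F f (hartogs D ρ) := by
  obtain ⟨F, hF, hFf⟩ := exists_extension_hull hD hρ hf
  refine ⟨F, ⟨hF, ?_⟩, hFf⟩
  have h0 : volume (hartogs (DHat D ρ) (rhoHat D ρ) \ hartogs D ρ) = 0 := by
    refine measure_null_of_locally_null _ fun p hp => ?_
    obtain ⟨s, hs, -, -, hpol, -⟩ := exists_local_box hD hρ hp.1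
    refine ⟨_, inter_mem_nhdsWithin _ ((isOpen_ball.prod isOpen_univ).mem_nhds
      (⟨mem_ball_self hs, mem_univ _⟩ : p ∈ ball p.1 s ×ˢ (univ : Set ℂ))), ?_⟩
    refine measure_mono_null (t := (ball p.1 s \ D) ×ˢ univ) (fun x hx => ⟨⟨hx.2.1, fun h =>
      hx.1.2 (hull_inter D ρ hx.1.1 h)⟩, mem_univ _⟩) ?_
    rw [Measure.volume_eq_prod, Measure.prod_prod, hpol.volume_eq_zero, zero_mul]
  have h1 : IntegrableOn (fun p => ‖F p‖ ^ 2) (hartogs D ρ) :=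
    IntegrableOn.congr_fun hf.2 (fun p hp => by simp only [hFf hp])
      (isOpen_hartogs hD hρ).measurableSet
  exact h1.congr_set_ae ((ae_le_set.2 h0).antisymm
    (LE.le.eventuallyLE (hartogs_subset_hull D ρ)))

theorem polarSet_ball_diff_of_extension {D : Set ℂ} (hD : IsOpen D) {G : Set (ℂ × ℂ)} {A : ℝ}
    (hGD : G ⊆ D ×ˢ ball 0 A) {q : ℂ × ℂ} (hqD : q.1 ∈ D) {ε δ : ℝ}
    (hε : 0 < ε) (hδ : 0 < δ)
    (H : ∀ f ∈ L2h G, ∃ g, DifferentiableOn ℂ g (ball q ε) ∧ EqOn g f (ball q δ)) :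
    PolarSet (ball q.1 ε \ D) := by
  set K : ℕ → Set ℂ := fun k => (Dᶜ ∩ {z | dist z q.1 + 1 / ((k : ℝ) + 1) ≤ ε}) ∩
    closedBall 0 k
  refine polarSet_of_not_capPos (K := K) (fun k => inter_subset_right) (fun k hk => ?_)
    fun z hz => ?_
  · have hKc : IsCompact (K k) := (isCompact_closedBall 0 _).inter_left
      (hD.isClosed_compl.inter (isClosed_le (by fun_prop) continuous_const))
    have hDK : D ⊆ (K k)ᶜ := fun z hz h => h.1.1 hz
    obtain ⟨f, hf, hfn⟩ := hk.exists_not_extend hKc isOpen_ball (convex_ball q.1 ε).isPreconnected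
      (fun z hz => mem_ball.2 (lt_of_lt_of_le (lt_add_of_pos_right _ (by positivity)) hz.1.2))
      (mem_ball_self hε) (hDK hqD)
    have hfG : (fun p : ℂ × ℂ => f p.1) ∈ L2h G := by
      refine ⟨(hf.1.mono hDK).comp differentiableOn_fst fun p hp => (hGD hp).1, ?_⟩
      refine IntegrableOn.mono_set (t := D ×ˢ ball 0 A) ?_ hGD
      have h1 : IntegrableOn (fun _ : ℂ => (1 : ℝ)) (ball 0 A) :=
        integrableOn_const measure_ball_lt_top.ne
      have h2 := Integrable.mul_prod (hf.2.mono_set hDK) h1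
      rw [Measure.prod_restrict, ← Measure.volume_eq_prod] at h2
      simp only [mul_one] at h2
      exact h2
    obtain ⟨g, hg, hgf⟩ := H _ hfG
    refine hfn ⟨fun z => g (z, q.2), hg.comp (by fun_prop) fun z hz => ?_, ?_⟩
    · rw [← ball_prod_same]
      exact ⟨hz, mem_ball_self hε⟩
    · filter_upwards [ball_mem_nhds q.1 hδ] with z hz
      refine hgf ?_
      rw [← ball_prod_same]
      exact ⟨hz, mem_ball_self hδ⟩
  · have h1 := (tendsto_one_div_add_atTop_nhds_zero_nat (𝕜 := ℝ)).eventually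
      (gt_mem_nhds (sub_pos.2 (mem_ball.1 hz.1)))
    obtain ⟨k₀, hk₀⟩ := eventually_atTop.1 (h1.and
      (tendsto_natCast_atTop_atTop.eventually_ge_atTop ‖z‖))
    exact ⟨k₀, fun k hk => ⟨⟨hz.2, by have := (hk₀ k hk).1; simp only [mem_ofPred_eq]; linarith⟩,
      mem_closedBall_zero_iff.2 (hk₀ k hk).2⟩⟩

theorem le_neg_log_of_extension {D : Set ℂ} (hD : IsOpen D) {v : ℂ → ℝ}
    (hv : UpperSemicontinuousOn v D) {G : Set (ℂ × ℂ)} (hG : IsOpen G)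
    (hGv : ∀ p, p ∈ G ↔ p.1 ∈ D ∧ ‖p.2‖ < Real.exp (-v p.1)) {p q : ℂ × ℂ} {ε δ : ℝ}
    (hqG : q ∈ G) (hδ : 0 < δ)
    (H : ∀ f ∈ L2h G, ∃ g, DifferentiableOn ℂ g (ball q ε) ∧ EqOn g f (ball q δ))
    (hpol : PolarSet (ball q.1 ε \ D)) (hp : p ∈ ball q ε) (hpD : p.1 ∈ D) (hp2 : p.2 ≠ 0)
    (hpk : HasPeaks v D p.1) : v p.1 ≤ -Real.log ‖p.2‖ := by
  obtain ⟨c, hc, N, hN⟩ := hpk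
  have hN' : ∀ j : ℕ, ∃ g : ℂ → ℂ, DifferentiableOn ℂ g D ∧
      IntegrableOn (fun z => ‖g z‖ ^ 2 * Real.exp (-(2 * (j + 1) * v z))) D ∧
      (∫ z in D, ‖g z‖ ^ 2 * Real.exp (-(2 * (j + 1) * v z))) ≤ 1 ∧
      (N ≤ j + 1 → c * Real.exp ((j + 1) * v p.1) ≤ ‖g p.1‖) := fun j => by
    by_cases h : N ≤ j + 1
    · obtain ⟨g, h1, h2, h3, h4⟩ := hN _ h
      exact ⟨g, h1, h2, h3, fun _ => h4⟩
    · exact ⟨0, differentiableOn_const 0, by simp [IntegrableOn], by simp, fun h' => (h h').elim⟩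
  choose g hg hi h1 hgp using hN'
  set f : ℕ → ℂ × ℂ → ℂ := fun j p => g j p.1 * p.2 ^ j with hf
  have hfd : ∀ j, DifferentiableOn ℂ (f j) G := fun j =>
    ((hg j).comp differentiableOn_fst fun p hp => ((hGv p).1 hp).1).mul
      (differentiable_snd.pow j).differentiableOn
  have hloc : ∀ p ∈ G, ∃ C, ∀ᶠ q in 𝓝 p, ∀ j, ‖f j q‖ ≤ C := fun p hp =>
    exists_local_bound_mul_pow hD hv hg hi h1 ((hGv p).1 hp).1 ((hGv p).1 hp).2
  have hL : ∀ j, eLpNorm (f j) 2 (volume.restrict G) ≤ (NNReal.pi : ENNReal) := fun j => by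
    have h2 := eLpNorm_mul_pow_le hG hGv hD (hg j) j (hi j) (h1 j)
    by_contra! h3
    have h4 : (1 : ENNReal) ≤ NNReal.pi := by
      have : (1 : NNReal) ≤ NNReal.pi := by
        rw [← NNReal.coe_le_coe]; simpa using (by linarith [Real.pi_gt_three] : (1 : ℝ) ≤ Real.pi)
      exact_mod_cast this
    refine absurd h2 (not_le.2 (h3.trans_le ?_))
    rw [sq]
    exact le_mul_of_one_le_left' (h4.trans h3.le)
  have hext : ∀ x : ℕ → ℂ, (Summable fun j => ‖x j‖) → ∃ h, DifferentiableOn ℂ h (ball q ε) ∧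
      ∀ p ∈ ball q δ, h p = ∑' j, x j * f j p := fun x hx =>
    H _ (tsum_mem_L2h hG hfd hloc ENNReal.coe_ne_top hL hx)
  obtain ⟨C, hC⟩ := hloc q hqG
  obtain ⟨δ', hδ', hC'⟩ := eventually_nhds_iff_ball.1 (hC.and (ball_mem_nhds q hδ))
  have hε : 0 < ε := pos_of_mem_ball hp
  set m := max ‖p - q‖ (ε / 2)
  have hm0 : 0 < m := lt_max_of_lt_right (half_pos hε)
  have hmε : m < ε := max_lt (mem_ball_iff_norm.1 hp) (half_lt_self hε)
  have hline : ∀ {η : ℝ} {s : ℂ}, s ∈ ball (0 : ℂ) (η / m) → q + s • (p - q) ∈ ball q η := by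
    intro η s hs
    rw [mem_ball_zero_iff, lt_div_iff₀ hm0] at hs
    rw [mem_ball_iff_norm, add_sub_cancel_left, norm_smul]
    exact (mul_le_mul_of_nonneg_left (le_max_left _ _) (norm_nonneg _)).trans_lt hs
  have hcomp : ∀ h : ℂ × ℂ → ℂ, DifferentiableOn ℂ h (ball q ε) →
      DifferentiableOn ℂ (fun s : ℂ => h (q + s • (p - q))) (ball 0 (ε / m)) := fun h hh =>
    hh.comp (by fun_prop) fun s hs => hline hs
  obtain ⟨C', hC''⟩ := exists_bound_of_extension (a := fun s j => f j (q + s • (p - q)))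
    (r := δ' / m) (R := ε / m) (C := C) (div_pos hδ' hm0) ((one_lt_div hm0).2 hmε)
    (fun s hs j => (hC' _ (hline hs)).1 j) fun x hx => by
      obtain ⟨h, hh, hhx⟩ := hext x hx
      exact ⟨_, hcomp h hh, fun s hs => hhx _ (hC' _ (hline hs)).2⟩
  have hbound : ∀ j, ‖f j p‖ ≤ C' := fun j => by
    obtain ⟨h, hh, hhx⟩ := hext (Pi.single j 1)
      (summable_of_ne_finset_zero (s := {j}) fun i hi => by simp_all)
    have hhf : ∀ p ∈ ball q δ, h p = f j p := fun p hp => by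
      rw [hhx p hp, tsum_eq_single j fun i hi => by simp [hi]]
      simp
    have h2 := hC'' j _ (hcomp h hh) fun s hs => hhf _ (hC' _ (hline hs)).2
    rw [one_smul, add_sub_cancel] at h2
    have hsub : (ball q.1 ε ∩ D) ×ˢ ball q.2 ε ⊆ ball q ε := by
      rw [← ball_prod_same]
      exact prod_mono_left inter_subset_left
    rw [← ball_prod_same] at hp
    rwa [eqOn_of_isPreconnected ((isOpen_ball.inter hD).prod isOpen_ball)
      ((hpol.isPreconnected_ball_inter hD).prod (convex_ball _ _).isPreconnected) (hh.mono hsub)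
      (((hg j).comp differentiableOn_fst fun p hp => hp.1.2).mul
        (differentiable_snd.pow j).differentiableOn)
      (q := q) ⟨⟨mem_ball_self hε, ((hGv q).1 hqG).1⟩, mem_ball_self hε⟩
      (by filter_upwards [ball_mem_nhds q hδ] with p hp using hhf p hp)
      (show p ∈ _ from ⟨⟨hp.1, hpD⟩, hp.2⟩)] at h2
  by_contra! hcon
  have hw : 0 < ‖p.2‖ := norm_pos_iff.2 hp2
  have hpos : 0 < v p.1 + Real.log ‖p.2‖ := by linarith
  have ht : Tendsto (fun j : ℕ => c * Real.exp (v p.1) *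
      Real.exp (j * (v p.1 + Real.log ‖p.2‖))) atTop atTop :=
    (Real.tendsto_exp_atTop.comp (tendsto_natCast_atTop_atTop.atTop_mul_const hpos)).const_mul_atTop
      (by positivity)
  obtain ⟨j, hj, hjN⟩ := ((ht.eventually_gt_atTop C').and
    (tendsto_natCast_atTop_atTop.eventually_ge_atTop N)).exists
  refine absurd (hbound j) (not_le.2 (hj.trans_le ?_))
  rw [hf, norm_mul, norm_pow]
  calc _ = c * Real.exp ((j + 1) * v p.1) * ‖p.2‖ ^ j := by
        rw [mul_add, Real.exp_add, mul_comm (j : ℝ) (Real.log _), Real.exp_mul (Real.log _),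
          Real.exp_log hw, Real.rpow_natCast, add_one_mul, Real.exp_add]
        ring
    _ ≤ _ := mul_le_mul_of_nonneg_right (hgp j (by linarith)) (by positivity)

theorem isL2hDomainOfHolomorphy_hull {D : Set ℂ} (hD : IsOpen D) {ρ : ℂ → EReal}
    (hρ : UpperSemicontinuousOn ρ D) {v : ℂ → ℝ} (hρv : ∀ z ∈ D, ρ z = v z)
    (hv : UpperSemicontinuousOn v D) {M : ℝ} (hM : ∀ z ∈ D, M ≤ v z)
    (hpk : ∀ z₀ ∈ D, HasPeaks v D z₀) :
    IsL2hDomainOfHolomorphy (hartogs (DHat D ρ) (rhoHat D ρ)) := by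
  rintro ⟨D₀, D₁, hD₀, hD₀c, hD₁, hD₁c, hsub, hnot, hext⟩
  set G' := hartogs (DHat D ρ) (rhoHat D ρ)
  have hG'o : IsOpen G' := isOpen_hull hD hρ
  have hGo : IsOpen (hartogs D ρ) := isOpen_hartogs hD hρ
  have hGv : ∀ p, p ∈ hartogs D ρ ↔ p.1 ∈ D ∧ ‖p.2‖ < Real.exp (-v p.1) := fun p =>
    and_congr_right fun hp => by rw [hρv _ hp, elog_norm_lt_neg_coe_iff]
  obtain ⟨x₀, hx₀⟩ := hD₀c.nonempty
  set V := connectedComponentIn (D₁ ∩ G') x₀ with hV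
  have hVo : IsOpen V := (hD₁.inter hG'o).connectedComponentIn
  have hVsub : V ⊆ D₁ ∩ G' := connectedComponentIn_subset _ _
  have hx₀V : x₀ ∈ V := mem_connectedComponentIn (hsub hx₀)
  obtain ⟨p, ⟨hpcl, hpD₁⟩, hpV⟩ : ∃ p ∈ closure V ∩ D₁, p ∉ V := by
    by_contra! hcon
    exact hnot ((hD₁c.isPreconnected.subset_of_closure_inter_subset hVo
      ⟨x₀, (hsub hx₀).1, hx₀V⟩ hcon).trans (hVsub.trans inter_subset_right))
  have hpG' : p ∉ G' := fun h => hpV <| by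
    obtain ⟨η, hη, hηs⟩ := isOpen_iff.1 (hD₁.inter hG'o) p ⟨hpD₁, h⟩
    obtain ⟨y, hyV, hyb⟩ := mem_closure_iff.1 hpcl η hη
    have hy : y ∈ ball p η := by rwa [mem_ball, dist_comm]
    have h1 := (convex_ball p η).isPreconnected.subset_connectedComponentIn hy hηs
    rw [hV, connectedComponentIn_eq hyV]
    exact h1 (mem_ball_self hη)
  obtain ⟨ε, hε, hεs⟩ : ∃ ε > 0, ball p (2 * ε) ⊆ D₁ := by
    obtain ⟨η, hη, hηs⟩ := isOpen_iff.1 hD₁ p hpD₁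
    exact ⟨η / 2, half_pos hη, by rwa [mul_div_cancel₀ _ two_ne_zero]⟩
  obtain ⟨q, ⟨hqV, hqp⟩, hqD⟩ : ∃ q ∈ V ∩ ball p ε, q.1 ∈ D := by
    obtain ⟨y, hyp, hyV⟩ := _root_.mem_closure_iff.1 hpcl _ isOpen_ball (mem_ball_self hε)
    obtain ⟨s, hs, -, -, hpol, -⟩ := exists_local_box hD hρ (hVsub hyV).2
    have hcl := mem_closure_of_polar isOpen_ball hpol (mem_ball_self hs)
    have hW : (fun z : ℂ => (z, y.2)) ⁻¹' (V ∩ ball p ε) ∈ 𝓝 y.1 :=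
      ((hVo.inter isOpen_ball).preimage (by fun_prop)).mem_nhds ⟨hyV, hyp⟩
    obtain ⟨z, hz, hzD⟩ := mem_closure_iff_nhds.1 hcl _ hW
    exact ⟨(z, y.2), hz, hzD⟩
  have hqG : q ∈ hartogs D ρ := hull_inter D ρ (hVsub hqV).2 hqD
  obtain ⟨δ, hδ, hδs⟩ := isOpen_iff.1 (hVo.inter hGo) q ⟨hqV, hqG⟩
  have hbD₁ : ball q ε ⊆ D₁ := (ball_subset_ball' (by
    have := mem_ball.1 hqp; linarith)).trans hεs
  have H : ∀ f ∈ L2h (hartogs D ρ), ∃ g, DifferentiableOn ℂ g (ball q ε) ∧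
      EqOn g f (ball q δ) := fun f hf => by
    obtain ⟨F, hF, hFf⟩ := exists_L2h_extension_hull hD hρ hf
    obtain ⟨g, hg, hgF⟩ := hext F hF
    refine ⟨g, hg.mono hbD₁, fun y hy => ?_⟩
    have h1 := eqOn_of_isPreconnected hVo isPreconnected_connectedComponentIn
      (hg.mono (hVsub.trans inter_subset_left)) (hF.1.mono (hVsub.trans inter_subset_right)) hx₀V
      (by filter_upwards [hD₀.mem_nhds hx₀] with y hy using hgF hy)
    exact (h1 (hδs hy).1).trans (hFf (hδs hy).2)
  have hGA : hartogs D ρ ⊆ D ×ˢ ball 0 (Real.exp (-M)) := fun y hy =>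
    ⟨hy.1, mem_ball_zero_iff.2 (((hGv y).1 hy).2.trans_le
      (Real.exp_le_exp.2 (neg_le_neg (hM _ hy.1))))⟩
  have hpol := polarSet_ball_diff_of_extension hD hGA hqD hε hδ H
  have hpq : p ∈ ball q.1 ε ×ˢ ball q.2 ε := by rwa [ball_prod_same, mem_ball_comm]
  obtain ⟨w, hw, hpw⟩ : ∃ w ∈ ball q.2 ε, ‖p.2‖ < ‖w‖ := by
    obtain ⟨u, hu, hpu⟩ : ∃ u : ℂ, ‖u‖ = 1 ∧ p.2 = (‖p.2‖ : ℂ) * u := by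
      by_cases h0 : p.2 = 0
      · exact ⟨1, by simp, by simp [h0]⟩
      · exact ⟨p.2 / ‖p.2‖, by simp [h0], (mul_div_cancel₀ _ (by simpa using h0)).symm⟩
    have h1 : ContinuousAt (fun s : ℝ => ((‖p.2‖ + s : ℝ) : ℂ) * u) 0 := by fun_prop
    have h2 := h1.preimage_mem_nhds (t := ball q.2 ε) (by
      simp only [add_zero]
      rw [← hpu]
      exact isOpen_ball.mem_nhds hpq.2)
    obtain ⟨s, hs, hs0⟩ := ((Filter.Eventually.filter_mono nhdsWithin_le_nhds h2).and
      (self_mem_nhdsWithin (s := Ioi (0 : ℝ)))).exists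
    refine ⟨_, hs, ?_⟩
    have hs0' : 0 < s := hs0
    rw [norm_mul, hu, mul_one, Complex.norm_real, Real.norm_of_nonneg (by positivity)]
    linarith
  have hw0 : 0 < ‖w‖ := (norm_nonneg _).trans_lt hpw
  refine hpG' (box_subset_hull hD (U := ball q.1 ε) (c := -Real.log ‖w‖) isOpen_ball hpol
    (fun z hz => ?_) ⟨hpq.1, ?_⟩)
  · rw [hρv z hz.2, EReal.coe_le_coe_iff]
    exact le_neg_log_of_extension hD hv hGo hGv hqG hδ H hpol (p := (z, w))
      (by rw [← ball_prod_same]; exact ⟨hz.1, hw⟩) hz.2 (norm_pos_iff.1 hw0) (hpk z hz.2)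
  · rw [neg_neg, Real.exp_log hw0, mem_ball_zero_iff]
    exact hpw

/-- **Corollary 7, main case.** If `ρ` is subharmonic on `D`, bounded from
below, and (`ℂ \ D` is not polar or `ρ` is not constant), then every `f ∈ L²ₕ(G_{D,ρ})`
extends holomorphically to `G_{D̂,ρ̂}`, and `G_{D̂,ρ̂}` is an `L²ₕ`-domain of holomorphy. -/
theorem corollary7 (D : Set ℂ) (hDopen : IsOpen D) (hDconn : IsConnected D)
    (ρ : ℂ → EReal) (hρ : SubharmonicOn ρ D) (hbd : ∃ M : ℝ, ∀ z ∈ D, (M : EReal) ≤ ρ z)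
    (hcase : ¬ PolarSet Dᶜ ∨ ¬ ∃ c : EReal, ∀ z ∈ D, ρ z = c) :
    (∀ f ∈ L2h (hartogs D ρ), ∃ F : ℂ × ℂ → ℂ,
        DifferentiableOn ℂ F (hartogs (DHat D ρ) (rhoHat D ρ)) ∧
        Set.EqOn F f (hartogs D ρ)) ∧
      IsL2hDomainOfHolomorphy (hartogs (DHat D ρ) (rhoHat D ρ)) := by
  obtain ⟨M, hM⟩ := hbd
  refine ⟨fun f hf => exists_extension_hull hDopen hρ.2.1 hf, ?_⟩
  have hv := hρ.bsub_truncation M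
  set v : ℂ → ℝ := fun z => (max (ρ z) M).toReal with hvdef
  have hρv : ∀ z ∈ D, ρ z = v z := fun z hz => by
    simp only [hvdef]
    rw [max_eq_left (hM z hz), EReal.coe_toReal (hρ.2.2.1 z hz)
      ((EReal.bot_lt_coe M).trans_le (hM z hz)).ne']
  have hMv : ∀ z ∈ D, M ≤ v z := fun z hz => by
    rw [← EReal.coe_le_coe_iff, ← hρv z hz]
    exact hM z hz
  refine isL2hDomainOfHolomorphy_hull hDopen hρ.2.1 hρv hv.usc hMv fun z₀ hz₀ => ?_
  by_cases hconst : ∀ z ∈ D, v z = v z₀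
  · refine exists_peaks_of_const hDopen (hcase.resolve_right (not_not.2 ⟨v z₀, fun z hz => ?_⟩))
      hconst hz₀
    rw [hρv z hz, hconst z hz]
  · push Not at hconst
    obtain ⟨b, hb, hne⟩ := hconst
    rcases hne.lt_or_gt with h | h
    · exact hv.exists_peaks hMv hb hz₀ h hz₀
    · exact hv.exists_peaks hMv hz₀ hb h hz₀
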